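/- Among the 298 combinatorially inequivalent orientation-reversing gluing patterns of the faces of the octahedron, consider the 113 patterns whose non-sphere vertex-link data consists of a single genus-2 surface (one vertex class has link of Euler characteristic −2 and all other vertex links are 2-spheres). The corresponding quotient spaces X(φ) fall into exactly 79 homeomorphism classes. -/

import Mathlib

/-! Combinatorial model of the octahedron and of orientation-reversing gluing
patterns of its faces, following Heard–Pervova–Petronio. -/

/-- Vertices of the octahedron `±e_i`, encoded as a pair (axis, sign). -/
abbrev OctVertex : Type := Fin 3 × Bool

/-- Faces of the octahedron: a choice of a sign for each coordinate axis;
the face `F` has vertex set `{(i, F i) : i ∈ Fin 3}`. -/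
abbrev OctFace : Type := Fin 3 → Bool

/-- The parity of a face.  The cyclic order (axis 0, axis 1, axis 2) of the vertices of
a face `F` agrees with the cyclic order induced by the outward orientation of the
boundary of the solid octahedron if and only if `faceSign F = true`. -/
def faceSign (F : OctFace) : Bool := Bool.xor (F 0) (Bool.xor (F 1) (F 2))

/-- `IsGluing σ π` says that the fixed-point-free involution `σ` of the set of faces,
together with the face identifications `π` (the bijection `φ_F` from the vertices of `F`
to those of `σ F` sends the vertex of `F` on axis `i` to the vertex of `σ F` on axis
`π F i`), is an orientation-reversing gluing pattern: `φ_{σ F} = φ_F⁻¹` and every `φ_F`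
reverses the cyclic orderings induced by the boundary orientation (a bijection
`F → σ F` given by `π` reverses them iff `sign (π) · faceSign F · faceSign (σ F) = -1`). -/
def IsGluing (σ : Equiv.Perm OctFace) (π : OctFace → Equiv.Perm (Fin 3)) : Prop :=
  (∀ F, σ (σ F) = F) ∧ (∀ F, σ F ≠ F) ∧ (∀ F, π (σ F) = (π F)⁻¹) ∧
    (∀ F, Equiv.Perm.sign (π F) = 1 ↔ faceSign F ≠ faceSign (σ F))

instance : DecidablePred fun p : Equiv.Perm OctFace × (OctFace → Equiv.Perm (Fin 3)) =>
    IsGluing p.1 p.2 := fun p => by unfold IsGluing; infer_instance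

/-- An orientation-reversing gluing pattern of the faces of the octahedron. -/
abbrev Gluing : Type :=
  {p : Equiv.Perm OctFace × (OctFace → Equiv.Perm (Fin 3)) // IsGluing p.1 p.2}

/-- The involution on faces underlying a gluing pattern. -/
def Gluing.face (g : Gluing) : Equiv.Perm OctFace := g.1.1

/-- The face identifications of a gluing pattern, as permutations of the axes. -/
def Gluing.axisMap (g : Gluing) : OctFace → Equiv.Perm (Fin 3) := g.1.2

/-- The action of the symmetry of the octahedron given by the signed axis permutation
`(ρ, ε)` (sending the vertex `(i, b)` to `(ρ i, xor b (ε i))`) on faces. -/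
def symMapFace (ρ : Equiv.Perm (Fin 3)) (ε : Fin 3 → Bool) (F : OctFace) : OctFace :=
  fun j => Bool.xor (F (ρ⁻¹ j)) (ε (ρ⁻¹ j))

/-- Two gluing patterns are combinatorially equivalent if some symmetry of the
octahedron conjugates one into the other. -/
def EquivGluing (g h : Gluing) : Prop :=
  ∃ (ρ : Equiv.Perm (Fin 3)) (ε : Fin 3 → Bool),
    (∀ F, h.face (symMapFace ρ ε F) = symMapFace ρ ε (g.face F)) ∧
    (∀ F, h.axisMap (symMapFace ρ ε F) = ρ * g.axisMap F * ρ⁻¹)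

/-- The combinatorial equivalence class (orbit under the symmetry group) of a gluing. -/
def orbit (g : Gluing) : Set Gluing := {h | EquivGluing g h}

/-- The identifications induced by a gluing pattern on the vertices of the octahedron:
the vertex of `F` on axis `i` is glued to the corresponding vertex of `face F`. -/
def vtxRel (g : Gluing) (v w : OctVertex) : Prop :=
  ∃ (F : OctFace) (i : Fin 3),
    v = (i, F i) ∧ w = (g.axisMap F i, g.face F (g.axisMap F i))

/-- The equivalence relation on vertices generated by the face identifications. -/
def vtxSetoid (g : Gluing) : Setoid OctVertex := Relation.EqvGen.setoid (vtxRel g)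

/-- The number of vertex classes of a gluing pattern. -/
noncomputable def vtxCount (g : Gluing) : ℕ := Nat.card (Quotient (vtxSetoid g))

/-- An edge-end (corner) of the octahedron: an ordered pair of vertices lying on
distinct axes; it represents the edge between them together with the choice of the
first vertex as its endpoint.  Edge-ends correspond to the corners of the
quadrilateral vertex links. -/
abbrev EdgeEnd : Type := {p : OctVertex × OctVertex // p.1.1 ≠ p.2.1}

/-- The identifications induced by a gluing pattern on edge-ends: an edge-end contained
in the face `F` is glued to the corresponding edge-end of `face F`. -/
def endRel (g : Gluing) (p q : EdgeEnd) : Prop :=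
  ∃ (F : OctFace) (i j : Fin 3), i ≠ j ∧ p.1 = ((i, F i), (j, F j)) ∧
    q.1 = ((g.axisMap F i, g.face F (g.axisMap F i)),
           (g.axisMap F j, g.face F (g.axisMap F j)))

/-- The equivalence relation on edge-ends generated by the face identifications.
Its classes are the vertices of the quadrangulated link surfaces of the vertex
classes. -/
def endSetoid (g : Gluing) : Setoid EdgeEnd := Relation.EqvGen.setoid (endRel g)

/-- The relation on edge-ends generating the edge identifications: face identifications
together with forgetting the choice of endpoint. -/
def edgeRel (g : Gluing) (p q : EdgeEnd) : Prop :=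
  endRel g p q ∨ q.1 = (p.1.2, p.1.1)

/-- The equivalence relation whose classes are the edge classes of a gluing pattern. -/
def edgeSetoid (g : Gluing) : Setoid EdgeEnd := Relation.EqvGen.setoid (edgeRel g)

/-- The number of edge classes of a gluing pattern. -/
noncomputable def edgeCount (g : Gluing) : ℕ := Nat.card (Quotient (edgeSetoid g))

/-- The number of vertices of the octahedron lying in the vertex class `c`; this is
the number of quadrilaterals tiling the link surface of `c`. -/
noncomputable def classSize (g : Gluing) (c : Quotient (vtxSetoid g)) : ℕ :=
  Nat.card {v : OctVertex // Quotient.mk (vtxSetoid g) v = c}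

/-- The number of vertices of the quadrangulated link surface of the vertex class `c`:
the number of classes of edge-ends whose endpoint lies in `c`. -/
noncomputable def cornerCount (g : Gluing) (c : Quotient (vtxSetoid g)) : ℕ :=
  Nat.card {q : Quotient (endSetoid g) //
    ∃ p : EdgeEnd, Quotient.mk (endSetoid g) p = q ∧ Quotient.mk (vtxSetoid g) p.1.1 = c}

/-- The Euler characteristic of the link surface of the vertex class `c`: the link is
tiled by `classSize g c` quadrilaterals, with `2 * classSize g c` edges and
`cornerCount g c` vertices, so `χ = cornerCount - 2 * classSize + classSize`. -/
noncomputable def linkChi (g : Gluing) (c : Quotient (vtxSetoid g)) : ℤ :=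
  (cornerCount g c : ℤ) - (classSize g c : ℤ)

/-- All vertex links are 2-spheres: the quotient space is a closed manifold. -/
def AllLinksSphere (g : Gluing) : Prop := ∀ c, linkChi g c = 2

/-- The non-sphere vertex-link data consists of a single torus. -/
def LinksOneTorus (g : Gluing) : Prop :=
  (∀ c, linkChi g c = 2 ∨ linkChi g c = 0) ∧
    Nat.card {c : Quotient (vtxSetoid g) // linkChi g c = 0} = 1

/-- The non-sphere vertex-link data consists of two tori. -/
def LinksTwoTori (g : Gluing) : Prop :=
  (∀ c, linkChi g c = 2 ∨ linkChi g c = 0) ∧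
    Nat.card {c : Quotient (vtxSetoid g) // linkChi g c = 0} = 2

/-- The non-sphere vertex-link data consists of a single genus-2 surface. -/
def LinksGenusTwo (g : Gluing) : Prop :=
  (∀ c, linkChi g c = 2 ∨ linkChi g c = -2) ∧
    Nat.card {c : Quotient (vtxSetoid g) // linkChi g c = -2} = 1

/-- The non-sphere vertex-link data consists of one genus-2 surface and one torus. -/
def LinksGenusTwoTorus (g : Gluing) : Prop :=
  (∀ c, linkChi g c = 2 ∨ linkChi g c = 0 ∨ linkChi g c = -2) ∧
    Nat.card {c : Quotient (vtxSetoid g) // linkChi g c = 0} = 1 ∧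
    Nat.card {c : Quotient (vtxSetoid g) // linkChi g c = -2} = 1

/-- The non-sphere vertex-link data consists of a single genus-3 surface. -/
def LinksGenusThree (g : Gluing) : Prop :=
  (∀ c, linkChi g c = 2 ∨ linkChi g c = -4) ∧
    Nat.card {c : Quotient (vtxSetoid g) // linkChi g c = -4} = 1

/-! The geometric realization: the solid octahedron in `ℝ³` and the quotient
space `X(φ)` of a gluing pattern `φ`. -/

/-- The point `±e_i` of `ℝ³` corresponding to a vertex of the octahedron. -/
def vertexPt (v : OctVertex) : Fin 3 → ℝ :=
  fun j => if j = v.1 then (if v.2 then 1 else -1) else 0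

/-- The solid octahedron: the convex hull of `{±e₁, ±e₂, ±e₃}` in `ℝ³`. -/
def SolidOcta : Set (Fin 3 → ℝ) := convexHull ℝ (Set.range vertexPt)

theorem vertexPt_mem_solidOcta (v : OctVertex) : vertexPt v ∈ SolidOcta :=
  subset_convexHull ℝ _ (Set.mem_range_self v)

/-- The gluing relation on the solid octahedron: the point of the closed triangular face
of `F` with barycentric coordinates `w` is glued to the point of the face of
`face F` with the corresponding barycentric coordinates, i.e. the faces
are identified via the affine extensions of the combinatorial identifications. -/
def glueRel (g : Gluing) (x y : SolidOcta) : Prop :=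
  ∃ (F : OctFace) (w : Fin 3 → ℝ), (∀ i, 0 ≤ w i) ∧ (∑ i, w i) = 1 ∧
    (x : Fin 3 → ℝ) = ∑ i, w i • vertexPt (i, F i) ∧
    (y : Fin 3 → ℝ) = ∑ i, w i • vertexPt (g.axisMap F i, g.face F (g.axisMap F i))

/-- The equivalence relation on the solid octahedron generated by the affine face
identifications of a gluing pattern. -/
def glueSetoid (g : Gluing) : Setoid SolidOcta := Relation.EqvGen.setoid (glueRel g)

/-- The quotient space `X(φ)` of the solid octahedron by the gluing pattern `φ`,
with the quotient topology. -/
abbrev XSpace (g : Gluing) : Type := Quotient (glueSetoid g)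


open Topology Set Filter

noncomputable section

/-- The quotient of a compact Hausdorff space by a closed equivalence relation is Hausdorff. -/
theorem t2Space_quotient_of_isClosed {Z : Type*} [TopologicalSpace Z] [CompactSpace Z] [T2Space Z]
    (r : Setoid Z) (h : IsClosed {p : Z × Z | r p.1 p.2}) : T2Space (Quotient r) := by
  have hclosed : IsClosedMap (Quotient.mk r) := by
    intro C hC
    rw [← (isQuotientMap_quotient_mk' (s := r)).isClosed_preimage]
    have : Quotient.mk r ⁻¹' (Quotient.mk r '' C) = Prod.snd '' ({p : Z × Z | r p.1 p.2} ∩ (C ×ˢ univ)) := by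
      ext z
      simp only [mem_preimage, mem_image, mem_inter_iff, mem_ofPred_eq, mem_prod, mem_univ, and_true,
        Prod.exists, exists_eq_right]
      constructor
      · rintro ⟨x, hx, hxz⟩
        exact ⟨x, Quotient.exact hxz, hx⟩
      · rintro ⟨x, hxz, hx⟩
        exact ⟨x, hx, Quotient.sound hxz⟩
    change IsClosed (Quotient.mk r ⁻¹' (Quotient.mk r '' C))
    rw [this]
    exact isClosedMap_snd_of_compactSpace _ (h.inter (hC.prod isClosed_univ))
  refine ⟨fun x y hxy => ?_⟩
  have hpt : ∀ x : Quotient r, IsClosed ({x} : Set (Quotient r)) := by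
    intro x
    obtain ⟨z, rfl⟩ := Quotient.exists_rep x
    have := hclosed {z} isClosed_singleton
    simpa using this
  have hc : Continuous (Quotient.mk r) := continuous_quotient_mk'
  obtain ⟨U, V, hU, hV, hxU, hyV, hUV⟩ := normal_separation ((hpt x).preimage hc) ((hpt y).preimage hc)
    (by rw [Set.disjoint_left]; rintro a h1 h2; exact hxy (h1.symm.trans h2))
  refine ⟨(Quotient.mk r '' Uᶜ)ᶜ, (Quotient.mk r '' Vᶜ)ᶜ, (hclosed _ hU.isClosed_compl).isOpen_compl,
    (hclosed _ hV.isClosed_compl).isOpen_compl, ?_, ?_, ?_⟩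
  · rintro ⟨a, ha, rfl⟩; exact ha (hxU rfl)
  · rintro ⟨a, ha, rfl⟩; exact ha (hyV rfl)
  · rw [Set.disjoint_left]
    intro q h1 h2
    obtain ⟨z, rfl⟩ := Quotient.exists_rep q
    have hzU : z ∈ U := by by_contra hz; exact h1 ⟨z, hz, rfl⟩
    have hzV : z ∈ V := by by_contra hz; exact h2 ⟨z, hz, rfl⟩
    exact Set.disjoint_left.1 hUV hzU hzV

/-- A finite closed cover of a preconnected set that is pairwise disjoint on the set consists of
one relevant piece. -/
theorem IsPreconnected.subset_of_finite_closed_cover {Z ι : Type*} [TopologicalSpace Z] [Finite ι]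
    {S : Set Z} (hS : IsPreconnected S) (C : ι → Set Z) (hC : ∀ i, IsClosed (C i))
    (hcov : ∀ x ∈ S, ∃ i, x ∈ C i) (hdis : ∀ x ∈ S, ∀ i k, x ∈ C i → x ∈ C k → i = k)
    {x : Z} (hx : x ∈ S) {i : ι} (hi : x ∈ C i) : S ⊆ C i := by
  classical
  have := Fintype.ofFinite ι
  have h := isPreconnected_iff_subset_of_disjoint_closed.1 hS (C i) (⋃ k ∈ {k | k ≠ i}, C k) (hC i)
    ((Set.toFinite _).isClosed_biUnion fun k _ => hC k) ?_ ?_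
  · rcases h with h | h
    · exact h
    · obtain ⟨k, hk, hxk⟩ := Set.mem_iUnion₂.1 (h hx)
      exact absurd (hdis x hx _ _ hxk hi) hk
  · intro y hy
    obtain ⟨k, hk⟩ := hcov y hy
    by_cases hki : k = i
    · left; exact hki ▸ hk
    · right; exact Set.mem_iUnion₂.2 ⟨k, hki, hk⟩
  · ext y
    simp only [mem_inter_iff, mem_iUnion, mem_empty_iff_false, iff_false, not_and]
    rintro hy hyi ⟨k, hk, hyk⟩
    exact hk (hdis y hy _ _ hyk hyi)

/-- Continuous extension over a dense set along a finite-to-one map. -/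
theorem exists_extension_of_finite_fibers {K W X : Type*} [TopologicalSpace K] [TopologicalSpace W]
    [TopologicalSpace X] [CompactSpace W] [T2Space W] [T2Space X] (p : W → X) (hp : Continuous p)
    (hfin : ∀ x, (p ⁻¹' {x}).Finite) (j : K → X) (hj : Continuous j) (D : Set K)
    (hconn : ∀ x : K, ∀ U ∈ 𝓝 x, ∃ V ∈ 𝓝 x, V ⊆ U ∧ IsPreconnected (V ∩ D) ∧ (V ∩ D).Nonempty)
    (s : K → W) (hs : ContinuousOn s D) (hps : ∀ x ∈ D, p (s x) = j x) :
    ∃ s' : K → W, Continuous s' ∧ (∀ x ∈ D, s' x = s x) ∧ ∀ x, p (s' x) = j x := by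
  have hD : Dense D := by
    intro x
    rw [mem_closure_iff_nhds]
    intro t ht
    obtain ⟨V, hV, hVt, -, hne⟩ := hconn x t ht
    exact hne.mono (by gcongr)
  have key : ∀ x, ∃ w, Tendsto s (𝓝[D] x) (𝓝 w) := by
    intro x
    obtain ⟨U, hU, hUd⟩ := (hfin (j x)).t2_separation
    -- any shrinking of the separating neighbourhoods
    have step : ∀ N : W → Set W, (∀ w ∈ p ⁻¹' {j x}, w ∈ N w ∧ IsOpen (N w) ∧ N w ⊆ U w) →
        ∀ T ∈ 𝓝 x, ∃ w ∈ p ⁻¹' {j x}, ∃ V ∈ 𝓝 x, V ⊆ T ∧ (V ∩ D).Nonempty ∧ s '' (V ∩ D) ⊆ N w := by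
      intro N hN T hT
      have hop : IsOpen (⋃ w ∈ p ⁻¹' {j x}, N w) := isOpen_biUnion fun w hw => (hN w hw).2.1
      have hcl : IsClosed (p '' (⋃ w ∈ p ⁻¹' {j x}, N w)ᶜ) :=
        (hop.isClosed_compl.isCompact.image hp).isClosed
      have hx : j x ∉ p '' (⋃ w ∈ p ⁻¹' {j x}, N w)ᶜ := by
        rintro ⟨w, hw, hwx⟩
        exact hw (Set.mem_iUnion₂.2 ⟨w, hwx, (hN w hwx).1⟩)
      obtain ⟨V, hV, hVU, hVc, hVn⟩ := hconn x _ (inter_mem hT (hj.continuousAt (hcl.isOpen_compl.mem_nhds hx)))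
      have hsub : s '' (V ∩ D) ⊆ ⋃ w ∈ p ⁻¹' {j x}, N w := by
        rintro _ ⟨y, ⟨hyV, hyD⟩, rfl⟩
        by_contra hc
        exact (hVU hyV).2 ⟨s y, hc, hps y hyD⟩
      have hpre : IsPreconnected (s '' (V ∩ D)) := hVc.image s (hs.mono inter_subset_right)
      obtain ⟨y, hy⟩ := hVn
      obtain ⟨w, hw, hyw⟩ := Set.mem_iUnion₂.1 (hsub ⟨y, hy, rfl⟩)
      refine ⟨w, hw, V, hV, fun z hz => (hVU hz).1, ⟨y, hy⟩, ?_⟩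
      refine hpre.subset_left_of_subset_union (hN w hw).2.1
        (isOpen_biUnion fun w' (hw' : w' ∈ p ⁻¹' {j x} \ {w}) => (hN w' hw'.1).2.1) ?_ ?_ ⟨_, ⟨y, hy, rfl⟩, hyw⟩
      · rw [Set.disjoint_iUnion₂_right]
        intro w' hw'
        exact (hUd hw hw'.1 (Ne.symm hw'.2)).mono (hN w hw).2.2 (hN w' hw'.1).2.2
      · intro z hz
        obtain ⟨w', hw', hzw⟩ := Set.mem_iUnion₂.1 (hsub hz)
        by_cases h : w' = w
        · left; exact h ▸ hzw
        · right; exact Set.mem_iUnion₂.2 ⟨w', ⟨hw', h⟩, hzw⟩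
    obtain ⟨w, hw, V, hV, -, -, hVs⟩ := step U (fun w hw => ⟨(hU w).1, (hU w).2, le_rfl⟩) univ univ_mem
    refine ⟨w, fun N hN => ?_⟩
    obtain ⟨N', hN'N, hN'o, hwN'⟩ := mem_nhds_iff.1 hN
    classical
    obtain ⟨w', hw', V', hV', hV'V, ⟨y, hy⟩, hs'⟩ := step (fun u => if u = w then U u ∩ N' else U u) (by
      intro u hu
      by_cases h : u = w
      · subst h; simp only [if_true]
        exact ⟨⟨(hU u).1, hwN'⟩, (hU u).2.inter hN'o, inter_subset_left⟩
      · simp only [if_neg h]; exact ⟨(hU u).1, (hU u).2, le_rfl⟩) V hV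
    have hww : w' = w := by
      by_contra hne
      have h1 := hs' ⟨y, hy, rfl⟩
      simp only [if_neg hne] at h1
      exact Set.disjoint_left.1 (hUd hw' hw hne) h1 (hVs ⟨y, ⟨hV'V hy.1, hy.2⟩, rfl⟩)
    subst hww
    simp only [if_true] at hs'
    rw [mem_map, mem_nhdsWithin_iff_exists_mem_nhds_inter]
    exact ⟨V', hV', fun z hz => hN'N (hs' ⟨z, hz, rfl⟩).2⟩
  have hext : ContinuousOn (extendFrom D s) univ :=
    continuousOn_extendFrom (fun x _ => hD x) (fun x _ => key x)
  have hcont : Continuous (extendFrom D s) := continuousOn_univ.1 hext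
  have heq : ∀ x ∈ D, extendFrom D s x = s x := fun x hx =>
    extendFrom_eq (hD x) (hs x hx)
  refine ⟨extendFrom D s, hcont, heq, fun x => ?_⟩
  have : (fun x => p (extendFrom D s x)) = j :=
    Continuous.ext_on hD (hp.comp hcont) hj (fun x hx => by
      rw [heq x hx, hps x hx])
  exact congrFun this x

open Topology Set Filter MeasureTheory

/-- A convex body minus finitely many subsets of lines is preconnected (and nonempty), in dimension
at least three. -/
theorem Convex.isPreconnected_diff_lines {E ι : Type*} [NormedAddCommGroup E] [NormedSpace ℝ E]
    [FiniteDimensional ℝ E] (hE : 2 < Module.finrank ℝ E) [Finite ι] {K : Set E} (hK : Convex ℝ K)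
    (hKint : (interior K).Nonempty) (q d : ι → E) (S : ι → Set E)
    (hS : ∀ i, ∀ u ∈ S i, ∃ r : ℝ, u = q i + r • d i) :
    IsPreconnected (K \ ⋃ i, S i) ∧ (K \ ⋃ i, S i).Nonempty := by
  let : MeasurableSpace E := borel E
  have : BorelSpace E := ⟨rfl⟩
  have key : ∀ x y : E, ∃ z ∈ interior K, ∀ i, z - x ∉ Submodule.span ℝ {q i - x, d i} ∧
      z - y ∉ Submodule.span ℝ {q i - y, d i} := by
    intro x y
    have hne : ∀ (i : ι) (x : E), Measure.addHaar (G := E)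
        (AffineSubspace.mk' x (Submodule.span ℝ {q i - x, d i}) : Set E) = 0 := by
      intro i x
      apply Measure.addHaar_affineSubspace
      intro h
      have h2 : (AffineSubspace.mk' x (Submodule.span ℝ {q i - x, d i})).direction = ⊤ := by
        rw [h]; exact AffineSubspace.direction_top ℝ E E
      rw [AffineSubspace.direction_mk'] at h2
      have h3 : Module.finrank ℝ (Submodule.span ℝ ({q i - x, d i} : Set E)) ≤ 2 := by
        classical
        have := finrank_span_finset_le_card (R := ℝ) ({q i - x, d i} : Finset E)
        simp only [Finset.coe_insert, Finset.coe_singleton] at this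
        exact this.trans Finset.card_le_two
      rw [h2, finrank_top] at h3
      omega
    by_contra hcon
    push Not at hcon
    have hsub : interior K ⊆ ⋃ i, ((AffineSubspace.mk' x (Submodule.span ℝ {q i - x, d i}) : Set E) ∪
        (AffineSubspace.mk' y (Submodule.span ℝ {q i - y, d i}) : Set E)) := by
      intro z hz
      obtain ⟨i, hi⟩ := hcon z hz
      refine mem_iUnion.2 ⟨i, ?_⟩
      by_cases h : z - x ∈ Submodule.span ℝ {q i - x, d i}
      · left; exact h
      · right; exact hi h
    have hpos := isOpen_interior.measure_pos (Measure.addHaar (G := E)) hKint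
    have : Countable ι := Finite.to_countable
    have h0 : Measure.addHaar (G := E) (interior K) = 0 := by
      refine measure_mono_null hsub (measure_iUnion_null fun i => ?_)
      exact measure_union_null (hne i x) (hne i y)
    exact hpos.ne' h0
  have hseg : ∀ x z : E, x ∉ ⋃ i, S i → (∀ i, z - x ∉ Submodule.span ℝ {q i - x, d i}) →
      ∀ u ∈ segment ℝ x z, u ∉ ⋃ i, S i := by
    intro x z hx hz u hu hmem
    obtain ⟨i, hi⟩ := mem_iUnion.1 hmem
    obtain ⟨r, hr⟩ := hS i u hi
    rw [segment_eq_image'] at hu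
    obtain ⟨t, ht, rfl⟩ := hu
    have ht0 : t ≠ 0 := by
      rintro rfl
      apply hx
      simpa using hmem
    apply hz i
    rw [Submodule.mem_span_pair]
    refine ⟨t⁻¹, t⁻¹ * r, ?_⟩
    have h1 : t • (z - x) = q i - x + r • d i := by
      have : t • (z - x) = (q i + r • d i) - x := by rw [← hr]; simp
      rw [this]; abel
    rw [mul_smul, ← smul_add, ← h1, smul_smul, inv_mul_cancel₀ ht0, one_smul]
  constructor
  · refine isPreconnected_of_forall_pair fun x hx y hy => ?_
    obtain ⟨z, hz, hzz⟩ := key x y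
    refine ⟨segment ℝ x z ∪ segment ℝ y z, ?_, Or.inl (left_mem_segment ℝ x z),
      Or.inr (left_mem_segment ℝ y z), ?_⟩
    · rintro u (hu | hu)
      · exact ⟨hK.segment_subset hx.1 (interior_subset hz) hu, hseg x z hx.2 (fun i => (hzz i).1) u hu⟩
      · exact ⟨hK.segment_subset hy.1 (interior_subset hz) hu, hseg y z hy.2 (fun i => (hzz i).2) u hu⟩
    · exact IsPreconnected.union z (right_mem_segment ℝ x z) (right_mem_segment ℝ y z)
        (convex_segment x z).isPreconnected (convex_segment y z).isPreconnected
  · obtain ⟨x, hx⟩ := hKint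
    obtain ⟨z, hz, hzz⟩ := key x x
    refine ⟨z, interior_subset hz, fun hmem => ?_⟩
    obtain ⟨i, hi⟩ := mem_iUnion.1 hmem
    obtain ⟨r, hr⟩ := hS i z hi
    apply (hzz i).1
    rw [Submodule.mem_span_pair]
    refine ⟨1, r, ?_⟩
    rw [hr, one_smul]; abel

/-- Lifting a map from a convex body along the quotient by a finite group which acts freely over all
but finitely many points of the body. -/
theorem exists_lift_of_finite_bad {E : Type*} [NormedAddCommGroup E] [NormedSpace ℝ E]
    [FiniteDimensional ℝ E] (hE : 2 < Module.finrank ℝ E) {G W X : Type*} [Group G] [Finite G]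
    [TopologicalSpace W] [CompactSpace W] [T2Space W] [TopologicalSpace X] [T2Space X]
    [MulAction G W] [ContinuousConstSMul G W] {p : W → X} (hp : IsQuotientMap p)
    (hfib : ∀ {w w' : W}, p w = p w' ↔ w ∈ MulAction.orbit G w') (U : Set X)
    (hfree : ∀ w, p w ∈ U → ∀ g : G, g • w = w → g = 1)
    {K : Set E} (hK : Convex ℝ K) (hKint : (interior K).Nonempty) (j : K → X) (hj : Continuous j)
    (hbad : (j ⁻¹' Uᶜ).Finite) (b : K) (hb : j b ∈ U) (w0 : W) (hw0 : p w0 = j b) :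
    ∃ s : K → W, Continuous s ∧ (∀ x, p (s x) = j x) ∧ s b = w0 := by
  let : TopologicalSpace G := ⊥
  have hcovOn : IsCoveringMapOn p U := by
    have h : IsCoveringMapOn p (p '' {e | MulAction.stabilizer G e = ⊥}) :=
      hp.isCoveringMapOn_of_properlyDiscontinuousSMul hfib
    refine h.mono fun x hx => ?_
    obtain ⟨w, rfl⟩ := hp.surjective x
    refine ⟨w, ?_, rfl⟩
    rw [mem_ofPred_eq, eq_bot_iff]
    intro g hg
    exact hfree w hx g hg
  have hcov : IsCoveringMap (U.restrictPreimage p) := hcovOn.isCoveringMap_restrictPreimage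
  set Q : Set K := j ⁻¹' Uᶜ with hQ
  let D : Set K := {y | ∀ q ∈ Q, (q : E) ∉ segment ℝ (b : E) y}
  let pt : ↥(unitInterval) × D → K := fun a => ⟨(b : E) + (a.1 : ℝ) • ((a.2.1 : E) - b), by
    have := hK.segment_subset b.2 a.2.1.2
    apply this
    rw [segment_eq_image']
    exact ⟨a.1, a.1.2, rfl⟩⟩
  have hptc : Continuous pt := by
    apply Continuous.subtype_mk
    fun_prop
  have hptU : ∀ a, j (pt a) ∈ U := by
    intro a
    by_contra hc
    refine a.2.2 (pt a) hc ?_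
    rw [segment_eq_image']
    exact ⟨a.1, a.1.2, rfl⟩
  let H : C(↥(unitInterval) × D, U) := ⟨fun a => ⟨j (pt a), hptU a⟩,
    (hj.comp hptc).subtype_mk _⟩
  let f : C(D, p ⁻¹' U) := ⟨fun _ => ⟨w0, by rw [mem_preimage, hw0]; exact hb⟩, continuous_const⟩
  have H0 : ∀ a, H (0, a) = U.restrictPreimage p (f a) := by
    intro a
    apply Subtype.ext
    simp [H, f, pt, hw0]
  let L := hcov.liftHomotopy H f H0
  have hL : ∀ a, p (L a) = j (pt a) := by
    intro a
    have := congrFun (hcov.liftHomotopy_lifts H f H0) a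
    exact congrArg Subtype.val this
  have hbD : b ∈ D := by
    intro q hq hqb
    rw [segment_same] at hqb
    have : q = b := Subtype.ext hqb
    exact hq (this ▸ hb)
  have hpt1 : ∀ a : D, pt (1, a) = a.1 := by
    intro a; apply Subtype.ext; simp [pt]
  have hconn : ∀ x : K, ∀ T ∈ 𝓝 x, ∃ V ∈ 𝓝 x, V ⊆ T ∧ IsPreconnected (V ∩ D) ∧ (V ∩ D).Nonempty := by
    intro x T hT
    obtain ⟨ε, hε, hεT⟩ := Metric.mem_nhds_iff.1 hT
    refine ⟨Metric.ball x ε, Metric.ball_mem_nhds x hε, hεT, ?_⟩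
    have hfinQ : Finite Q := hbad
    have hconv : Convex ℝ (K ∩ Metric.ball (x : E) ε) := hK.inter (convex_ball _ _)
    have hne : (interior (K ∩ Metric.ball (x : E) ε)).Nonempty := by
      rw [interior_inter, Metric.isOpen_ball.interior_eq]
      have hx : (x : E) ∈ closure (interior K) := by
        rw [hK.closure_interior_eq_closure_of_nonempty_interior hKint]
        exact subset_closure x.2
      rw [Metric.mem_closure_iff] at hx
      obtain ⟨y, hy, hxy⟩ := hx ε hε
      exact ⟨y, hy, by rwa [Metric.mem_ball, dist_comm]⟩
    have := hconv.isPreconnected_diff_lines hE hne (fun q : Q => (q.1 : E)) (fun q : Q => (q.1 : E) - b)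
      (fun q : Q => {y | (q.1 : E) ∈ segment ℝ (b : E) y}) (by
        rintro q y hy
        rw [mem_ofPred_eq, segment_eq_image'] at hy
        obtain ⟨t, ht, hy⟩ := hy
        have ht0 : t ≠ 0 := by
          rintro rfl
          apply q.2
          have : b = q.1 := Subtype.ext (by simpa using hy)
          rw [← this]; exact hb
        refine ⟨t⁻¹ - 1, ?_⟩
        have h1 : (q.1 : E) - b = t • (y - b) := by rw [← hy]; simp
        have h2 : t⁻¹ • ((q.1 : E) - b) = y - b := by rw [h1, smul_smul, inv_mul_cancel₀ ht0, one_smul]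
        rw [sub_smul, h2, one_smul]; abel)
    have himg : Subtype.val '' (Metric.ball x ε ∩ D) = (K ∩ Metric.ball (x : E) ε) \
        ⋃ q : Q, {y | (q.1 : E) ∈ segment ℝ (b : E) y} := by
      ext y
      simp only [mem_image, mem_inter_iff, Metric.mem_ball, Set.mem_sdiff, mem_iUnion, mem_ofPred_eq, not_exists]
      constructor
      · rintro ⟨z, ⟨hz, hzD⟩, rfl⟩
        exact ⟨⟨z.2, hz⟩, fun q => hzD q.1 q.2⟩
      · rintro ⟨⟨hyK, hy⟩, hq⟩
        exact ⟨⟨y, hyK⟩, ⟨hy, fun q hqQ => hq ⟨q, hqQ⟩⟩, rfl⟩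
    rw [← himg] at this
    exact ⟨IsInducing.subtypeVal.isPreconnected_image.1 this.1, this.2.of_image⟩
  have hfinfib : ∀ x, (p ⁻¹' {x}).Finite := by
    intro x
    obtain ⟨w, rfl⟩ := hp.surjective x
    refine (Set.finite_range (fun g : G => g • w)).subset ?_
    intro w' hw'
    exact hfib.1 hw'
  classical
  let s : K → W := fun x => if h : x ∈ D then (L (1, ⟨x, h⟩) : W) else w0
  have hsD : ∀ x : D, s x = L (1, x) := fun x => by simp only [s, x.2, dif_pos]
  obtain ⟨s', hs'c, hs', hs'p⟩ := exists_extension_of_finite_fibers p hp.continuous hfinfib j hj D hconn s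
    (by
      rw [continuousOn_iff_continuous_domRestrict]
      have : D.domRestrict s = fun x => (L (1, x) : W) := by
        ext x; exact hsD x
      rw [this]
      exact continuous_subtype_val.comp (L.continuous.comp (by fun_prop)))
    (by
      intro x hx
      rw [hsD ⟨x, hx⟩, hL, hpt1])
  refine ⟨s', hs'c, hs'p, ?_⟩
  rw [hs' b hbD, hsD ⟨b, hbD⟩]
  -- the path over the constant path is constant
  have hcst : (fun t : unitInterval => (L (t, ⟨b, hbD⟩))) = fun _ => f ⟨b, hbD⟩ := by
    refine hcov.eq_of_comp_eq (by fun_prop) continuous_const ?_ 0 ?_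
    · ext t
      have h1 := hL (t, ⟨b, hbD⟩)
      have : pt (t, ⟨b, hbD⟩) = b := by apply Subtype.ext; simp [pt]
      rw [this] at h1
      change p (L (t, ⟨b, hbD⟩)) = p w0
      rw [h1, hw0]
    · exact hcov.liftHomotopy_zero H f H0 _
  exact congrArg Subtype.val (congrFun hcst 1)

/-- A relation generated by finitely many partial maps with closed domains, closed under inverses,
all of whose composites belong to a finite family of continuous maps, generates a closed
equivalence relation. -/
theorem isClosed_eqvGen_of_finite {Z ι κ : Type*} [TopologicalSpace Z] [T2Space Z] [Finite ι] [Finite κ]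
    (T : ι → Z → Z) (hT : ∀ i, Continuous (T i)) (e : ι) (he : T e = id)
    (t : κ → Z → Z) (hcomp : ∀ k i, ∃ i', T i' = t k ∘ T i) (C : κ → Set Z) (hC : ∀ k, IsClosed (C k))
    (inv : κ → κ) (hinv : ∀ k, ∀ x ∈ C k, t k x ∈ C (inv k) ∧ t (inv k) (t k x) = x)
    (r : Z → Z → Prop) (hr : ∀ x y, r x y ↔ ∃ k, x ∈ C k ∧ y = t k x) :
    IsClosed {p : Z × Z | Relation.EqvGen r p.1 p.2} := by
  choose m hm using hcomp
  have hsymm : ∀ x y, r x y → r y x := by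
    intro x y h
    obtain ⟨k, hk, rfl⟩ := (hr x y).1 h
    exact (hr _ _).2 ⟨inv k, (hinv k x hk).1, (hinv k x hk).2.symm⟩
  let step : Set (ι × κ) → ι → ι → Prop := fun τ i i' => ∃ k, (i, k) ∈ τ ∧ i' = m k i
  let good : Set (ι × κ) → Set Z := fun τ => ⋂ a ∈ τ, T a.1 ⁻¹' C a.2
  have hgood : ∀ τ, IsClosed (good τ) := fun τ =>
    isClosed_biInter fun a _ => (hC a.2).preimage (hT a.1)
  have hsound : ∀ τ i, Relation.ReflTransGen (step τ) e i → ∀ x ∈ good τ, Relation.EqvGen r x (T i x) := by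
    intro τ i h x hx
    induction h with
    | refl => rw [he]; exact Relation.EqvGen.refl x
    | @tail i i' _ h' ih =>
      obtain ⟨k, hk, rfl⟩ := h'
      refine ih.trans _ _ _ (Relation.EqvGen.rel _ _ ((hr _ _).2 ⟨k, ?_, ?_⟩))
      · exact mem_iInter₂.1 hx (i, k) hk
      · rw [hm]; rfl
  have hcomplete : ∀ x y, Relation.EqvGen r x y → ∃ τ i, Relation.ReflTransGen (step τ) e i ∧ x ∈ good τ ∧
      y = T i x := by
    intro x y h
    have h2 : Relation.ReflTransGen r x y := by
      induction h with
      | rel x y h => exact Relation.ReflTransGen.single h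
      | refl x => exact Relation.ReflTransGen.refl
      | symm x y _ ih =>
        clear * - ih hsymm
        induction ih with
        | refl => exact Relation.ReflTransGen.refl
        | tail _ h ih => exact ih.head (hsymm _ _ h)
      | trans x y z _ _ ih1 ih2 => exact ih1.trans ih2
    refine ⟨{a | T a.1 x ∈ C a.2}, ?_⟩
    have hx : x ∈ good {a | T a.1 x ∈ C a.2} := mem_iInter₂.2 fun a ha => ha
    clear h
    induction h2 with
    | refl => exact ⟨e, Relation.ReflTransGen.refl, hx, by rw [he]; rfl⟩
    | tail h1 h' ih =>
      obtain ⟨i, hi, -, rfl⟩ := ih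
      obtain ⟨k, hk, rfl⟩ := (hr _ _).1 h'
      exact ⟨m k i, hi.tail ⟨k, hk, rfl⟩, hx, by rw [hm]; rfl⟩
  have : {p : Z × Z | Relation.EqvGen r p.1 p.2} =
      ⋃ a ∈ {a : Set (ι × κ) × ι | Relation.ReflTransGen (step a.1) e a.2},
        {p : Z × Z | p.1 ∈ good a.1 ∧ p.2 = T a.2 p.1} := by
    ext ⟨x, y⟩
    simp only [mem_ofPred_eq, mem_iUnion, exists_prop, Prod.exists]
    constructor
    · intro h
      obtain ⟨τ, i, h1, h2, h3⟩ := hcomplete x y h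
      exact ⟨τ, i, h1, h2, h3⟩
    · rintro ⟨τ, i, h1, h2, rfl⟩
      exact hsound τ i h1 x h2
  rw [this]
  refine (Set.toFinite _).isClosed_biUnion fun a _ => ?_
  exact ((hgood a.1).preimage continuous_fst).inter
    (isClosed_eq continuous_snd ((hT a.2).comp continuous_fst))

/-- The sign `±1` attached to a boolean. -/
def sgn (b : Bool) : ℝ := if b then 1 else -1

theorem sgn_mul_self (b : Bool) : sgn b * sgn b = 1 := by cases b <;> norm_num [sgn]

theorem abs_sgn (b : Bool) : |sgn b| = 1 := by cases b <;> norm_num [sgn]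

theorem sgn_ne_zero (b : Bool) : sgn b ≠ 0 := by cases b <;> norm_num [sgn]

theorem sgn_injective : Function.Injective sgn := by
  intro a b h; cases a <;> cases b <;> first | rfl | (norm_num [sgn] at h)

theorem sgn_beq (a b : Bool) : sgn (a == b) = sgn a * sgn b := by
  cases a <;> cases b <;> norm_num [sgn]

theorem vertexPt_apply (v : OctVertex) (j : Fin 3) :
    vertexPt v j = if j = v.1 then sgn v.2 else 0 := rfl

theorem sum_smul_vertexPt (F : OctFace) (w : Fin 3 → ℝ) :
    ∑ i, w i • vertexPt (i, F i) = fun i => sgn (F i) * w i := by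
  ext j
  rw [Finset.sum_apply, Finset.sum_eq_single j]
  · simp [vertexPt_apply, mul_comm]
  · intro b _ hb; simp [vertexPt_apply, hb.symm]
  · simp

/-- The closed face of the octahedron spanned by the vertices of `F`. -/
def faceSet (F : OctFace) : Set (Fin 3 → ℝ) :=
  {x | (∀ i, 0 ≤ sgn (F i) * x i) ∧ ∑ i, sgn (F i) * x i = 1}

theorem isClosed_faceSet (F : OctFace) : IsClosed (faceSet F) := by
  apply IsClosed.inter
  · have : {x : Fin 3 → ℝ | ∀ i, 0 ≤ sgn (F i) * x i} = ⋂ i, {x | 0 ≤ sgn (F i) * x i} := by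
      ext x; simp
    change IsClosed {x : Fin 3 → ℝ | ∀ i, 0 ≤ sgn (F i) * x i}
    rw [this]
    exact isClosed_iInter fun i => isClosed_le continuous_const (by fun_prop)
  · exact isClosed_eq (by fun_prop) continuous_const

theorem convex_faceSet (F : OctFace) : Convex ℝ (faceSet F) := by
  intro x hx y hy a b ha hb hab
  refine ⟨fun i => ?_, ?_⟩
  · have h1 := mul_nonneg ha (hx.1 i)
    have h2 := mul_nonneg hb (hy.1 i)
    simp only [Pi.add_apply, Pi.smul_apply, smul_eq_mul]
    nlinarith
  · have : ∑ i, sgn (F i) * (a • x + b • y) i = a * ∑ i, sgn (F i) * x i + b * ∑ i, sgn (F i) * y i := by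
      rw [Finset.mul_sum, Finset.mul_sum, ← Finset.sum_add_distrib]
      refine Finset.sum_congr rfl fun i _ => ?_
      simp only [Pi.add_apply, Pi.smul_apply, smul_eq_mul]; ring
    rw [this, hx.2, hy.2]; linarith

theorem sgn_mul_eq_abs {b : Bool} {x : ℝ} (h : 0 ≤ sgn b * x) : sgn b * x = |x| := by
  rw [← abs_of_nonneg h, abs_mul, abs_sgn, one_mul]

theorem mem_faceSet_iff (F : OctFace) (x : Fin 3 → ℝ) :
    x ∈ faceSet F ↔ (∀ i, 0 ≤ sgn (F i) * x i) ∧ ∑ i, |x i| = 1 := by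
  refine and_congr_right fun h => ?_
  rw [Finset.sum_congr rfl fun i _ => sgn_mul_eq_abs (h i)]

/-- The solid octahedron is the unit ball of the `ℓ¹` norm. -/
theorem mem_solidOcta (x : Fin 3 → ℝ) : x ∈ SolidOcta ↔ ∑ i, |x i| ≤ 1 := by
  constructor
  · intro h
    have hconv : Convex ℝ {x : Fin 3 → ℝ | ∑ i, |x i| ≤ 1} := by
      intro x hx y hy a b ha hb hab
      have : ∀ i, |(a • x + b • y) i| ≤ a * |x i| + b * |y i| := by
        intro i
        refine (abs_add_le _ _).trans ?_
        simp [abs_mul, abs_of_nonneg ha, abs_of_nonneg hb]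
      calc ∑ i, |(a • x + b • y) i| ≤ ∑ i, (a * |x i| + b * |y i|) := Finset.sum_le_sum fun i _ => this i
        _ = a * ∑ i, |x i| + b * ∑ i, |y i| := by rw [Finset.mul_sum, Finset.mul_sum, Finset.sum_add_distrib]
        _ ≤ a * 1 + b * 1 := by gcongr <;> assumption
        _ = 1 := by linarith
    refine convexHull_min ?_ hconv h
    rintro _ ⟨v, rfl⟩
    rw [mem_ofPred_eq, Finset.sum_eq_single v.1]
    · simp [vertexPt_apply, abs_sgn]
    · intro b _ hb; simp [vertexPt_apply, hb]
    · simp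
  · intro h
    have hv := fun v => vertexPt_mem_solidOcta v
    have hc : Convex ℝ SolidOcta := convex_convexHull ℝ _
    have h0 : (0 : Fin 3 → ℝ) ∈ SolidOcta := by
      have := hc (hv (0, true)) (hv (0, false)) (by norm_num : (0 : ℝ) ≤ 1 / 2)
        (by norm_num : (0 : ℝ) ≤ 1 / 2) (by norm_num)
      convert! this
      ext j; simp only [Pi.add_apply, Pi.smul_apply, vertexPt_apply]; split_ifs <;> simp [sgn]
    let F : OctFace := fun i => decide (0 ≤ x i)
    have hF : ∀ i, 0 ≤ sgn (F i) * x i := by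
      intro i
      by_cases hx : 0 ≤ x i
      · simp [F, hx, sgn]
      · simp [F, hx, sgn]; exact (not_le.1 hx).le
    have hsum := hc.sum_mem (t := (Finset.univ : Finset (Option (Fin 3))))
      (w := fun o => o.elim (1 - ∑ i, |x i|) (fun i => |x i|))
      (z := fun o => o.elim 0 (fun i => vertexPt (i, F i))) (by
        rintro (_ | i) _
        · simpa using h
        · exact abs_nonneg _) (by rw [Fintype.sum_option]; simp) (by
        rintro (_ | i) _
        · exact h0
        · exact hv _)
    rw [Fintype.sum_option] at hsum
    simp only [Option.elim, smul_zero, zero_add] at hsum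
    rw [sum_smul_vertexPt] at hsum
    convert! hsum
    rename_i i
    rw [← sgn_mul_eq_abs (hF i), ← mul_assoc, sgn_mul_self, one_mul]

theorem faceSet_subset (F : OctFace) : faceSet F ⊆ SolidOcta := fun x hx =>
  (mem_solidOcta x).2 ((mem_faceSet_iff F x).1 hx).2.le

/-- The signed coordinate permutation extending the identification of the face `F`. -/
def Gluing.move (g : Gluing) (F : OctFace) (x : Fin 3 → ℝ) : Fin 3 → ℝ := fun j =>
  sgn (g.face F j) * (sgn (F ((g.axisMap F)⁻¹ j)) * x ((g.axisMap F)⁻¹ j))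

theorem Gluing.face_face (g : Gluing) (F : OctFace) : g.face (g.face F) = F := g.2.1 F

theorem Gluing.face_ne (g : Gluing) (F : OctFace) : g.face F ≠ F := g.2.2.1 F

theorem Gluing.axisMap_face (g : Gluing) (F : OctFace) : g.axisMap (g.face F) = (g.axisMap F)⁻¹ :=
  g.2.2.2.1 F

theorem Gluing.move_move (g : Gluing) (F : OctFace) (x : Fin 3 → ℝ) :
    g.move (g.face F) (g.move F x) = x := by
  ext j
  simp only [Gluing.move, g.face_face, g.axisMap_face, inv_inv, Equiv.Perm.coe_inv, Equiv.symm_apply_apply]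
  rw [← mul_assoc (sgn (g.face F _)), sgn_mul_self, one_mul, ← mul_assoc, sgn_mul_self, one_mul]

theorem Gluing.move_mem (g : Gluing) {F : OctFace} {x : Fin 3 → ℝ} (hx : x ∈ faceSet F) :
    g.move F x ∈ faceSet (g.face F) := by
  have : ∀ j, sgn (g.face F j) * g.move F x j =
      sgn (F ((g.axisMap F)⁻¹ j)) * x ((g.axisMap F)⁻¹ j) := by
    intro j
    rw [Gluing.move, ← mul_assoc, sgn_mul_self, one_mul]
  refine ⟨fun i => ?_, ?_⟩
  · rw [this]; exact hx.1 _
  · rw [Finset.sum_congr rfl fun j _ => this j, ← hx.2]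
    exact Equiv.sum_comp (g.axisMap F)⁻¹ (fun i => sgn (F i) * x i)

theorem Gluing.sum_abs_move (g : Gluing) (F : OctFace) (x : Fin 3 → ℝ) :
    ∑ i, |g.move F x i| = ∑ i, |x i| := by
  simp only [Gluing.move, abs_mul, abs_sgn, one_mul]
  exact Equiv.sum_comp (g.axisMap F)⁻¹ (fun i => |x i|)

theorem Gluing.continuous_move (g : Gluing) (F : OctFace) : Continuous (g.move F) := by
  unfold Gluing.move; fun_prop

/-- The signed coordinate permutation as a self-map of the solid octahedron. -/
def Gluing.omove (g : Gluing) (F : OctFace) (x : SolidOcta) : SolidOcta :=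
  ⟨g.move F x, by rw [mem_solidOcta, g.sum_abs_move, ← mem_solidOcta]; exact x.2⟩

theorem Gluing.continuous_omove (g : Gluing) (F : OctFace) : Continuous (g.omove F) :=
  ((g.continuous_move F).comp continuous_subtype_val).subtype_mk _

theorem Gluing.omove_omove (g : Gluing) (F : OctFace) (x : SolidOcta) :
    g.omove (g.face F) (g.omove F x) = x := Subtype.ext (g.move_move F x)

theorem glueRel_iff (g : Gluing) (x y : SolidOcta) :
    glueRel g x y ↔ ∃ F, (x : Fin 3 → ℝ) ∈ faceSet F ∧ y = g.omove F x := by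
  have hsum : ∀ (F : OctFace) (w : Fin 3 → ℝ),
      ∑ i, w i • vertexPt (g.axisMap F i, g.face F (g.axisMap F i)) =
        fun j => sgn (g.face F j) * w ((g.axisMap F)⁻¹ j) := by
    intro F w
    rw [← sum_smul_vertexPt, ← Equiv.sum_comp (g.axisMap F) (fun i => w ((g.axisMap F)⁻¹ i) • _)]
    simp
  constructor
  · rintro ⟨F, w, hw, hw1, hx, hy⟩
    rw [sum_smul_vertexPt] at hx
    rw [hsum] at hy
    have hxi : ∀ i, sgn (F i) * (x : Fin 3 → ℝ) i = w i := by
      intro i; rw [hx, ← mul_assoc, sgn_mul_self, one_mul]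
    refine ⟨F, ⟨fun i => by rw [hxi]; exact hw i, by simp_rw [hxi]; exact hw1⟩, ?_⟩
    apply Subtype.ext
    rw [hy]
    ext j
    change _ = g.move F x j
    rw [Gluing.move, hxi]
  · rintro ⟨F, hx, rfl⟩
    refine ⟨F, fun i => sgn (F i) * (x : Fin 3 → ℝ) i, hx.1, hx.2, ?_, ?_⟩
    · rw [sum_smul_vertexPt]
      ext i
      rw [← mul_assoc, sgn_mul_self, one_mul]
    · rw [hsum]; rfl

instance : CompactSpace SolidOcta := by
  have : IsCompact SolidOcta := by
    unfold SolidOcta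
    exact (Set.finite_range vertexPt).isCompact_convexHull (𝕜 := ℝ)
  exact isCompact_iff_compactSpace.1 this

theorem convex_solidOcta : Convex ℝ SolidOcta := convex_convexHull ℝ _

theorem interior_solidOcta_nonempty : (interior SolidOcta).Nonempty := by
  refine ⟨0, mem_interior_iff_mem_nhds.2 ?_⟩
  have : IsOpen {x : Fin 3 → ℝ | ∑ i, |x i| < 1} := isOpen_lt (by fun_prop) continuous_const
  refine Filter.mem_of_superset (this.mem_nhds (by simp)) fun x hx => (mem_solidOcta x).2 (le_of_lt hx)

/-- A signed coordinate permutation, as a self-map of the solid octahedron. -/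
def smap (q : Equiv.Perm (Fin 3) × (Fin 3 → Bool)) (x : SolidOcta) : SolidOcta :=
  ⟨fun j => sgn (q.2 j) * (x : Fin 3 → ℝ) (q.1 j), by
    rw [mem_solidOcta]
    simp only [abs_mul, abs_sgn, one_mul]
    rw [Equiv.sum_comp q.1 (fun i => |(x : Fin 3 → ℝ) i|), ← mem_solidOcta]
    exact x.2⟩

theorem continuous_smap (q : Equiv.Perm (Fin 3) × (Fin 3 → Bool)) : Continuous (smap q) := by
  have h : Continuous fun x : Fin 3 → ℝ => fun j => sgn (q.2 j) * x (q.1 j) := by fun_prop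
  exact (h.comp continuous_subtype_val).subtype_mk _

theorem smap_one : smap (1, fun _ => true) = id := by
  ext x; simp [smap, sgn]

theorem Gluing.exists_omove_comp_smap (g : Gluing) (F : OctFace)
    (q : Equiv.Perm (Fin 3) × (Fin 3 → Bool)) : ∃ q', smap q' = g.omove F ∘ smap q := by
  refine ⟨((q.1 * (g.axisMap F)⁻¹), fun j => g.face F j == (F ((g.axisMap F)⁻¹ j) ==
    q.2 ((g.axisMap F)⁻¹ j))), ?_⟩
  ext x j
  simp only [smap, Gluing.omove, Gluing.move, sgn_beq, Function.comp, Equiv.Perm.mul_apply]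
  ring

theorem glueRel_symm (g : Gluing) {x y : SolidOcta} (h : glueRel g x y) : glueRel g y x := by
  obtain ⟨F, hF, rfl⟩ := (glueRel_iff g x y).1 h
  exact (glueRel_iff g _ _).2 ⟨g.face F, g.move_mem hF, (g.omove_omove F x).symm⟩

theorem isClosed_glueSetoid (g : Gluing) :
    IsClosed {p : SolidOcta × SolidOcta | glueSetoid g p.1 p.2} :=
  isClosed_eqvGen_of_finite smap continuous_smap _ smap_one (fun F => g.omove F)
    (fun F q => g.exists_omove_comp_smap F q) (fun F => {x | (x : Fin 3 → ℝ) ∈ faceSet F})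
    (fun F => (isClosed_faceSet F).preimage continuous_subtype_val) g.face
    (fun F x hx => ⟨g.move_mem hx, g.omove_omove F x⟩) _ (glueRel_iff g)

instance (g : Gluing) : T2Space (XSpace g) := t2Space_quotient_of_isClosed _ (isClosed_glueSetoid g)

/-- Induction along a symmetric relation. -/
theorem Relation.EqvGen.invariant {Z : Type*} {r : Z → Z → Prop} (hr : ∀ x y, r x y → r y x)
    (P : Z → Prop) (hP : ∀ x y, P x → r x y → P y) {x y : Z} (h : Relation.EqvGen r x y) : P x ↔ P y := by
  induction h with
  | rel x y h => exact ⟨fun hx => hP _ _ hx h, fun hy => hP _ _ hy (hr _ _ h)⟩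
  | refl => exact Iff.rfl
  | symm _ _ _ ih => exact ih.symm
  | trans _ _ _ _ _ ih1 ih2 => exact ih1.trans ih2

theorem exists_smap_of_glueSetoid (g : Gluing) {x y : SolidOcta} (h : glueSetoid g x y) :
    ∃ q, y = smap q x := by
  refine (Relation.EqvGen.invariant (fun _ _ => glueRel_symm g) (fun z => ∃ q, z = smap q x) ?_ h).1
    ⟨_, (congrFun smap_one x).symm⟩
  rintro z w ⟨q, rfl⟩ hw
  obtain ⟨F, -, rfl⟩ := (glueRel_iff g _ _).1 hw
  obtain ⟨q', hq⟩ := g.exists_omove_comp_smap F q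
  exact ⟨q', (congrFun hq x).symm⟩

theorem finite_glueSetoid (g : Gluing) (x : SolidOcta) : {y | glueSetoid g x y}.Finite :=
  (Set.finite_range fun q => smap q x).subset fun _ hy =>
    let ⟨q, hq⟩ := exists_smap_of_glueSetoid g hy
    ⟨q, hq.symm⟩

section Labelled

variable {G : Type*} [Group G]

/-- A labelling of the faces by a group: paired faces carry inverse labels. -/
def IsLabel (g : Gluing) (a : OctFace → G) : Prop := ∀ F, a F * a (g.face F) = 1

/-- The identifications of the covering space attached to a labelling. -/
def lrel (g : Gluing) (a : OctFace → G) (x y : SolidOcta × G) : Prop :=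
  ∃ F, (x.1 : Fin 3 → ℝ) ∈ faceSet F ∧ y = (g.omove F x.1, x.2 * a F)

theorem lrel_symm {g : Gluing} {a : OctFace → G} (ha : IsLabel g a) (x y : SolidOcta × G)
    (h : lrel g a x y) : lrel g a y x := by
  obtain ⟨F, hF, rfl⟩ := h
  exact ⟨g.face F, g.move_mem hF, by rw [g.omove_omove, mul_assoc, ha F, mul_one]⟩

/-- The equivalence relation generated by the labelled identifications. -/
def lsetoid (g : Gluing) (a : OctFace → G) : Setoid (SolidOcta × G) := Relation.EqvGen.setoid (lrel g a)

/-- The covering space attached to a labelling. -/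
abbrev YSpace (g : Gluing) (a : OctFace → G) : Type _ := Quotient (lsetoid g a)

theorem lrel_mul {g : Gluing} {a : OctFace → G} (k : G) {x y : SolidOcta × G} (h : lrel g a x y) :
    lrel g a (x.1, k * x.2) (y.1, k * y.2) := by
  obtain ⟨F, hF, rfl⟩ := h
  exact ⟨F, hF, by rw [mul_assoc]⟩

theorem lsetoid_mul {g : Gluing} {a : OctFace → G} (k : G) {x y : SolidOcta × G}
    (h : lsetoid g a x y) : lsetoid g a (x.1, k * x.2) (y.1, k * y.2) := by
  induction h with
  | rel x y h => exact Relation.EqvGen.rel _ _ (lrel_mul k h)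
  | refl x => exact Relation.EqvGen.refl _
  | symm x y _ ih => exact ih.symm
  | trans x y z _ _ ih1 ih2 => exact Setoid.trans' _ ih1 ih2

/-- The class of a labelled point in the covering space. -/
def ymk (g : Gluing) (a : OctFace → G) (x : SolidOcta) (h : G) : YSpace g a := Quotient.mk _ (x, h)

instance (g : Gluing) (a : OctFace → G) : MulAction G (YSpace g a) where
  smul k := Quotient.map (fun x => (x.1, k * x.2)) fun _ _ h => lsetoid_mul k h
  one_smul y := by
    obtain ⟨x, rfl⟩ := Quotient.exists_rep y
    change Quotient.mk _ (x.1, 1 * x.2) = _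
    rw [one_mul]
  mul_smul k k' y := by
    obtain ⟨x, rfl⟩ := Quotient.exists_rep y
    change Quotient.mk _ (x.1, k * k' * x.2) = Quotient.mk _ (x.1, k * (k' * x.2))
    rw [mul_assoc]

theorem smul_ymk (g : Gluing) (a : OctFace → G) (x : SolidOcta) (h k : G) :
    k • ymk g a x h = ymk g a x (k * h) := rfl

theorem ymk_omove (g : Gluing) (a : OctFace → G) {x : SolidOcta} {F : OctFace}
    (hx : (x : Fin 3 → ℝ) ∈ faceSet F) (h : G) :
    ymk g a (g.omove F x) (h * a F) = ymk g a x h :=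
  (Quotient.sound (Relation.EqvGen.rel _ _ ⟨F, hx, rfl⟩)).symm

theorem exists_ymk (g : Gluing) (a : OctFace → G) (y : YSpace g a) : ∃ x h, ymk g a x h = y :=
  let ⟨x, hx⟩ := Quotient.exists_rep y
  ⟨x.1, x.2, hx⟩

/-- The covering projection. -/
def yproj (g : Gluing) (a : OctFace → G) : YSpace g a → XSpace g :=
  Quotient.map Prod.fst fun x y h => by
    induction h with
    | rel x y h =>
      obtain ⟨F, hF, rfl⟩ := h
      exact Relation.EqvGen.rel _ _ ((glueRel_iff _ _ _).2 ⟨F, hF, rfl⟩)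
    | refl x => exact Setoid.refl' _ _
    | symm x y _ ih => exact Setoid.symm' _ ih
    | trans x y z _ _ ih1 ih2 => exact Setoid.trans' _ ih1 ih2

theorem yproj_ymk (g : Gluing) (a : OctFace → G) (x : SolidOcta) (h : G) :
    yproj g a (ymk g a x h) = Quotient.mk _ x := rfl

theorem exists_ymk_eq_of_glueSetoid {g : Gluing} (a : OctFace → G) {x y : SolidOcta}
    (hxy : glueSetoid g x y) : ∃ k, ymk g a y k = ymk g a x 1 := by
  induction hxy with
  | rel x y h =>
    obtain ⟨F, hF, rfl⟩ := (glueRel_iff _ _ _).1 h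
    exact ⟨_, ymk_omove g a hF 1⟩
  | refl x => exact ⟨1, rfl⟩
  | symm x y _ ih =>
    obtain ⟨k, hk⟩ := ih
    refine ⟨k⁻¹, ?_⟩
    have := congrArg (k⁻¹ • ·) hk
    simp only [smul_ymk, inv_mul_cancel, mul_one] at this
    exact this.symm
  | trans x y z _ _ ih1 ih2 =>
    obtain ⟨k, hk⟩ := ih1
    obtain ⟨l, hl⟩ := ih2
    refine ⟨k * l, ?_⟩
    rw [← smul_ymk, hl, smul_ymk, mul_one, hk]

theorem yproj_eq_iff {g : Gluing} {a : OctFace → G} {w w' : YSpace g a} :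
    yproj g a w = yproj g a w' ↔ w ∈ MulAction.orbit G w' := by
  obtain ⟨x, h, rfl⟩ := exists_ymk g a w
  obtain ⟨y, k, rfl⟩ := exists_ymk g a w'
  constructor
  · intro e
    obtain ⟨l, hl⟩ := exists_ymk_eq_of_glueSetoid a (Quotient.exact e : glueSetoid g x y)
    refine ⟨h * l * k⁻¹, ?_⟩
    change (h * l * k⁻¹) • ymk g a y k = _
    rw [smul_ymk, inv_mul_cancel_right, ← smul_ymk, hl, smul_ymk, mul_one]
  · rintro ⟨l, hl⟩
    rw [← hl]; rfl

theorem continuous_ymk [TopologicalSpace G] (g : Gluing) (a : OctFace → G) (h : G) : Continuous fun x => ymk g a x h :=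
  continuous_quotient_mk'.comp (by fun_prop)

variable [Finite G] [TopologicalSpace G] [DiscreteTopology G]

theorem isClosed_lsetoid {g : Gluing} {a : OctFace → G} (ha : IsLabel g a) :
    IsClosed {p : (SolidOcta × G) × (SolidOcta × G) | lsetoid g a p.1 p.2} :=
  isClosed_eqvGen_of_finite (ι := (Equiv.Perm (Fin 3) × (Fin 3 → Bool)) × G)
    (fun i x => (smap i.1 x.1, x.2 * i.2))
    (fun i => ((continuous_smap i.1).comp continuous_fst).prodMk
      ((continuous_of_discreteTopology (f := fun k : G => k * i.2)).comp continuous_snd))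
    ((1, fun _ => true), 1) (by ext1 x; simp [smap_one])
    (fun F x => (g.omove F x.1, x.2 * a F))
    (fun F i => by
      obtain ⟨q, hq⟩ := g.exists_omove_comp_smap F i.1
      refine ⟨(q, i.2 * a F), ?_⟩
      ext1 x
      simp [hq, mul_assoc])
    (fun F => {x | (x.1 : Fin 3 → ℝ) ∈ faceSet F})
    (fun F => (isClosed_faceSet F).preimage (continuous_subtype_val.comp continuous_fst)) g.face
    (fun F x hx => ⟨g.move_mem hx, by rw [g.omove_omove, mul_assoc, ha F, mul_one]⟩) _
    (fun _ _ => Iff.rfl)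

theorem t2Space_ySpace {g : Gluing} {a : OctFace → G} (ha : IsLabel g a) : T2Space (YSpace g a) :=
  t2Space_quotient_of_isClosed _ (isClosed_lsetoid ha)

instance (g : Gluing) (a : OctFace → G) : ContinuousConstSMul G (YSpace g a) where
  continuous_const_smul k := by
    refine continuous_quot_lift _ (continuous_quotient_mk'.comp ?_)
    exact continuous_fst.prodMk ((continuous_of_discreteTopology (f := fun l : G => k * l)).comp continuous_snd)

theorem isQuotientMap_yproj (g : Gluing) (a : OctFace → G) : IsQuotientMap (yproj g a) := by
  have h1 : IsQuotientMap (fun x : SolidOcta => (Quotient.mk _ x : XSpace g)) := isQuotientMap_quotient_mk'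
  refine IsQuotientMap.of_comp (f := fun x => ymk g a x 1) (continuous_ymk g a 1) ?_ h1
  exact continuous_quot_lift _ (continuous_quotient_mk'.comp continuous_fst)

end Labelled

/-- The image of the vertex of `F` on axis `i` under the identification of `F`. -/
def vimg (g : Gluing) (F : OctFace) (i : Fin 3) : OctVertex :=
  (g.axisMap F i, g.face F (g.axisMap F i))

theorem Gluing.move_vertexPt (g : Gluing) (F : OctFace) (i : Fin 3) :
    g.move F (vertexPt (i, F i)) = vertexPt (vimg g F i) := by
  ext j
  simp only [Gluing.move, vertexPt_apply, vimg]
  by_cases h : j = g.axisMap F i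
  · subst h; simp [sgn_mul_self]
  · have h' : ¬ (g.axisMap F)⁻¹ j = i := fun e => h (by rw [← e]; simp)
    simp only [h, h', if_false, mul_zero]

theorem Gluing.move_add (g : Gluing) (F : OctFace) (s t : ℝ) (x y : Fin 3 → ℝ) :
    g.move F (s • x + t • y) = s • g.move F x + t • g.move F y := by
  ext j
  simp only [Gluing.move, Pi.add_apply, Pi.smul_apply, smul_eq_mul]
  ring

/-- The point dividing an edge in the ratio `t`. -/
def edgePt (e : OctVertex × OctVertex) (t : ℝ) : Fin 3 → ℝ :=
  t • vertexPt e.1 + (1 - t) • vertexPt e.2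

theorem eq_of_edgePt_mem_faceSet {v u : OctVertex} (h : v.1 ≠ u.1) {t : ℝ} (h0 : 0 < t) (h1 : t < 1)
    {F : OctFace} (hF : edgePt (v, u) t ∈ faceSet F) : F v.1 = v.2 ∧ F u.1 = u.2 := by
  have hv := hF.1 v.1
  have hu := hF.1 u.1
  simp only [edgePt, Pi.add_apply, Pi.smul_apply, vertexPt_apply, smul_eq_mul, if_true, h, h.symm, if_false,
    mul_zero, add_zero, zero_add] at hv hu
  have key : ∀ (a b : Bool) (s : ℝ), 0 < s → 0 ≤ sgn a * (s * sgn b) → a = b := by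
    intro a b s hs hab
    cases a <;> cases b <;> simp [sgn] at hab ⊢ <;> linarith
  exact ⟨key _ _ _ h0 hv, key _ _ _ (sub_pos.2 h1) hu⟩

theorem vertexPt_mem_faceSet (F : OctFace) (i : Fin 3) : vertexPt (i, F i) ∈ faceSet F := by
  refine ⟨fun j => ?_, ?_⟩
  · rw [vertexPt_apply]
    split_ifs with h
    · simp only at h; subst h; rw [sgn_mul_self]; norm_num
    · simp
  · rw [Finset.sum_eq_single i]
    · simp [vertexPt_apply, sgn_mul_self]
    · intro b _ hb; simp [vertexPt_apply, hb]
    · simp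

theorem edgePt_injective {v u v' u' : OctVertex} (h : v.1 ≠ u.1) (h' : v'.1 ≠ u'.1) {t : ℝ} (h0 : 0 < t)
    (h1 : t < 1) (he : edgePt (v, u) t = edgePt (v', u') t) :
    (v', u') = (v, u) ∨ (v', u') = (u, v) := by
  have e := congrFun he
  have hs : (1 - t) ≠ 0 := (sub_pos.2 h1).ne'
  have ev := e v.1
  have eu := e u.1
  simp only [edgePt, Pi.add_apply, Pi.smul_apply, vertexPt_apply, smul_eq_mul, if_true, h, h.symm, if_false,
    mul_zero, add_zero, zero_add] at ev eu
  have key : ∀ (a b : Bool) (s s' : ℝ), 0 < s → 0 < s' → s * sgn a = s' * sgn b → a = b := by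
    intro a b s s' hs hs' hab
    cases a <;> cases b <;> simp [sgn] at hab ⊢ <;> linarith
  have h2 := sub_pos.2 h1
  obtain ⟨i, a⟩ := v
  obtain ⟨j, b⟩ := u
  obtain ⟨i', a'⟩ := v'
  obtain ⟨j', b'⟩ := u'
  simp only at h h' ev eu
  by_cases c1 : i = i'
  · subst c1
    by_cases c4 : j = j'
    · subst c4
      simp only [if_true, h, h.symm, if_false, mul_zero, add_zero, zero_add] at ev eu
      left; rw [key _ _ _ _ h0 h0 ev, key _ _ _ _ h2 h2 eu]
    · simp [h.symm, c4, hs, sgn_ne_zero] at eu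
  · by_cases c2 : i = j'
    · subst c2
      by_cases c3 : j = i'
      · subst c3
        simp only [if_true, h, h.symm, if_false, mul_zero, add_zero, zero_add] at ev eu
        right; rw [key _ _ _ _ h0 h2 ev, key _ _ _ _ h2 h0 eu]
      · simp [h.symm, c3, hs, sgn_ne_zero] at eu
    · simp [c1, c2, h0.ne', sgn_ne_zero] at ev

section

variable {G : Type*} [Group G]

/-- The labelled identifications of ordered edges. -/
def erel (g : Gluing) (a : OctFace → G) (p q : (OctVertex × OctVertex) × G) : Prop :=
  ∃ (F : OctFace) (i j : Fin 3), i ≠ j ∧ p.1 = ((i, F i), (j, F j)) ∧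
    q = ((vimg g F i, vimg g F j), p.2 * a F)

/-- No edge is identified with itself with the opposite orientation. -/
def NoFlip (g : Gluing) : Prop := ∀ e e' : EdgeEnd, endSetoid g e e' → e'.1 ≠ (e.1.2, e.1.1)

/-- A labelling is admissible if its holonomy around each edge is trivial. -/
def IsAdm (g : Gluing) (a : OctFace → G) : Prop :=
  IsLabel g a ∧ ∀ v u : OctVertex, v.1 ≠ u.1 → ∀ k, Relation.EqvGen (erel g a) ((v, u), 1) ((v, u), k) → k = 1

theorem erel_ends {g : Gluing} {a : OctFace → G} {p q : (OctVertex × OctVertex) × G} (h : erel g a p q) :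
    ∃ (hp : p.1.1.1 ≠ p.1.2.1) (hq : q.1.1.1 ≠ q.1.2.1), endRel g ⟨p.1, hp⟩ ⟨q.1, hq⟩ := by
  obtain ⟨F, i, j, hij, hp, hq⟩ := h
  have hp1 : p.1.1.1 = i := by rw [hp]
  have hp2 : p.1.2.1 = j := by rw [hp]
  have hq1 : q.1.1.1 = g.axisMap F i := by rw [hq]; rfl
  have hq2 : q.1.2.1 = g.axisMap F j := by rw [hq]; rfl
  refine ⟨by rw [hp1, hp2]; exact hij, by rw [hq1, hq2]; exact fun h => hij ((g.axisMap F).injective h),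
    F, i, j, hij, hp, ?_⟩
  exact congrArg Prod.fst hq

theorem ends_of_eqvGen_erel {g : Gluing} {a : OctFace → G} {p q : (OctVertex × OctVertex) × G}
    (h : Relation.EqvGen (erel g a) p q) (hp : p.1.1.1 ≠ p.1.2.1) :
    ∃ hq : q.1.1.1 ≠ q.1.2.1, endSetoid g ⟨p.1, hp⟩ ⟨q.1, hq⟩ := by
  suffices H : p = q ∨ ∃ (hp : p.1.1.1 ≠ p.1.2.1) (hq : q.1.1.1 ≠ q.1.2.1),
      endSetoid g ⟨p.1, hp⟩ ⟨q.1, hq⟩ by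
    rcases H with rfl | ⟨_, hq, h⟩
    · exact ⟨hp, Setoid.refl' _ _⟩
    · exact ⟨hq, h⟩
  clear hp
  induction h with
  | rel p q h =>
    obtain ⟨hp, hq, h⟩ := erel_ends h
    exact Or.inr ⟨hp, hq, Relation.EqvGen.rel _ _ h⟩
  | refl => exact Or.inl rfl
  | symm p q _ ih =>
    rcases ih with rfl | ⟨hp, hq, h⟩
    · exact Or.inl rfl
    · exact Or.inr ⟨hq, hp, Setoid.symm' _ h⟩
  | trans p q r _ _ ih1 ih2 =>
    rcases ih1 with rfl | ⟨hp, hq, h⟩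
    · exact ih2
    · rcases ih2 with rfl | ⟨hp', hq', h'⟩
      · exact Or.inr ⟨hp, hq, h⟩
      · exact Or.inr ⟨hp, hq', Setoid.trans' _ h h'⟩

/-- The points equivalent to a point in the interior of an edge. -/
theorem exists_edge_of_lsetoid {g : Gluing} {a : OctFace → G} (ha : IsLabel g a) {v u : OctVertex}
    (h : v.1 ≠ u.1) {t : ℝ} (h0 : 0 < t) (h1 : t < 1) {x y : SolidOcta} {k : G}
    (hx : (x : Fin 3 → ℝ) = edgePt (v, u) t) (hxy : lsetoid g a (x, 1) (y, k)) :
    ∃ e, (y : Fin 3 → ℝ) = edgePt e t ∧ Relation.EqvGen (erel g a) ((v, u), 1) (e, k) := by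
  refine (Relation.EqvGen.invariant (lrel_symm ha) (fun z => ∃ e, (z.1 : Fin 3 → ℝ) = edgePt e t ∧
    Relation.EqvGen (erel g a) ((v, u), 1) (e, z.2)) ?_ hxy).1 ⟨(v, u), hx, Relation.EqvGen.refl _⟩
  rintro z w ⟨⟨v', u'⟩, hz, he⟩ ⟨F, hF, rfl⟩
  obtain ⟨hq, -⟩ := ends_of_eqvGen_erel he h
  simp only at hq
  rw [hz] at hF
  obtain ⟨e1, e2⟩ := eq_of_edgePt_mem_faceSet hq h0 h1 hF
  refine ⟨(vimg g F v'.1, vimg g F u'.1), ?_, he.trans _ _ _ (Relation.EqvGen.rel _ _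
    ⟨F, v'.1, u'.1, hq, by rw [e1, e2], rfl⟩)⟩
  change g.move F z.1 = _
  rw [hz, edgePt, g.move_add]
  simp only
  rw [← Prod.mk.eta (p := v'), ← Prod.mk.eta (p := u'), ← e1, ← e2, g.move_vertexPt, g.move_vertexPt]
  rfl

/-- A point of the boundary of the octahedron with a zero coordinate that is not a vertex lies
in the interior of an edge. -/
theorem exists_edgePt {F : OctFace} {x : Fin 3 → ℝ} (hx : x ∈ faceSet F) (h0 : ∃ i, x i = 0)
    (hv : ∀ v, x ≠ vertexPt v) :
    ∃ (i j : Fin 3) (t : ℝ), i ≠ j ∧ 0 < t ∧ t < 1 ∧ x = edgePt ((i, F i), (j, F j)) t := by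
  obtain ⟨k, hk⟩ := h0
  obtain ⟨i, j, hij, hik, hjk⟩ : ∃ i j : Fin 3, i ≠ j ∧ i ≠ k ∧ j ≠ k := by
    clear hk; revert k; decide
  have huniv : (Finset.univ : Finset (Fin 3)) = {i, j, k} := by
    clear hk; revert i j k; decide
  have hsum := hx.2
  rw [huniv, Finset.sum_insert (by simp [hij, hik]), Finset.sum_insert (by simp [hjk]),
    Finset.sum_singleton, hk, mul_zero, add_zero] at hsum
  have hxi : ∀ l, x l = sgn (F l) * (sgn (F l) * x l) := fun l => by
    rw [← mul_assoc, sgn_mul_self, one_mul]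
  have hform : x = edgePt ((i, F i), (j, F j)) (sgn (F i) * x i) := by
    ext l
    have hl : l ∈ ({i, j, k} : Finset (Fin 3)) := huniv ▸ Finset.mem_univ l
    simp only [Finset.mem_insert, Finset.mem_singleton] at hl
    have hs : 1 - sgn (F i) * x i = sgn (F j) * x j := by linarith
    rw [edgePt, hs]
    rcases hl with rfl | rfl | rfl
    · simp [vertexPt_apply, hij]; rw [mul_comm, ← mul_assoc, sgn_mul_self, one_mul]
    · simp [vertexPt_apply, hij.symm]; rw [mul_comm, ← mul_assoc, sgn_mul_self, one_mul]
    · simp [vertexPt_apply, hik.symm, hjk.symm, hk]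
  refine ⟨i, j, _, hij, (hx.1 i).lt_of_ne fun h => hv (j, F j) ?_, ?_, hform⟩
  · rw [hform, ← h]; simp [edgePt]
  · rw [← hsum]
    refine lt_add_of_pos_right _ ((hx.1 j).lt_of_ne fun h => hv (i, F i) ?_)
    rw [hform, show sgn (F i) * x i = 1 by linarith]; simp [edgePt]

theorem faceSet_unique {F F' : OctFace} {x : Fin 3 → ℝ} (hx : x ∈ faceSet F) (hx' : x ∈ faceSet F')
    (h0 : ∀ i, x i ≠ 0) : F = F' := by
  ext1 i
  have h1 := hx.1 i
  have h2 := hx'.1 i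
  have h3 := h0 i
  rcases lt_or_gt_of_ne h3 with h | h <;> cases hF : F i <;> cases hF' : F' i <;>
    simp [sgn, hF, hF'] at h1 h2 ⊢ <;> linarith

/-- The deck group acts freely away from the vertices. -/
theorem eq_one_of_lsetoid {g : Gluing} {a : OctFace → G} (ha : IsAdm g a) (hg : NoFlip g) {x : SolidOcta}
    (hv : ∀ v, (x : Fin 3 → ℝ) ≠ vertexPt v) {k : G} (h : lsetoid g a (x, 1) (x, k)) : k = 1 := by
  by_cases hF : ∃ F, (x : Fin 3 → ℝ) ∈ faceSet F
  · obtain ⟨F, hF⟩ := hF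
    by_cases h0 : ∃ i, (x : Fin 3 → ℝ) i = 0
    · obtain ⟨i, j, t, hij, ht0, ht1, hx⟩ := exists_edgePt hF h0 hv
      obtain ⟨⟨v', u'⟩, he, hr⟩ := exists_edge_of_lsetoid (v := (i, F i)) (u := (j, F j)) ha.1 hij ht0 ht1 hx h
      obtain ⟨hq, hs⟩ := ends_of_eqvGen_erel hr hij
      rcases edgePt_injective hij hq ht0 ht1 (hx.symm.trans he) with e | e
      · rw [e] at hr
        exact ha.2 _ _ hij _ hr
      · exact absurd e (hg _ _ hs)
    · push Not at h0
      have hinv := Relation.EqvGen.invariant (lrel_symm ha.1)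
        (fun z => z = (x, 1) ∨ z = (g.omove F x, a F)) ?_ h
      · rcases hinv.1 (Or.inl rfl) with e | e
        · exact (Prod.ext_iff.1 e).2
        · exfalso
          have e1 : x = g.omove F x := (Prod.ext_iff.1 e).1
          have hm : (x : Fin 3 → ℝ) ∈ faceSet (g.face F) := by
            rw [e1]; exact g.move_mem hF
          exact g.face_ne F (faceSet_unique hm hF h0)
      · rintro _ w (rfl | rfl) ⟨F', hF', rfl⟩
        · rw [← faceSet_unique hF hF' h0, one_mul]; exact Or.inr rfl
        · have hm : ((g.omove F x : SolidOcta) : Fin 3 → ℝ) ∈ faceSet (g.face F) := g.move_mem hF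
          have : g.face F = F' := faceSet_unique hm hF' fun i =>
            mul_ne_zero (sgn_ne_zero _) (mul_ne_zero (sgn_ne_zero _) (h0 _))
          subst this
          rw [g.omove_omove, ha.1 F]; exact Or.inl rfl
  · push Not at hF
    have hinv := Relation.EqvGen.invariant (lrel_symm ha.1) (fun z => z = (x, 1)) ?_ h
    · exact (Prod.ext_iff.1 (hinv.1 rfl)).2
    · rintro _ w rfl ⟨F', hF', rfl⟩
      exact absurd hF' (hF F')

end

theorem finite_quadratic_roots {α β : ℝ} (γ : ℝ) (h : α ≠ 0 ∨ β ≠ 0) :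
    {t : ℝ | α * t ^ 2 + β * t + γ = 0}.Finite := by
  let p : Polynomial ℝ := Polynomial.C α * Polynomial.X ^ 2 + Polynomial.C β * Polynomial.X + Polynomial.C γ
  have hp : p ≠ 0 := by
    intro e
    rcases h with h | h
    · exact h (by simpa [p] using congrArg (Polynomial.coeff · 2) e)
    · exact h (by simpa [p] using congrArg (Polynomial.coeff · 1) e)
  refine (Polynomial.finite_setOfPred_isRoot hp).subset fun t ht => ?_
  change p.eval t = 0
  simpa [p] using ht

/-- A curve in a face meeting every line in finitely many points. -/
def faceCurve (F : OctFace) (t : ℝ) : Fin 3 → ℝ := fun i => sgn (F i) * ![t, t ^ 2, 1 - t - t ^ 2] i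

theorem faceCurve_mem (F : OctFace) {t : ℝ} (ht : t ∈ Ioo (0 : ℝ) (1 / 2)) : faceCurve F t ∈ faceSet F := by
  have h : ∀ i, sgn (F i) * faceCurve F t i = ![t, t ^ 2, 1 - t - t ^ 2] i := fun i => by
    rw [faceCurve, ← mul_assoc, sgn_mul_self, one_mul]
  refine ⟨fun i => ?_, ?_⟩
  · rw [h]
    obtain ⟨h1, h2⟩ := ht
    fin_cases i <;> simp <;> nlinarith
  · simp_rw [h, Fin.sum_univ_three]; simp

theorem faceCurve_finite (F : OctFace) {x b : Fin 3 → ℝ} (hx : x ∈ faceSet F) (hb : b ∈ faceSet F)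
    (hbx : b ≠ x) : {t | b ∈ segment ℝ x (faceCurve F t)}.Finite := by
  have hD : b 1 - x 1 ≠ 0 ∨ b 0 - x 0 ≠ 0 := by
    by_contra! h
    apply hbx
    have e1 := hx.2
    have e2 := hb.2
    rw [Fin.sum_univ_three] at e1 e2
    have e0 : b 0 = x 0 := by linarith [h.2]
    have e1' : b 1 = x 1 := by linarith [h.1]
    rw [e0, e1'] at e2
    have : sgn (F 2) * b 2 = sgn (F 2) * x 2 := by linarith
    ext i; fin_cases i
    · exact e0
    · exact e1'
    · exact mul_left_cancel₀ (sgn_ne_zero _) this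
  refine (finite_quadratic_roots (α := sgn (F 1) * (b 0 - x 0)) (β := - (sgn (F 0) * (b 1 - x 1)))
    (x 0 * (b 1 - x 1) - x 1 * (b 0 - x 0)) ?_).subset ?_
  · rcases hD with h | h
    · right; exact neg_ne_zero.2 (mul_ne_zero (sgn_ne_zero _) h)
    · left; exact mul_ne_zero (sgn_ne_zero _) h
  · rintro t ⟨r, s, -, -, hrs, rfl⟩
    have e0 : faceCurve F t 0 = sgn (F 0) * t := by simp [faceCurve]
    have e1 : faceCurve F t 1 = sgn (F 1) * t ^ 2 := by simp [faceCurve]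
    simp only [mem_ofPred_eq, Pi.add_apply, Pi.smul_apply, smul_eq_mul, e0, e1]
    have : r = 1 - s := by linarith
    subst this
    ring

theorem isPreconnected_faceSet_diff (F : OctFace) {B : Set (Fin 3 → ℝ)} (hB : B.Finite) :
    IsPreconnected (faceSet F \ B) := by
  refine isPreconnected_of_forall_pair fun x hx y hy => ?_
  have hfin : ∀ z ∈ faceSet F \ B, {t | ∃ b ∈ B, b ∈ faceSet F ∧ b ∈ segment ℝ z (faceCurve F t)}.Finite := by
    intro z hz
    refine (hB.biUnion (t := fun b => {t | b ∈ faceSet F ∧ b ∈ segment ℝ z (faceCurve F t)})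
      fun b hb => ?_).subset ?_
    · by_cases hbF : b ∈ faceSet F
      · refine (faceCurve_finite F hz.1 hbF ?_).subset fun t ht => ht.2
        rintro rfl
        exact hz.2 hb
      · refine Set.finite_empty.subset fun t ht => hbF ht.1
    · rintro t ⟨b, hb, h⟩
      exact mem_iUnion₂.2 ⟨b, hb, h⟩
  obtain ⟨t, ht, htn⟩ := (Set.Ioo_infinite (by norm_num : (0 : ℝ) < 1 / 2)).exists_notMem_finite
    ((hfin x hx).union (hfin y hy))
  have hc := faceCurve_mem F ht
  have hseg : ∀ z ∈ faceSet F, segment ℝ z (faceCurve F t) ⊆ faceSet F := fun z hz =>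
    (convex_faceSet F).segment_subset hz hc
  refine ⟨segment ℝ x (faceCurve F t) ∪ segment ℝ y (faceCurve F t), ?_,
    Or.inl (left_mem_segment _ _ _), Or.inr (left_mem_segment _ _ _),
    IsPreconnected.union (faceCurve F t) (right_mem_segment _ _ _) (right_mem_segment _ _ _)
      (convex_segment _ _).isPreconnected (convex_segment _ _).isPreconnected⟩
  rintro z (hz | hz)
  · exact ⟨hseg x hx.1 hz, fun hzB => htn (Or.inl ⟨z, hzB, hseg x hx.1 hz, hz⟩)⟩
  · exact ⟨hseg y hy.1 hz, fun hzB => htn (Or.inr ⟨z, hzB, hseg y hy.1 hz, hz⟩)⟩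

/-- A convex set with at least two points is contained in the closure of the complement of a
finite subset. -/
theorem Convex.subset_closure_diff_finite {E : Type*} [NormedAddCommGroup E] [NormedSpace ℝ E] {K : Set E}
    (hK : Convex ℝ K) (hK' : K.Nontrivial) {B : Set E} (hB : B.Finite) : K ⊆ closure (K \ B) := by
  intro x hx
  obtain ⟨y, hy, hyx⟩ := hK'.exists_ne x
  have hinj : Function.Injective fun r : ℝ => x + r • (y - x) := by
    intro r s h
    exact smul_left_injective ℝ (sub_ne_zero.2 hyx) (add_left_cancel h)
  have hfin : ((fun r : ℝ => x + r • (y - x)) ⁻¹' B).Finite := hB.preimage hinj.injOn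
  have htend : Tendsto (fun r : ℝ => x + r • (y - x)) (𝓝[>] 0) (𝓝 x) := by
    have : Continuous fun r : ℝ => x + r • (y - x) := by fun_prop
    simpa using (this.tendsto 0).mono_left nhdsWithin_le_nhds
  refine mem_closure_of_tendsto htend ?_
  have h1 : ∀ᶠ r : ℝ in 𝓝[>] 0, r < 1 := mem_nhdsWithin_of_mem_nhds (Iio_mem_nhds one_pos)
  have h2 : ∀ᶠ r : ℝ in 𝓝[>] 0, r ∉ ((fun r : ℝ => x + r • (y - x)) ⁻¹' B) \ {0} :=
    mem_nhdsWithin_of_mem_nhds ((hfin.subset sdiff_subset).isClosed.isOpen_compl.mem_nhds (by simp))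
  filter_upwards [h1, h2, self_mem_nhdsWithin] with r hr1 hr2 hr0
  have hr0' : (0 : ℝ) < r := hr0
  exact ⟨hK.add_smul_sub_mem hx hy ⟨hr0'.le, hr1.le⟩, fun h => hr2 ⟨h, hr0'.ne'⟩⟩

theorem faceSet_nontrivial (F : OctFace) : (faceSet F).Nontrivial := by
  refine ⟨_, vertexPt_mem_faceSet F 0, _, vertexPt_mem_faceSet F 1, fun h => ?_⟩
  have := congrFun h 0
  simp [vertexPt_apply, sgn_ne_zero] at this

/-- The closed face as a subset of the solid octahedron. -/
def oface (F : OctFace) : Set SolidOcta := {x | (x : Fin 3 → ℝ) ∈ faceSet F}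

theorem image_val_oface_diff (F : OctFace) (B : Set SolidOcta) :
    Subtype.val '' (oface F \ B) = faceSet F \ (Subtype.val '' B) := by
  rw [Set.image_sdiff Subtype.val_injective]
  congr 1
  ext x
  simp only [oface, mem_image, mem_ofPred_eq, Subtype.exists, exists_and_left, exists_prop, exists_eq_right_right]
  exact ⟨fun h => h.1, fun h => ⟨h, faceSet_subset F h⟩⟩

theorem isPreconnected_oface_diff (F : OctFace) {B : Set SolidOcta} (hB : B.Finite) :
    IsPreconnected (oface F \ B) := by
  rw [← Topology.IsInducing.subtypeVal.isPreconnected_image, image_val_oface_diff]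
  exact isPreconnected_faceSet_diff F (hB.image _)

theorem oface_subset_closure (F : OctFace) {B : Set SolidOcta} (hB : B.Finite) :
    oface F ⊆ closure (oface F \ B) := by
  intro x hx
  rw [closure_subtype, image_val_oface_diff]
  exact (convex_faceSet F).subset_closure_diff_finite (faceSet_nontrivial F) (hB.image _) hx

theorem oface_diff_nonempty (F : OctFace) {B : Set SolidOcta} (hB : B.Finite) : (oface F \ B).Nonempty := by
  rw [← closure_nonempty_iff]
  exact ⟨⟨_, vertexPt_mem_solidOcta (0, F 0)⟩, oface_subset_closure F hB (vertexPt_mem_faceSet F 0)⟩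

theorem isPreconnected_compl_finite {B : Set SolidOcta} (hB : B.Finite) : IsPreconnected Bᶜ ∧ Bᶜ.Nonempty := by
  have := hB.to_subtype
  have h := convex_solidOcta.isPreconnected_diff_lines (by simp) interior_solidOcta_nonempty
    (fun b : B => (b : Fin 3 → ℝ)) (fun _ => 0) (fun b => {(b : Fin 3 → ℝ)}) (by
      rintro b u rfl; exact ⟨0, by simp⟩)
  have e : Subtype.val '' Bᶜ = SolidOcta \ ⋃ b : B, {((b : SolidOcta) : Fin 3 → ℝ)} := by
    ext x
    simp only [mem_image, mem_compl_iff, Subtype.exists, exists_and_right, exists_eq_right, Set.mem_sdiff,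
      mem_iUnion, mem_singleton_iff]
    constructor
    · rintro ⟨hx, hB⟩
      refine ⟨hx, ?_⟩
      rintro ⟨y, hy, hyB, rfl⟩
      exact hB hyB
    · rintro ⟨hx, hn⟩
      exact ⟨hx, fun h => hn ⟨x, hx, h, rfl⟩⟩
  rw [← e] at h
  exact ⟨Topology.IsInducing.subtypeVal.isPreconnected_image.1 h.1, Set.image_nonempty.1 h.2⟩

/-- A vertex of the octahedron as a point of the solid octahedron. -/
def vpt (v : OctVertex) : SolidOcta := ⟨vertexPt v, vertexPt_mem_solidOcta v⟩

theorem vertexPt_injective : Function.Injective vertexPt := by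
  rintro ⟨i, a⟩ ⟨j, b⟩ h
  have h1 := congrFun h i
  simp only [vertexPt_apply, if_true] at h1
  by_cases hij : i = j
  · subst hij
    rw [if_pos rfl] at h1
    rw [sgn_injective h1]
  · rw [if_neg hij] at h1
    exact absurd h1 (sgn_ne_zero _)

theorem vertexPt_mem_faceSet_iff {v : OctVertex} {F : OctFace} : vertexPt v ∈ faceSet F ↔ F v.1 = v.2 := by
  constructor
  · intro h
    have h1 := h.1 v.1
    rw [vertexPt_apply, if_pos rfl] at h1
    cases hF : F v.1 <;> cases hv : v.2 <;> simp [sgn, hF, hv] at h1 ⊢ <;> linarith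
  · intro h
    have := vertexPt_mem_faceSet F v.1
    rwa [h] at this

/-- All vertices are identified. -/
def OneVertex (g : Gluing) : Prop := ∀ v w, vtxSetoid g v w

theorem omove_vpt (g : Gluing) (F : OctFace) (i : Fin 3) : g.omove F (vpt (i, F i)) = vpt (vimg g F i) :=
  Subtype.ext (g.move_vertexPt F i)

/-- The vertex class of the quotient space. -/
def xvtx (g : Gluing) : XSpace g := Quotient.mk _ (vpt (0, true))

theorem mk_eq_xvtx_iff {g : Gluing} (hg : OneVertex g) (x : SolidOcta) :
    (Quotient.mk _ x : XSpace g) = xvtx g ↔ ∃ v, x = vpt v := by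
  constructor
  · intro h
    refine (Relation.EqvGen.invariant (fun _ _ => glueRel_symm g) (fun z => ∃ v, z = vpt v) ?_
      (Quotient.exact h : glueSetoid g _ _)).2 ⟨_, rfl⟩
    rintro _ w ⟨⟨i, b⟩, rfl⟩ hw
    obtain ⟨F, hF, rfl⟩ := (glueRel_iff g _ _).1 hw
    have : F i = b := vertexPt_mem_faceSet_iff.1 hF
    subst this
    exact ⟨_, omove_vpt g F i⟩
  · rintro ⟨v, rfl⟩
    refine Quotient.sound ?_
    suffices H : ∀ v w, vtxSetoid g v w → glueSetoid g (vpt v) (vpt w) from H _ _ (hg v (0, true))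
    intro v w h
    induction h with
    | rel v w h =>
      obtain ⟨F, i, rfl, rfl⟩ := h
      exact Relation.EqvGen.rel _ _ ((glueRel_iff g _ _).2 ⟨F, vertexPt_mem_faceSet F i, (omove_vpt g F i).symm⟩)
    | refl => exact Setoid.refl' _ _
    | symm _ _ _ ih => exact Setoid.symm' _ ih
    | trans _ _ _ _ _ ih1 ih2 => exact Setoid.trans' _ ih1 ih2

theorem finite_preimage_mk (g : Gluing) (q : XSpace g) : {x : SolidOcta | Quotient.mk _ x = q}.Finite := by
  obtain ⟨y, rfl⟩ := Quotient.exists_rep q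
  exact (finite_glueSetoid g y).subset fun x hx => Setoid.symm' _ (Quotient.exact hx)

section

variable {G : Type*} [Group G]

/-- The order of the stabilizer of a vertex of the covering space. -/
def vstab (g : Gluing) (a : OctFace → G) : ℕ :=
  Nat.card (MulAction.stabilizer G (ymk g a (vpt (0, true)) 1))

theorem free_ySpace {g : Gluing} {a : OctFace → G} (ha : IsAdm g a) (h1 : OneVertex g) (h2 : NoFlip g)
    (w : YSpace g a) (hw : yproj g a w ≠ xvtx g) (k : G) (hk : k • w = w) : k = 1 := by
  obtain ⟨x, h, rfl⟩ := exists_ymk g a w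
  have hx : ∀ v, (x : Fin 3 → ℝ) ≠ vertexPt v := fun v e =>
    hw ((mk_eq_xvtx_iff h1 x).2 ⟨v, Subtype.ext e⟩)
  rw [smul_ymk] at hk
  have h3 : lsetoid g a (x, k * h) (x, h) := Quotient.exact hk
  have h4 := lsetoid_mul h⁻¹ (Setoid.symm' _ h3)
  simp only [inv_mul_cancel] at h4
  have h5 := eq_one_of_lsetoid ha h2 hx h4
  simpa [mul_assoc] using congrArg (fun z => h * z * h⁻¹) h5

theorem card_stabilizer_le [Finite G] {g : Gluing} {a : OctFace → G} (ha : IsAdm g a) (h1 : OneVertex g)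
    (h2 : NoFlip g) (w : YSpace g a) : Nat.card (MulAction.stabilizer G w) ≤ vstab g a := by
  by_cases hw : yproj g a w = xvtx g
  · obtain ⟨k, hk⟩ := yproj_eq_iff.1 (hw.trans (yproj_ymk g a (vpt (0, true)) 1).symm)
    refine le_of_eq (Nat.card_congr (MulAction.stabilizerEquivStabilizer (g := k⁻¹) (a := w) ?_).toEquiv)
    rw [← hk]; simp
  · have : Subsingleton (MulAction.stabilizer G w) := by
      refine ⟨fun x y => Subtype.ext ?_⟩
      rw [free_ySpace ha h1 h2 w hw x x.2, free_ySpace ha h1 h2 w hw y y.2]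
    exact (Finite.card_le_one_iff_subsingleton.2 this).trans Nat.card_pos

/-- A point in the interior of an edge. -/
def ept (e : OctVertex × OctVertex) (t : Icc (0 : ℝ) 1) : SolidOcta :=
  ⟨edgePt e t, convex_solidOcta (vertexPt_mem_solidOcta _) (vertexPt_mem_solidOcta _) t.2.1
    (sub_nonneg.2 t.2.2) (by ring)⟩

theorem ymk_ept_eq {g : Gluing} {a : OctFace → G} (t : Icc (0 : ℝ) 1)
    {p q : (OctVertex × OctVertex) × G} (h : Relation.EqvGen (erel g a) p q) :
    ymk g a (ept p.1 t) p.2 = ymk g a (ept q.1 t) q.2 := by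
  induction h with
  | rel p q h =>
    obtain ⟨⟨v, u⟩, k⟩ := p
    obtain ⟨F, i, j, hij, hp, rfl⟩ := h
    obtain ⟨rfl, rfl⟩ := Prod.ext_iff.1 hp
    simp only
    have hm : (ept ((i, F i), (j, F j)) t : Fin 3 → ℝ) ∈ faceSet F :=
      convex_faceSet F (vertexPt_mem_faceSet F i) (vertexPt_mem_faceSet F j) t.2.1 (sub_nonneg.2 t.2.2) (by ring)
    rw [← ymk_omove g a hm]
    congr 1
    refine Subtype.ext ?_
    change g.move F (edgePt _ _) = edgePt _ _
    rw [edgePt, g.move_add, g.move_vertexPt, g.move_vertexPt]; rfl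
  | refl => rfl
  | symm _ _ _ ih => exact ih.symm
  | trans _ _ _ _ _ ih1 ih2 => exact ih1.trans ih2

theorem ept_injective {v u : OctVertex} (h : v.1 ≠ u.1) : Function.Injective (ept (v, u)) := by
  intro s t e
  have := congrFun (congrArg Subtype.val e) v.1
  simp only [ept, edgePt, Pi.add_apply, Pi.smul_apply, vertexPt_apply, smul_eq_mul, if_true, h, if_false,
    mul_zero, add_zero] at this
  exact Subtype.ext (mul_right_cancel₀ (sgn_ne_zero _) this)

variable [Finite G] [TopologicalSpace G] [DiscreteTopology G]

/-- An equivariant family of lifts transporting a labelling along a map of quotient spaces. -/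
structure IsTransfer (g g' : Gluing) (j : SolidOcta → XSpace g) (a a' : OctFace → G)
    (s : SolidOcta → YSpace g a) : Prop where
  cont : Continuous s
  proj : ∀ x, yproj g a (s x) = j x
  adm : IsAdm g' a'
  glue : ∀ F, ∀ x ∈ oface F, s x = a' F • s (g'.omove F x)

theorem exists_transfer {g g' : Gluing} (h1 : OneVertex g) (h2 : NoFlip g) (f : XSpace g' ≃ₜ XSpace g)
    {a : OctFace → G} (ha : IsAdm g a) (b x0 : SolidOcta)
    (hb : (Quotient.mk _ x0 : XSpace g) = f (Quotient.mk _ b)) (hbv : f (Quotient.mk _ b) ≠ xvtx g) :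
    ∃ a' s, IsTransfer g g' (fun x => f (Quotient.mk _ x)) a a' s ∧ s b = ymk g a x0 1 := by
  have := t2Space_ySpace ha.1
  set j : SolidOcta → XSpace g := fun x => f (Quotient.mk _ x) with hj
  have hjc : Continuous j := f.continuous.comp continuous_quotient_mk'
  have hbad : (j ⁻¹' {xvtx g}ᶜᶜ).Finite := by
    refine (finite_preimage_mk g' (f.symm (xvtx g))).subset fun x hx => ?_
    rw [compl_compl] at hx
    have hx' : f (Quotient.mk _ x) = xvtx g := hx
    change Quotient.mk _ x = f.symm (xvtx g)
    rw [← hx', f.symm_apply_apply]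
  have hfree : ∀ w, yproj g a w ∈ ({xvtx g}ᶜ : Set (XSpace g)) → ∀ k : G, k • w = w → k = 1 :=
    fun w hw k hk => free_ySpace ha h1 h2 w hw k hk
  obtain ⟨s, hs, hps, hsb⟩ := exists_lift_of_finite_bad (by simp) (isQuotientMap_yproj g a) yproj_eq_iff
    {xvtx g}ᶜ hfree convex_solidOcta interior_solidOcta_nonempty j hjc hbad b hbv (ymk g a x0 1)
    ((yproj_ymk g a x0 1).trans hb)
  set B := j ⁻¹' {xvtx g}ᶜᶜ with hB
  have hnB : ∀ x ∉ B, yproj g a (s x) ≠ xvtx g := by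
    intro x hx e
    apply hx
    rw [hB, compl_compl]
    exact (hps x).symm.trans e
  have huniq : ∀ x ∉ B, ∀ y, ∀ k l : G, s x = k • y → s x = l • y → k = l := by
    intro x hx y k l hk hl
    have e : (k * l⁻¹) • s x = s x := by
      conv_lhs => rw [hl]
      rw [smul_smul, inv_mul_cancel_right, ← hk]
    have := free_ySpace ha h1 h2 _ (hnB x hx) _ e
    exact mul_inv_eq_one.1 this
  have hex : ∀ F, ∀ x ∈ oface F, ∃ k : G, s x = k • s (g'.omove F x) := by
    intro F x hx
    have : yproj g a (s x) = yproj g a (s (g'.omove F x)) := by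
      rw [hps, hps, hj]
      simp only
      congr 1
      exact Quotient.sound (Relation.EqvGen.rel _ _ ((glueRel_iff _ _ _).2 ⟨F, hx, rfl⟩))
    obtain ⟨k, hk⟩ := yproj_eq_iff.1 this
    exact ⟨k, hk.symm⟩
  have hconst : ∀ F, ∃ k : G, ∀ x ∈ oface F, s x = k • s (g'.omove F x) := by
    intro F
    let C : G → Set SolidOcta := fun k => {x | s x = k • s (g'.omove F x)}
    have hC : ∀ k, IsClosed (C k) := fun k =>
      isClosed_eq hs ((hs.comp (g'.continuous_omove F)).const_smul k)
    obtain ⟨x, hx⟩ := oface_diff_nonempty F hbad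
    obtain ⟨k, hk⟩ := hex F x hx.1
    have := (isPreconnected_oface_diff F hbad).subset_of_finite_closed_cover C hC
      (fun y hy => hex F y hy.1) (fun y hy k l hk hl => huniq y hy.2 _ k l hk hl) hx hk
    exact ⟨k, fun y hy => closure_minimal this (hC k) (oface_subset_closure F hbad hy)⟩
  choose a' ha' using hconst
  have hlabel : IsLabel g' a' := by
    intro F
    obtain ⟨x, hx, hxB⟩ := oface_diff_nonempty F hbad
    refine huniq x hxB (s x) _ _ ?_ (one_smul G _).symm
    have e1 := ha' F x hx
    have e2 := ha' (g'.face F) (g'.omove F x) (g'.move_mem hx)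
    rw [g'.omove_omove] at e2
    rw [mul_smul, ← e2, ← e1]
  refine ⟨a', s, ⟨hs, hps, ⟨hlabel, ?_⟩, ha'⟩, hsb⟩
  intro v u hvu k hk
  have hdesc : ∀ x y : SolidOcta × G, lsetoid g' a' x y → x.2 • s x.1 = y.2 • s y.1 := by
    intro x y h
    induction h with
    | rel x y h =>
      obtain ⟨F, hF, rfl⟩ := h
      simp only
      rw [mul_smul, ← ha' F x.1 hF]
    | refl => rfl
    | symm _ _ _ ih => exact ih.symm
    | trans _ _ _ _ _ ih1 ih2 => exact ih1.trans ih2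
  obtain ⟨t, ht⟩ : ∃ t, ept (v, u) t ∉ B := by
    by_contra! hc
    have hfin : (Set.univ : Set (Icc (0 : ℝ) 1)).Finite :=
      (hbad.preimage (ept_injective hvu).injOn).subset fun t _ => hc t
    exact (Set.Icc_infinite (zero_lt_one (α := ℝ))).to_subtype.not_finite (Set.finite_univ_iff.1 hfin)
  have := hdesc _ _ (Quotient.exact (ymk_ept_eq t hk) : lsetoid g' a' _ _)
  simp only [one_smul] at this
  exact huniq _ ht _ k 1 this (one_smul G _).symm

theorem IsTransfer.smul_eq {g g' : Gluing} {j : SolidOcta → XSpace g} {a a' : OctFace → G}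
    {s : SolidOcta → YSpace g a} (h : IsTransfer g g' j a a' s) {x y : SolidOcta} {k l : G}
    (hxy : ymk g' a' x k = ymk g' a' y l) : k • s x = l • s y := by
  have hdesc : ∀ x y : SolidOcta × G, lsetoid g' a' x y → x.2 • s x.1 = y.2 • s y.1 := by
    intro x y e
    induction e with
    | rel x y e =>
      obtain ⟨F, hF, rfl⟩ := e
      simp only
      rw [mul_smul, ← h.glue F x.1 hF]
    | refl => rfl
    | symm _ _ _ ih => exact ih.symm
    | trans _ _ _ _ _ ih1 ih2 => exact ih1.trans ih2
  exact hdesc _ _ (Quotient.exact hxy)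

theorem IsTransfer.vstab_le {g g' : Gluing} (h1 : OneVertex g) (h2 : NoFlip g) {j : SolidOcta → XSpace g}
    {a a' : OctFace → G} (ha : IsAdm g a)
    {s : SolidOcta → YSpace g a} (h : IsTransfer g g' j a a' s) : vstab g' a' ≤ vstab g a := by
  refine le_trans ?_ (card_stabilizer_le ha h1 h2 (s (vpt (0, true))))
  refine Nat.card_mono (Set.toFinite _) fun k hk => ?_
  have hk' : ymk g' a' (vpt (0, true)) (k * 1) = ymk g' a' (vpt (0, true)) 1 := hk
  have := h.smul_eq hk'
  rw [mul_one, one_smul] at this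
  exact this

theorem IsTransfer.injective {g g' : Gluing} (h1 : OneVertex g) (h2 : NoFlip g) (f : XSpace g' ≃ₜ XSpace g)
    {a1 a2 a' : OctFace → G} (ha1 : IsAdm g a1) (ha2 : IsAdm g a2) {b x0 : SolidOcta}
    (hb : (Quotient.mk _ x0 : XSpace g) = f (Quotient.mk _ b)) (hbv : f (Quotient.mk _ b) ≠ xvtx g)
    {s1 : SolidOcta → YSpace g a1} {s2 : SolidOcta → YSpace g a2}
    (t1 : IsTransfer g g' (fun x => f (Quotient.mk _ x)) a1 a' s1)
    (t2 : IsTransfer g g' (fun x => f (Quotient.mk _ x)) a2 a' s2)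
    (e1 : s1 b = ymk g a1 x0 1) (e2 : s2 b = ymk g a2 x0 1) : a1 = a2 := by
  have T1 := t2Space_ySpace ha1.1
  have T2 := t2Space_ySpace ha2.1
  -- matching lifts along the first covering match along the second one
  have key : ∀ y y' : SolidOcta, ∀ k k' : G, f (Quotient.mk _ y) ≠ xvtx g → k • s1 y = k' • s1 y' →
      k • s2 y = k' • s2 y' := by
    intro y y' k k' hy e
    have h3 : (Quotient.mk _ y : XSpace g') = Quotient.mk _ y' := by
      apply f.injective
      rw [← t1.proj y, ← t1.proj y']
      refine yproj_eq_iff.2 ⟨k⁻¹ * k', ?_⟩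
      change (k⁻¹ * k') • s1 y' = _
      rw [mul_smul, ← e, inv_smul_smul]
    obtain ⟨l, hl⟩ := exists_ymk_eq_of_glueSetoid a' (Quotient.exact h3 : glueSetoid g' _ _)
    have h4 := t1.smul_eq hl
    have h5 := t2.smul_eq hl
    rw [one_smul] at h4 h5
    have h6 : (l * k'⁻¹ * k) • s1 y = s1 y := by
      rw [mul_smul, e, smul_smul, inv_mul_cancel_right, h4]
    have h7 := free_ySpace ha1 h1 h2 _ (by rw [t1.proj]; exact hy) _ h6
    have h8 : k = k' * l⁻¹ := by
      rw [← inv_inv k, ← eq_inv_of_mul_eq_one_left h7]; group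
    rw [h8, ← h5, smul_smul, inv_mul_cancel_right]
  have hrep : ∀ x : SolidOcta, ∃ (y : SolidOcta) (k : G), f (Quotient.mk _ y) = Quotient.mk _ x ∧ k • s1 y = ymk g a1 x 1 := by
    intro x
    obtain ⟨y, hy⟩ := Quotient.exists_rep (f.symm (Quotient.mk _ x))
    have hy' : f (Quotient.mk _ y) = Quotient.mk _ x := by
      rw [← f.apply_symm_apply (Quotient.mk _ x)]
      exact congrArg f hy
    obtain ⟨k, hk⟩ := yproj_eq_iff.1 (((yproj_ymk g a1 x 1).trans hy'.symm).trans (t1.proj y).symm)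
    exact ⟨y, k, hy', hk⟩
  have hV : {x : SolidOcta | (Quotient.mk _ x : XSpace g) = xvtx g}.Finite := finite_preimage_mk _ _
  let C : G → Set SolidOcta := fun l => {x | ∃ (y : SolidOcta) (k : G), k • s1 y = ymk g a1 x 1 ∧ k • s2 y = ymk g a2 x l}
  have hC : ∀ l, IsClosed (C l) := by
    intro l
    have : C l = ⋃ k : G, Prod.fst '' {z : SolidOcta × SolidOcta | k • s1 z.2 = ymk g a1 z.1 1 ∧
        k • s2 z.2 = ymk g a2 z.1 l} := by
      ext x
      simp only [C, mem_ofPred_eq, mem_iUnion, mem_image, Prod.exists, exists_and_right, exists_eq_right]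
      exact ⟨fun ⟨y, k, h⟩ => ⟨k, y, h⟩, fun ⟨k, y, h⟩ => ⟨y, k, h⟩⟩
    rw [this]
    refine isClosed_iUnion_of_finite fun k => isClosedMap_fst_of_compactSpace _ ?_
    exact (isClosed_eq ((t1.cont.comp continuous_snd).const_smul k) ((continuous_ymk g a1 1).comp continuous_fst)).inter
      (isClosed_eq ((t2.cont.comp continuous_snd).const_smul k) ((continuous_ymk g a2 l).comp continuous_fst))
  have hcov := (isPreconnected_compl_finite hV).1.subset_of_finite_closed_cover C hC (by
    intro x _
    obtain ⟨y, k, hy, hk⟩ := hrep x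
    obtain ⟨l, hl⟩ := yproj_eq_iff.1 (((t2.proj y).trans hy).trans (yproj_ymk g a2 x 1).symm)
    refine ⟨k * l, y, k, hk, ?_⟩
    have hl' : l • ymk g a2 x 1 = s2 y := hl
    rw [← hl', smul_ymk, smul_ymk, mul_one]) (by
    rintro x hx l l' ⟨y, k, h3, h4⟩ ⟨y', k', h5, h6⟩
    have hy : f (Quotient.mk _ y) ≠ xvtx g := by
      rw [← t1.proj y]
      intro e
      apply hx
      change Quotient.mk _ x = _
      rw [← e, ← yproj_ymk g a1 x 1]
      exact yproj_eq_iff.2 ⟨k, h3⟩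
    have h7 := key y y' k k' hy (h3.trans h5.symm)
    rw [h4, h6] at h7
    have h8 : (l * l'⁻¹) • ymk g a2 x l' = ymk g a2 x l' := by
      rw [smul_ymk, inv_mul_cancel_right, h7]
    exact mul_inv_eq_one.1 (free_ySpace ha2 h1 h2 (ymk g a2 x l') (fun e => hx e) _ h8)) (x := x0) (i := 1)
    (by change _ ≠ _; rw [hb]; exact hbv)
    ⟨b, 1, by rw [one_smul, e1], by rw [one_smul, e2]⟩
  ext1 F
  obtain ⟨x, hx, hxV⟩ := oface_diff_nonempty F hV
  have hxV' : (Quotient.mk _ x : XSpace g) ≠ xvtx g := hxV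
  have hmk : (Quotient.mk _ x : XSpace g) = Quotient.mk _ (g.omove F x) :=
    Quotient.sound (Relation.EqvGen.rel _ _ ((glueRel_iff _ _ _).2 ⟨F, hx, rfl⟩))
  obtain ⟨y, k, h3, h4⟩ := hcov hxV
  obtain ⟨y', k', h5, h6⟩ := hcov (show g.omove F x ∈ _ by change _ ≠ _; rw [← hmk]; exact hxV')
  have h7 : ∀ a : OctFace → G, ymk g a x 1 = a F • ymk g a (g.omove F x) 1 := by
    intro a
    rw [← ymk_omove g a hx, smul_ymk, one_mul, mul_one]
  have hy : f (Quotient.mk _ y) ≠ xvtx g := by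
    rw [← t1.proj y]
    intro e
    apply hxV'
    rw [← e, ← yproj_ymk g a1 x 1]
    exact yproj_eq_iff.2 ⟨k, h3⟩
  have h8 := key y y' k (a1 F * k') hy (by rw [h3, mul_smul, h5, h7])
  rw [h4, mul_smul, h6, h7, smul_ymk, smul_ymk, mul_one, mul_one] at h8
  have h9 : (a1 F * (a2 F)⁻¹) • ymk g a2 (g.omove F x) (a2 F) = ymk g a2 (g.omove F x) (a2 F) := by
    rw [smul_ymk, inv_mul_cancel_right, h8]
  exact mul_inv_eq_one.1 (free_ySpace ha2 h1 h2 _ (by rw [yproj_ymk, ← hmk]; exact hxV') _ h9)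

end

section
variable {G : Type*} [Group G] [Finite G]

theorem exists_injective_adm {g g' : Gluing} (h1 : OneVertex g) (h2 : NoFlip g) (f : XSpace g' ≃ₜ XSpace g) :
    ∃ T : {a : OctFace → G // IsAdm g a} → {a : OctFace → G // IsAdm g' a},
      Function.Injective T ∧ ∀ a, vstab g' (T a).1 ≤ vstab g a.1 := by
  let _ : TopologicalSpace G := ⊥
  have : DiscreteTopology G := ⟨rfl⟩
  have hB : {x : SolidOcta | f (Quotient.mk _ x) = xvtx g}.Finite :=
    (finite_preimage_mk g' (f.symm (xvtx g))).subset fun x hx => by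
      rw [mem_ofPred_eq] at hx ⊢
      rw [← hx, f.symm_apply_apply]
  obtain ⟨b, hbv⟩ := (isPreconnected_compl_finite hB).2
  obtain ⟨x0, hb⟩ := Quotient.exists_rep (f (Quotient.mk _ b))
  choose T s hT he using fun a : {a : OctFace → G // IsAdm g a} =>
    exists_transfer h1 h2 f a.2 b x0 hb hbv
  refine ⟨fun a => ⟨T a, (hT a).adm⟩, fun a a' h => ?_, fun a => (hT a).vstab_le h1 h2 a.2⟩
  have h' : T a = T a' := congrArg Subtype.val h
  have := hT a'
  rw [← h'] at this
  exact Subtype.ext ((hT a).injective h1 h2 f a.2 a'.2 hb hbv this (he a) (he a'))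

theorem exists_equiv_of_injective_le {α β : Type*} [Finite α] [Finite β] (w : α → ℕ) (w' : β → ℕ)
    (S : α → β) (hS : Function.Injective S) (hw : ∀ a, w' (S a) ≤ w a)
    (T : β → α) (hT : Function.Injective T) (hw' : ∀ b, w (T b) ≤ w' b) :
    ∃ e : α ≃ β, ∀ a, w' (e a) = w a := by
  have := Fintype.ofFinite α
  have := Fintype.ofFinite β
  have hc : Fintype.card α = Fintype.card β :=
    le_antisymm (Fintype.card_le_of_injective S hS) (Fintype.card_le_of_injective T hT)
  have hSb := (Fintype.bijective_iff_injective_and_card S).2 ⟨hS, hc⟩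
  have hTb := (Fintype.bijective_iff_injective_and_card T).2 ⟨hT, hc.symm⟩
  have e1 : ∑ a, w' (S a) = ∑ b, w' b := hSb.sum_comp w'
  have e2 : ∑ b, w (T b) = ∑ a, w a := hTb.sum_comp w
  have l1 : ∑ a, w' (S a) ≤ ∑ a, w a := Finset.sum_le_sum fun a _ => hw a
  have l2 : ∑ b, w (T b) ≤ ∑ b, w' b := Finset.sum_le_sum fun a _ => hw' a
  have e3 : ∑ a, w' (S a) = ∑ a, w a := by omega
  have := (Finset.sum_eq_sum_iff_of_le fun a _ => hw a).1 e3
  exact ⟨Equiv.ofBijective S hSb, fun a => this a (Finset.mem_univ a)⟩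

/-- Admissible labellings, together with their vertex stabilizer orders, are a topological invariant. -/
theorem exists_equiv_adm {g g' : Gluing} (h1 : OneVertex g) (h2 : NoFlip g) (h1' : OneVertex g')
    (h2' : NoFlip g') (f : XSpace g ≃ₜ XSpace g') :
    ∃ e : {a : OctFace → G // IsAdm g a} ≃ {a : OctFace → G // IsAdm g' a},
      ∀ a, vstab g' (e a).1 = vstab g a.1 := by
  obtain ⟨S, hS, hw⟩ := exists_injective_adm (G := G) h1 h2 f.symm
  obtain ⟨T, hT, hw'⟩ := exists_injective_adm (G := G) h1' h2' f
  have F1 : Finite {a : OctFace → G // IsAdm g a} := Subtype.finite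
  have F2 : Finite {a : OctFace → G // IsAdm g' a} := Subtype.finite
  have := exists_equiv_of_injective_le (α := {a : OctFace → G // IsAdm g a}) (β := {a : OctFace → G // IsAdm g' a})
    (fun a => vstab g a.1) (fun a => vstab g' a.1) S hS hw
  exact this T hT hw'

/-- The number of admissible labellings whose vertex stabilizer order satisfies `P`. -/
def admCount (G : Type*) [Group G] (P : ℕ → Prop) (g : Gluing) : ℕ :=
  Nat.card {a : OctFace → G // IsAdm g a ∧ P (vstab g a)}

theorem admCount_eq (P : ℕ → Prop) {g g' : Gluing} (h1 : OneVertex g) (h2 : NoFlip g) (h1' : OneVertex g')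
    (h2' : NoFlip g') (f : XSpace g ≃ₜ XSpace g') : admCount G P g = admCount G P g' := by
  obtain ⟨e, he⟩ := exists_equiv_adm (G := G) h1 h2 h1' h2' f
  refine Nat.card_congr ((Equiv.subtypeSubtypeEquivSubtypeInter _ fun a => P (vstab g a)).symm.trans
    ((e.subtypeEquiv fun a => ?_).trans (Equiv.subtypeSubtypeEquivSubtypeInter _ fun a => P (vstab g' a))))
  rw [he a]
end

/-! ### Finite groups given by their multiplication tables -/

/-- A list of rows of a multiplication table, each paired with the row of the inverse element;
a row stores its entries as consecutive bytes. -/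
inductive Tab : Type
  | nil : Tab
  | cons (a b : ℕ) (t : Tab) : Tab

/-- The entry at position `v` of a row. -/
def app (X v : ℕ) : ℕ := Nat.land (Nat.shiftRight X (Nat.mul 8 v)) 255

/-- Summation over the rows of a table. -/
def Tab.sum (t : Tab) (f : ℕ → ℕ → ℕ) : ℕ := Tab.rec 0 (fun a b _ s => Nat.add (f a b) s) t

/-- Test a property of all rows of a table. -/
def Tab.all (t : Tab) (f : ℕ → ℕ → Bool) : Bool := Tab.rec true (fun a b _ s => and (f a b) s) t

/-- The number of rows. -/
def Tab.size (t : Tab) : ℕ := Tab.rec 0 (fun _ _ _ s => Nat.add s 1) t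

/-- The `i`-th row. -/
def Tab.row (t : Tab) : ℕ → ℕ :=
  Tab.rec (fun _ => 0) (fun a _ _ s i => cond (Nat.beq i 0) a (s (Nat.sub i 1))) t

/-- The row of the inverse of the `i`-th element. -/
def Tab.irow (t : Tab) : ℕ → ℕ :=
  Tab.rec (fun _ => 0) (fun _ b _ s i => cond (Nat.beq i 0) b (s (Nat.sub i 1))) t

/-- A Boolean test for all `i < n`. -/
def allLt (n : ℕ) (f : ℕ → Bool) : Bool := Nat.rec true (fun i s => and (f i) s) n

theorem allLt_iff {n : ℕ} {f : ℕ → Bool} : allLt n f = true ↔ ∀ i < n, f i = true := by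
  induction n with
  | zero => simp [allLt]
  | succ n ih =>
    have : allLt (n + 1) f = (f n && allLt n f) := rfl
    rw [this, Bool.and_eq_true, ih]
    constructor
    · rintro ⟨h1, h2⟩ i hi
      rcases Nat.lt_succ_iff_lt_or_eq.1 hi with h | rfl
      · exact h2 i h
      · exact h1
    · exact fun h => ⟨h n (by omega), fun i hi => h i (by omega)⟩

theorem Tab.sum_eq (t : Tab) (f : ℕ → ℕ → ℕ) : t.sum f = ∑ i ∈ Finset.range t.size, f (t.row i) (t.irow i) := by
  induction t with
  | nil => rfl
  | cons a b t ih =>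
    have h1 : (Tab.cons a b t).sum f = f a b + t.sum f := rfl
    have h2 : (Tab.cons a b t).size = t.size + 1 := rfl
    rw [h1, h2, Finset.sum_range_succ', ih, add_comm]
    rfl

theorem Tab.all_iff {t : Tab} {f : ℕ → ℕ → Bool} :
    t.all f = true ↔ ∀ i < t.size, f (t.row i) (t.irow i) = true := by
  induction t with
  | nil => simp [Tab.all, Tab.size]
  | cons a b t ih =>
    have h1 : (Tab.cons a b t).all f = (f a b && t.all f) := rfl
    have h2 : (Tab.cons a b t).size = t.size + 1 := rfl
    rw [h1, h2, Bool.and_eq_true, ih]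
    constructor
    · rintro ⟨h3, h4⟩ i hi
      cases i with
      | zero => exact h3
      | succ i => exact h4 i (by omega)
    · exact fun h => ⟨h 0 (by omega), fun i hi => h (i + 1) (by omega)⟩

/-- The validity test for multiplication tables: closure, units, inverses, associativity with a
generator in the middle, and generation. -/
def Tab.check (t : Tab) (n : ℕ) (gens : List ℕ) : Bool :=
  and (Nat.beq t.size n) <| and (Nat.blt 0 n) <|
  and (t.all fun X Y => and (Nat.beq (app X 0) (app X (app Y (app X 0)))) <|
    and (Nat.beq (app Y (app X 0)) 0) <| and (Nat.blt (app Y 0) n) <|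
    and (Nat.beq (t.row (app Y 0)) Y) <| allLt n fun y => Nat.blt (app X y) n) <|
  and (allLt n fun y => Nat.beq (app (t.row 0) y) y) <|
  and (allLt n fun x => Nat.beq (app (t.row x) 0) x) <|
  and (gens.all fun g => t.all fun X _ => allLt n fun y =>
    Nat.beq (app (t.row (app X g)) y) (app X (app (t.row g) y))) <|
  and (gens.all fun g => Nat.blt g n) <|
  allLt n fun x => or (Nat.beq x 0) (gens.any fun g => Nat.beq
    (app (t.row (app (t.row x) (app (t.irow g) 0))) g) x &&
      Nat.blt (app (t.row x) (app (t.irow g) 0)) x)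

/-- A finite group presented by a multiplication table. -/
structure TabGroup where
  tab : Tab
  n : ℕ
  gens : List ℕ
  ok : tab.check n gens = true

/-- The elements of a group presented by a multiplication table. -/
def TabGroup.El (D : TabGroup) : Type := Fin D.n

theorem TabGroup.facts (D : TabGroup) : D.tab.size = D.n ∧ 0 < D.n ∧
    (∀ x < D.n, app (D.tab.irow x) (app (D.tab.row x) 0) = 0 ∧ app (D.tab.irow x) 0 < D.n ∧
      D.tab.row (app (D.tab.irow x) 0) = D.tab.irow x ∧ ∀ y < D.n, app (D.tab.row x) y < D.n) ∧
    (∀ y < D.n, app (D.tab.row 0) y = y) ∧ (∀ x < D.n, app (D.tab.row x) 0 = x) ∧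
    (∀ g ∈ D.gens, ∀ x < D.n, ∀ y < D.n,
      app (D.tab.row (app (D.tab.row x) g)) y = app (D.tab.row x) (app (D.tab.row g) y)) ∧
    (∀ g ∈ D.gens, g < D.n) ∧
    ∀ x < D.n, x = 0 ∨ ∃ g ∈ D.gens, ∃ z < x, app (D.tab.row z) g = x := by
  have h := D.ok
  simp only [Tab.check, Bool.and_eq_true, Tab.all_iff, allLt_iff, List.all_eq_true, Nat.beq_eq,
    Bool.or_eq_true, List.any_eq_true, Nat.blt_eq] at h
  obtain ⟨h1, h2, h3, h4, h5, h6, h7, h8⟩ := h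
  rw [h1] at h3 h6
  exact ⟨h1, h2, fun x hx => ⟨(h3 x hx).2.1, (h3 x hx).2.2.1, (h3 x hx).2.2.2.1, (h3 x hx).2.2.2.2⟩, h4, h5, h6, h7,
    fun x hx => (h8 x hx).imp id fun ⟨g, hg, e1, e2⟩ => ⟨g, hg, _, e2, e1⟩⟩

namespace TabGroup

variable (D : TabGroup)

/-- The product of two elements given by their indices. -/
def op (x y : ℕ) : ℕ := app (D.tab.row x) y

theorem op_lt {x y : ℕ} (hx : x < D.n) (hy : y < D.n) : D.op x y < D.n := ((D.facts.2.2.1 x hx).2.2.2) y hy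

theorem op_zero {x : ℕ} (hx : x < D.n) : D.op x 0 = x := D.facts.2.2.2.2.1 x hx

theorem zero_op {x : ℕ} (hx : x < D.n) : D.op 0 x = x := D.facts.2.2.2.1 x hx

theorem op_assoc {x y z : ℕ} (hx : x < D.n) (hy : y < D.n) (hz : z < D.n) :
    D.op (D.op x y) z = D.op x (D.op y z) := by
  obtain ⟨-, -, -, -, -, h6, h7, h8⟩ := D.facts
  induction y using Nat.strong_induction_on generalizing x z with
  | _ y ih =>
    rcases h8 y hy with rfl | ⟨g, hg, w, hw, rfl⟩
    · rw [D.op_zero hx, D.zero_op hz]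
    · have hw' : w < D.n := hw.trans hy
      have hgn := h7 g hg
      have e1 : ∀ u < D.n, ∀ v < D.n, D.op (D.op u g) v = D.op u (D.op g v) := fun u hu v hv => h6 g hg u hu v hv
      change D.op (D.op x (D.op w g)) z = D.op x (D.op (D.op w g) z)
      rw [← ih w hw hx hw' hgn, e1 _ (D.op_lt hx hw') _ hz, e1 _ hw' _ hz,
        ih w hw hx hw' (D.op_lt hgn hz)]

theorem inv_op {x : ℕ} (hx : x < D.n) : D.op (app (D.tab.irow x) 0) x = 0 := by
  obtain ⟨h1, h2, h3⟩ := D.facts.2.2.1 x hx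
  have := D.facts.2.2.2.2.1 x hx
  rw [this] at h1
  unfold op
  rw [h3.1, h1]

instance : Mul D.El := ⟨fun x y => ⟨D.op x.1 y.1, D.op_lt x.2 y.2⟩⟩

instance : One D.El := ⟨⟨0, D.facts.2.1⟩⟩

theorem inv_lt {x : ℕ} (hx : x < D.n) : app (D.tab.irow x) 0 < D.n := (D.facts.2.2.1 x hx).2.1

instance : Inv D.El := ⟨fun x => ⟨app (D.tab.irow x.1) 0, D.inv_lt x.2⟩⟩

instance : Group D.El :=
  Group.ofLeftAxioms (fun a b c => Fin.ext (D.op_assoc a.2 b.2 c.2)) (fun a => Fin.ext (D.zero_op a.2))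
    (fun a => Fin.ext (D.inv_op a.2))

instance : Finite D.El := inferInstanceAs (Finite (Fin D.n))

instance : Fintype D.El := inferInstanceAs (Fintype (Fin D.n))

instance : DecidableEq D.El := inferInstanceAs (DecidableEq (Fin D.n))

end TabGroup

/-! ### Gluing patterns given by numerical codes -/

/-- The face whose sign on axis `i` is the `i`-th bit of `f`. -/
def faceN (f : ℕ) : OctFace := fun i => Nat.testBit f i

/-- The number of a face. -/
def faceNum (F : OctFace) : ℕ := (F 0).toNat + 2 * (F 1).toNat + 4 * (F 2).toNat

theorem faceNum_lt (F : OctFace) : faceNum F < 8 := by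
  revert F; decide

theorem faceN_faceNum (F : OctFace) : faceN (faceNum F) = F := by
  revert F; decide

theorem faceNum_faceN {f : ℕ} (h : f < 8) : faceNum (faceN f) = f := by
  revert f; decide

/-- The value at `i` of the `p`-th permutation of the axes. -/
def pact (p i : ℕ) : ℕ := (35540509284 >>> (6 * p + 2 * i)) % 4

/-- The number of the inverse of the `p`-th permutation of the axes. -/
def pinv (p : ℕ) : ℕ := if p = 1 then 2 else if p = 2 then 1 else p

/-- The `p`-th permutation of the axes. -/
def permN (p : ℕ) : Equiv.Perm (Fin 3) :=
  if p = 0 then 1 else if p = 1 then finRotate 3 else if p = 2 then (finRotate 3)⁻¹ else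
  if p = 3 then Equiv.swap 1 2 else if p = 4 then Equiv.swap 0 2 else Equiv.swap 0 1

theorem val_permN {p : ℕ} (hp : p < 6) (i : Fin 3) : (permN p i).val = pact p i := by
  revert i; revert p; decide

theorem permN_pinv {p : ℕ} (hp : p < 6) : permN (pinv p) = (permN p)⁻¹ := by
  revert p; decide

theorem sign_permN {p : ℕ} (hp : p < 6) : Equiv.Perm.sign (permN p) = 1 ↔ p < 3 := by
  revert p; decide

/-- The face glued to the face `f`. -/
def csig (c f : ℕ) : ℕ := (c >>> (6 * f)) % 8

/-- The number of the axis permutation at the face `f`. -/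
def cprm (c f : ℕ) : ℕ := (c >>> (6 * f + 3)) % 8

/-- The parity of the number of a face. -/
def cpar (f : ℕ) : ℕ := (f + f / 2 + f / 4) % 2

theorem faceSign_faceN {f f' : ℕ} (hf : f < 8) (hf' : f' < 8) :
    faceSign (faceN f) ≠ faceSign (faceN f') ↔ cpar f ≠ cpar f' := by
  revert f'; revert f; decide

/-- The numerical condition for a code to define a gluing pattern. -/
def ValidCode (c : ℕ) : Prop := ∀ f < 8, csig c (csig c f) = f ∧ csig c f ≠ f ∧ cprm c f < 6 ∧
  cprm c (csig c f) = pinv (cprm c f) ∧ (cprm c f < 3 ↔ cpar f ≠ cpar (csig c f))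

instance (c : ℕ) : Decidable (ValidCode c) := by unfold ValidCode; infer_instance

theorem csig_lt (c f : ℕ) : csig c f < 8 := Nat.mod_lt _ (by norm_num)

theorem involutive_csig {c : ℕ} (h : ValidCode c) :
    Function.Involutive fun F : OctFace => faceN (csig c (faceNum F)) := fun F => by
  change faceN (csig c (faceNum (faceN (csig c (faceNum F))))) = F
  rw [faceNum_faceN (csig_lt _ _), (h _ (faceNum_lt F)).1, faceN_faceNum]

/-- The gluing pattern with a given code. -/
def gluingOf (c : ℕ) (h : ValidCode c) : Gluing :=
  ⟨((involutive_csig h).toPerm _, fun F => permN (cprm c (faceNum F))), by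
    refine ⟨involutive_csig h, fun F hF => ?_, fun F => ?_, fun F => ?_⟩
    · have := congrArg faceNum hF
      change faceNum (faceN _) = _ at this
      rw [faceNum_faceN (csig_lt _ _)] at this
      exact (h _ (faceNum_lt F)).2.1 this
    · change permN (cprm c (faceNum (faceN _))) = _
      rw [faceNum_faceN (csig_lt _ _), (h _ (faceNum_lt F)).2.2.2.1, permN_pinv (h _ (faceNum_lt F)).2.2.1]
    · change _ ↔ faceSign F ≠ faceSign (faceN (csig c (faceNum F)))
      rw [sign_permN (h _ (faceNum_lt F)).2.2.1, (h _ (faceNum_lt F)).2.2.2.2,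
        ← faceSign_faceN (faceNum_lt F) (csig_lt _ _), faceN_faceNum]⟩

theorem gluingOf_face {c : ℕ} (h : ValidCode c) {f : ℕ} (hf : f < 8) :
    (gluingOf c h).face (faceN f) = faceN (csig c f) := by
  change faceN (csig c (faceNum (faceN f))) = _
  rw [faceNum_faceN hf]

theorem gluingOf_axisMap {c : ℕ} (h : ValidCode c) {f : ℕ} (hf : f < 8) :
    (gluingOf c h).axisMap (faceN f) = permN (cprm c f) := by
  change permN (cprm c (faceNum (faceN f))) = _
  rw [faceNum_faceN hf]

/-- The sign bit of a face on an axis. -/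
def fbit (f i : ℕ) : ℕ := (f >>> i) % 2

/-- The number of the vertex of the face `f` on axis `i`. -/
def fvtx (f i : ℕ) : ℕ := 2 * i + fbit f i

/-- The number of the vertex to which the vertex of `f` on axis `i` is glued. -/
def cimg (c f i : ℕ) : ℕ := fvtx (csig c f) (pact (cprm c f) i)

/-- The vertex with a given number. -/
def vertN (s : ℕ) : OctVertex := (Fin.ofNat 3 (s / 2), Nat.testBit s 0)

/-- The number of a vertex. -/
def vertNum (v : OctVertex) : ℕ := 2 * v.1.val + v.2.toNat

theorem vertN_vertNum (v : OctVertex) : vertN (vertNum v) = v := by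
  revert v; decide

theorem vertNum_vertN {s : ℕ} (h : s < 6) : vertNum (vertN s) = s := by
  revert s; decide

theorem vertNum_lt (v : OctVertex) : vertNum v < 6 := by
  revert v; decide

theorem vertNum_mk (f : ℕ) (i : Fin 3) : vertNum (i, faceN f i) = fvtx f i := by
  simp only [vertNum, faceN, fvtx, fbit, Nat.testBit_eq_decide_div_mod_eq, Nat.shiftRight_eq_div_pow]
  rcases Nat.mod_two_eq_zero_or_one (f / 2 ^ i.val) with h | h <;> simp [h]

theorem vertN_fvtx (f : ℕ) (i : Fin 3) : vertN (fvtx f i) = (i, faceN f i) := by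
  rw [← vertNum_mk, vertN_vertNum]

theorem vertNum_vimg {c : ℕ} (h : ValidCode c) {f : ℕ} (hf : f < 8) (i : Fin 3) :
    vertNum (vimg (gluingOf c h) (faceN f) i) = cimg c f i := by
  unfold vimg
  rw [gluingOf_face h hf, gluingOf_axisMap h hf, vertNum_mk, val_permN (h f hf).2.2.1]
  rfl

theorem cimg_lt {c : ℕ} (h : ValidCode c) {f i : ℕ} (hf : f < 8) (hi : i < 3) : cimg c f i < 6 := by
  have := vertNum_vimg h hf ⟨i, hi⟩
  rw [← this]
  exact vertNum_lt _

theorem vimg_eq {c : ℕ} (h : ValidCode c) {f : ℕ} (hf : f < 8) (i : Fin 3) :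
    vimg (gluingOf c h) (faceN f) i = vertN (cimg c f i) := by
  rw [← vertNum_vimg h hf, vertN_vertNum]

/-! ### Words in the generators of a group -/

section Words

variable {G : Type*} [Group G]

/-- The inverse of a letter; the letters `2 * n` and `2 * n + 1` denote the `n`-th generator and
its inverse. -/
def linv (l : ℕ) : ℕ := if l % 2 = 0 then l + 1 else l - 1

/-- The value of a letter. -/
def letterVal (x : ℕ → G) (l : ℕ) : G := if l % 2 = 0 then x (l / 2) else (x (l / 2))⁻¹

/-- The value of a word. -/
def val (x : ℕ → G) (w : List ℕ) : G := w.foldr (fun l t => letterVal x l * t) 1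

/-- Prepend a letter to a reduced word. -/
def redCons (l : ℕ) : List ℕ → List ℕ
  | [] => [l]
  | m :: t => if m = linv l then t else l :: m :: t

/-- Free reduction. -/
def red (w : List ℕ) : List ℕ := w.foldr redCons []

/-- The inverse of a word. -/
def winv (w : List ℕ) : List ℕ := (w.map linv).reverse

theorem letterVal_linv (x : ℕ → G) (l : ℕ) : letterVal x (linv l) = (letterVal x l)⁻¹ := by
  unfold letterVal linv
  rcases Nat.mod_two_eq_zero_or_one l with h | h
  · rw [if_pos h, if_pos h, if_neg (by omega), show (l + 1) / 2 = l / 2 by omega]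
  · have h1 : (l - 1) % 2 = 0 := by omega
    have h2 : (l - 1) / 2 = l / 2 := by omega
    simp [h, h1, h2]

@[simp] theorem val_nil (x : ℕ → G) : val x [] = 1 := rfl

theorem val_cons (x : ℕ → G) (l : ℕ) (w : List ℕ) : val x (l :: w) = letterVal x l * val x w := rfl

theorem val_append (x : ℕ → G) (w w' : List ℕ) : val x (w ++ w') = val x w * val x w' := by
  induction w with
  | nil => simp
  | cons l w ih => rw [List.cons_append, val_cons, val_cons, ih, mul_assoc]

theorem val_winv (x : ℕ → G) (w : List ℕ) : val x (winv w) = (val x w)⁻¹ := by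
  unfold winv
  induction w with
  | nil => simp
  | cons l w ih => rw [List.map_cons, List.reverse_cons, val_append, ih, val_cons, val_cons, val_nil, mul_one,
      letterVal_linv, mul_inv_rev]

theorem val_red (x : ℕ → G) (w : List ℕ) : val x (red w) = val x w := by
  induction w with
  | nil => rfl
  | cons l w ih =>
    rw [val_cons, ← ih]
    change val x (redCons l (red w)) = _
    cases h : red w with
    | nil => rfl
    | cons m t =>
      change val x (if m = linv l then t else l :: m :: t) = _
      split_ifs with h'
      · rw [val_cons, h', letterVal_linv, mul_inv_cancel_left]
      · rfl

end Words

/-! ### Presentations of gluing patterns -/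

/-- Data for the computation of the admissible labels of a gluing pattern: its code, the faces
`f1`, …, `f4` carrying the labels, the starting points and lengths of the walks around the two edges,
the relator, the words carried by the loops in the vertex link, and a spanning tree of the vertices. -/
structure Pres where
  code : ℕ
  f1 : ℕ
  f2 : ℕ
  f3 : ℕ
  f4 : ℕ
  v1 : ℕ
  u1 : ℕ
  n1 : ℕ
  v2 : ℕ
  u2 : ℕ
  g2 : ℕ
  n2 : ℕ
  r : List ℕ
  P : List (List ℕ)
  vt : List (ℕ × ℕ)

namespace Pres

/-- One step of a walk around an edge. -/
def next (c : ℕ) (s : ℕ × ℕ × ℕ) : ℕ × ℕ × ℕ :=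
  (cimg c s.2.2 (s.1 / 2), cimg c s.2.2 (s.2.1 / 2),
    csig c s.2.2 ^^^ (1 <<< (3 - cimg c s.2.2 (s.1 / 2) / 2 - cimg c s.2.2 (s.2.1 / 2) / 2)))

/-- The walk around an edge. -/
def walk (c : ℕ) : ℕ → ℕ × ℕ × ℕ → List (ℕ × ℕ × ℕ)
  | 0, _ => []
  | n + 1, s => s :: walk c n (next c s)

/-- The state reached after a walk. -/
def walkEnd (c : ℕ) : ℕ → ℕ × ℕ × ℕ → ℕ × ℕ × ℕ
  | 0, s => s
  | n + 1, s => walkEnd c n (next c s)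

variable (p : Pres)

/-- The first walk. -/
def s1 : ℕ × ℕ × ℕ := (p.v1, p.u1, p.f4)

/-- The second walk. -/
def s2 : ℕ × ℕ × ℕ := (p.v2, p.u2, p.g2)

/-- The word carried by one of the first three pairs of faces. -/
def letter (f : ℕ) : List ℕ :=
  if f = p.f1 then [0] else if f = p.f2 then [2] else if f = p.f3 then [4] else
  if f = csig p.code p.f1 then [1] else if f = csig p.code p.f2 then [3] else
  if f = csig p.code p.f3 then [5] else []

/-- The word carried by the inverse of the label of `f4`. -/
def u : List ℕ := red ((walk p.code (p.n1 - 1) (next p.code p.s1)).flatMap fun s => p.letter s.2.2)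

/-- The word carried by a face. -/
def phi (f : ℕ) : List ℕ :=
  if f = p.f4 then winv p.u else if f = csig p.code p.f4 then p.u else p.letter f

/-- The words carried by the initial segments of a walk. -/
def wtab : ℕ → ℕ × ℕ × ℕ → List ℕ → List ((ℕ × ℕ) × List ℕ)
  | 0, _, _ => []
  | n + 1, s, w => ((s.1, s.2.1), w) :: wtab n (next p.code s) (red (w ++ p.phi s.2.2))

/-- The words carried by the edge ends. -/
def W (v u : ℕ) : List ℕ :=
  let T := p.wtab p.n1 p.s1 [] ++ p.wtab p.n2 p.s2 []
  match T.lookup (v, u) with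
  | some w => w
  | none => (T.lookup (u, v)).getD []

/-- Extend a table of paths by one step. -/
def vstep (T : List (ℕ × List ℕ)) (s : ℕ × ℕ) : List (ℕ × List ℕ) :=
  if s.2 < 8 ∧ s.1 = fvtx s.2 (s.1 / 2) ∧ s.1 < 6 then
    match T.lookup s.1 with
    | some w => (cimg p.code s.2 (s.1 / 2), red (w ++ p.phi s.2)) :: T
    | none => T
  else T

/-- The words carried by the paths in the spanning tree of the vertices. -/
def vtab : List (ℕ × List ℕ) := p.vt.foldl p.vstep [(1, [])]

/-- The words carried by the vertices. -/
def V (v : ℕ) : List ℕ := (p.vtab.lookup v).getD []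

/-- The words carried by the loops in the vertex link. -/
def loop (f i : ℕ) : List ℕ := red (p.V (fvtx f i) ++ p.phi f ++ winv (p.V (cimg p.code f i)))

/-- The two edge classes, distinguished by orientation. -/
def col (v u : ℕ) : Bool := ((walk p.code p.n1 p.s1 ++ walk p.code p.n2 p.s2).map fun s => (s.1, s.2.1)).contains (v, u)

/-- The consistency of the data. -/
def Check : Prop :=
  ValidCode p.code ∧
  (∀ f < 8, f ∈ [p.f1, p.f2, p.f3, p.f4] ∨ csig p.code f ∈ [p.f1, p.f2, p.f3, p.f4]) ∧
  (∀ f ∈ [p.f1, p.f2, p.f3, p.f4], f < 8) ∧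
  (∀ f < 8, red (p.phi f ++ p.phi (csig p.code f)) = []) ∧
  (p.phi p.f1 = [0] ∧ p.phi p.f2 = [2] ∧ p.phi p.f3 = [4]) ∧
  (∀ f < 8, ∀ i < 3, ∀ j < 3, i ≠ j → red (p.W (fvtx f i) (fvtx f j) ++ p.phi f ++
    winv (p.W (cimg p.code f i) (cimg p.code f j))) ∈ [[], p.r, winv p.r]) ∧
  (∀ f < 8, ∀ i < 3, ∀ j < 3, i ≠ j → p.col (fvtx f i) (fvtx f j) = p.col (cimg p.code f i) (cimg p.code f j) ∧
    p.col (fvtx f i) (fvtx f j) ≠ p.col (fvtx f j) (fvtx f i)) ∧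
  (∀ n ∈ [(p.n1, p.s1), (p.n2, p.s2)], walkEnd p.code n.1 n.2 = n.2 ∧ ∀ s ∈ walk p.code n.1 n.2, s.2.2 < 8 ∧
    s.1 < 6 ∧ s.2.1 < 6 ∧ s.1 / 2 ≠ s.2.1 / 2 ∧ s.1 = fvtx s.2.2 (s.1 / 2) ∧ s.2.1 = fvtx s.2.2 (s.2.1 / 2)) ∧
  (∀ s ∈ walk p.code (p.n1 - 1) (next p.code p.s1), p.letter s.2.2 ≠ []) ∧ p.n1 ≠ 0 ∧
  red ((walk p.code p.n2 p.s2).flatMap fun s => p.phi s.2.2) = p.r ∧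
  (∀ v < 6, (p.vtab.lookup v).isSome) ∧ p.V 1 = [] ∧
  (∀ f < 8, ∀ i < 3, p.loop f i ∈ [] :: p.P ++ p.P.map winv) ∧
  (∀ w ∈ p.P, ∃ f ∈ List.range 8, ∃ i ∈ List.range 3, p.loop f i = w)

set_option synthInstance.maxSize 1000 in
set_option synthInstance.maxHeartbeats 200000 in
instance : Decidable p.Check := by unfold Check; infer_instance

end Pres

namespace Pres

variable {p : Pres}

/-- The gluing pattern of a presentation. -/
def gl (p : Pres) (h : p.Check) : Gluing := gluingOf p.code h.1

section

variable {G : Type*} [Group G]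

/-- The labels of the first three pairs of faces. -/
def env (p : Pres) (a : OctFace → G) (n : ℕ) : G :=
  if n = 0 then a (faceN p.f1) else if n = 1 then a (faceN p.f2) else a (faceN p.f3)

theorem label_csig {c : ℕ} (hc : ValidCode c) {a : OctFace → G} (ha : IsLabel (gluingOf c hc) a) {f : ℕ} (hf : f < 8) :
    a (faceN (csig c f)) = (a (faceN f))⁻¹ := by
  have := ha (faceN f)
  rw [gluingOf_face hc hf] at this
  exact (inv_eq_of_mul_eq_one_right this).symm

theorem label_letter (h : p.Check) {a : OctFace → G} (ha : IsLabel (p.gl h) a) {f : ℕ}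
    (hl : p.letter f ≠ []) : a (faceN f) = val (p.env a) (p.letter f) := by
  have h3 := h.2.2.1
  simp only [List.mem_cons, List.not_mem_nil, or_false, forall_eq_or_imp, forall_eq] at h3
  obtain ⟨e1, e2, e3, e4⟩ := h3
  have c1 := label_csig h.1 ha e1
  have c2 := label_csig h.1 ha e2
  have c3 := label_csig h.1 ha e3
  unfold letter at hl ⊢
  split_ifs at hl ⊢ with k1 k2 k3 k4 k5 k6
  · rw [k1]; simp [val_cons, letterVal, env]
  · rw [k2]; simp [val_cons, letterVal, env]
  · rw [k3]; simp [val_cons, letterVal, env]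
  · rw [k4, c1]; simp [val_cons, letterVal, env]
  · rw [k5, c2]; simp [val_cons, letterVal, env]
  · rw [k6, c3]; simp [val_cons, letterVal, env]
  · exact absurd rfl hl

/-- The numerical condition for a step around an edge to make sense. -/
def Step (s : ℕ × ℕ × ℕ) : Prop := s.2.2 < 8 ∧ s.1 < 6 ∧ s.2.1 < 6 ∧ s.1 / 2 ≠ s.2.1 / 2 ∧
  s.1 = fvtx s.2.2 (s.1 / 2) ∧ s.2.1 = fvtx s.2.2 (s.2.1 / 2)

theorem vertN_eq {f s : ℕ} (hs : s < 6) (h : s = fvtx f (s / 2)) :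
    vertN s = (⟨s / 2, by omega⟩, faceN f ⟨s / 2, by omega⟩) := by
  rw [← vertN_fvtx]
  exact congrArg vertN h

theorem erel_step {c : ℕ} (hc : ValidCode c) (a : OctFace → G) {s : ℕ × ℕ × ℕ} (hs : Step s) (k : G) :
    erel (gluingOf c hc) a ((vertN s.1, vertN s.2.1), k)
      ((vertN (next c s).1, vertN (next c s).2.1), k * a (faceN s.2.2)) := by
  obtain ⟨h1, h2, h3, h4, h5, h6⟩ := hs
  refine ⟨faceN s.2.2, ⟨s.1 / 2, by omega⟩, ⟨s.2.1 / 2, by omega⟩, fun e => h4 (congrArg Fin.val e), ?_, ?_⟩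
  · exact congrArg₂ Prod.mk (vertN_eq h2 h5) (vertN_eq h3 h6)
  · rw [vimg_eq hc h1, vimg_eq hc h1]
    rfl

theorem eqvGen_walk {c : ℕ} (hc : ValidCode c) (a : OctFace → G) (n : ℕ) (s : ℕ × ℕ × ℕ)
    (hs : ∀ t ∈ walk c n s, Step t) (k : G) :
    Relation.EqvGen (erel (gluingOf c hc) a) ((vertN s.1, vertN s.2.1), k)
      ((vertN (walkEnd c n s).1, vertN (walkEnd c n s).2.1), k * ((walk c n s).map fun t => a (faceN t.2.2)).prod) := by
  induction n generalizing s k with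
  | zero => simpa [walk, walkEnd] using Relation.EqvGen.refl _
  | succ n ih =>
    have h1 := Relation.EqvGen.rel _ _ (erel_step hc a (hs s (by simp [walk])) k)
    have h2 := ih (next c s) (fun t ht => hs t (by simp [walk, ht])) (k * a (faceN s.2.2))
    refine h1.trans _ _ _ ?_
    simpa [walk, walkEnd, mul_assoc] using h2

theorem prod_walk_eq_one {c : ℕ} (hc : ValidCode c) {a : OctFace → G} (ha : IsAdm (gluingOf c hc) a) {n : ℕ}
    {s : ℕ × ℕ × ℕ} (hs : ∀ t ∈ walk c n s, Step t) (he : walkEnd c n s = s) :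
    ((walk c n s).map fun t => a (faceN t.2.2)).prod = 1 := by
  cases n with
  | zero => rfl
  | succ n =>
    have h := eqvGen_walk hc a _ s hs 1
    rw [he, one_mul] at h
    obtain ⟨h1, h2, h3, h4, h5, h6⟩ := hs s (by simp [walk])
    refine ha.2 _ _ ?_ _ h
    rw [vertN_eq h2 h5, vertN_eq h3 h6]
    exact fun e => h4 (congrArg Fin.val e)

theorem val_flatMap (x : ℕ → G) {ι : Type*} (l : List ι) (w : ι → List ℕ) :
    val x (l.flatMap w) = (l.map fun i => val x (w i)).prod := by
  induction l with
  | nil => rfl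
  | cons i l ih => rw [List.flatMap_cons, val_append, ih, List.map_cons, List.prod_cons]

theorem walk_step (h : p.Check) {n : ℕ × ℕ × ℕ × ℕ} (hn : n ∈ [(p.n1, p.s1), (p.n2, p.s2)]) :
    walkEnd p.code n.1 n.2 = n.2 ∧ ∀ t ∈ walk p.code n.1 n.2, Step t := h.2.2.2.2.2.2.2.1 n hn

theorem phi_of_ne {f : ℕ} (h : f ≠ p.f4) (h' : f ≠ csig p.code p.f4) : p.phi f = p.letter f := by
  simp [phi, h, h']

theorem label_f4 (h : p.Check) {a : OctFace → G} (ha : IsAdm (p.gl h) a) :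
    a (faceN p.f4) = (val (p.env a) p.u)⁻¹ := by
  have h1 := walk_step h (n := (p.n1, p.s1)) (by simp)
  have h2 := prod_walk_eq_one h.1 ha h1.2 h1.1
  have h9 := h.2.2.2.2.2.2.2.2.1
  obtain ⟨m, hm⟩ := Nat.exists_eq_succ_of_ne_zero h.2.2.2.2.2.2.2.2.2.1
  have e : walk p.code p.n1 p.s1 = p.s1 :: walk p.code (p.n1 - 1) (next p.code p.s1) := by rw [hm]; rfl
  rw [e, List.map_cons, List.prod_cons] at h2
  rw [eq_inv_iff_mul_eq_one, u, val_red, val_flatMap]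
  convert! h2 using 3
  exact List.map_congr_left fun s hs => (label_letter h ha.1 (h9 s hs)).symm

theorem label_eq (h : p.Check) {a : OctFace → G} (ha : IsAdm (p.gl h) a) {f : ℕ} (hf : f < 8) :
    a (faceN f) = val (p.env a) (p.phi f) := by
  have h3 := h.2.2.1
  simp only [List.mem_cons, List.not_mem_nil, or_false, forall_eq_or_imp, forall_eq] at h3
  have h4 := label_f4 h ha
  by_cases k1 : f = p.f4
  · simp [phi, k1, h4, val_winv]
  by_cases k2 : f = csig p.code p.f4
  · rw [k2, label_csig h.1 ha.1 h3.2.2.2, h4, inv_inv, phi, if_neg (k2 ▸ k1), if_pos rfl]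
  rw [phi_of_ne k1 k2]
  refine label_letter h ha.1 ?_
  have hinv : ∀ x, csig p.code f = x → f = csig p.code x := fun x hx => by rw [← hx, (h.1 f hf).1]
  have h2 := h.2.1 f hf
  simp only [List.mem_cons, List.not_mem_nil, or_false] at h2
  unfold letter
  split_ifs with k3 k4 k5 k6 k7 k8
  all_goals try simp
  rcases h2 with (e | e | e | e) | (e | e | e | e)
  · exact k3 e
  · exact k4 e
  · exact k5 e
  · exact k1 e
  · exact k6 (hinv _ e)
  · exact k7 (hinv _ e)
  · exact k8 (hinv _ e)
  · exact k2 (hinv _ e)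

theorem val_r (h : p.Check) {a : OctFace → G} (ha : IsAdm (p.gl h) a) : val (p.env a) p.r = 1 := by
  have h1 := walk_step h (n := (p.n2, p.s2)) (by simp)
  have h2 := prod_walk_eq_one h.1 ha h1.2 h1.1
  rw [← h.2.2.2.2.2.2.2.2.2.2.1, val_red, val_flatMap, ← h2]
  congr 1
  exact List.map_congr_left fun s hs => (label_eq h ha (h1.2 s hs).1).symm

/-- The labelling with given values at the generators. -/
def lab (p : Pres) (x : ℕ → G) (F : OctFace) : G := val x (p.phi (faceNum F))

theorem lab_faceN (x : ℕ → G) {f : ℕ} (hf : f < 8) : p.lab x (faceN f) = val x (p.phi f) := by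
  rw [lab, faceNum_faceN hf]

theorem isLabel_lab (h : p.Check) (x : ℕ → G) : IsLabel (p.gl h) (p.lab x) := fun F => by
  rw [← faceN_faceNum F, gl, gluingOf_face h.1 (faceNum_lt F), lab_faceN _ (faceNum_lt F), lab_faceN _ (csig_lt _ _),
    ← val_append, ← val_red, h.2.2.2.1 _ (faceNum_lt F), val_nil]

theorem isAdm_lab (h : p.Check) {x : ℕ → G} (hx : val x p.r = 1) : IsAdm (p.gl h) (p.lab x) := by
  refine ⟨isLabel_lab h x, fun v u _ k hk => ?_⟩
  have key : ∀ q q', Relation.EqvGen (erel (p.gl h) (p.lab x)) q q' →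
      q.2 * (val x (p.W (vertNum q.1.1) (vertNum q.1.2)))⁻¹ =
        q'.2 * (val x (p.W (vertNum q'.1.1) (vertNum q'.1.2)))⁻¹ := by
    intro q q' hq
    induction hq with
    | rel q q' hq =>
      obtain ⟨F, i, j, hij, e1, e2⟩ := hq
      have := h.2.2.2.2.2.1 _ (faceNum_lt F) i i.2 j j.2 (fun e => hij (Fin.ext e))
      have H : val x (red (p.W (fvtx (faceNum F) i) (fvtx (faceNum F) j) ++ p.phi (faceNum F) ++
          winv (p.W (cimg p.code (faceNum F) i) (cimg p.code (faceNum F) j)))) = 1 := by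
        simp only [List.mem_cons, List.not_mem_nil, or_false] at this
        rcases this with e | e | e <;> rw [e]
        · rfl
        · exact hx
        · rw [val_winv, hx, inv_one]
      rw [val_red, val_append, val_append, val_winv] at H
      rw [e2, e1]
      change _ = q.2 * p.lab x F * _
      rw [← faceN_faceNum F, lab_faceN _ (faceNum_lt F), vertNum_mk, vertNum_mk]
      simp only [gl]
      rw [vertNum_vimg h.1 (faceNum_lt F), vertNum_vimg h.1 (faceNum_lt F)]
      rw [mul_assoc, mul_right_inj, inv_eq_iff_mul_eq_one, ← mul_assoc, H]
    | refl => rfl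
    | symm _ _ _ ih => exact ih.symm
    | trans _ _ _ _ _ ih1 ih2 => exact ih1.trans ih2
  have := key _ _ hk
  simpa using this

theorem lab_env (h : p.Check) {a : OctFace → G} (ha : IsAdm (p.gl h) a) : p.lab (p.env a) = a := by
  funext F
  conv_rhs => rw [← faceN_faceNum F]
  rw [label_eq h ha (faceNum_lt F)]
  rfl

/-- The triple of values as an assignment to all generators. -/
def env3 (t : G × G × G) (n : ℕ) : G := if n = 0 then t.1 else if n = 1 then t.2.1 else t.2.2

theorem env_lab (h : p.Check) (t : G × G × G) : p.env (p.lab (env3 t)) = env3 t := by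
  have h3 := h.2.2.1
  simp only [List.mem_cons, List.not_mem_nil, or_false, forall_eq_or_imp, forall_eq] at h3
  obtain ⟨k1, k2, k3⟩ := h.2.2.2.2.1
  funext n
  unfold env
  rw [lab_faceN _ h3.1, lab_faceN _ h3.2.1, lab_faceN _ h3.2.2.1, k1, k2, k3]
  simp [val_cons, letterVal, env3]

end

end Pres

theorem List.lookup_mem {α β : Type*} [DecidableEq α] {l : List (α × β)} {x : α} {y : β} (h : l.lookup x = some y) :
    (x, y) ∈ l := by
  induction l with
  | nil => simp at h
  | cons q l ih =>
    obtain ⟨x', y'⟩ := q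
    rw [List.lookup_cons] at h
    by_cases hx : x = x'
    · simp [hx] at h
      simp [hx, h]
    · have : (x == x') = false := by simpa using hx
      rw [this] at h
      exact List.mem_cons_of_mem _ (ih (by simpa using h))

namespace Pres

variable {p : Pres} {G : Type*} [Group G]

theorem ymk_vertex (h : p.Check) (x : ℕ → G) {f : ℕ} (hf : f < 8) (i : Fin 3) (k : G) :
    ymk (p.gl h) (p.lab x) (vpt (vertN (cimg p.code f i))) (k * val x (p.phi f)) =
      ymk (p.gl h) (p.lab x) (vpt (vertN (fvtx f i))) k := by
  rw [vertN_fvtx, ← vimg_eq h.1 hf, ← omove_vpt, ← lab_faceN x hf]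
  exact Eq.symm (Quotient.sound (Relation.EqvGen.rel _ _ ⟨faceN f, vertexPt_mem_faceSet _ _, rfl⟩))

theorem vtab_spec (h : p.Check) (x : ℕ → G) : ∀ q ∈ p.vtab,
    ymk (p.gl h) (p.lab x) (vpt (vertN q.1)) (val x q.2) = ymk (p.gl h) (p.lab x) (vpt (0, true)) 1 ∧
      vtxSetoid (p.gl h) (vertN q.1) (0, true) := by
  have key : ∀ (l : List (ℕ × ℕ)) (T : List (ℕ × List ℕ)), (∀ q ∈ T,
      ymk (p.gl h) (p.lab x) (vpt (vertN q.1)) (val x q.2) = ymk (p.gl h) (p.lab x) (vpt (0, true)) 1 ∧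
      vtxSetoid (p.gl h) (vertN q.1) (0, true)) → ∀ q ∈ l.foldl p.vstep T,
      ymk (p.gl h) (p.lab x) (vpt (vertN q.1)) (val x q.2) = ymk (p.gl h) (p.lab x) (vpt (0, true)) 1 ∧
      vtxSetoid (p.gl h) (vertN q.1) (0, true) := by
    intro l
    induction l with
    | nil => exact fun T hT => hT
    | cons s l ih =>
      intro T hT
      refine ih _ ?_
      unfold vstep
      split_ifs with hs
      · obtain ⟨h1, h2, h3⟩ := hs
        cases hl : T.lookup s.1 with
        | none => exact hT
        | some w =>
          intro q hq
          rcases List.mem_cons.1 hq with rfl | hq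
          · obtain ⟨e1, e2⟩ := hT _ (List.lookup_mem hl)
            have hi : s.1 / 2 < 3 := by omega
            have h4 : vertN (fvtx s.2 ((⟨s.1 / 2, hi⟩ : Fin 3) : ℕ)) = vertN s.1 := congrArg vertN h2.symm
            constructor
            · have := ymk_vertex h x h1 ⟨s.1 / 2, hi⟩ (val x w)
              rw [h4] at this
              rw [val_red, val_append, ← e1, ← this]
            · refine Setoid.trans' _ (Setoid.symm' _ (Relation.EqvGen.rel _ _ ?_)) e2
              refine ⟨faceN s.2, ⟨s.1 / 2, hi⟩, ?_, ?_⟩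
              · rw [← vertN_fvtx, h4]
              · exact (vimg_eq h.1 h1 ⟨s.1 / 2, hi⟩).symm
          · exact hT q hq
      · exact hT
  refine key p.vt _ fun q hq => ?_
  obtain rfl := List.mem_singleton.1 hq
  exact ⟨rfl, Setoid.refl' _ _⟩

theorem mem_vtab (h : p.Check) {v : ℕ} (hv : v < 6) : (v, p.V v) ∈ p.vtab := by
  obtain ⟨w, hw⟩ := Option.isSome_iff_exists.1 (h.2.2.2.2.2.2.2.2.2.2.2.1 v hv)
  have : p.V v = w := by rw [V, hw]; rfl
  exact this ▸ List.lookup_mem hw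

theorem oneVertex (h : p.Check) : OneVertex (p.gl h) := fun v w => by
  have h1 := (vtab_spec h (fun _ => (1 : Unit)) _ (mem_vtab h (vertNum_lt v))).2
  have h2 := (vtab_spec h (fun _ => (1 : Unit)) _ (mem_vtab h (vertNum_lt w))).2
  rw [vertN_vertNum] at h1 h2
  exact Setoid.trans' _ h1 (Setoid.symm' _ h2)

theorem noFlip (h : p.Check) : NoFlip (p.gl h) := by
  have hc := h.2.2.2.2.2.2.1
  have key : ∀ e e', endSetoid (p.gl h) e e' → p.col (vertNum e.1.1) (vertNum e.1.2) =
      p.col (vertNum e'.1.1) (vertNum e'.1.2) := by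
    intro e e' he
    induction he with
    | rel e e' he =>
      obtain ⟨F, i, j, hij, e1, e2⟩ := he
      have := (hc _ (faceNum_lt F) i i.2 j j.2 (fun e => hij (Fin.ext e))).1
      rw [← vertNum_vimg h.1 (faceNum_lt F), ← vertNum_vimg h.1 (faceNum_lt F), ← vertNum_mk, ← vertNum_mk,
        faceN_faceNum] at this
      rw [e1, e2]
      exact this
    | refl => rfl
    | symm _ _ _ ih => exact ih.symm
    | trans _ _ _ _ _ ih1 ih2 => exact ih1.trans ih2
  intro e e' he hf
  have h1 := key e e' he
  rw [hf] at h1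
  obtain ⟨⟨⟨i, b⟩, ⟨j, b'⟩⟩, hij⟩ := e
  let F : OctFace := fun l => if l = i then b else b'
  have hF : F i = b ∧ F j = b' := by
    have : j ≠ i := fun e => hij e.symm
    simp [F, this]
  have := (hc _ (faceNum_lt F) i i.2 j j.2 (fun e => hij (Fin.ext e))).2
  rw [← vertNum_mk, ← vertNum_mk, faceN_faceNum, hF.1, hF.2] at this
  exact this h1

theorem val_loop (x : ℕ → G) (f i : ℕ) :
    val x (p.loop f i) = val x (p.V (fvtx f i)) * val x (p.phi f) * (val x (p.V (cimg p.code f i)))⁻¹ := by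
  rw [loop, val_red, val_append, val_append, val_winv]

/-- The subgroup generated by the loops in the vertex link. -/
def per (p : Pres) (x : ℕ → G) : Subgroup G := Subgroup.closure {k | ∃ w ∈ p.P, val x w = k}

theorem fvtx_lt (f : ℕ) {i : ℕ} (hi : i < 3) : fvtx f i < 6 := by
  unfold fvtx fbit
  omega

theorem stabilizer_lab (h : p.Check) (x : ℕ → G) :
    MulAction.stabilizer G (ymk (p.gl h) (p.lab x) (vpt (0, true)) 1) = p.per x := by
  apply le_antisymm
  · intro k hk
    rw [MulAction.mem_stabilizer_iff, smul_ymk, mul_one] at hk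
    have hk' : Relation.EqvGen (lrel (p.gl h) (p.lab x)) (vpt (0, true), k) (vpt (0, true), 1) := Quotient.exact hk
    let Q : SolidOcta × G → Prop := fun q => ∃ v, q.1 = vpt v ∧ q.2 * (val x (p.V (vertNum v)))⁻¹ ∈ p.per x
    have hQ : ∀ q q', Q q → lrel (p.gl h) (p.lab x) q q' → Q q' := by
      rintro q q' ⟨v, hv, hm⟩ ⟨F, hF, rfl⟩
      rw [hv] at hF ⊢
      have hv' : v = (v.1, F v.1) := Prod.ext rfl (vertexPt_mem_faceSet_iff.1 hF).symm
      refine ⟨vimg (p.gl h) F v.1, ?_, ?_⟩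
      · conv_lhs => rw [hv']
        exact omove_vpt _ _ _
      · have hn : vertNum v = fvtx (faceNum F) v.1 := by
          rw [← vertNum_mk, faceN_faceNum, ← hv']
        rw [hn] at hm
        have hl : val x (p.loop (faceNum F) v.1) ∈ p.per x := by
          have := h.2.2.2.2.2.2.2.2.2.2.2.2.2.1 _ (faceNum_lt F) _ v.1.2
          rcases List.mem_append.1 this with e | e
          · rcases List.mem_cons.1 e with e | e
            · rw [e]; exact one_mem _
            · exact Subgroup.subset_closure ⟨_, e, rfl⟩
          · obtain ⟨w, hw, e⟩ := List.mem_map.1 e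
            rw [← e, val_winv]
            exact inv_mem (Subgroup.subset_closure ⟨_, hw, rfl⟩)
        have := mul_mem hm hl
        rw [val_loop] at this
        have e : vertNum (vimg (p.gl h) F v.1) = cimg p.code (faceNum F) v.1 := by
          rw [← vertNum_vimg h.1 (faceNum_lt F), faceN_faceNum]; rfl
        rw [e]
        change q.2 * val x (p.phi (faceNum F)) * _ ∈ _
        convert! this using 1
        group
    have hV : p.V (vertNum (0, true)) = [] := h.2.2.2.2.2.2.2.2.2.2.2.2.1
    obtain ⟨v, hv, hm⟩ := (Relation.EqvGen.invariant (lrel_symm (isLabel_lab h x)) Q hQ hk').2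
      ⟨(0, true), rfl, by rw [hV, val_nil, inv_one, mul_one]; exact one_mem _⟩
    obtain rfl : ((0, true) : OctVertex) = v := vertexPt_injective (congrArg Subtype.val hv)
    rwa [hV, val_nil, inv_one, mul_one] at hm
  · rw [per, Subgroup.closure_le]
    rintro _ ⟨w, hw, rfl⟩
    obtain ⟨f, hf, i, hi, rfl⟩ := h.2.2.2.2.2.2.2.2.2.2.2.2.2.2 w hw
    have hf' := List.mem_range.1 hf
    have hi' := List.mem_range.1 hi
    have e1 := (vtab_spec h x _ (mem_vtab h (fvtx_lt f hi'))).1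
    have e2 := (vtab_spec h x _ (mem_vtab h (cimg_lt h.1 hf' hi'))).1
    have e3 := ymk_vertex h x hf' ⟨i, hi'⟩ (val x (p.V (fvtx f i)))
    simp only at e1 e2 e3
    rw [SetLike.mem_coe, MulAction.mem_stabilizer_iff]
    conv_lhs => rw [← e2, smul_ymk, val_loop, inv_mul_cancel_right, e3, e1]

/-- The admissible labels of a gluing pattern in terms of its presentation. -/
theorem admCount_gl (h : p.Check) (Q : ℕ → Prop) :
    admCount G Q (p.gl h) = Nat.card {t : G × G × G // val (env3 t) p.r = 1 ∧ Q (Nat.card (p.per (env3 t)))} := by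
  have hst : ∀ x : ℕ → G, vstab (p.gl h) (p.lab x) = Nat.card (p.per x) := fun x => by
    rw [vstab, stabilizer_lab h x]
  have h3 : ∀ a : OctFace → G, env3 (a (faceN p.f1), a (faceN p.f2), a (faceN p.f3)) = p.env a := fun a => rfl
  refine Nat.card_congr ⟨fun a => ⟨(a.1 (faceN p.f1), a.1 (faceN p.f2), a.1 (faceN p.f3)), ?_, ?_⟩,
    fun t => ⟨p.lab (env3 t.1), isAdm_lab h t.2.1, ?_⟩, fun a => ?_, fun t => ?_⟩
  · rw [h3]
    exact val_r h a.2.1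
  · rw [h3, ← hst, lab_env h a.2.1]
    exact a.2.2
  · rw [hst]
    exact t.2.2
  · refine Subtype.ext ?_
    change p.lab (env3 _) = a.1
    rw [h3, lab_env h a.2.1]
  · have e := env_lab h t.1
    exact Subtype.ext (Prod.ext (congrFun e 0) (Prod.ext (congrFun e 1) (congrFun e 2)))

end Pres

/-! ### Counting solutions of equations in finite groups -/

/-- The row belonging to a letter. -/
def sel (X X' Y Y' Z Z' : ℕ) : ℕ → ℕ
  | 0 => X
  | 1 => X'
  | 2 => Y
  | 3 => Y'
  | 4 => Z
  | 5 => Z'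
  | l + 6 => if l % 2 = 0 then Z else Z'

/-- The action of a word on an element. -/
def evw (X X' Y Y' Z Z' : ℕ) : List ℕ → ℕ → ℕ
  | [], v => v
  | l :: w, v => app (sel X X' Y Y' Z Z' l) (evw X X' Y Y' Z Z' w v)

namespace TabGroup

variable (D : TabGroup)

theorem mul_val (x y : D.El) : (x * y).val = app (D.tab.row x.val) y.val := rfl

theorem inv_val (x : D.El) : (x⁻¹).val = app (D.tab.irow x.val) 0 := rfl

theorem inv_mul_val (x y : D.El) : (x⁻¹ * y).val = app (D.tab.irow x.val) y.val := by
  rw [mul_val, inv_val, (D.facts.2.2.1 x.1 x.2).2.2.1]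

theorem evw_eq (t : D.El × D.El × D.El) (w : List ℕ) (v : D.El) :
    evw (D.tab.row t.1.val) (D.tab.irow t.1.val) (D.tab.row t.2.1.val) (D.tab.irow t.2.1.val)
      (D.tab.row t.2.2.val) (D.tab.irow t.2.2.val) w v.val = (val (Pres.env3 t) w * v).val := by
  induction w with
  | nil => rw [val_nil, one_mul]; rfl
  | cons l w ih =>
    rw [val_cons, mul_assoc, evw, ih]
    match l with
    | 0 => rfl
    | 1 => exact (D.inv_mul_val _ _).symm
    | 2 => rfl
    | 3 => exact (D.inv_mul_val _ _).symm
    | 4 => rfl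
    | 5 => exact (D.inv_mul_val _ _).symm
    | l + 6 =>
      have h0 : Pres.env3 t ((l + 6) / 2) = t.2.2 := by
        have h1 : (l + 6) / 2 ≠ 0 := by omega
        have h2 : (l + 6) / 2 ≠ 1 := by omega
        simp [Pres.env3, h1, h2]
      have e : ∀ a b c d k k' : ℕ, sel a b c d k k' (l + 6) = if l % 2 = 0 then k else k' := fun _ _ _ _ _ _ => rfl
      rw [e]
      have e' : letterVal (Pres.env3 t) (l + 6) = if l % 2 = 0 then t.2.2 else t.2.2⁻¹ := by
        unfold letterVal
        rw [h0, show (l + 6) % 2 = l % 2 by omega]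
      rw [e']
      by_cases h : l % 2 = 0
      · simp only [h, if_true]; rfl
      · simp only [h, if_false]
        exact (D.inv_mul_val _ _).symm

end TabGroup

/-- Decide whether the orbit of the elements in the list `todo` under the generators `acts` exhausts a set
with exactly `b` elements outside the set of visited elements, which are the bits of `V`. -/
def orbitSize (acts : ℕ → List ℕ) (b : ℕ) : ℕ → List ℕ → Bool :=
  Nat.rec (fun V todo => List.rec true (fun y _ ih => and (Nat.testBit V y) ih) todo)
    (fun _ go V todo => List.rec false
      (fun y todo ih => cond (Nat.testBit V y) ih (go (Nat.lor V (Nat.shiftLeft 1 y)) (acts y ++ todo))) todo) b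

theorem testBit_insert (V x y : ℕ) :
    Nat.testBit (Nat.lor V (Nat.shiftLeft 1 y)) x = true ↔ x = y ∨ Nat.testBit V x = true := by
  have : Nat.lor V (Nat.shiftLeft 1 y) = V ||| 2 ^ y := by
    rw [← Nat.one_shiftLeft]; rfl
  rw [this, Nat.testBit_or, Nat.testBit_two_pow, Bool.or_eq_true, decide_eq_true_eq, or_comm, eq_comm]

theorem orbitSize_iff {acts : ℕ → List ℕ} {H : Finset ℕ} (h0 : ∀ x ∈ H, ∀ y ∈ acts x, y ∈ H)
    (hH : ∀ S : Finset ℕ, S ⊆ H → 0 ∈ S → (∀ x ∈ S, ∀ y ∈ acts x, y ∈ S) → S = H) (b V : ℕ) (todo : List ℕ)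
    (S : Finset ℕ) (hS : ∀ x, x ∈ S ↔ Nat.testBit V x = true) (h1 : S ⊆ H) (h2 : ∀ x ∈ todo, x ∈ H)
    (h3 : ∀ x ∈ S, ∀ y ∈ acts x, y ∈ S ∨ y ∈ todo) (h4 : 0 ∈ S ∨ 0 ∈ todo) :
    orbitSize acts b V todo = true ↔ H.card = S.card + b := by
  induction b generalizing V todo S with
  | zero =>
    induction todo with
    | nil =>
      have : S = H := hH S h1 (by simpa using h4) (fun x hx y hy => by simpa using h3 x hx y hy)
      rw [this]
      exact ⟨fun _ => rfl, fun _ => rfl⟩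
    | cons y todo ih =>
      have e : orbitSize acts 0 V (y :: todo) = (Nat.testBit V y && orbitSize acts 0 V todo) := rfl
      by_cases hy : y ∈ S
      · rw [e, (hS y).1 hy, Bool.true_and]
        refine ih (fun x hx => h2 x (List.mem_cons_of_mem _ hx)) (fun x hx z hz => ?_) ?_
        · rcases h3 x hx z hz with h | h
          · exact Or.inl h
          · rcases List.mem_cons.1 h with rfl | h
            · exact Or.inl hy
            · exact Or.inr h
        · rcases h4 with h | h
          · exact Or.inl h
          · rcases List.mem_cons.1 h with rfl | h
            · exact Or.inl hy
            · exact Or.inr h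
      · have hV : Nat.testBit V y = false := by
          rw [← Bool.not_eq_true, ← hS]; exact hy
        rw [e, hV, Bool.false_and]
        have h5 : insert y S ⊆ H := Finset.insert_subset (h2 y (by simp)) h1
        have h6 := Finset.card_le_card h5
        rw [Finset.card_insert_of_notMem hy] at h6
        constructor
        · simp
        · intro h7; omega
  | succ b ihb =>
    induction todo with
    | nil =>
      have : S = H := hH S h1 (by simpa using h4) (fun x hx y hy => by simpa using h3 x hx y hy)
      have e : orbitSize acts (b + 1) V [] = false := rfl
      rw [this, e]
      constructor
      · simp
      · intro h7; omega
    | cons y todo ih =>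
      have e : orbitSize acts (b + 1) V (y :: todo) = cond (Nat.testBit V y) (orbitSize acts (b + 1) V todo)
        (orbitSize acts b (Nat.lor V (Nat.shiftLeft 1 y)) (acts y ++ todo)) := rfl
      by_cases hy : y ∈ S
      · rw [e, (hS y).1 hy, cond_true]
        refine ih (fun x hx => h2 x (List.mem_cons_of_mem _ hx)) (fun x hx z hz => ?_) ?_
        · rcases h3 x hx z hz with h | h
          · exact Or.inl h
          · rcases List.mem_cons.1 h with rfl | h
            · exact Or.inl hy
            · exact Or.inr h
        · rcases h4 with h | h
          · exact Or.inl h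
          · rcases List.mem_cons.1 h with rfl | h
            · exact Or.inl hy
            · exact Or.inr h
      · have hV : Nat.testBit V y = false := by
          rw [← Bool.not_eq_true, ← hS]; exact hy
        have hyH := h2 y (by simp)
        rw [e, hV, cond_false, ihb _ _ (insert y S), Finset.card_insert_of_notMem hy, add_assoc, add_comm 1 b]
        · intro x
          rw [Finset.mem_insert, testBit_insert, hS]
        · exact Finset.insert_subset hyH h1
        · intro x hx
          rcases List.mem_append.1 hx with h | h
          · exact h0 y hyH x h
          · exact h2 x (List.mem_cons_of_mem _ h)
        · intro x hx z hz
          rcases Finset.mem_insert.1 hx with rfl | hx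
          · exact Or.inr (List.mem_append_left _ hz)
          · rcases h3 x hx z hz with h | h
            · exact Or.inl (Finset.mem_insert_of_mem h)
            · rcases List.mem_cons.1 h with rfl | h
              · exact Or.inl (Finset.mem_insert_self _ _)
              · exact Or.inr (List.mem_append_right _ h)
        · rcases h4 with h | h
          · exact Or.inl (Finset.mem_insert_of_mem h)
          · rcases List.mem_cons.1 h with h | h
            · exact Or.inl (h ▸ Finset.mem_insert_self _ _)
            · exact Or.inr (List.mem_append_right _ h)

theorem val_map {G H : Type*} [Group G] [Group H] (f : G →* H) (x : ℕ → G) (w : List ℕ) :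
    val (fun n => f (x n)) w = f (val x w) := by
  induction w with
  | nil => simp
  | cons l w ih =>
    rw [val_cons, val_cons, map_mul, ih]
    congr 1
    unfold letterVal
    split_ifs <;> simp

theorem Pres.per_map {G H : Type*} [Group G] [Group H] (p : Pres) (f : G →* H) (x : ℕ → G) :
    p.per (fun n => f (x n)) = (p.per x).map f := by
  unfold Pres.per
  rw [MonoidHom.map_closure]
  congr 1
  ext k
  simp only [Set.mem_ofPred_eq, Set.mem_image, val_map]
  constructor
  · rintro ⟨w, hw, rfl⟩; exact ⟨_, ⟨w, hw, rfl⟩, rfl⟩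
  · rintro ⟨_, ⟨w, hw, rfl⟩, rfl⟩; exact ⟨w, hw, rfl⟩

theorem Pres.env3_map {G H : Type*} [Group G] [Group H] (f : G →* H) (t : G × G × G) :
    Pres.env3 (f t.1, f t.2.1, f t.2.2) = fun n => f (Pres.env3 t n) := by
  funext n
  unfold Pres.env3
  split_ifs <;> rfl

/-- The labels counted by a statistic. -/
def Pres.Good {G : Type*} [Group G] (p : Pres) (Q : ℕ → Prop) (t : G × G × G) : Prop :=
  val (Pres.env3 t) p.r = 1 ∧ Q (Nat.card (p.per (Pres.env3 t)))

theorem Pres.good_map {G H : Type*} [Group G] [Group H] (p : Pres) (Q : ℕ → Prop) (f : G ≃* H) (t : G × G × G) :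
    p.Good Q (f t.1, f t.2.1, f t.2.2) ↔ p.Good Q t := by
  have := Pres.env3_map f.toMonoidHom t
  have e : Pres.env3 (f t.1, f t.2.1, f t.2.2) = fun n => f.toMonoidHom (Pres.env3 t n) := this
  unfold Pres.Good
  rw [e, val_map, Pres.per_map]
  have h1 : Nat.card ((p.per (Pres.env3 t)).map f.toMonoidHom) = Nat.card (p.per (Pres.env3 t)) :=
    Nat.card_congr (Subgroup.equivMapOfInjective _ _ f.injective).toEquiv.symm
  rw [h1]
  simp

open Pointwise in
theorem eq_closure_of_smul_mem {G : Type*} [Group G] [Finite G] {A T : Set G} (hT : T ⊆ Subgroup.closure A)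
    (h1 : 1 ∈ T) (h : ∀ x ∈ T, ∀ a ∈ A, a * x ∈ T) : T = Subgroup.closure A := by
  refine le_antisymm hT ?_
  have : Subgroup.closure A ≤ MulAction.stabilizer G T := by
    rw [Subgroup.closure_le]
    intro a ha
    have h2 : a • T ⊆ T := by
      rintro _ ⟨x, hx, rfl⟩
      exact h x hx a ha
    exact Set.eq_of_subset_of_ncard_le h2 (by rw [Set.ncard_smul_set]) (Set.toFinite _)
  intro g hg
  have h3 : g • T = T := this hg
  rw [← h3]
  exact ⟨1, h1, by simp⟩

/-- The condition on the order of the subgroup generated by the words of the peripheral loops. -/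
def SizeCond (k n : ℕ) : Prop := k = 0 ∨ n = k

/-- Evaluate the argument of a function to a numeral before calling it. -/
def forceN {α : Type} (x : ℕ) (f : ℕ → α) : α := Nat.rec (f 0) (fun n _ => f n) (Nat.add x 1)

theorem forceN_eq {α : Type} (x : ℕ) (f : ℕ → α) : forceN x f = f x := rfl

/-- Evaluate the values of a function on a list to numerals. -/
def forceMap {α β : Type} (f : α → ℕ) (L : List α) : (List ℕ → β) → β :=
  List.rec (fun k => k []) (fun a _ ih k => forceN (f a) fun x => ih fun M => k (x :: M)) L

theorem forceMap_eq {α β : Type} (f : α → ℕ) (L : List α) (k : List ℕ → β) : forceMap f L k = k (L.map f) := by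
  induction L generalizing k with
  | nil => rfl
  | cons a L ih => exact ih fun M => k (f a :: M)

/-- The decision procedure for the condition on the order of the subgroup. -/
def sizeTest (t : Tab) (k : ℕ) (P : List (List ℕ)) (X X' Y Y' Z Z' : ℕ) : Bool :=
  or (Nat.beq k 0) (forceMap (fun w => t.row (evw X X' Y Y' Z Z' w 0)) P fun M =>
    orbitSize (fun v => M.map fun x => app x v) k 0 [0])

/-- The order of a finite set which is partitioned into orbits: `cls` lists the cardinalities and
representatives of the orbits, and the bytes of `cr` are the representatives of the elements. -/
def isOrbits (n : ℕ) (cls : List (ℕ × ℕ)) (cr : ℕ) : Bool :=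
  ((List.range n).map (app cr)).isPerm (cls.flatMap fun e => List.replicate e.1 e.2)

/-- The sum of a function over a list of elements with multiplicities. -/
def wsum {α : Type} (L : List (ℕ × α)) (f : α → ℕ) : ℕ := L.foldr (fun e s => Nat.add (Nat.mul e.1 (f e.2)) s) 0

theorem wsum_cons {α : Type} (e : ℕ × α) (L : List (ℕ × α)) (f : α → ℕ) :
    wsum (e :: L) f = e.1 * f e.2 + wsum L f := rfl

theorem wsum_eq (f : ℕ → ℕ) (L : List (ℕ × ℕ)) :
    ((L.flatMap fun e => List.replicate e.1 e.2).map f).sum = wsum L f := by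
  induction L with
  | nil => rfl
  | cons e L ih =>
    rw [List.flatMap_cons, List.map_append, List.sum_append, ih, List.map_replicate, List.sum_replicate]
    rfl

theorem sum_eq_of_isOrbits {n : ℕ} {cls : List (ℕ × ℕ)} {cr : ℕ} (h : isOrbits n cls cr = true) {f : ℕ → ℕ}
    (hf : ∀ y < n, f y = f (app cr y)) : ∑ y ∈ Finset.range n, f y = wsum cls f := by
  rw [← wsum_eq, ← ((List.isPerm_iff.1 h).map f).sum_eq, List.map_map]
  have : ∀ g : ℕ → ℕ, ((List.range n).map g).sum = ∑ y ∈ Finset.range n, g y := fun g => by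
    rw [Finset.sum_eq_multiset_sum, Finset.range_val, Multiset.range, Multiset.map_coe, Multiset.sum_coe]
  rw [this]
  exact Finset.sum_congr rfl fun y hy => hf y (Finset.mem_range.1 hy)

/-- A finite group given by a multiplication table, with a list of its conjugacy classes: `cls` lists
cardinalities and representatives, followed by the orbits of the centralizer of the representative. The bytes of `cr`
and `ch` are representatives and conjugating elements. -/
structure ClsGroup extends TabGroup where
  cls : List (ℕ × ℕ × List (ℕ × ℕ) × ℕ × ℕ)
  cr : ℕ
  ch : ℕ
  okc : (and (isOrbits n (cls.map fun e => (e.1, e.2.1)) cr) <|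
    and (allLt n fun y => and (Nat.blt (app ch y) n) <| and (Nat.blt (app cr y) n) <|
      Nat.beq (app (tab.row (app ch y)) y) (app (tab.row (app cr y)) (app ch y))) <|
    cls.all fun e => and (isOrbits n e.2.2.1 e.2.2.2.1) <| and (Nat.blt e.2.1 n) <| allLt n fun y =>
      and (Nat.blt (app e.2.2.2.2 y) n) <| and (Nat.blt (app e.2.2.2.1 y) n) <|
      and (Nat.beq (app (tab.row (app e.2.2.2.2 y)) y) (app (tab.row (app e.2.2.2.1 y)) (app e.2.2.2.2 y))) <|
      Nat.beq (app (tab.row (app e.2.2.2.2 y)) e.2.1) (app (tab.row e.2.1) (app e.2.2.2.2 y))) = true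

/-- The number of good labels with given first and second labels. -/
def ClsGroup.cnt (C : ClsGroup) (k : ℕ) (ev : ℕ → ℕ → ℕ → ℕ → ℕ → ℕ → ℕ) (P : List (List ℕ))
    (X X' Y Y' : ℕ) : ℕ :=
  C.tab.sum fun Z Z' => cond (Nat.beq (ev X X' Y Y' Z Z') 0) (cond (sizeTest C.tab k P X X' Y Y' Z Z') 1 0) 0

/-- The number of good labels. -/
def ClsGroup.count (C : ClsGroup) (k : ℕ) (ev : ℕ → ℕ → ℕ → ℕ → ℕ → ℕ → ℕ) (P : List (List ℕ)) : ℕ :=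
  wsum C.cls fun e => forceN (C.tab.row e.1) fun X => forceN (C.tab.irow e.1) fun X' =>
    wsum e.2.1 fun y => forceN (C.tab.row y) fun Y => forceN (C.tab.irow y) fun Y' => C.cnt k ev P X X' Y Y'

namespace ClsGroup

variable (C : ClsGroup)

theorem sizeTest_iff (p : Pres) (k : ℕ) (t : C.El × C.El × C.El) :
    sizeTest C.tab k p.P (C.tab.row t.1.val) (C.tab.irow t.1.val) (C.tab.row t.2.1.val) (C.tab.irow t.2.1.val)
      (C.tab.row t.2.2.val) (C.tab.irow t.2.2.val) = true ↔ SizeCond k (Nat.card (p.per (Pres.env3 t))) := by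
  unfold sizeTest SizeCond
  rw [Bool.or_eq_true, Nat.beq_eq, forceMap_eq]
  refine or_congr_right ?_
  have he : ∀ (w : List ℕ) (x : C.El), app (C.tab.row (evw (C.tab.row t.1.val) (C.tab.irow t.1.val)
      (C.tab.row t.2.1.val) (C.tab.irow t.2.1.val) (C.tab.row t.2.2.val) (C.tab.irow t.2.2.val) w 0)) x.val =
      (val (Pres.env3 t) w * x).val := by
    intro w x
    have := C.evw_eq t w 1
    rw [mul_one] at this
    rw [C.mul_val, ← this]
    rfl
  set K := p.per (Pres.env3 t) with hK
  have hfin : (K : Set C.El).Finite := Set.toFinite _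
  let vl : C.El ↪ ℕ := ⟨fun x => x.val, fun x y h => Fin.ext h⟩
  let H : Finset ℕ := hfin.toFinset.map vl
  have hH : ∀ x : C.El, x.val ∈ H ↔ x ∈ K := by
    intro x
    simp only [H, Finset.mem_map, Set.Finite.mem_toFinset, SetLike.mem_coe]
    exact ⟨fun ⟨y, hy, e⟩ => (vl.injective e) ▸ hy, fun h => ⟨x, h, rfl⟩⟩
  have hc : H.card = Nat.card K := by
    rw [Finset.card_map, ← Set.ncard_eq_toFinset_card]; rfl
  have key := orbitSize_iff (H := H) (acts := fun v => (p.P.map fun w => C.tab.row (evw (C.tab.row t.1.val)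
      (C.tab.irow t.1.val) (C.tab.row t.2.1.val) (C.tab.irow t.2.1.val) (C.tab.row t.2.2.val) (C.tab.irow t.2.2.val) w 0)).map
      fun x => app x v) ?_ ?_ k 0 [0] ∅
      (by simp) (by simp) ?_ (by simp) (by simp)
  · rw [key, hc]; simp
  · intro x hx y hy
    obtain ⟨x, hx', rfl⟩ := Finset.mem_map.1 hx
    rw [List.map_map] at hy
    obtain ⟨w, hw, rfl⟩ := List.mem_map.1 hy
    change app (C.tab.row (evw _ _ _ _ _ _ w 0)) x.val ∈ H
    rw [he w x, hH]
    exact mul_mem (Subgroup.subset_closure ⟨w, hw, rfl⟩) ((hH x).1 hx)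
  · intro S hS h0 hcl
    let T : Set C.El := {x | x.val ∈ S}
    have hT : T = K := by
      refine eq_closure_of_smul_mem (fun x hx => (hH x).1 (hS hx)) h0 ?_
      rintro x hx _ ⟨w, hw, rfl⟩
      change (val (Pres.env3 t) w * x).val ∈ S
      rw [← he w x]
      exact hcl _ hx _ (by rw [List.map_map]; exact List.mem_map.2 ⟨w, hw, rfl⟩)
    refine hS.antisymm fun x hx => ?_
    obtain ⟨x, hx', rfl⟩ := Finset.mem_map.1 hx
    have : x ∈ T := by rw [hT]; exact (hH x).1 hx
    exact this
  · intro x hx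
    rw [List.mem_singleton.1 hx]
    exact (hH 1).2 (one_mem K)

theorem count_eq (k : ℕ) (ev : ℕ → ℕ → ℕ → ℕ → ℕ → ℕ → ℕ) (P : List (List ℕ)) (g : ℕ → ℕ → ℕ)
    (hg : ∀ x y, g x y = C.cnt k ev P (C.tab.row x) (C.tab.irow x) (C.tab.row y) (C.tab.irow y))
    (hc : ∀ h < C.n, ∀ x < C.n, ∀ x' < C.n, ∀ y < C.n, ∀ y' < C.n, C.op h x = C.op x' h → C.op h y = C.op y' h →
      g x y = g x' y') :
    ∑ x ∈ Finset.range C.n, ∑ y ∈ Finset.range C.n, g x y = C.count k ev P := by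
  have hok := C.okc
  simp only [Bool.and_eq_true, allLt_iff, Nat.beq_eq, Nat.blt_eq, List.all_eq_true] at hok
  obtain ⟨h1, h2, h3⟩ := hok
  rw [sum_eq_of_isOrbits h1 (f := fun x => ∑ y ∈ Finset.range C.n, g x y)]
  · unfold count
    have : ∀ L : List (ℕ × ℕ × List (ℕ × ℕ) × ℕ × ℕ), (∀ e ∈ L, e ∈ C.cls) →
        wsum (L.map fun e => (e.1, e.2.1)) (fun x => ∑ y ∈ Finset.range C.n, g x y) =
        wsum L fun e => wsum e.2.1 fun y => g e.1 y := by
      intro L hL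
      induction L with
      | nil => rfl
      | cons e L ih =>
        have ih := ih fun e he => hL e (List.mem_cons_of_mem _ he)
        obtain ⟨k1, k2, k3⟩ := h3 e (hL e (by simp))
        have : ∑ y ∈ Finset.range C.n, g e.2.1 y = wsum e.2.2.1 fun y => g e.2.1 y := by
          refine sum_eq_of_isOrbits k1 fun y hy => ?_
          obtain ⟨m1, m2, m3, m4⟩ := k3 y hy
          exact hc _ m1 _ k2 _ k2 _ hy _ m2 m4 m3
        rw [List.map_cons, wsum_cons, wsum_cons, ih, this]
    rw [this C.cls fun _ => id]
    simp only [forceN_eq, hg]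
  · intro x hx
    obtain ⟨m1, m2, m3⟩ := h2 x hx
    let h' : C.El := ⟨app C.ch x, m1⟩
    let f : C.El ≃ C.El := (MulAut.conj h').toEquiv
    rw [Finset.sum_range, Finset.sum_range]
    refine Fintype.sum_equiv f _ _ fun y => hc _ m1 _ hx _ m2 _ y.2 _ (f y).2 m3 ?_
    have e : h' * y = f y * h' := by simp [f]
    exact congrArg Fin.val e

open Classical in
theorem card_good (p : Pres) (k : ℕ) (ev : ℕ → ℕ → ℕ → ℕ → ℕ → ℕ → ℕ)
    (hev : ∀ X X' Y Y' Z Z', evw X X' Y Y' Z Z' p.r 0 = ev X X' Y Y' Z Z') :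
    Nat.card {t : C.El × C.El × C.El // p.Good (SizeCond k) t} = C.count k ev p.P := by
  have hxy : ∀ x y : C.El, C.cnt k ev p.P (C.tab.row x.val) (C.tab.irow x.val) (C.tab.row y.val) (C.tab.irow y.val) =
      ∑ z : C.El, if p.Good (SizeCond k) (x, y, z) then 1 else 0 := by
    intro x y
    unfold ClsGroup.cnt
    rw [Tab.sum_eq, C.toTabGroup.facts.1, Finset.sum_range]
    refine Finset.sum_congr rfl fun (z : C.El) _ => ?_
    have h1 := C.evw_eq (x, y, z) p.r 1
    have h2 := C.sizeTest_iff p k (x, y, z)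
    rw [← hev]
    have h3 : Nat.beq (evw (C.tab.row x.val) (C.tab.irow x.val) (C.tab.row y.val) (C.tab.irow y.val)
      (C.tab.row z.val) (C.tab.irow z.val) p.r 0) 0 = true ↔ val (Pres.env3 (x, y, z)) p.r = 1 := by
      rw [Nat.beq_eq]
      refine (show _ ↔ _ from ⟨fun h => ?_, fun h => ?_⟩)
      · rw [mul_one] at h1
        exact Fin.ext (h1.symm.trans h)
      · rw [mul_one, h] at h1
        exact h1
    unfold Pres.Good
    by_cases a1 : val (Pres.env3 (x, y, z)) p.r = 1
    · have a2 := h3.2 a1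
      by_cases b1 : SizeCond k (Nat.card (p.per (Pres.env3 (x, y, z))))
      · rw [if_pos ⟨a1, b1⟩]
        have b2 := h2.2 b1
        exact (congrArg₂ (fun a b => cond a (cond b 1 0) 0) a2 b2)
      · rw [if_neg fun h => b1 h.2]
        have b2 := Bool.eq_false_iff.2 (mt h2.1 b1)
        exact (congrArg₂ (fun a b => cond a (cond b 1 0) 0) a2 b2)
    · rw [if_neg fun h => a1 h.1]
      have a2 := Bool.eq_false_iff.2 (mt h3.1 a1)
      exact (congrArg (fun a => cond a _ 0) a2)
  rw [← C.count_eq k ev p.P _ fun x y => rfl]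
  · rw [Nat.card_eq_fintype_card, Fintype.card_subtype, Finset.card_filter, Fintype.sum_prod_type, Finset.sum_range]
    refine Finset.sum_congr rfl fun x _ => ?_
    rw [Fintype.sum_prod_type, Finset.sum_range]
    exact Finset.sum_congr rfl fun y _ => (hxy x y).symm
  · intro h hh x hx x' hx' y hy y' hy' e1 e2
    refine (hxy ⟨x, hx⟩ ⟨y, hy⟩).trans (Eq.trans ?_ (hxy ⟨x', hx'⟩ ⟨y', hy'⟩).symm)
    let f : C.El ≃* C.El := MulAut.conj ⟨h, hh⟩
    have hf : ∀ (x y : ℕ) (hx : x < C.n) (hy : y < C.n), C.op h x = C.op y h → f ⟨x, hx⟩ = (⟨y, hy⟩ : C.El) := by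
      intro x y hx hy e
      let h' : C.El := ⟨h, hh⟩
      let x' : C.El := ⟨x, hx⟩
      let y' : C.El := ⟨y, hy⟩
      have e' : h' * x' = y' * h' := Fin.ext e
      change h' * x' * h'⁻¹ = y'
      rw [e', mul_inv_cancel_right]
    refine Fintype.sum_equiv f.toEquiv _ _ fun z => ?_
    have := p.good_map (SizeCond k) f (⟨x, hx⟩, ⟨y, hy⟩, z)
    rw [hf x x' hx hx' e1, hf y y' hy hy' e2] at this
    exact if_congr this.symm rfl rfl

end ClsGroup

/-! ### The groups and statistics used to distinguish the quotient spaces -/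

/-- The composition of two rows. -/
def rowComp (n A B : ℕ) : ℕ :=
  Nat.rec 0 (fun v s => Nat.lor s (Nat.shiftLeft (app A (app B v)) (Nat.mul 8 v))) n

/-- The multiplication table of a group with `n` elements, from the rows `gens` of the generators. The `i`-th
element is the product of an earlier element, whose position is determined by the `i`-th byte of `par`, and the generator
numbered by the `i`-th byte of `gi`; its inverse is the `i`-th byte of `inv`. -/
def mkTab (n : ℕ) (gens : List ℕ) (par gi inv : ℕ) : Tab :=
  Nat.rec (motive := fun _ => ℕ → Tab → Tab)
    (fun _ R => Nat.rec (motive := fun _ => Tab → Tab) (fun t => t)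
      (fun i ih t => forceN (R.row (Nat.sub (Nat.sub n 1) i)) fun a =>
        forceN (R.row (Nat.sub (Nat.sub n 1) (app inv i))) fun b => ih (.cons a b t)) n .nil)
    (fun _ ih i R => forceN (rowComp n (R.row (app par i)) (gens.getD (app gi i) 0)) fun x =>
      forceN (Nat.add i 1) fun j => ih j (.cons x 0 R))
    (Nat.sub n 1) 1 (.cons (Nat.rec 0 (fun v s => Nat.lor s (Nat.shiftLeft v (Nat.mul 8 v))) n) 0 .nil)

/-- A group of order 2. -/
def grpC2 : ClsGroup :=
  ⟨⟨mkTab 2 [1]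
    0
    0
    256, 2, [1], by decide +kernel⟩,
    [(1, 0, [(1, 0), (1, 1)], 256, 0),
      (1, 1, [(1, 0), (1, 1)], 256, 0)],
    256,
    0, by decide +kernel⟩

/-- A group of order 3. -/
def grpC3 : ClsGroup :=
  ⟨⟨mkTab 3 [513]
    0
    0
    66048, 3, [1], by decide +kernel⟩,
    [(1, 0, [(1, 0), (1, 1), (1, 2)], 131328, 0),
      (1, 1, [(1, 0), (1, 1), (1, 2)], 131328, 0),
      (1, 2, [(1, 0), (1, 1), (1, 2)], 131328, 0)],
    131328,
    0, by decide +kernel⟩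

/-- A group of order 12. -/
def grpA4 : ClsGroup :=
  ⟨⟨mkTab 12 [2798710588452789219469034241, 2477108023776159716090447106]
    622611019758234269711925248
    18519083147019223040
    3412835534445802185831088896, 12, [1, 2], by decide +kernel⟩,
    [(1, 0, [(1, 0), (4, 1), (4, 2), (3, 4)], 1240362650256924034587558144, 622606260644066182582763520),
      (4, 1, [(1, 0), (1, 1), (3, 2), (1, 3), (3, 4), (3, 6)], 1240386262451033727903596800, 932086547952279918678638592),
      (4, 2, [(1, 0), (3, 1), (1, 2), (3, 3), (3, 4), (1, 6)], 1241571594524690112372146432, 626233056619183960504664064),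
      (3, 4, [(1, 0), (4, 1), (4, 2), (1, 4), (1, 5), (1, 11)], 3406757719006340615172653312, 4854685341494558945443840)],
    1240362650256924034587558144,
    622606260644066182582763520, by decide +kernel⟩

/-- Centralizer data of `grpC9`. -/
def cenC9 : List (ℕ × ℕ) × ℕ × ℕ := ([(1, 0), (1, 1), (1, 2), (1, 3), (1, 4), (1, 5), (1, 6), (1, 7), (1, 8)], 148080050112590643456, 0)

/-- A group of order 9. -/
def grpC9 : ClsGroup :=
  ⟨⟨mkTab 9 [578437695752307201]
    0
    0
    18591708106338011136, 9, [1], by decide +kernel⟩,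
    [(1, 0, cenC9),
      (1, 1, cenC9),
      (1, 2, cenC9),
      (1, 3, cenC9),
      (1, 4, cenC9),
      (1, 5, cenC9),
      (1, 6, cenC9),
      (1, 7, cenC9),
      (1, 8, cenC9)],
    148080050112590643456,
    0, by decide +kernel⟩

/-- Generation data of `grpS4`. -/
def fstS4 : ℕ := 73944409358921796863374193320339469681626962036141457664

/-- Generation data of `grpS4`. -/
def sndS4 : ℕ := 123175463245336415005585128813007298828906978222234664960

/-- A group of order 24. -/
def grpS4 : ClsGroup :=
  ⟨⟨mkTab 24 [491359772144221820783093853594159789851342855178476061441, 418665377833932601887129918437769811037293772423334724866]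
    123080050578131682502161887378642185109394767949519192064
    24615709630889631304737739563930665494191980909953089536
    565208030737536986157675798583129649395554480850739529216, 24, [1, 2], by decide +kernel⟩,
    [(1, 0, [(1, 0), (6, 1), (6, 2), (3, 3), (8, 4)], fstS4, sndS4),
      (6, 1, [(1, 0), (1, 1), (4, 2), (1, 3), (4, 4), (1, 6), (4, 7), (4, 11), (2, 15), (2, 19)], 368183578147753135413518928468871209534570823758869823744, 25095738376572103668324591851365739523618647707150712832),
      (6, 2, [(1, 0), (4, 1), (1, 2), (2, 3), (4, 4), (2, 7), (4, 12), (4, 16), (1, 17), (1, 23)], 565112243903054744961597209773324483859854563070554800384, 2203735486291761965494806827775454370790305498442760192),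
      (3, 3, [(1, 0), (2, 1), (4, 2), (1, 3), (8, 4), (4, 7), (2, 15), (2, 19)], 368183578147753135413482439857230707510876956643041607936, 25095738376572103668397528829525551413116397411886956544),
      (8, 4, [(1, 0), (3, 1), (3, 2), (3, 3), (1, 4), (3, 5), (3, 6), (3, 11), (1, 14), (3, 16)], 74042829802184158863700112427782922348161613829276565760, 344621451814064828471098093270974465793908887512789549056)],
    fstS4,
    sndS4, by decide +kernel⟩

/-- Centralizer data of `grpF72`. -/
def cenF72 : List (ℕ × ℕ) × ℕ × ℕ := ([(1, 0), (8, 1), (1, 3), (8, 6), (1, 10), (8, 15), (1, 22), (8, 27), (1, 33), (8, 36), (1, 43), (8, 46), (1, 53), (8, 55), (1, 63), (8, 64)], 62075081154034079136699351150312419054860569229826461356234033553705170581617131986326251410561557191604242776338634671405713186291063065384578468478536460132850033754177792, 2936469001467680775021154036830467974979663008499803551159300107661999041956492432774917326667460313992968728312682446382892851325980618153050818011642831785162965382004736)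

/-- Generation data of `grpF72`. -/
def fstF72 : ℕ := 61105158011002296650239745418590233684368802358277426771386952327369314452170691040974599352490593309356906791772818955859703574267152497578736870995635375426086415603138816

/-- Generation data of `grpF72`. -/
def sndF72 : ℕ := 6778213707849425484799222570847155897951016754379682341074081315021038971158502270628210753079075820221735388135831002503751779661989647034304094084187055421738817798733824

/-- A group of order 72. -/
def grpF72 : ClsGroup :=
  ⟨⟨mkTab 72 [63060129516804402652467115410039719291135681941398421978108670528656422872372654517749280393620071324840529120884261736307760302652486292935921410575534911200750080828441601, 67886968949323860122293069463269073043678661658417489413370462251017315858452379785520183602191457648607277843017911503254721171136268959147098218428780047428251720605959426, 1007987438377855563512769745355117041589066428772590388300542716654851128138274188856696628348354222867275459625238958644523211843642856060711829426033943214430811226441731]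
    7759385144254259892146570987597622663179244886051745645479713640471890254564086079646538479195151637764009799002360712778230282056391293356713665516299709685772020674002944
    1939846286063564973023344597554827589447879854699908848329451885935704203386942048806670221674242113495054192474366980270523353210322895256344692122546399373524309687468032
    11657903070691052716646117958518791284466862940814864920008363692634136388442957048482805463898748748191749784296131269904806282497301014884931694251351058023354831879996416, 72, [1, 2, 3], by decide +kernel⟩,
    [(1, 0, [(1, 0), (8, 1), (9, 3), (9, 10), (9, 22), (9, 33), (9, 43), (9, 53), (9, 63)], fstF72, sndF72),
      (8, 1, [(1, 0), (1, 1), (1, 2), (9, 3), (1, 4), (1, 5), (1, 7), (9, 10), (1, 11), (1, 13), (9, 22), (1, 23), (9, 33), (9, 43), (9, 53), (9, 63)], 61105158011002296650239745418590233684368802358277426771386952327369314452170691040974599352490593309356906791772819495298133959060030639717133819914561927913145453653393664, 6778228449890164726609552259595029052083721436668359178919018002892456858408487433790525222101117024775939266439322899459363963531335612777558907217035756043488430634565632),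
      (9, 3, cenF72),
      (9, 10, cenF72),
      (9, 22, cenF72),
      (9, 33, cenF72),
      (9, 43, cenF72),
      (9, 53, cenF72),
      (9, 63, cenF72)],
    fstF72,
    sndF72, by decide +kernel⟩

/-- A group of order 6. -/
def grpS3 : ClsGroup :=
  ⟨⟨mkTab 6 [2220498354945, 1112463639810]
    2207630032896
    4295032832
    5514754917120, 6, [1, 2], by decide +kernel⟩,
    [(1, 0, [(1, 0), (2, 1), (3, 2)], 2207630098688, 3302863405056),
      (2, 1, [(1, 0), (1, 1), (3, 2), (1, 3)], 2207663653120, 3302829850624),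
      (3, 2, [(1, 0), (2, 1), (1, 2), (2, 4)], 4415243288832, 2199056809984)],
    2207630098688,
    3302863405056, by decide +kernel⟩

/-- Centralizer data of `grpC5`. -/
def cenC5 : List (ℕ × ℕ) × ℕ × ℕ := ([(1, 0), (1, 1), (1, 2), (1, 3), (1, 4)], 17230332160, 0)

/-- A group of order 5. -/
def grpC5 : ClsGroup :=
  ⟨⟨mkTab 5 [67305985]
    0
    0
    4328719360, 5, [1], by decide +kernel⟩,
    [(1, 0, cenC5),
      (1, 1, cenC5),
      (1, 2, cenC5),
      (1, 3, cenC5),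
      (1, 4, cenC5)],
    17230332160,
    0, by decide +kernel⟩

/-- Centralizer data of `grpD9`. -/
def cenD9 : List (ℕ × ℕ) × ℕ × ℕ := ([(1, 0), (1, 1), (9, 2), (1, 3), (1, 6), (1, 9), (1, 10), (1, 13), (1, 14), (1, 17)], 1481592156985744071513182068462138339492096, 1038127066056754969558390401437708320768)

/-- A group of order 18. -/
def grpD9 : ClsGroup :=
  ⟨⟨mkTab 18 [1136564461616093792646888307221502760321793, 961656656137423481399704823843153191634178]
    349475323398046081728030651259584174424064
    87113615180038750655880733619076896718848
    528138223866003242407593375497707608738048, 18, [1, 2], by decide +kernel⟩,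
    [(1, 0, [(1, 0), (2, 1), (9, 2), (2, 3), (2, 6), (2, 10)], 523356990764369828186713023709864064581888, 175254733986285706078886151125236348616704),
      (2, 1, cenD9),
      (9, 2, [(1, 0), (2, 1), (1, 2), (2, 3), (2, 4), (2, 6), (2, 7), (2, 10), (2, 11), (2, 15)], 527797941499003070945894008252767464980736, 174905147022679362831643301260088842387456),
      (2, 3, cenD9),
      (2, 6, cenD9),
      (2, 10, cenD9)],
    523356990764369828186713023709864064581888,
    175254733986285706078886151125236348616704, by decide +kernel⟩

/-- Centralizer data of `grpF36`. -/
def cenF36 : List (ℕ × ℕ) × ℕ × ℕ := ([(1, 0), (1, 1), (1, 2), (9, 3), (1, 4), (1, 5), (1, 7), (9, 10), (1, 11), (1, 13), (9, 20), (1, 21)], 39005744032140059777983961527210222454148608332397833838353171350467477537576628388096, 3893045725977402635503606766683130244473497129379469194490645669673703511850443866112)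

/-- Centralizer data of `grpF36`. -/
def cenF36' : List (ℕ × ℕ) × ℕ × ℕ := ([(1, 0), (4, 1), (1, 3), (4, 5), (4, 6), (1, 10), (4, 14), (4, 16), (1, 20), (4, 24), (4, 26), (4, 32)], 62409190448699672523937207111385469340555812084741511226903081497273492870576285483264, 19450047433393490556452533687325770055029337885014608743557477974816618654811256193024)

/-- Generation data of `grpF36`. -/
def fstF36 : ℕ := 39005744032140059777983961527210216467837901825019480713798962805299505219309460848896

/-- Generation data of `grpF36`. -/
def sndF36 : ℕ := 3893045725977402635503606766683133985917688696490940201572937951422547497112662376448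

/-- A group of order 36. -/
def grpF36 : ClsGroup :=
  ⟨⟨mkTab 36 [58493587620014349687335971367106127144580139566370557836921475530056123921734115329025, 60489109470305601741122137850016602926629441605905782534292056379507929670739166692610, 21407924570765131223141927616858354198227321334943726613015456929897838041638101190915]
    9759084078253669751675506033090517535981137181295190165213265991568745237358550515712
    3900574403213999075946738683696630055828549893543914049597335941520187396122027819008
    29314987592027248368856294347614809843134377369934937101987004255918778447909569889280, 36, [1, 2, 3], by decide +kernel⟩,
    [(1, 0, [(1, 0), (4, 1), (9, 3), (4, 5), (9, 10), (9, 20)], fstF36, sndF36),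
      (4, 1, cenF36),
      (9, 3, cenF36'),
      (4, 5, cenF36),
      (9, 10, cenF36'),
      (9, 20, cenF36')],
    fstF36,
    sndF36, by decide +kernel⟩

/-- Centralizer data of `grpSL23`. -/
def cenSL23 : List (ℕ × ℕ) × ℕ × ℕ := ([(1, 0), (4, 1), (4, 2), (6, 4), (4, 7), (4, 9), (1, 16)], 221350204680041075661851307944551088791098319289647759616, 73752103529129431703614865425994587984819515531177492480)

/-- A group of order 24. -/
def grpSL23 : ClsGroup :=
  ⟨⟨mkTab 24 [491456681394522355134820194842862580097165511428845863681, 197501863888616510116204005767692198632665469371336230146]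
    147888823119542642625218702057856410694503090350704361472
    24616083775308788354837938632400184249662962915619176448
    197217889724650206750192213506850831949243066975846269696, 24, [1, 2], by decide +kernel⟩,
    [(1, 0, cenSL23),
      (4, 1, [(1, 0), (1, 1), (3, 2), (1, 3), (3, 4), (3, 6), (3, 7), (3, 9), (1, 11), (3, 14), (1, 16), (1, 22)], 222788804615260828308357179228775211579750573899593679104, 73560164507680695569397218608953340323664729787496136704),
      (4, 2, [(1, 0), (3, 1), (1, 2), (3, 3), (3, 4), (1, 6), (3, 7), (1, 8), (3, 9), (3, 14), (1, 16), (1, 23)], 564629220449239560696516701541263898086560250252593594624, 192313188837747520076243176988366824785354274885337088),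
      (6, 4, [(1, 0), (2, 1), (2, 2), (2, 3), (1, 4), (2, 5), (2, 6), (2, 7), (2, 9), (2, 10), (2, 12), (1, 16), (2, 17), (1, 20)], 295197356968378288319863267996482278674034709172779614464, 98464335101235152063539279958624942427482034488549048320),
      (4, 7, [(1, 0), (3, 1), (3, 2), (3, 4), (3, 5), (1, 7), (3, 8), (3, 9), (1, 12), (1, 15), (1, 16), (1, 19)], 221445987215608752050796630216765655090429526859608883456, 172312603925330342188951562582729378835407432335484780544),
      (4, 9, [(1, 0), (3, 1), (3, 2), (3, 4), (3, 5), (3, 7), (1, 9), (1, 10), (3, 11), (1, 13), (1, 16), (1, 21)], 270397546337656591428361287772115420464519151322918945024, 246157109456702842265253206500403348563036905044227129344),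
      (1, 16, cenSL23)],
    221350204680041075661851307944551088791098319289647759616,
    73752103529129431703614865425994587984819515531177492480, by decide +kernel⟩

/-- Generation data of `grpS5`. -/
def fstS5 : ℕ := 1257281543275867998369572638381482751126240306933048766706553849323999047219580656248468076020319822450187956409519862462962496531340359362942021659404984260119470034462645516864346319098164600291328737692797225750395225855253733927171287995433371671685655549907817493294402975658751951104

/-- Generation data of `grpS5`. -/
def sndS5 : ℕ := 424554379823450506311254987245441446678257185216096972338411130803064321568245657119381078331984302447887422627570398074122760981215473128747612324819048593522686047077601122378987117200385069368229935714503879320536676499524408186481687166221272342751118270679199923177351920140603621376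

/-- A group of order 120. -/
def grpS5 : ClsGroup :=
  ⟨⟨mkTab 120 [2407541632169792494682310424397689527184461258688038364985340081375136762783670300609688887097446069869378164819209944731093676009136332345127140801802669044808252003637594286440433625155865333285728753698660803604304036102481692773679574849952623568157138106833419725062659509979764228865, 4509732194233065466734630064911517972775257166663917621740472156068522574591926038980435889993915106591878172696303663745861791802256331634102240693925823302863792511161970733608881142959843244771683386148059394054148420003560734910525838561233306751869401975887219567964473419278369948930]
    305737093252613825049097335642249252873760168533655602221218297788619594538084527926217691283359350630027159576507163257302912001576527668243542872155875149185630092290856775269718199848403831717443995452199150819651501515893831158031530444023727191586993284487440149125338871732667219968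
    2277871045345881435429887527675250681272927795368058350565578353387755619530195410532149159867312411576089024450489155130385805193180274185168037409115875967875471843308895130883812451647031345589209131561103234088570719655150706065662420332438707115217548593115094176942193180672
    2067170430022123530507382670983944562236733049253449887817866842620484763704457367078233269339474301450670551395800013041111712469703783084000843092436744289098019701264030683963486325715687379614949504993892048146187901450880641104488942937818435545825588003175355165797123880127385701120, 120, [1, 2], by decide +kernel⟩,
    [(1, 0, [(1, 0), (24, 1), (10, 2), (30, 4), (20, 7), (15, 15), (20, 33)], fstS5, sndS5),
      (24, 1, [(1, 0), (1, 1), (5, 2), (1, 3), (5, 4), (1, 6), (5, 7), (5, 10), (1, 11), (5, 12), (5, 15), (5, 17), (5, 19), (5, 22), (5, 24), (5, 33), (5, 35), (5, 43), (5, 47), (5, 49), (5, 57), (5, 60), (5, 61), (5, 64), (5, 67), (5, 75), (5, 93), (5, 105)], 1262687287094947112434404683737366025553574400733566163733845520612254330121813918138771256135249108819760426875557978758083273709092353855594139161860929084375872843950170325343516650651562193259546305617935672249705091710986614171760698763982535845613342852447398614315268482935541596416, 4188961506097045150393569434893945443429825614968286156635551201292884290832286432582846566497116432481392825033043414286749435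09963052824695389002047601565151798605107831844091972756441773324919248766562300922706212191729807133750156530071415725997296356794082469983139917228394621698048),
      (10, 2, [(1, 0), (12, 1), (1, 2), (12, 3), (12, 4), (12, 7), (6, 8), (6, 15), (12, 20), (6, 31), (3, 32), (12, 33), (6, 36), (3, 49), (2, 54), (6, 55), (2, 77), (6, 78)], 2067134277336287615841328797670826436083062346870371193045568444026241026489359794510042397711353858542427716568692736865404005873164468854918858289822809222067519487256769747913532919193721949028266037278467183386496365355212030307857123565470368437405863931113389890712213305314569748736, 1222942527886232198400456780085586973171503445160562595824757115636353062135711304127182254673894565695257940736399734073825723190321435390753424587241553938914764694332100653420073736002605216337281552716312451907349281148220538398804700334443278428719364244925958754720091779739148091392),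
      (30, 4, [(1, 0), (4, 1), (4, 2), (4, 3), (1, 4), (4, 5), (4, 6), (4, 7), (4, 9), (4, 11), (4, 12), (4, 13), (1, 15), (4, 18), (4, 19), (4, 20), (4, 21), (1, 26), (4, 28), (4, 29), (4, 31), (4, 33), (4, 35), (4, 36), (4, 41), (4, 46), (4, 48), (4, 49), (4, 50), (4, 52), (2, 53), (2, 65), (4, 66), (4, 95)], 1562587613462683152040142551779120824458262670916309136044449438855774646449490701348826480505621797010731194551963046735389538626184764934858354933588394481600753743261995059538883015147925533371681437959500257178010692628998284928557119728997184310027732848039830306861910837986184003840, 991997701844730659605772797457776453275989804572850165459575107523838442074170218006360535576892626355126135573471423249159566677033875532778938381941705692973266445944837801611638526205155886975043931576755429511616601647677795255771826189169179915871625048648002532254544408067501457408),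
      (20, 7, [(1, 0), (6, 1), (6, 2), (6, 3), (6, 4), (6, 5), (6, 6), (1, 7), (6, 8), (6, 9), (6, 11), (6, 12), (3, 15), (1, 16), (6, 18), (6, 19), (6, 20), (6, 33), (1, 35), (3, 37), (6, 39), (6, 40), (6, 46), (6, 49), (1, 65), (1, 71)], 1524072126127243252184705097657244649411516703767721467873919722436291298704481816285900927334127207945457705809300689714017892378176510226584475752675405913220542360655609186955513688233100862095342198320084861380704190706334208109961567927759656959368961368630251229446470821188858937600, 276176812654645901162736613478994285359395007683985455645078781222000965869564409325535235000828459542987121639916082269740864572936852474641360309710370455770239774121313492781719230916471598412156930853766236399277289740500004027003387626426790486036851984814956341042835972993149042688),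
      (15, 15, [(1, 0), (8, 1), (4, 2), (8, 3), (2, 4), (8, 5), (4, 7), (8, 9), (8, 13), (1, 15), (4, 18), (8, 20), (8, 21), (8, 28), (4, 31), (8, 33), (4, 35), (8, 41), (8, 49), (2, 53), (2, 65), (4, 95)], 1562139765791334622167216870442445315256787759055486509739988674811765501261399726589143482999903621706785159136012267436190579059430299162578400517083108283408348558057141205191815103470761916390795499344224889903627769778145216353295784421222244993390338204208457011096136886675499516160, 999461829687428949490315836960296353723222628679966819662335002858154016706609759952275675500002500799796704249964471094552468081577887391661826199869633767084410433755121289218575537879687043143487866675104728270420229723479649712098533419191309497159874218661561795022583425084346597376),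
      (20, 33, [(1, 0), (6, 1), (6, 2), (6, 3), (6, 4), (6, 5), (6, 6), (6, 7), (6, 8), (6, 9), (6, 11), (6, 15), (6, 18), (6, 19), (6, 21), (1, 31), (1, 33), (3, 34), (6, 35), (6, 38), (6, 40), (1, 45), (3, 53), (1, 58), (6, 61), (1, 83)], 1333587590395036688763835669166025502825832238740113687697629372645571591248889108741094684531194188951731635470298067838256330525572636584255031738955628723119400757519065224354314054551569193593837765765766524501015936088286308932627062218813078611156273512788434048547506941159807254784, 1268593396041884093066648963256692845212558108122384556660366406697127669825261105535597062832044707495426710461918629595148775444390036522538663226394196668579299213113489559991747517282359047305698850195048909767826933396880605521842626205603121188954954637138441619134211910595816456192)],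
    fstS5,
    sndS5, by decide +kernel⟩

/-- Centralizer data of `grpF21`. -/
def cenF21 : List (ℕ × ℕ) × ℕ × ℕ := ([(1, 0), (1, 1), (7, 2), (1, 3), (7, 6), (1, 7), (1, 13), (1, 19), (1, 20)], 29338637552009154580536079420073651782790357844224, 68648906412880269400093498305322714562297856)

/-- Centralizer data of `grpF21`. -/
def cenF21' : List (ℕ × ℕ) × ℕ × ℕ := ([(1, 0), (3, 1), (1, 2), (3, 4), (1, 6), (3, 7), (3, 8), (3, 9), (3, 15)], 10270809609912568200648494323310155629709714653440, 8780562133352547121731633234930770089597319774208)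

/-- Generation data of `grpF21`. -/
def fstF21 : ℕ := 10270608377457530326208463624408351673349813960960

/-- A group of order 21. -/
def grpF21 : ClsGroup :=
  ⟨⟨mkTab 21 [114313800253361833955004131848868423529725690625, 20507119959163217655077134694877410714825882207490]
    1490180920379624522919553706841201141861215961088
    1461501637332232146199779238321374936133854625792
    1478741162124985726205544091514705888369604695040, 21, [1, 2], by decide +kernel⟩,
    [(1, 0, [(1, 0), (3, 1), (7, 2), (7, 6), (3, 7)], fstF21, 8780495928697164100514044743473264063304381235200),
      (3, 1, cenF21),
      (7, 2, cenF21'),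
      (7, 6, cenF21'),
      (3, 7, cenF21)],
    fstF21,
    8780495928697164100514044743473264063304381235200, by decide +kernel⟩

/-- Centralizer data of `grpF20`. -/
def cenF20 : List (ℕ × ℕ) × ℕ × ℕ := ([(1, 0), (4, 1), (1, 2), (4, 4), (1, 6), (4, 9), (1, 13), (4, 16)], 91702063509419209903047966084202802754500034816, 11552918475245585922642482692722998142339907584)

/-- A group of order 20. -/
def grpF20 : ClsGroup :=
  ⟨⟨mkTab 20 [103053404496594011585663087986994952421844976385, 5866316601372887110843301899556186955524211970]
    28656895191242354911748830262044925754695811072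
    22388199096077582830655062309098751109693440
    57201762625577364519150189462908058477966200320, 20, [1, 2], by decide +kernel⟩,
    [(1, 0, [(1, 0), (4, 1), (5, 2), (5, 6), (5, 13)], 74507926599659519191398474787567948750133526784, 45738916876962089603624599276490283099025833984),
      (4, 1, [(1, 0), (1, 1), (5, 2), (1, 3), (5, 6), (1, 7), (5, 13), (1, 14)], 74507926599727019050559427547171190766674510080, 79992862522721073970236295179465693690404536320),
      (5, 2, cenF20),
      (5, 6, cenF20),
      (5, 13, cenF20)],
    74507926599659519191398474787567948750133526784,
    45738916876962089603624599276490283099025833984, by decide +kernel⟩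

/-- Centralizer data of `grpF42`. -/
def cenF42 : List (ℕ × ℕ) × ℕ × ℕ := ([(1, 0), (6, 1), (1, 2), (6, 4), (1, 6), (6, 10), (1, 14), (6, 18), (1, 24), (6, 27), (1, 33), (6, 36)], 19762453607451195872856400000820980884642562333754201882381277508192664244846616932670780337482236160, 1106558882821263952661477524157343298515007781738625098942496053786578993475979521035934908708552704)

/-- Generation data of `grpF42`. -/
def fstF42 : ℕ := 18115582473496928093830507141001619225357954300772957558965230921653478567091106464060633259574427904

/-- Generation data of `grpF42`. -/
def sndF42 : ℕ := 3829858457276728494799133726781750771434813220839377311998124550391241905266941338036279614818484224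

/-- A group of order 42. -/
def grpF42 : ClsGroup :=
  ⟨⟨mkTab 42 [21413546588222819193467814038713457789486045192053057241153833316979581627552187495534257566633952001, 600338621117228362537996016341663515276596030148246931604460399303314759088853475325852408357455106]
    3842699312560455535242371540365993486608975898112193949104505357035292999055549359306993137944166400
    2144363455667669276140153520150935341672578648498572664774957827583703578491231881036496732487680
    6032069240349292806849081461593827515171876728055086646854630376104767589736040337521752376088797696, 42, [1, 2], by decide +kernel⟩,
    [(1, 0, [(1, 0), (6, 1), (7, 2), (7, 6), (7, 14), (7, 24), (7, 33)], fstF42, sndF42),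
      (6, 1, [(1, 0), (1, 1), (7, 2), (1, 3), (7, 6), (1, 7), (7, 14), (1, 15), (7, 24), (1, 25), (7, 33), (1, 34)], 18115582473496928344252669029474507273608407240304407384950994627043718571906904999902695210541515008, 3830033841109025308843502491957917609877481062056610725447230642052606334793914059657224247931043840),
      (7, 2, cenF42),
      (7, 6, cenF42),
      (7, 14, cenF42),
      (7, 24, cenF42),
      (7, 33, cenF42)],
    fstF42,
    sndF42, by decide +kernel⟩

/-- Centralizer data of `grpF55`. -/
def cenF55 : List (ℕ × ℕ) × ℕ × ℕ := ([(1, 0), (1, 1), (11, 2), (1, 3), (11, 6), (1, 7), (11, 14), (1, 15), (11, 28), (1, 29), (1, 45), (1, 51), (1, 52), (1, 53), (1, 54)], 601201604784037291316111050907559836743392398092479880555652627740864637316975639310207622226873915299453070049580925335189860778240, 116735977176001185193280298153562200216443919267547468913236514771870623237368601808002519976041870484096463880558540226560)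

/-- Centralizer data of `grpF55`. -/
def cenF55' : List (ℕ × ℕ) × ℕ × ℕ := ([(1, 0), (5, 1), (1, 2), (5, 3), (5, 4), (1, 6), (5, 8), (5, 10), (1, 14), (5, 17), (5, 21), (1, 28), (5, 32), (5, 38), (5, 46)], 33402513692651003229619694530907805401861736238285927880268677544708939484927771153007499530811607309988718066486056258997743386880, 22443673852338828884284890053429073613668705405236795779037816449814892122795106985955928730311179508491307436754559653410462760960)

/-- Generation data of `grpF55`. -/
def fstF55 : ℕ := 33402513645988228962115082051143111385002561137033538208697213340247172191014282692995044408158213170281620615189966516799502680320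

/-- Generation data of `grpF55`. -/
def sndF55 : ℕ := 22443673862818151056847903456424801208086873979952196657483293106272137254677530091778117547637825557101346806403850820635454341120

/-- A group of order 55. -/
def grpF55 : ClsGroup :=
  ⟨⟨mkTab 55 [565633791201281002464762147552550761669958554793396083280205311216176363441355378944917826164151002529945340559861492638093674808065, 90030714445596609658223539364904218866129587441276740619949886793563653391621695334671110938675228056290338682693465806458031834370]
    44580350619533465250108789493897567795216899831648151845862104887181719755182928366178470862277479995952997415874164746927227338752
    11134002401519992430850955433104918841925231670844932603024310173786508509942633461196755058966534014713277884581703053248995328000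
    77680614847992781734302252769704426297877319184908257324945631414383091747161551826832088947288774598750357141433016231650997843200, 55, [1, 2], by decide +kernel⟩,
    [(1, 0, [(1, 0), (5, 1), (11, 2), (5, 3), (11, 6), (11, 14), (11, 28)], fstF55, sndF55),
      (5, 1, cenF55),
      (11, 2, cenF55'),
      (5, 3, cenF55),
      (11, 6, cenF55'),
      (11, 14, cenF55'),
      (11, 28, cenF55')],
    fstF55,
    sndF55, by decide +kernel⟩

/-- Centralizer data of `grpA5`. -/
def cenA5 : List (ℕ × ℕ) × ℕ × ℕ := ([(1, 0), (1, 1), (5, 2), (1, 3), (5, 4), (5, 6), (1, 7), (5, 8), (5, 12), (1, 14), (5, 15), (5, 19), (5, 28), (5, 36), (5, 41), (5, 49)], 598096061293726462096216929947245745763357803035024159472904330425405262253814758714499843743392653958485745911118535022352226393903356142813440, 12861398909912666659397273393934766410201712147909226234589708502591626115004697713038857241184149593138249237302431223452470634103861726412800)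

/-- Generation data of `grpA5`. -/
def fstA5 : ℕ := 97650288381585048239929237162791923564748419880336088893922996713615440278297032982239934609361654458003498555104720924944831195823828820427008

/-- Generation data of `grpA5`. -/
def sndA5 : ℕ := 245463561382378940240062606384643044631102025636618508396952899011136078325082798342614722672751802948220444630906845826112547210073246414143488

/-- A group of order 60. -/
def grpA5 : ClsGroup :=
  ⟨⟨mkTab 60 [683982209081079559707976077648264281279328102004288079950892831431944438744091593852822432372721579859663905272941708676867736402212047030584065, 660693408881771055974391140599178764935418553273082735121598121809962450382602558324434480358158239022022709199743557944204885705677079988012290]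
    49064061175912959148472219800083743763253378829955259019089589646667799335404865279327790176348573237431947644776453821888513013382007738138624
    12241965106985262933027628572800112092921811635243721413511364528091914482299933559051584770960296254238742023081558799292874455085827577937920
    721711958788481094577276817957514318251273123327955342322074405917963246606209744030298015040837787464301449920297017417529854772417345314229760, 60, [1, 2], by decide +kernel⟩,
    [(1, 0, [(1, 0), (12, 1), (20, 2), (12, 3), (15, 8)], fstA5, sndA5),
      (12, 1, cenA5),
      (20, 2, [(1, 0), (3, 1), (1, 2), (3, 3), (3, 4), (1, 6), (3, 7), (3, 8), (3, 9), (3, 10), (3, 14), (3, 16), (3, 19), (3, 26), (3, 27), (3, 29), (3, 30), (3, 32), (3, 33), (3, 40), (3, 41), (3, 52)], 635539242443856399390063544589054807998135372597989123891696590623901388907662156740826921399401469156796402537178725043125025560003783612825856, 24485046649674616349872821263737550314778089544309111810720713787246313560240044074497976056763292893581218449344349624855038797763623321075712),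
      (12, 3, cenA5),
      (15, 8, [(1, 0), (4, 1), (4, 2), (4, 3), (4, 4), (4, 5), (1, 8), (4, 9), (4, 10), (4, 11), (4, 12), (4, 19), (4, 22), (4, 27), (4, 41), (1, 49), (1, 52), (4, 53)], 647593260920631728658281942931636484882200813638973154661410753165613565316257752773487196018911369418662939560339350275512391914156602721173760, 97937209547057963281889761143915884336833729391815001503404879236316194707949745542810572351791910578440520789604810127659957586044581960482816)],
    fstA5,
    sndA5, by decide +kernel⟩

/-- Centralizer data of `grpC4`. -/
def cenC4 : List (ℕ × ℕ) × ℕ × ℕ := ([(1, 0), (1, 1), (1, 2), (1, 3)], 50462976, 0)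

/-- A group of order 4. -/
def grpC4 : ClsGroup :=
  ⟨⟨mkTab 4 [197121]
    0
    0
    16909056, 4, [1], by decide +kernel⟩,
    [(1, 0, cenC4),
      (1, 1, cenC4),
      (1, 2, cenC4),
      (1, 3, cenC4)],
    50462976,
    0, by decide +kernel⟩

/-- The statistics: a finite group and a condition on the order of the image of the peripheral subgroup. -/
def statOf (i : ℕ) : ClsGroup × ℕ :=
  [(grpC2, 0), (grpC3, 0), (grpA4, 0), (grpC9, 3), (grpS4, 0), (grpF72, 0), (grpS3, 0), (grpA4, 2), (grpC5, 0), (grpD9, 6), (grpS4, 4), (grpF36, 0), (grpSL23, 3), (grpS5, 8), (grpF21, 0), (grpF20, 0), (grpF42, 0), (grpF55, 0), (grpA5, 0), (grpC4, 0), (grpC4, 2)].getD i (grpC2, 0)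

/-- An explicit form of the evaluation of the relator of a presentation. -/
def Ev (p : Pres) : Type :=
  {ev : ℕ → ℕ → ℕ → ℕ → ℕ → ℕ → ℕ // ∀ X X' Y Y' Z Z', evw X X' Y Y' Z Z' p.r 0 = ev X X' Y Y' Z Z'}

/-- The presentation of a gluing pattern together with the values of some statistics. -/
structure SpaceData where
  p : Pres
  vals : List (ℕ × ℕ)
  ok : p.Check := by decide +kernel
  ev : Ev p := by exact ⟨_, fun X X' Y Y' Z Z' => by simp only [evw, sel]; exact rfl⟩
  hvals : (vals.all fun e => Nat.beq ((statOf e.1).1.count (statOf e.1).2 ev.1 p.P) e.2) = true := by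
    decide +kernel

def rep0 : SpaceData where
  p := ⟨84818091893572, 1, 2, 3, 0, 0, 2, 1, 0, 3, 2, 11,
  [2, 5, 5, 0, 0, 0, 5, 2, 2], [[4, 3, 3, 0], [5, 0], [4, 2, 1, 1], [4, 4, 1, 1], [1, 1, 1]], [(1, 1), (1, 3), (1, 5), (2, 1), (3, 6)]⟩
  vals := [(0, 4), (1, 27), (2, 816), (3, 24)]

def rep1 : SpaceData where
  p := ⟨49633721901892, 1, 2, 3, 0, 0, 2, 1, 0, 3, 2, 11,
  [2, 5, 0, 0, 0, 5, 5, 2, 2], [[1, 2, 2, 4], [0, 0, 5], [5, 2, 5], [5, 5, 0], [1, 5]], [(1, 1), (1, 3), (1, 5), (1, 7), (4, 2)]⟩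
  vals := [(0, 4), (1, 27), (2, 816), (3, 78)]

def rep3 : SpaceData where
  p := ⟨84818360329036, 1, 2, 3, 4, 0, 5, 4, 0, 2, 0, 8,
  [0, 5, 2, 1, 1, 4, 4, 3, 3, 0, 5, 2], [[0, 3, 4, 1, 2, 5], [0, 3, 4, 1, 3, 4], [0, 3, 4, 1, 3, 0], [5, 0], [0, 0, 5, 2, 1, 1], [4, 2, 1, 1], [4, 4, 1, 1]], [(1, 1), (1, 3), (1, 5), (2, 1), (2, 4)]⟩
  vals := [(0, 8), (1, 27), (2, 768), (19, 64)]

def rep4 : SpaceData where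
  p := ⟨49633990337356, 1, 2, 3, 4, 0, 5, 5, 0, 2, 0, 7,
  [0, 5, 5, 2, 1, 1, 4, 3, 3, 0, 5, 5, 2], [[0, 3, 4, 4, 1, 2, 4], [0, 3, 4, 4, 1, 3, 4, 4], [0, 3, 4, 4, 1, 3, 0], [0, 0, 5, 5, 2, 5], [0, 0, 5], [5, 2, 5], [5, 5, 0]], [(1, 1), (1, 3), (1, 5), (1, 7), (2, 4)]⟩
  vals := [(0, 4), (1, 27), (2, 720), (3, 24), (4, 1152)]

def rep5 : SpaceData where
  p := ⟨49625400403276, 1, 2, 3, 4, 0, 5, 6, 0, 2, 0, 6,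
  [0, 0, 5, 5, 2, 1, 4, 3, 3, 0, 0, 5, 5, 2], [[1, 3, 4, 4, 1, 1, 2, 4], [1, 3, 4, 4, 1, 1, 3, 4, 4], [1, 3, 4, 4, 1, 1, 3, 0, 0], [4, 1], [0, 5, 5, 2, 1], [5, 2, 1], [5, 5, 0, 0]], [(1, 1), (1, 5), (1, 7), (2, 5), (2, 4)]⟩
  vals := [(0, 4), (1, 27), (2, 720), (3, 78)]

def rep6 : SpaceData where
  p := ⟨84260014613836, 0, 1, 3, 2, 0, 4, 6, 0, 3, 2, 6,
  [0, 0, 3, 4, 4, 1, 2, 2, 5, 0, 0, 3, 4, 4], [[2, 5, 5, 2, 1, 2], [2, 5, 5, 2, 1, 1, 1, 4], [2, 5, 5, 2, 1, 1, 5, 5, 2, 1, 1, 5], [3, 0, 3], [3, 3, 4], [4, 4, 3], [5, 2, 1, 1, 4]], [(1, 1), (1, 3), (1, 5), (1, 7), (5, 6)]⟩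
  vals := [(0, 4), (1, 27), (2, 720), (3, 24), (4, 1248)]

def rep7 : SpaceData where
  p := ⟨111234296113092, 1, 2, 3, 0, 0, 2, 1, 0, 3, 2, 11,
  [2, 1, 5, 0, 4, 0, 5, 2, 2], [[5, 3, 3, 0, 4], [0], [5, 2, 1, 5], [5, 1, 1, 5], [5, 1, 4, 1, 5]], [(1, 3), (1, 5), (2, 1), (3, 6), (3, 7)]⟩
  vals := [(0, 4), (1, 9), (2, 336), (4, 1248), (6, 54), (8, 25), (9, 90), (10, 132), (11, 1944)]

def rep8 : SpaceData where
  p := ⟨111225704081348, 1, 2, 3, 0, 0, 2, 1, 0, 3, 2, 11,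
  [2, 1, 5, 1, 4, 1, 5, 2, 2], [[5, 2, 2, 2, 5], [0], [4, 1, 5, 2, 5], [4, 3, 1, 4], [5, 5]], [(1, 3), (1, 5), (5, 6), (5, 7), (4, 2)]⟩
  vals := [(0, 4), (1, 9), (2, 336), (6, 54), (8, 25), (9, 252), (10, 132)]

def rep13 : SpaceData where
  p := ⟨146410344606156, 0, 2, 3, 1, 1, 4, 2, 0, 2, 0, 10,
  [0, 5, 5, 0, 3, 4, 4, 3, 3, 0], [[5, 0, 0, 0, 5], [5, 0, 2, 2, 5], [5, 0, 3, 4], [4, 1, 4, 2, 5], [4, 1, 5, 2, 5]], [(1, 1), (1, 5), (5, 4), (5, 6), (4, 0)]⟩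
  vals := [(0, 4), (1, 27), (2, 624), (3, 78), (6, 72)]

def rep14 : SpaceData where
  p := ⟨145860588825036, 0, 2, 3, 1, 1, 4, 2, 0, 2, 0, 10,
  [0, 5, 5, 0, 3, 3, 4, 4, 3, 0], [[4, 3, 0, 0, 5], [4, 3, 1, 4], [4, 3, 3, 3, 4], [4, 1, 4, 3, 4], [4, 1, 5, 3, 4]], [(1, 1), (1, 5), (5, 4), (5, 6), (4, 2)]⟩
  vals := [(0, 4), (1, 27), (2, 624), (3, 24), (6, 72)]

def rep19 : SpaceData where
  p := ⟨86146579011212, 1, 3, 5, 4, 0, 5, 4, 0, 2, 0, 8,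
  [0, 2, 4, 4, 1, 2, 2, 5, 0, 0, 2, 4], [[0, 5, 3, 1, 2], [0, 5, 5], [0, 0, 2, 4, 0, 2], [0, 0, 2, 4, 4, 3], [2, 1, 2], [2, 2, 5]], [(1, 1), (1, 3), (1, 5), (1, 7), (0, 0)]⟩
  vals := [(0, 8), (1, 9), (2, 384), (20, 14)]

def rep20 : SpaceData where
  p := ⟨50962209019532, 1, 3, 5, 4, 0, 5, 5, 0, 2, 0, 7,
  [0, 2, 2, 4, 4, 1, 2, 5, 0, 0, 2, 2, 4], [[0, 5, 3], [4, 3], [0, 0, 2, 2, 4, 0, 2, 2, 4, 3], [0, 0, 2, 2, 4, 0, 0, 2, 2, 4, 1], [0, 0, 2, 2, 4, 4, 2], [3, 3, 0, 2, 2, 4, 1]], [(1, 1), (1, 3), (1, 7), (0, 0), (0, 4)]⟩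
  vals := [(0, 4), (1, 9), (2, 336), (4, 1152), (6, 54), (8, 25), (9, 90), (10, 132)]

def rep21 : SpaceData where
  p := ⟨85588233296012, 0, 3, 5, 2, 0, 4, 6, 0, 3, 2, 6,
  [0, 0, 4, 3, 3, 0, 5, 2, 2, 5, 1, 1, 2, 4], [[4, 0, 2, 2, 5, 1, 1, 3], [4, 0, 0, 4, 3], [4, 1, 2], [2, 2, 5, 1, 1, 2], [2, 0, 0, 4, 3, 3, 0, 3, 3], [2, 0, 0, 4, 3, 3, 4, 3, 3], [2, 5, 3, 3]], [(1, 3), (1, 5), (1, 7), (3, 3), (3, 2)]⟩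
  vals := [(0, 4), (1, 9), (2, 336), (4, 1248), (6, 54), (8, 25), (9, 90), (10, 132), (11, 3240)]

def rep22 : SpaceData where
  p := ⟨95330032522884, 1, 3, 5, 0, 0, 2, 1, 0, 3, 2, 11,
  [1, 2, 5, 0, 3, 1, 4, 4, 2], [[0, 3, 3], [4, 3], [5, 5, 0, 0, 3], [2, 1, 4], [2, 1, 2, 4]], [(1, 1), (1, 3), (1, 7), (3, 2), (5, 7)]⟩
  vals := [(0, 4), (1, 9), (2, 240), (6, 54), (15, 700)]

def rep23 : SpaceData where
  p := ⟨60154250368644, 1, 3, 5, 0, 0, 2, 1, 0, 3, 2, 11,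
  [1, 2, 5, 5, 0, 3, 1, 4, 2], [[0, 3, 3], [5, 0, 0, 3], [2, 5, 5], [2, 1, 5], [2, 1, 2, 5]], [(1, 1), (1, 3), (1, 5), (1, 7), (3, 2)]⟩
  vals := [(0, 4), (1, 9), (2, 240), (4, 1248), (6, 54), (10, 84), (15, 400)]

def rep30 : SpaceData where
  p := ⟨94230785136268, 0, 3, 5, 2, 0, 3, 2, 0, 2, 0, 10,
  [0, 4, 4, 2, 1, 2, 2, 5, 2, 0], [[2, 0, 0, 4], [2, 0, 2, 0, 3], [2, 0, 4, 4], [4, 3, 0, 3], [4, 2, 4]], [(1, 1), (1, 5), (1, 7), (0, 0), (0, 4)]⟩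
  vals := [(0, 4), (1, 9), (2, 240), (4, 1152), (6, 54), (9, 90), (10, 84), (14, 441), (15, 400)]

def rep31 : SpaceData where
  p := ⟨59055002982028, 0, 3, 5, 2, 0, 3, 2, 0, 2, 0, 10,
  [0, 4, 2, 1, 2, 2, 5, 5, 2, 0], [[2, 0, 4], [5, 0, 5], [5, 2, 0, 3], [4, 4, 3, 0, 3], [4, 4, 2, 5]], [(1, 1), (1, 5), (1, 7), (0, 4), (5, 5)]⟩
  vals := [(0, 4), (1, 9), (2, 240), (6, 54), (15, 600)]

def rep32 : SpaceData where
  p := ⟨95330300958348, 1, 3, 5, 4, 0, 5, 3, 0, 2, 0, 9,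
  [0, 2, 4, 4, 2, 1, 2, 5, 0, 0, 2], [[0, 3, 3], [4, 3], [0, 0, 2, 0, 2, 4], [0, 0, 2, 0, 0, 2, 1], [0, 0, 2, 4, 4], [0, 3, 1, 2, 4]], [(1, 1), (1, 3), (1, 7), (0, 0), (0, 4)]⟩
  vals := [(0, 4), (1, 9), (2, 240), (6, 72), (14, 735)]

def rep33 : SpaceData where
  p := ⟨60154518804108, 1, 3, 5, 4, 0, 5, 3, 0, 2, 0, 9,
  [0, 2, 4, 2, 1, 2, 5, 5, 0, 0, 2], [[0, 0, 2, 4], [0, 3, 3], [5, 0, 2, 5], [5, 0, 0, 2, 1], [2, 5, 5], [0, 3, 1, 2, 5]], [(1, 1), (1, 3), (1, 5), (1, 7), (0, 4)]⟩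
  vals := [(0, 4), (1, 9), (2, 240), (6, 72), (14, 441)]

def rep34 : SpaceData where
  p := ⟨94780543047308, 1, 3, 5, 4, 0, 5, 5, 0, 2, 0, 7,
  [0, 2, 1, 2, 4, 4, 2, 5, 0, 0, 2, 1, 2], [[0, 3, 0, 3, 1, 2, 1], [5, 3], [0, 0, 2, 1, 2, 0, 2, 1], [0, 0, 2, 1, 2, 4, 3], [4, 1, 2, 1], [4, 2, 5]], [(1, 1), (1, 3), (1, 5), (0, 6), (0, 0)]⟩
  vals := [(0, 4), (1, 9), (2, 240), (4, 1152), (6, 54), (9, 252), (10, 84), (15, 400)]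

def rep35 : SpaceData where
  p := ⟨59604760893068, 1, 3, 5, 4, 0, 5, 5, 0, 2, 0, 7,
  [0, 2, 1, 2, 4, 2, 5, 5, 0, 0, 2, 1, 2], [[0, 0, 2, 1, 2, 4], [0, 3, 0, 3, 1, 2, 1], [4, 3], [5, 0, 2, 1], [2, 4, 1, 2, 1], [2, 4, 2, 5, 3]], [(1, 1), (1, 3), (1, 7), (0, 6), (5, 5)]⟩
  vals := [(0, 4), (1, 9), (2, 240), (4, 1152), (6, 54), (9, 90), (14, 735), (15, 400)]

def rep36 : SpaceData where
  p := ⟨59055003048588, 0, 3, 5, 2, 0, 4, 6, 0, 3, 2, 6,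
  [0, 0, 4, 2, 1, 4, 4, 3, 0, 0, 4, 2, 1, 2], [[2, 0, 4], [2, 0, 0, 4, 2, 1, 4], [5, 0, 5], [0, 3, 5, 1, 1, 2, 5], [0, 3, 5, 1, 1, 3, 0, 3], [0, 3, 5, 1, 1, 5, 5]], [(1, 3), (1, 5), (1, 7), (1, 1), (0, 4)]⟩
  vals := [(0, 8), (1, 9), (2, 288), (14, 441), (20, 6)]

def rep37 : SpaceData where
  p := ⟨59055003015308, 0, 3, 5, 1, 1, 2, 4, 0, 2, 0, 8,
  [0, 4, 2, 1, 4, 4, 3, 3, 4, 4, 3, 0], [[2, 0, 4], [2, 2, 5, 5, 2, 5, 5], [2, 1, 2, 5, 5], [5, 0, 5], [4, 3, 5, 5]], [(1, 3), (1, 5), (1, 7), (1, 1), (5, 5)]⟩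
  vals := [(0, 4), (1, 9), (2, 240), (4, 1056), (6, 54), (14, 735), (15, 400)]

def rep38 : SpaceData where
  p := ⟨59054868764308, 0, 3, 5, 2, 0, 3, 2, 0, 2, 0, 10,
  [0, 3, 5, 1, 3, 4, 4, 3, 3, 0], [[2, 0, 5], [2, 1, 4], [5, 1, 3, 4], [4, 4, 3, 3, 4], [4, 4, 2, 5]], [(1, 1), (1, 5), (1, 7), (5, 5), (2, 1)]⟩
  vals := [(0, 4), (1, 9), (2, 240), (6, 54), (10, 84), (15, 500)]

def rep39 : SpaceData where
  p := ⟨60154384586388, 0, 1, 5, 6, 0, 5, 4, 0, 3, 2, 8,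
  [3, 3, 0, 0, 5, 5, 2, 0, 4, 3, 0, 0], [[2, 0, 5], [2, 1, 4], [2, 1, 1, 2, 1, 1, 2], [5, 0, 0, 5], [5, 1, 3, 0, 0, 5], [3, 0, 0, 3, 3, 0, 0, 5], [3, 0, 0, 5, 5]], [(1, 1), (1, 5), (1, 7), (1, 3), (5, 6)]⟩
  vals := [(0, 4), (1, 9), (2, 240), (4, 1056), (6, 54), (9, 252), (14, 441), (15, 400)]

def rep40 : SpaceData where
  p := ⟨59604626675348, 1, 3, 5, 0, 0, 4, 6, 0, 2, 0, 6,
  [1, 4, 4, 3, 5, 3, 0, 3, 1, 1, 4, 4, 3, 5], [[4, 4, 3, 5, 3], [0, 4, 2, 5, 5, 0, 4], [4, 3], [5, 0, 2, 1], [2, 5, 5, 0, 2, 1], [2, 4, 1, 2, 1], [2, 4, 2, 5, 3]], [(1, 1), (1, 3), (1, 7), (0, 6), (5, 5)]⟩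
  vals := [(0, 8), (1, 9), (2, 288), (14, 735), (20, 6)]

def rep51 : SpaceData where
  p := ⟨146993384544716, 1, 2, 3, 4, 0, 5, 3, 0, 2, 0, 9,
  [0, 4, 3, 4, 1, 3, 5, 0, 3, 0, 4], [[4, 0, 4, 0, 4, 1], [4, 2], [0, 5, 1, 3, 4, 1], [0, 5, 5, 0], [1, 2, 1]], [(1, 1), (1, 3), (1, 7), (5, 6), (5, 4)]⟩
  vals := [(0, 4), (1, 9), (2, 144), (4, 1056), (6, 54), (14, 441), (15, 600)]

def rep52 : SpaceData where
  p := ⟨112358770366412, 1, 2, 3, 4, 0, 5, 5, 0, 2, 0, 7,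
  [0, 5, 1, 4, 3, 4, 2, 0, 3, 0, 5, 1, 4], [[3, 0, 5, 1, 4, 0, 5], [3, 5, 0, 4, 1, 2, 5], [3, 5, 2, 5], [0], [4, 1, 3, 1, 2, 5], [4, 3, 0, 4, 1, 2, 5]], [(1, 3), (1, 5), (5, 5), (5, 7), (4, 1)]⟩
  vals := [(0, 4), (1, 9), (2, 144), (4, 1152), (6, 54), (14, 441), (15, 400), (16, 1764), (17, 5445)]

def rep53 : SpaceData where
  p := ⟨147010564446668, 1, 2, 3, 4, 0, 5, 3, 0, 2, 0, 9,
  [0, 4, 3, 5, 0, 3, 4, 1, 3, 0, 4], [[4, 0, 4, 0, 4, 1], [4, 2, 0, 4, 1], [1, 2], [0, 5, 2, 1], [0, 3, 5, 2]], [(1, 1), (1, 3), (1, 5), (5, 5), (5, 4)]⟩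
  vals := [(0, 4), (1, 9), (2, 144), (4, 1056), (6, 54), (9, 90), (15, 400), (18, 6300)]

def rep54 : SpaceData where
  p := ⟨112375950268364, 1, 2, 3, 4, 0, 5, 5, 0, 2, 0, 7,
  [0, 5, 1, 4, 3, 5, 2, 1, 3, 0, 5, 1, 4], [[3, 4, 0, 5, 1, 4, 0, 5], [3, 4, 2, 0, 5], [3, 0, 4, 1, 2], [0], [4, 3, 4, 2, 5], [4, 3, 1, 2]], [(1, 3), (1, 5), (5, 5), (5, 7), (4, 3)]⟩
  vals := [(0, 4), (1, 9), (2, 144), (4, 1152), (6, 54), (14, 441), (15, 400), (16, 1764), (17, 3025)]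

def rep55 : SpaceData where
  p := ⟨111817602455500, 0, 1, 3, 2, 0, 4, 3, 0, 3, 2, 9,
  [0, 0, 3, 1, 1, 4, 3, 0, 5, 3, 4], [[2], [4, 0, 2, 1, 1, 5], [1, 1, 4, 1, 1, 5], [1, 1, 5, 0, 5], [1, 1, 3, 0, 5]], [(1, 3), (1, 5), (0, 0), (0, 4), (0, 2)]⟩
  vals := [(0, 4), (1, 9), (2, 144), (4, 960), (6, 54), (9, 90), (10, 84), (14, 441)]

def rep56 : SpaceData where
  p := ⟨182186346634188, 0, 1, 3, 2, 0, 4, 3, 0, 3, 2, 9,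
  [0, 0, 3, 0, 5, 3, 1, 1, 4, 3, 4], [[4, 0, 2], [4, 0, 0, 5, 3], [4, 1, 4, 3], [1, 1, 3], [3, 0, 5, 3], [3, 1, 1, 4, 3], [2, 5, 2, 5, 3]], [(1, 1), (1, 3), (1, 7), (3, 3), (3, 6)]⟩
  vals := [(0, 4), (1, 9), (2, 144), (4, 960), (6, 54), (9, 252), (14, 441)]

def rep57 : SpaceData where
  p := ⟨112917118277580, 0, 1, 3, 2, 0, 4, 3, 0, 3, 2, 9,
  [0, 0, 3, 1, 1, 4, 1, 2, 5, 2, 4], [[4, 4, 1, 2, 5], [2], [1, 1, 5], [4, 4, 0, 2, 1, 1, 5, 5], [4, 3, 4, 1, 1, 5, 5]], [(1, 3), (3, 3), (3, 7), (0, 0), (0, 2)]⟩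
  vals := [(0, 4), (1, 9), (2, 144), (4, 960), (6, 54), (14, 735)]

def rep58 : SpaceData where
  p := ⟨146993250326996, 0, 1, 2, 6, 0, 5, 4, 0, 3, 2, 8,
  [4, 2, 1, 1, 2, 4, 1, 4, 3, 3, 0, 0], [[5, 0, 3], [5, 1, 1, 2], [5, 1, 5, 3, 0, 0, 3], [2, 1, 1, 2, 1, 1, 2, 2], [3, 4, 3]], [(1, 1), (1, 5), (1, 7), (5, 6), (0, 4)]⟩
  vals := [(0, 4), (1, 9), (2, 144), (4, 1056), (6, 54), (9, 90), (15, 400), (18, 5940)]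

def rep59 : SpaceData where
  p := ⟨112358636148692, 0, 1, 2, 6, 0, 3, 6, 0, 2, 0, 6,
  [0, 4, 2, 5, 0, 5, 2, 4, 1, 4, 3, 5, 3, 0], [[5, 0, 4, 2, 5, 0, 5], [2], [5, 1, 2, 4, 2, 5, 0, 5], [5, 1, 1, 4, 1, 4, 3], [5, 1, 1, 4, 3, 0, 4], [5, 1, 5, 3, 4, 1, 4, 3], [2, 5, 0, 4, 2, 5, 0, 5]], [(1, 5), (1, 3), (0, 4), (0, 6), (2, 5)]⟩
  vals := [(0, 8), (1, 9), (2, 192), (15, 1100), (20, 6)]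

def rep60 : SpaceData where
  p := ⟨147010430228948, 0, 1, 2, 6, 0, 5, 4, 0, 3, 2, 8,
  [4, 1, 4, 2, 1, 1, 2, 4, 3, 3, 0, 0], [[3, 0, 0, 0, 3], [3, 0, 0, 4, 1, 4], [3, 4], [5, 0, 2, 4, 3], [2, 5, 3, 0, 0, 3], [2, 5, 1, 1, 2, 4]], [(1, 1), (1, 5), (1, 3), (5, 5), (4, 0)]⟩
  vals := [(0, 4), (1, 9), (2, 144), (4, 1056), (6, 54), (9, 252), (10, 84), (15, 400)]

def rep61 : SpaceData where
  p := ⟨112375816050644, 0, 1, 2, 6, 0, 3, 6, 0, 2, 0, 6,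
  [0, 4, 1, 4, 2, 5, 2, 4, 3, 5, 0, 5, 3, 0], [[3, 5, 0, 5, 0, 4, 1, 4, 2, 5], [3], [3, 5, 0, 5, 1, 1, 4], [5, 0, 2, 4, 1, 4, 2, 5], [5, 2, 4, 4, 1, 4, 2, 5], [5, 2, 4, 3, 5, 0, 5, 3, 4]], [(1, 5), (1, 3), (4, 0), (4, 1), (4, 3)]⟩
  vals := [(0, 8), (1, 9), (2, 192), (15, 900), (20, 6)]

def rep62 : SpaceData where
  p := ⟨111817468237780, 1, 2, 3, 0, 0, 4, 2, 0, 2, 0, 10,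
  [2, 5, 1, 4, 2, 1, 3, 4, 1, 2], [[0], [4, 3, 0, 3, 5], [4, 3, 3, 4, 2], [3, 4, 3, 5], [3, 1, 4, 2]], [(1, 3), (1, 5), (0, 0), (0, 4), (3, 6)]⟩
  vals := [(0, 4), (1, 9), (2, 144), (4, 1152), (6, 54), (15, 500)]

def rep63 : SpaceData where
  p := ⟨182186212416468, 1, 2, 3, 0, 0, 4, 2, 0, 2, 0, 10,
  [2, 5, 1, 3, 4, 1, 4, 2, 1, 2], [[4, 2, 5, 1], [4, 3, 0], [3, 1], [1, 3, 4, 1], [0, 5, 0, 5, 1]], [(1, 1), (1, 3), (1, 7), (3, 3), (3, 6)]⟩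
  vals := [(0, 4), (1, 9), (2, 144), (4, 1152), (6, 54), (14, 441), (15, 400), (16, 2058)]

def rep64 : SpaceData where
  p := ⟨112916984059860, 1, 2, 3, 0, 0, 4, 2, 0, 2, 0, 10,
  [2, 5, 2, 0, 3, 5, 1, 4, 1, 2], [[0], [3, 5], [4, 4, 3, 0, 3, 5, 5], [4, 4, 3, 3, 0, 5], [4, 1, 4, 3, 5, 5]], [(1, 3), (3, 3), (3, 7), (0, 0), (0, 4)]⟩
  vals := [(0, 4), (1, 9), (2, 144), (4, 1152), (6, 54), (14, 735), (15, 400)]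

def rep65 : SpaceData where
  p := ⟨97789967356612, 1, 2, 6, 0, 0, 2, 1, 0, 3, 2, 11,
  [2, 0, 2, 0, 0, 5, 2, 5, 5], [[3, 4, 1], [0, 2, 0, 0], [0, 4, 4], [1, 4], [1, 2, 4]], [(1, 1), (1, 3), (1, 5), (1, 7), (3, 2)]⟩
  vals := [(0, 4), (1, 27), (2, 528), (3, 78), (4, 1248)]

def rep66 : SpaceData where
  p := ⟨97789965259972, 1, 2, 6, 0, 0, 2, 1, 0, 3, 2, 11,
  [2, 0, 0, 2, 0, 5, 2, 5, 5], [[3, 4, 1, 1], [1, 3, 1, 1], [0, 0, 4, 4], [0, 4], [0, 2, 4]], [(1, 1), (1, 3), (1, 5), (1, 7), (4, 1)]⟩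
  vals := [(0, 4), (1, 27), (2, 528), (3, 24), (4, 1248)]

def rep71 : SpaceData where
  p := ⟨97790235792076, 1, 2, 6, 4, 0, 5, 4, 0, 2, 0, 8,
  [0, 0, 5, 3, 1, 3, 4, 4, 3, 0, 0, 5], [[3, 0, 0, 5, 3, 1], [3, 4, 1], [0, 2, 0, 0], [0, 4, 4], [1, 2, 4]], [(1, 1), (1, 3), (1, 5), (1, 7), (3, 2)]⟩
  vals := [(0, 4), (1, 27), (2, 528), (3, 24), (4, 1056)]

def rep72 : SpaceData where
  p := ⟨97790233695436, 1, 2, 6, 4, 0, 5, 3, 0, 2, 0, 9,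
  [0, 5, 3, 1, 1, 3, 4, 4, 3, 0, 5], [[3, 0, 5, 0], [3, 4, 1, 1], [1, 3, 1, 1], [0, 0, 4, 4], [0, 2, 4]], [(1, 1), (1, 3), (1, 5), (1, 7), (4, 1)]⟩
  vals := [(0, 4), (1, 27), (2, 624), (3, 78), (6, 54), (7, 9)]

def rep73 : SpaceData where
  p := ⟨63155619517132, 1, 2, 6, 4, 0, 5, 5, 0, 2, 0, 7,
  [0, 0, 5, 5, 3, 1, 3, 4, 3, 0, 0, 5, 5], [[3, 0, 0, 5, 5, 3, 1], [3, 4, 4, 1], [5, 1], [0, 2, 0, 0, 5, 1], [0, 2, 0, 0], [1, 2, 4, 1]], [(1, 1), (1, 3), (1, 5), (3, 2), (3, 7)]⟩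
  vals := [(0, 4), (1, 27), (2, 528), (4, 1152), (5, 8424)]

def rep74 : SpaceData where
  p := ⟨97807415694028, 1, 2, 6, 4, 0, 5, 4, 0, 2, 0, 8,
  [0, 0, 5, 3, 4, 4, 3, 1, 3, 0, 0, 5], [[0, 5, 0, 0, 5, 0, 0], [0, 5, 2, 0, 0], [3, 0], [0, 2, 4], [0, 4, 4]], [(1, 1), (1, 3), (1, 7), (3, 7), (4, 3)]⟩
  vals := [(0, 4), (1, 27), (2, 528), (3, 78), (4, 1056)]

def rep75 : SpaceData where
  p := ⟨97807413597388, 1, 2, 6, 4, 0, 5, 3, 0, 2, 0, 9,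
  [0, 5, 3, 4, 4, 3, 1, 1, 3, 0, 5], [[0, 0, 5, 0, 5, 0], [0, 0, 5, 2, 0], [3, 1], [0, 0, 2, 4], [0, 0, 4, 4]], [(1, 1), (1, 3), (1, 7), (4, 1), (4, 0)]⟩
  vals := [(0, 4), (1, 27), (2, 624), (3, 24), (6, 54), (7, 9)]

def rep76 : SpaceData where
  p := ⟨63172799419084, 1, 2, 6, 4, 0, 5, 5, 0, 2, 0, 7,
  [0, 0, 5, 5, 3, 4, 3, 1, 3, 0, 0, 5, 5], [[0, 5, 5, 0, 0, 5, 5, 0, 0], [0, 5, 5, 2, 0, 0], [0, 5, 3, 1], [3, 0], [5, 1], [5, 5, 3, 1]], [(1, 1), (1, 3), (3, 2), (4, 3), (4, 0)]⟩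
  vals := [(0, 4), (1, 27), (2, 528), (4, 1152), (5, 5832)]

def rep77 : SpaceData where
  p := ⟨63155485299412, 0, 1, 2, 6, 0, 3, 6, 0, 2, 0, 6,
  [0, 4, 2, 4, 1, 4, 4, 2, 4, 1, 4, 3, 3, 0], [[5, 0, 4, 2, 4, 1, 4, 3], [5, 1, 5, 3], [2, 4, 1, 4, 4, 2, 4, 1, 4, 3], [5, 0, 5, 3, 5, 3], [2, 4, 2, 2], [2, 4, 1, 2], [3, 4, 4, 2, 4, 1, 4, 3]], [(1, 1), (1, 3), (1, 5), (3, 2), (3, 7)]⟩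
  vals := [(0, 8), (1, 27), (3, 78), (19, 32)]

def rep78 : SpaceData where
  p := ⟨63172665201364, 0, 1, 2, 6, 0, 3, 6, 0, 2, 0, 6,
  [0, 4, 1, 4, 2, 4, 4, 1, 4, 2, 4, 3, 3, 0], [[2, 4, 1, 4, 1, 2], [2, 4, 1, 1, 1, 2], [2, 4, 1, 4, 1, 4], [5, 2], [5, 3, 5, 0, 5, 3], [3, 0, 2, 2], [2, 5, 3, 5, 0, 5, 5, 3]], [(1, 1), (1, 3), (3, 2), (4, 0), (5, 4)]⟩
  vals := [(0, 8), (1, 27), (3, 24), (19, 32)]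

def rep79 : SpaceData where
  p := ⟨111647317739486, 1, 2, 3, 0, 2, 4, 2, 0, 2, 0, 10,
  [0, 3, 4, 1, 5, 1, 4, 3, 0, 2], [[4, 3, 0, 2, 5], [4, 3, 3, 4], [0], [5, 1, 2, 1, 5], [5, 1, 4, 1, 5]], [(1, 3), (1, 5), (2, 0), (2, 4), (3, 6)]⟩
  vals := [(0, 4), (1, 9), (2, 432), (9, 450)]

def rep80 : SpaceData where
  p := ⟨111638725707742, 1, 2, 3, 0, 2, 4, 2, 0, 2, 0, 10,
  [0, 3, 4, 0, 5, 0, 4, 3, 0, 2], [[4, 1, 3, 0, 2, 0, 5], [4, 1, 3, 3, 1, 4], [0], [4, 1, 5, 1, 4], [5, 2, 5]], [(1, 3), (1, 5), (5, 6), (4, 0), (2, 4)]⟩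
  vals := [(0, 4), (1, 9), (2, 432), (9, 126)]

def rep81 : SpaceData where
  p := ⟨181998877854686, 1, 2, 3, 0, 2, 4, 6, 0, 2, 0, 6,
  [0, 5, 1, 5, 0, 3, 4, 3, 0, 5, 1, 5, 0, 2], [[0, 2, 0, 5, 1, 5, 0, 3, 1], [0, 2, 2, 0], [4], [5, 1, 5, 0, 5, 1], [1, 5, 0, 5, 1, 5], [4, 0, 4, 1, 2, 5, 1]], [(1, 1), (1, 7), (3, 2), (3, 3), (3, 6)]⟩
  vals := [(0, 4), (1, 9), (2, 336), (6, 54), (8, 25), (9, 90), (10, 228), (11, 1944)]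

def rep82 : SpaceData where
  p := ⟨182016061918174, 0, 2, 3, 1, 1, 2, 2, 0, 2, 0, 10,
  [0, 3, 4, 4, 0, 4, 4, 3, 0, 2], [[5, 2, 0, 3, 4], [5, 2, 2, 5], [5, 1, 5, 1, 5], [5, 1, 2, 1, 5], [5, 1, 4, 1, 5]], [(1, 1), (1, 3), (3, 2), (3, 6), (2, 0)]⟩
  vals := [(0, 4), (1, 9), (2, 336), (6, 72), (13, 1440)]

def rep83 : SpaceData where
  p := ⟨182007469886430, 0, 1, 2, 3, 1, 4, 4, 0, 2, 0, 8,
  [0, 5, 2, 1, 2, 2, 2, 1, 2, 5, 0, 4], [[2, 4, 0, 5, 3], [2, 4, 4, 2], [3, 0, 3, 0, 3], [3, 3, 0, 3, 3], [3, 0, 3, 4, 3, 0, 3]], [(1, 1), (1, 7), (1, 3), (1, 5), (3, 2)]⟩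
  vals := [(0, 4), (1, 9), (2, 336), (6, 54), (8, 25), (9, 252), (10, 228), (12, 56)]

def rep84 : SpaceData where
  p := ⟨146814505765342, 1, 2, 3, 0, 2, 4, 6, 0, 2, 0, 6,
  [0, 4, 1, 4, 0, 3, 4, 3, 0, 4, 1, 4, 0, 2], [[0, 5, 2, 0, 4, 1, 4, 0, 3, 4, 1], [0, 5, 2, 2, 0, 4, 1, 4], [4], [5, 0, 5, 1, 5, 0], [0, 5, 1, 5, 0, 5], [1, 2, 1]], [(1, 1), (1, 7), (5, 5), (5, 6), (3, 2)]⟩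
  vals := [(0, 4), (1, 9), (2, 336), (6, 54), (8, 25), (9, 252), (10, 228), (12, 32)]

def rep85 : SpaceData where
  p := ⟨146831689828830, 0, 1, 2, 5, 1, 2, 4, 0, 2, 0, 8,
  [0, 5, 3, 0, 3, 3, 3, 0, 3, 5, 0, 4], [[3, 0, 3, 5, 0, 4, 2, 1, 2], [3, 0, 3, 5, 5, 3, 0, 3], [3, 0, 3, 0, 3], [3, 4, 3], [3, 3, 0, 3, 3]], [(1, 1), (1, 7), (1, 3), (1, 5), (2, 4)]⟩
  vals := [(0, 4), (1, 9), (2, 336), (6, 54), (8, 25), (9, 90), (10, 228), (11, 3240)]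

def rep86 : SpaceData where
  p := ⟨146823097797086, 0, 2, 3, 1, 1, 4, 2, 0, 2, 0, 10,
  [0, 3, 4, 4, 1, 4, 4, 3, 0, 2], [[4, 1, 3, 0, 2, 0, 5], [4, 1, 3, 3, 1, 4], [4, 1, 4, 1, 4], [4, 1, 5, 1, 4], [5, 2, 5]], [(1, 1), (1, 5), (5, 6), (4, 0), (2, 4)]⟩
  vals := [(0, 4), (1, 9), (2, 336), (6, 72), (13, 1200)]

def rep88 : SpaceData where
  p := ⟨183106847263726, 1, 2, 3, 0, 0, 2, 6, 0, 4, 0, 6,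
  [3, 4, 0, 4, 3, 1, 4, 1, 3, 4, 0, 4, 3, 3], [[0, 2, 5, 1, 5, 2, 2, 5], [0, 2, 5, 1], [0, 2, 5, 1, 5, 2, 2, 5, 1, 5, 2, 0], [1, 3, 1], [1, 5, 1], [5, 3, 4, 0, 4, 3, 5], [5, 0, 5]], [(1, 1), (1, 3), (1, 5), (1, 7), (3, 6)]⟩
  vals := [(0, 4), (1, 9), (2, 336), (6, 54), (8, 125)]

def rep89 : SpaceData where
  p := ⟨147931067206126, 1, 2, 3, 0, 0, 2, 6, 0, 4, 0, 6,
  [3, 4, 1, 4, 3, 1, 5, 1, 3, 4, 1, 4, 3, 3], [[0, 3, 3, 4, 1, 4, 3, 4], [0, 3, 3, 0], [0, 5, 0, 5, 2, 5], [4, 0, 4], [4, 3, 4], [1, 3, 4, 1, 4, 3, 1], [1, 4, 1]], [(1, 1), (1, 3), (1, 5), (1, 7), (5, 4)]⟩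
  vals := [(0, 4), (1, 9), (2, 336), (6, 54), (8, 25), (9, 90), (10, 228), (11, 4536)]

def rep90 : SpaceData where
  p := ⟨186396639164190, 1, 2, 3, 0, 0, 2, 4, 0, 3, 2, 8,
  [2, 4, 3, 4, 1, 1, 4, 0, 3, 1, 4, 0], [[4], [0, 2, 2], [3, 4, 1, 1, 4, 0, 5, 2], [3, 4, 1, 1, 1, 4, 0, 2], [3, 4, 1, 5, 1, 4, 0, 2], [3, 1, 5, 0, 2, 5, 2]], [(1, 1), (1, 7), (3, 3), (3, 6), (5, 4)]⟩
  vals := [(0, 4), (1, 9), (2, 240), (4, 1248), (6, 54), (10, 132), (13, 1080), (15, 400)]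

def rep91 : SpaceData where
  p := ⟨186413823227678, 0, 1, 2, 5, 1, 5, 2, 0, 2, 0, 10,
  [0, 3, 5, 5, 1, 4, 1, 2, 5, 2], [[2, 0, 3], [2, 4, 4], [4, 2, 1, 5], [5, 1, 2, 5], [4, 3, 4, 1, 5]], [(1, 1), (1, 3), (1, 5), (2, 0), (2, 4)]⟩
  vals := [(0, 4), (1, 9), (2, 240), (4, 1152), (6, 54), (9, 252), (10, 132), (15, 400)]

def rep92 : SpaceData where
  p := ⟨186405231195934, 1, 2, 3, 0, 0, 2, 6, 0, 3, 2, 6,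
  [2, 4, 1, 1, 4, 3, 4, 0, 3, 1, 4, 3, 4, 0], [[4, 3, 4], [0, 2, 2], [4, 1, 1, 4, 3, 4, 0, 5], [4, 1, 1, 4], [4, 1, 5, 2], [3, 1, 5, 2, 5, 0, 4]], [(1, 1), (1, 3), (1, 5), (1, 7), (5, 4)]⟩
  vals := [(0, 4), (1, 9), (2, 240), (4, 1056), (6, 54), (9, 90), (14, 441), (15, 400)]

def rep93 : SpaceData where
  p := ⟨151212267042590, 1, 2, 3, 0, 0, 2, 4, 0, 3, 2, 8,
  [2, 1, 5, 0, 0, 5, 2, 4, 3, 1, 4, 0], [[4], [3, 4, 0, 3, 1], [3, 0, 0, 3, 1], [3, 0, 5, 2], [3, 1, 4, 0, 2, 1, 5, 0, 2], [3, 1, 4, 0, 4, 3, 1]], [(1, 1), (1, 7), (0, 2), (4, 1), (4, 0)]⟩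
  vals := [(0, 4), (1, 9), (2, 240), (4, 1248), (6, 54), (10, 132), (13, 960), (15, 400)]

def rep94 : SpaceData where
  p := ⟨151229719542558, 0, 2, 3, 1, 1, 4, 2, 0, 2, 0, 10,
  [0, 5, 0, 3, 1, 2, 5, 2, 4, 4], [[4, 4, 0, 5, 5], [4, 4, 2, 1, 5], [5, 2, 4], [5, 1, 2], [3, 4, 1, 5]], [(1, 1), (1, 5), (1, 7), (2, 0), (2, 1)]⟩
  vals := [(0, 4), (1, 9), (2, 240), (4, 1152), (6, 54), (9, 90), (10, 132), (14, 441), (15, 400)]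

def rep95 : SpaceData where
  p := ⟨117135998580526, 1, 2, 3, 0, 0, 2, 4, 0, 4, 0, 8,
  [1, 4, 3, 3, 4, 0, 2, 5, 0, 0, 5, 3], [[0, 2], [0, 2, 5, 0, 0, 5], [0, 2, 5, 0, 5, 2, 5], [4, 3, 3, 4], [5, 1, 4, 3, 5]], [(1, 1), (1, 3), (1, 5), (0, 0), (0, 6)]⟩
  vals := [(0, 8), (1, 9), (2, 288), (20, 14)]

def rep96 : SpaceData where
  p := ⟨187504742823726, 1, 2, 3, 0, 0, 4, 2, 0, 2, 0, 10,
  [2, 2, 4, 1, 2, 1, 5, 2, 5, 0], [[0, 2, 2], [0, 3, 0, 5], [0, 3, 1, 4], [0, 3, 5, 2], [5, 2, 5]], [(1, 1), (1, 3), (1, 5), (1, 7), (0, 6)]⟩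
  vals := [(0, 4), (1, 9), (2, 240), (6, 54), (10, 132), (15, 500)]

def rep98 : SpaceData where
  p := ⟨111619947419614, 1, 2, 3, 0, 2, 4, 2, 0, 2, 0, 10,
  [0, 5, 1, 4, 3, 1, 2, 0, 3, 4], [[4, 3, 4, 0, 5, 2, 5], [4, 3, 4, 2, 0, 5], [0], [4, 1, 5, 2], [4, 3, 1, 2]], [(1, 3), (1, 5), (5, 5), (5, 6), (3, 3)]⟩
  vals := [(0, 4), (1, 9), (2, 144), (6, 72), (15, 400)]

def rep99 : SpaceData where
  p := ⟨111611357517790, 1, 2, 3, 0, 2, 4, 2, 0, 2, 0, 10,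
  [0, 5, 1, 4, 3, 0, 2, 1, 3, 4], [[4, 3, 0, 2, 5], [4, 3, 5, 2], [0], [4, 1, 5, 0, 2], [4, 1, 3, 0, 2]], [(1, 3), (1, 5), (5, 5), (5, 6), (3, 6)]⟩
  vals := [(0, 4), (1, 9), (2, 144), (6, 72), (15, 800)]

def rep100 : SpaceData where
  p := ⟨181980101696478, 1, 2, 3, 0, 0, 2, 5, 0, 3, 2, 7,
  [2, 1, 5, 2, 0, 4, 1, 4, 3, 5, 2, 0, 4], [[0, 2], [0, 4, 2, 5], [1, 5, 2, 0], [1, 5, 5, 2, 0, 4, 1], [1, 3, 5, 2, 0, 4, 1], [0, 5, 1, 3, 4, 0, 5]], [(1, 1), (1, 3), (1, 7), (3, 3), (3, 6)]⟩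
  vals := [(0, 4), (1, 9), (2, 144), (4, 960), (6, 54), (14, 1029)]

def rep102 : SpaceData where
  p := ⟨147903692724718, 1, 2, 3, 0, 0, 4, 3, 0, 2, 0, 9,
  [2, 0, 2, 5, 2, 1, 4, 1, 3, 0, 4], [[4, 2, 0, 2, 1], [4, 1, 3, 3, 5], [1, 2], [4, 2, 5, 2, 1], [3, 4, 1]], [(1, 1), (1, 3), (1, 5), (5, 5), (0, 2)]⟩
  vals := [(0, 4), (1, 9), (2, 144), (4, 1056), (6, 54), (9, 252), (10, 132), (15, 400)]

def rep103 : SpaceData where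
  p := ⟨147895102822894, 1, 2, 3, 0, 0, 4, 5, 0, 2, 0, 7,
  [2, 5, 2, 0, 2, 1, 4, 1, 3, 4, 3, 0, 4], [[4, 2, 5, 2, 0, 2], [4, 2, 1], [4, 1, 3, 4, 3, 0, 2], [4, 1, 3, 4, 3, 5, 2], [4, 1, 3, 4, 3, 3, 0], [1, 2, 5, 2], [1, 4, 1]], [(1, 1), (1, 3), (1, 5), (1, 7), (0, 6)]⟩
  vals := [(0, 4), (1, 9), (2, 144), (4, 960), (6, 54), (9, 90), (10, 132), (14, 441)]

def rep104 : SpaceData where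
  p := ⟨183079613324270, 1, 2, 3, 0, 0, 4, 4, 0, 2, 0, 8,
  [2, 5, 0, 2, 1, 2, 5, 0, 5, 1, 3, 4], [[0, 4, 2, 5], [0, 4, 1, 4, 3, 0], [3, 1], [1, 5, 0, 5], [1, 3, 0, 5], [4, 1, 2, 5, 0, 5]], [(1, 1), (1, 3), (1, 7), (3, 3), (5, 7)]⟩
  vals := [(0, 8), (1, 9), (2, 192), (15, 1100), (20, 14)]

def rep105 : SpaceData where
  p := ⟨147895241234926, 0, 1, 2, 4, 0, 5, 3, 0, 2, 0, 9,
  [0, 4, 3, 3, 0, 5, 0, 3, 5, 3, 0], [[2, 5, 0, 4], [2, 5, 1, 2, 4], [3, 0, 3], [5, 3, 1, 2, 2], [5, 3, 5, 2]], [(1, 1), (1, 5), (1, 7), (5, 5), (3, 7)]⟩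
  vals := [(0, 4), (1, 9), (2, 144), (4, 1056), (6, 54), (14, 1029), (15, 600)]

def rep106 : SpaceData where
  p := ⟨147895373355502, 1, 2, 3, 0, 0, 2, 4, 0, 4, 0, 8,
  [5, 0, 3, 1, 3, 4, 2, 1, 4, 0, 4, 3], [[0, 3, 5, 0], [4, 0, 2], [4, 3, 0], [3, 4, 1], [1, 5, 0, 3, 1]], [(1, 1), (1, 3), (1, 5), (1, 7), (5, 5)]⟩
  vals := [(0, 8), (1, 9), (2, 192), (15, 1000), (20, 14)]

def rep109 : SpaceData where
  p := ⟨637992490375, 0, 1, 3, 2, 0, 3, 5, 0, 2, 0, 7,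
  [0, 4, 3, 5, 2, 1, 2, 0, 5, 2, 1, 2, 4], [[1, 3, 0, 3, 4, 2, 0], [1, 5, 3, 0, 3, 4, 3], [4, 3], [1, 3, 0, 3, 0, 3, 4, 3], [1, 3, 5, 3, 0, 3, 4], [2, 5, 2, 1, 3, 0, 3, 4], [5, 2, 1, 2, 0, 3]], [(1, 1), (1, 7), (1, 5), (5, 5), (0, 6)]⟩
  vals := [(0, 4), (1, 27), (2, 528), (4, 960)]

def rep110 : SpaceData where
  p := ⟨1187748303751, 0, 1, 3, 2, 0, 3, 3, 0, 2, 0, 9,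
  [0, 4, 3, 0, 3, 5, 2, 0, 5, 2, 4], [[1, 3, 4, 0, 3], [1, 5, 3], [1, 3, 3, 4], [2, 1, 2, 5], [2, 1, 5, 3, 4], [5, 2, 0, 5]], [(1, 1), (1, 3), (1, 7), (1, 5), (3, 7)]⟩
  vals := [(0, 4), (1, 27), (2, 624), (3, 78), (6, 54), (7, 81)]

def rep111 : SpaceData where
  p := ⟨71006736668047, 1, 2, 3, 0, 0, 4, 4, 0, 2, 0, 8,
  [2, 0, 5, 1, 4, 3, 1, 2, 0, 5, 3, 4], [[0, 3, 4, 2, 0, 5, 2, 1], [0, 3, 4, 2, 2, 0, 5, 1], [0, 3, 4, 1, 2, 0, 5, 1], [4, 1], [0, 4, 1, 3, 5, 2], [0, 3, 1, 2]], [(1, 1), (1, 5), (5, 5), (5, 7), (3, 3)]⟩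
  vals := [(0, 8), (1, 27), (2, 576), (19, 64)]

def rep112 : SpaceData where
  p := ⟨71556492481423, 0, 1, 3, 2, 0, 3, 3, 0, 2, 0, 9,
  [0, 3, 5, 2, 0, 4, 3, 0, 5, 2, 4], [[2, 4, 0, 3], [2, 4, 3, 4, 2, 5], [2, 4, 3, 0], [5, 2, 0], [4, 3, 0, 5], [4, 3, 5, 0]], [(1, 1), (1, 3), (1, 7), (3, 3), (5, 6)]⟩
  vals := [(0, 4), (1, 27), (2, 624), (3, 24), (6, 54), (7, 81)]

/-- Two lists of values of statistics disagree. -/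
def differ (L M : List (ℕ × ℕ)) : Bool := L.any fun e => M.any fun e' => Nat.beq e.1 e'.1 && !Nat.beq e.2 e'.2

namespace SpaceData

/-- The gluing pattern. -/
def gl (A : SpaceData) : Gluing := A.p.gl A.ok

theorem admCount_stat (A : SpaceData) {e : ℕ × ℕ} (he : e ∈ A.vals) :
    admCount (statOf e.1).1.El (SizeCond (statOf e.1).2) A.gl = e.2 := by
  have h := List.all_eq_true.1 A.hvals e he
  rw [Nat.beq_eq] at h
  rw [← h, ← (statOf e.1).1.card_good A.p (statOf e.1).2 A.ev.1 A.ev.2]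
  exact A.p.admCount_gl A.ok _

theorem not_homeomorphic {A B : SpaceData} (h : differ A.vals B.vals = true) :
    ¬Nonempty (XSpace A.gl ≃ₜ XSpace B.gl) := by
  rintro ⟨f⟩
  obtain ⟨e, he, h⟩ := List.any_eq_true.1 h
  obtain ⟨e', he', h⟩ := List.any_eq_true.1 h
  rw [Bool.and_eq_true, Nat.beq_eq, Bool.not_eq_true'] at h
  refine Bool.eq_false_iff.1 h.2 ?_
  rw [Nat.beq_eq]
  rw [← A.admCount_stat he, ← B.admCount_stat he', h.1]
  exact admCount_eq _ (A.p.oneVertex A.ok) (A.p.noFlip A.ok) (B.p.oneVertex B.ok) (B.p.noFlip B.ok) f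

end SpaceData

/-- The pairwise non-homeomorphic quotient spaces. -/
def spaceReps : List SpaceData :=
  [rep0, rep1, rep3, rep4, rep5, rep6, rep7, rep8, rep13, rep14, rep19, rep20, rep21, rep22, rep23, 
rep30, rep31, rep32, rep33, rep34, rep35, rep36, rep37, rep38, rep39, rep40, rep51, rep52, rep53, 
rep54, rep55, rep56, rep57, rep58, rep59, rep60, rep61, rep62, rep63, rep64, rep65, rep66, rep71, 
rep72, rep73, rep74, rep75, rep76, rep77, rep78, rep79, rep80, rep81, rep82, rep83, rep84, rep85, 
rep86, rep88, rep89, rep90, rep91, rep92, rep93, rep94, rep95, rep96, rep98, rep99, rep100, rep102, 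
rep103, rep104, rep105, rep106, rep109, rep110, rep111, rep112]

theorem differ_spaceReps : (spaceReps.map SpaceData.vals).Pairwise fun L M => differ L M = true := by
  decide +kernel

theorem spaceReps_pairwise : spaceReps.Pairwise fun A B => ¬Nonempty (XSpace A.gl ≃ₜ XSpace B.gl) :=
  (List.pairwise_map.1 differ_spaceReps).imp SpaceData.not_homeomorphic

/-! ### Combinatorial equivalence of gluing patterns -/

theorem symMapFace_symm (ρ : Equiv.Perm (Fin 3)) (ε : Fin 3 → Bool) (F : OctFace) :
    symMapFace ρ⁻¹ (fun i => ε (ρ⁻¹ i)) (symMapFace ρ ε F) = F := by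
  ext j
  simp [symMapFace]

theorem symMapFace_symm' (ρ : Equiv.Perm (Fin 3)) (ε : Fin 3 → Bool) (F : OctFace) :
    symMapFace ρ ε (symMapFace ρ⁻¹ (fun i => ε (ρ⁻¹ i)) F) = F := by
  ext j
  simp [symMapFace]

/-- Conjugation by a symmetry of the octahedron carries one gluing pattern to the other. -/
def SymData (g h : Gluing) (ρ : Equiv.Perm (Fin 3)) (ε : Fin 3 → Bool) : Prop :=
  (∀ F, h.face (symMapFace ρ ε F) = symMapFace ρ ε (g.face F)) ∧
    (∀ F, h.axisMap (symMapFace ρ ε F) = ρ * g.axisMap F * ρ⁻¹)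

theorem SymData.symm {g h : Gluing} {ρ : Equiv.Perm (Fin 3)} {ε : Fin 3 → Bool} (H : SymData g h ρ ε) :
    SymData h g ρ⁻¹ (fun i => ε (ρ⁻¹ i)) := by
  refine ⟨fun F => ?_, fun F => ?_⟩
  · rw [← symMapFace_symm ρ ε (g.face _), ← H.1, symMapFace_symm']
  · have := H.2 (symMapFace ρ⁻¹ (fun i => ε (ρ⁻¹ i)) F)
    rw [symMapFace_symm'] at this
    rw [this]
    group

theorem EquivGluing.symm {g h : Gluing} (H : EquivGluing g h) : EquivGluing h g := by
  obtain ⟨ρ, ε, H⟩ := H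
  exact ⟨_, _, SymData.symm H⟩

theorem EquivGluing.refl (g : Gluing) : EquivGluing g g :=
  have e : ∀ F, symMapFace 1 (fun _ => false) F = F := fun F => by ext j; simp [symMapFace]
  ⟨1, fun _ => false, fun F => by rw [e, e], fun F => by rw [e]; simp⟩

theorem EquivGluing.trans {g h k : Gluing} (H : EquivGluing g h) (H' : EquivGluing h k) : EquivGluing g k := by
  obtain ⟨ρ, ε, H⟩ := H
  obtain ⟨ρ', ε', H'⟩ := H'
  have e : ∀ F, symMapFace (ρ' * ρ) (fun i => Bool.xor (ε i) (ε' (ρ i))) F = symMapFace ρ' ε' (symMapFace ρ ε F) := by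
    intro F
    ext j
    simp [symMapFace]
  refine ⟨ρ' * ρ, fun i => Bool.xor (ε i) (ε' (ρ i)), fun F => ?_, fun F => ?_⟩
  · rw [e, e, H'.1, H.1]
  · rw [e, H'.2, H.2]
    group

theorem orbit_eq_iff {g h : Gluing} : orbit g = orbit h ↔ EquivGluing g h := by
  constructor
  · intro H
    have : h ∈ orbit g := by rw [H]; exact EquivGluing.refl h
    exact this
  · intro H
    ext k
    exact ⟨fun hk => H.symm.trans hk, fun hk => H.trans hk⟩

theorem sgn_xor_not (a b : Bool) : sgn (Bool.xor a b) = sgn (!b) * sgn a := by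
  cases a <;> cases b <;> norm_num [sgn]

/-- The action of a symmetry on the points of the solid octahedron. -/
def symPoint (ρ : Equiv.Perm (Fin 3)) (ε : Fin 3 → Bool) : SolidOcta → SolidOcta :=
  smap (ρ⁻¹, fun j => !ε (ρ⁻¹ j))

theorem symPoint_symm (ρ : Equiv.Perm (Fin 3)) (ε : Fin 3 → Bool) (x : SolidOcta) :
    symPoint ρ⁻¹ (fun i => ε (ρ⁻¹ i)) (symPoint ρ ε x) = x := by
  apply Subtype.ext
  ext j
  change sgn (!ε (ρ⁻¹ (ρ⁻¹⁻¹ j))) * (sgn (!ε (ρ⁻¹ (ρ⁻¹⁻¹ j))) * (x : Fin 3 → ℝ) (ρ⁻¹ (ρ⁻¹⁻¹ j))) = _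
  rw [← mul_assoc, sgn_mul_self, one_mul]
  simp

theorem SymData.glueRel {g h : Gluing} {ρ : Equiv.Perm (Fin 3)} {ε : Fin 3 → Bool} (H : SymData g h ρ ε)
    {x y : SolidOcta} (hxy : glueRel g x y) : glueRel h (symPoint ρ ε x) (symPoint ρ ε y) := by
  obtain ⟨F, hx, rfl⟩ := (glueRel_iff g x y).1 hxy
  have e : ∀ j, sgn (symMapFace ρ ε F j) * (symPoint ρ ε x : Fin 3 → ℝ) j =
      sgn (F (ρ⁻¹ j)) * (x : Fin 3 → ℝ) (ρ⁻¹ j) := by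
    intro j
    change sgn (Bool.xor _ _) * (sgn (!ε (ρ⁻¹ j)) * _) = _
    rw [sgn_xor_not, mul_mul_mul_comm, ← mul_assoc, sgn_mul_self, one_mul]
  refine (glueRel_iff h _ _).2 ⟨symMapFace ρ ε F, ⟨fun i => ?_, ?_⟩, ?_⟩
  · rw [e]
    exact hx.1 _
  · rw [Finset.sum_congr rfl fun j _ => e j, ← hx.2]
    exact Equiv.sum_comp ρ⁻¹ fun i => sgn (F i) * (x : Fin 3 → ℝ) i
  · apply Subtype.ext
    ext j
    change sgn (!ε (ρ⁻¹ j)) * (sgn (g.face F (ρ⁻¹ j)) * (sgn (F ((g.axisMap F)⁻¹ (ρ⁻¹ j))) *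
      (x : Fin 3 → ℝ) ((g.axisMap F)⁻¹ (ρ⁻¹ j)))) = sgn (h.face (symMapFace ρ ε F) j) *
        (sgn (symMapFace ρ ε F ((h.axisMap (symMapFace ρ ε F))⁻¹ j)) *
          (symPoint ρ ε x : Fin 3 → ℝ) ((h.axisMap (symMapFace ρ ε F))⁻¹ j))
    rw [e, H.1, H.2]
    simp only [mul_inv_rev, inv_inv, Equiv.Perm.mul_apply, Equiv.Perm.inv_def, Equiv.apply_symm_apply]
    rw [← mul_assoc]
    congr 1
    exact (sgn_xor_not _ _).symm

theorem SymData.glueSetoid {g h : Gluing} {ρ : Equiv.Perm (Fin 3)} {ε : Fin 3 → Bool} (H : SymData g h ρ ε)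
    {x y : SolidOcta} (hxy : glueSetoid g x y) : glueSetoid h (symPoint ρ ε x) (symPoint ρ ε y) := by
  induction hxy with
  | rel x y hr => exact Relation.EqvGen.rel _ _ (H.glueRel hr)
  | refl x => exact Setoid.refl' _ _
  | symm x y _ ih => exact Setoid.symm' _ ih
  | trans x y z _ _ ih1 ih2 => exact Setoid.trans' _ ih1 ih2

theorem EquivGluing.homeo {g h : Gluing} (H : EquivGluing g h) : Nonempty (XSpace g ≃ₜ XSpace h) := by
  obtain ⟨ρ, ε, H⟩ := H
  have H : SymData g h ρ ε := H
  refine ⟨⟨⟨Quotient.map _ fun _ _ => H.glueSetoid, Quotient.map _ fun _ _ => H.symm.glueSetoid, fun x => ?_,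
    fun x => ?_⟩, ?_, ?_⟩⟩
  · induction x using Quotient.inductionOn with
    | h x => simp only [Quotient.map_mk, symPoint_symm]
  · induction x using Quotient.inductionOn with
    | h x =>
      simp only [Quotient.map_mk]
      congr 1
      have := symPoint_symm ρ⁻¹ (fun i => ε (ρ⁻¹ i)) x
      simpa using this
  · exact (continuous_smap _).quotient_map' fun _ _ => H.glueSetoid
  · exact (continuous_smap _).quotient_map' fun _ _ => H.symm.glueSetoid

/-! ### Invariance of the vertex-link data under combinatorial equivalence -/

theorem symMapFace_apply (ρ : Equiv.Perm (Fin 3)) (ε : Fin 3 → Bool) (F : OctFace) (i : Fin 3) :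
    symMapFace ρ ε F (ρ i) = Bool.xor (F i) (ε i) := by
  simp [symMapFace]

/-- The action of a symmetry of the octahedron on its vertices. -/
def symVert (ρ : Equiv.Perm (Fin 3)) (ε : Fin 3 → Bool) : OctVertex ≃ OctVertex where
  toFun v := (ρ v.1, Bool.xor v.2 (ε v.1))
  invFun v := (ρ⁻¹ v.1, Bool.xor v.2 (ε (ρ⁻¹ v.1)))
  left_inv v := by simp
  right_inv v := by simp

/-- The action of a symmetry of the octahedron on edge-ends. -/
def symEnd (ρ : Equiv.Perm (Fin 3)) (ε : Fin 3 → Bool) : EdgeEnd ≃ EdgeEnd where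
  toFun p := ⟨(symVert ρ ε p.1.1, symVert ρ ε p.1.2), fun h => p.2 (ρ.injective h)⟩
  invFun p := ⟨((symVert ρ ε).symm p.1.1, (symVert ρ ε).symm p.1.2), fun h => p.2 (ρ⁻¹.injective h)⟩
  left_inv p := by simp
  right_inv p := by simp

theorem symVert_symm (ρ : Equiv.Perm (Fin 3)) (ε : Fin 3 → Bool) :
    (symVert ρ ε).symm = symVert ρ⁻¹ (fun i => ε (ρ⁻¹ i)) := by
  ext v <;> rfl

theorem symEnd_symm (ρ : Equiv.Perm (Fin 3)) (ε : Fin 3 → Bool) :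
    (symEnd ρ ε).symm = symEnd ρ⁻¹ (fun i => ε (ρ⁻¹ i)) := by
  ext v <;> rfl

namespace SymData

variable {g h : Gluing} {ρ : Equiv.Perm (Fin 3)} {ε : Fin 3 → Bool}

theorem symVert_face (_ : SymData g h ρ ε) (F : OctFace) (i : Fin 3) :
    symVert ρ ε (i, F i) = (ρ i, symMapFace ρ ε F (ρ i)) := by
  rw [symMapFace_apply]
  rfl

theorem symVert_image (H : SymData g h ρ ε) (F : OctFace) (i : Fin 3) :
    symVert ρ ε (g.axisMap F i, g.face F (g.axisMap F i)) =
      (h.axisMap (symMapFace ρ ε F) (ρ i),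
        h.face (symMapFace ρ ε F) (h.axisMap (symMapFace ρ ε F) (ρ i))) := by
  have e : h.axisMap (symMapFace ρ ε F) (ρ i) = ρ (g.axisMap F i) := by
    rw [H.2]; simp
  rw [e, H.1, H.symVert_face]

theorem vtxRel (H : SymData g h ρ ε) {v w : OctVertex} (hr : vtxRel g v w) :
    vtxRel h (symVert ρ ε v) (symVert ρ ε w) := by
  obtain ⟨F, i, rfl, rfl⟩ := hr
  exact ⟨symMapFace ρ ε F, ρ i, H.symVert_face F i, H.symVert_image F i⟩

theorem endRel (H : SymData g h ρ ε) {v w : EdgeEnd} (hr : endRel g v w) :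
    endRel h (symEnd ρ ε v) (symEnd ρ ε w) := by
  obtain ⟨F, i, j, hij, h1, h2⟩ := hr
  refine ⟨symMapFace ρ ε F, ρ i, ρ j, fun e => hij (ρ.injective e), ?_, ?_⟩
  · change (symVert ρ ε v.1.1, symVert ρ ε v.1.2) = _
    rw [h1, H.symVert_face, H.symVert_face]
  · change (symVert ρ ε w.1.1, symVert ρ ε w.1.2) = _
    rw [h2, H.symVert_image, H.symVert_image]

theorem vtxSetoid (H : SymData g h ρ ε) {v w : OctVertex} (hr : vtxSetoid g v w) :
    vtxSetoid h (symVert ρ ε v) (symVert ρ ε w) := by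
  induction hr with
  | rel x y hr => exact Relation.EqvGen.rel _ _ (H.vtxRel hr)
  | refl x => exact Setoid.refl' _ _
  | symm x y _ ih => exact Setoid.symm' _ ih
  | trans x y z _ _ ih1 ih2 => exact Setoid.trans' _ ih1 ih2

theorem endSetoid (H : SymData g h ρ ε) {v w : EdgeEnd} (hr : endSetoid g v w) :
    endSetoid h (symEnd ρ ε v) (symEnd ρ ε w) := by
  induction hr with
  | rel x y hr => exact Relation.EqvGen.rel _ _ (H.endRel hr)
  | refl x => exact Setoid.refl' _ _
  | symm x y _ ih => exact Setoid.symm' _ ih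
  | trans x y z _ _ ih1 ih2 => exact Setoid.trans' _ ih1 ih2

theorem vtxSetoid_iff (H : SymData g h ρ ε) (v w : OctVertex) :
    _root_.vtxSetoid g v w ↔ _root_.vtxSetoid h (symVert ρ ε v) (symVert ρ ε w) := by
  refine ⟨H.vtxSetoid, fun hr => ?_⟩
  have := H.symm.vtxSetoid hr
  rwa [← symVert_symm, Equiv.symm_apply_apply, Equiv.symm_apply_apply] at this

theorem endSetoid_iff (H : SymData g h ρ ε) (v w : EdgeEnd) :
    _root_.endSetoid g v w ↔ _root_.endSetoid h (symEnd ρ ε v) (symEnd ρ ε w) := by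
  refine ⟨H.endSetoid, fun hr => ?_⟩
  have := H.symm.endSetoid hr
  rwa [← symEnd_symm, Equiv.symm_apply_apply, Equiv.symm_apply_apply] at this

/-- The bijection between vertex classes. -/
def vtxClass (H : SymData g h ρ ε) : Quotient (_root_.vtxSetoid g) ≃ Quotient (_root_.vtxSetoid h) :=
  Quotient.congr (symVert ρ ε) H.vtxSetoid_iff

/-- The bijection between classes of edge-ends. -/
def endClass (H : SymData g h ρ ε) : Quotient (_root_.endSetoid g) ≃ Quotient (_root_.endSetoid h) :=
  Quotient.congr (symEnd ρ ε) H.endSetoid_iff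

theorem classSize_eq (H : SymData g h ρ ε) (c : Quotient (_root_.vtxSetoid g)) :
    classSize h (H.vtxClass c) = classSize g c := by
  refine (Nat.card_congr ((symVert ρ ε).subtypeEquiv fun v => ?_)).symm
  change _ ↔ H.vtxClass (Quotient.mk _ v) = _
  exact H.vtxClass.injective.eq_iff.symm

theorem cornerCount_eq (H : SymData g h ρ ε) (c : Quotient (_root_.vtxSetoid g)) :
    cornerCount h (H.vtxClass c) = cornerCount g c := by
  refine (Nat.card_congr (H.endClass.subtypeEquiv fun q => ?_)).symm
  refine (symEnd ρ ε).exists_congr fun p => and_congr ?_ ?_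
  · change _ ↔ H.endClass (Quotient.mk _ p) = _
    exact H.endClass.injective.eq_iff.symm
  · change _ ↔ H.vtxClass (Quotient.mk _ p.1.1) = _
    exact H.vtxClass.injective.eq_iff.symm

theorem linkChi_eq (H : SymData g h ρ ε) (c : Quotient (_root_.vtxSetoid g)) :
    linkChi h (H.vtxClass c) = linkChi g c := by
  unfold linkChi
  rw [H.classSize_eq, H.cornerCount_eq]

end SymData

theorem EquivGluing.linksGenusTwo {g h : Gluing} (H : EquivGluing g h) (hg : LinksGenusTwo g) :
    LinksGenusTwo h := by
  obtain ⟨ρ, ε, H⟩ := H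
  have H : SymData g h ρ ε := H
  refine ⟨fun c => ?_, ?_⟩
  · rw [← H.vtxClass.apply_symm_apply c, H.linkChi_eq]
    exact hg.1 _
  · rw [← hg.2]
    exact (Nat.card_congr (H.vtxClass.subtypeEquiv fun c => by rw [H.linkChi_eq])).symm

/-! ### Computing classes of a finite equivalence relation -/

/-- Merge the classes of the labels `a` and `b`. -/
def relabel (a b : ℕ) (L : List ℕ) : List ℕ :=
  bif Nat.beq a b then L else L.map fun x => bif Nat.beq x b then a else x

/-- The label of an element. -/
def lab (L : List ℕ) (x : ℕ) : ℕ := L.getD x 0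

/-- Merge the classes of two elements. -/
def merge (L : List ℕ) (p : ℕ × ℕ) : List ℕ := relabel (lab L p.1) (lab L p.2) L

/-- The labelling of the elements below `n` by the classes of the relation generated by a list of pairs. -/
def labels (n : ℕ) (ps : List (ℕ × ℕ)) : List ℕ := ps.foldl merge (List.range n)

theorem lab_relabel {n a b : ℕ} {L : List ℕ} (hL : L.length = n) {x : ℕ} (hx : x < n) :
    lab (relabel a b L) x = if lab L x = b then a else lab L x := by
  subst hL
  unfold relabel
  cases h : Nat.beq a b
  · rw [cond_false]
    simp only [lab, List.getD_eq_getElem?_getD, List.getElem?_map, List.getElem?_eq_getElem hx, Option.map_some,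
      Option.getD_some]
    by_cases h' : L[x] = b
    · rw [if_pos h', h', Nat.beq_refl, cond_true]
    · rw [if_neg h', Bool.eq_false_iff.2 (fun e => h' (Nat.eq_of_beq_eq_true e)), cond_false]
  · have := Nat.eq_of_beq_eq_true h
    subst this
    split <;> simp_all

theorem length_relabel (a b : ℕ) (L : List ℕ) : (relabel a b L).length = L.length := by
  unfold relabel
  cases Nat.beq a b <;> simp

theorem labels_spec (n : ℕ) (ps : List (ℕ × ℕ)) (h : ∀ p ∈ ps, p.1 < n ∧ p.2 < n) :
    (labels n ps).length = n ∧ (∀ x < n, lab (labels n ps) x < n) ∧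
    (∀ x < n, ∀ y < n, lab (labels n ps) x = lab (labels n ps) y →
      Relation.EqvGen (fun a b => (a, b) ∈ ps) x y) ∧
    (∀ p ∈ ps, lab (labels n ps) p.1 = lab (labels n ps) p.2) := by
  induction ps using List.reverseRecOn with
  | nil =>
    refine ⟨by simp [labels], fun x hx => ?_, fun x hx y hy e => ?_, by simp⟩
    · simp [labels, lab, hx]
    · simp only [labels, lab, List.foldl_nil, List.getD_eq_getElem?_getD, List.getElem?_range hx,
        List.getElem?_range hy, Option.getD_some] at e
      subst e
      exact Relation.EqvGen.refl _
  | append_singleton ps p ih =>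
    obtain ⟨h1, h2, h3, h4⟩ := ih fun q hq => h q (by simp [hq])
    obtain ⟨ha, hb⟩ := h p (by simp)
    have e : labels n (ps ++ [p]) = merge (labels n ps) p := by simp [labels]
    rw [e]
    set L := labels n ps
    have hl : ∀ x < n, lab (merge L p) x = if lab L x = lab L p.2 then lab L p.1 else lab L x :=
      fun x hx => lab_relabel h1 hx
    have mono : ∀ {x y}, Relation.EqvGen (fun a b => (a, b) ∈ ps) x y →
        Relation.EqvGen (fun a b => (a, b) ∈ ps ++ [p]) x y :=
      fun hxy => hxy.mono fun _ _ hab => by simp [hab]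
    have hp : Relation.EqvGen (fun a b => (a, b) ∈ ps ++ [p]) p.1 p.2 :=
      Relation.EqvGen.rel _ _ (by simp)
    refine ⟨by rw [merge, length_relabel, h1], fun x hx => ?_, fun x hx y hy hxy => ?_, fun q hq => ?_⟩
    · rw [hl x hx]
      split
      · exact h2 _ ha
      · exact h2 _ hx
    · rw [hl x hx, hl y hy] at hxy
      split at hxy <;> split at hxy
      · rename_i e1 e2
        exact mono (h3 x hx y hy (e1.trans e2.symm))
      · rename_i e1 e2
        exact (mono (h3 x hx _ hb e1)).trans _ _ _ (hp.symm.trans _ _ _ (mono (h3 _ ha y hy hxy)))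
      · rename_i e1 e2
        exact (mono (h3 x hx _ ha hxy)).trans _ _ _ (hp.trans _ _ _ (mono (h3 _ hb y hy e2.symm)))
      · exact mono (h3 x hx y hy hxy)
    · rw [hl _ (h q hq).1, hl _ (h q hq).2]
      rcases List.mem_append.1 hq with hq | hq
      · rw [h4 q hq]
      · rw [List.mem_singleton] at hq
        subst hq
        rw [if_pos rfl]
        split <;> rfl

section Encoding

variable {α : Type*} {num : α → ℕ} {r : α → α → Prop} {ps : List (ℕ × ℕ)} {n : ℕ}

theorem eqvGen_of_encoded (hinj : Function.Injective num)
    (h : ∀ p ∈ ps, ∃ v w, r v w ∧ num v = p.1 ∧ num w = p.2) {x y : ℕ}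
    (hxy : Relation.EqvGen (fun a b => (a, b) ∈ ps) x y) :
    x = y ∨ ∃ v w, Relation.EqvGen r v w ∧ num v = x ∧ num w = y := by
  induction hxy with
  | rel x y hr =>
    obtain ⟨v, w, hvw, e1, e2⟩ := h _ hr
    exact Or.inr ⟨v, w, Relation.EqvGen.rel _ _ hvw, e1, e2⟩
  | refl x => exact Or.inl rfl
  | symm x y _ ih =>
    rcases ih with rfl | ⟨v, w, hvw, e1, e2⟩
    · exact Or.inl rfl
    · exact Or.inr ⟨w, v, hvw.symm, e2, e1⟩
  | trans x y z _ _ ih1 ih2 =>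
    rcases ih1 with rfl | ⟨v, w, hvw, e1, e2⟩
    · exact ih2
    · rcases ih2 with rfl | ⟨v', w', hvw', e1', e2'⟩
      · exact Or.inr ⟨v, w, hvw, e1, e2⟩
      · have := hinj (e2.trans e1'.symm)
        subst this
        exact Or.inr ⟨v, w', hvw.trans _ _ _ hvw', e1, e2'⟩

theorem lab_eq_iff (hinj : Function.Injective num) (hlt : ∀ a, num a < n)
    (h : ∀ p ∈ ps, ∃ v w, r v w ∧ num v = p.1 ∧ num w = p.2)
    (h' : ∀ v w, r v w → (num v, num w) ∈ ps) (v w : α) :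
    lab (labels n ps) (num v) = lab (labels n ps) (num w) ↔ Relation.EqvGen r v w := by
  obtain ⟨-, -, h3, h4⟩ := labels_spec n ps fun p hp => by
    obtain ⟨v, w, -, e1, e2⟩ := h p hp
    rw [← e1, ← e2]
    exact ⟨hlt _, hlt _⟩
  constructor
  · intro e
    rcases eqvGen_of_encoded hinj h (h3 _ (hlt v) _ (hlt w) e) with e | ⟨v', w', hr, e1, e2⟩
    · rw [hinj e]
      exact Relation.EqvGen.refl _
    · rwa [← hinj e1, ← hinj e2]
  · intro hr
    induction hr with
    | rel x y hr => exact h4 _ (h' _ _ hr)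
    | refl x => rfl
    | symm x y _ ih => exact ih.symm
    | trans x y z _ _ ih1 ih2 => exact ih1.trans ih2

theorem lab_labels_lt (hlt : ∀ a, num a < n)
    (h : ∀ p ∈ ps, ∃ v w, r v w ∧ num v = p.1 ∧ num w = p.2) (v : α) : lab (labels n ps) (num v) < n :=
  (labels_spec n ps fun p hp => by
    obtain ⟨v, w, -, e1, e2⟩ := h p hp
    rw [← e1, ← e2]
    exact ⟨hlt _, hlt _⟩).2.1 _ (hlt v)

end Encoding

theorem card_eq_length_filter {α : Type*} (f : α → ℕ) (hf : Function.Injective f) (n : ℕ) (p : ℕ → Bool) (P : α → Prop)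
    (hlt : ∀ a, P a → f a < n) (h : ∀ m < n, p m = true ↔ ∃ a, P a ∧ f a = m) :
    Nat.card {a // P a} = ((List.range n).filter p).length := by
  have e : f '' {a | P a} = ((Finset.range n).filter fun m => p m = true : Finset ℕ) := by
    ext m
    simp only [mem_image, mem_ofPred_eq, Finset.coe_filter, Finset.mem_range]
    constructor
    · rintro ⟨a, ha, rfl⟩
      exact ⟨hlt a ha, (h _ (hlt a ha)).2 ⟨a, ha, rfl⟩⟩
    · rintro ⟨hm, hp⟩
      exact (h m hm).1 hp
  rw [← Set.coe_ofPred, ← Nat.card_image_of_injective hf, e]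
  rw [Nat.card_coe_set_eq, Set.ncard_coe_finset]
  simp only [Finset.card, Finset.filter, Finset.range, Multiset.range, Multiset.filter_coe, Multiset.coe_card]
  congr 2
  ext m
  simp

/-! ### Computing the vertex-link data of a code -/

/-- The generating identifications of vertices. -/
def vpairs (c : ℕ) : List (ℕ × ℕ) :=
  (List.range 8).flatMap fun f => (List.range 3).map fun i => (fvtx f i, cimg c f i)

/-- The generating identifications of edge-ends. -/
def epairs (c : ℕ) : List (ℕ × ℕ) :=
  (List.range 8).flatMap fun f => [(0, 1), (0, 2), (1, 0), (1, 2), (2, 0), (2, 1)].map fun e =>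
    (6 * fvtx f e.1 + fvtx f e.2, 6 * cimg c f e.1 + cimg c f e.2)

/-- The number of an edge-end. -/
def endNum (p : EdgeEnd) : ℕ := 6 * vertNum p.1.1 + vertNum p.1.2

theorem vertNum_injective : Function.Injective vertNum :=
  Function.LeftInverse.injective vertN_vertNum

theorem endNum_div (p : EdgeEnd) : endNum p / 6 = vertNum p.1.1 := by
  have := vertNum_lt p.1.2
  unfold endNum
  omega

theorem endNum_mod (p : EdgeEnd) : endNum p % 6 = vertNum p.1.2 := by
  have := vertNum_lt p.1.2
  unfold endNum
  omega

theorem endNum_injective : Function.Injective endNum := fun p q h =>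
  Subtype.ext (Prod.ext (vertNum_injective (by rw [← endNum_div, h, endNum_div]))
    (vertNum_injective (by rw [← endNum_mod, h, endNum_mod])))

theorem endNum_lt (p : EdgeEnd) : endNum p < 36 := by
  have h1 := vertNum_lt p.1.1
  have h2 := vertNum_lt p.1.2
  unfold endNum
  omega

theorem vertNum_div (v : OctVertex) : vertNum v / 2 = v.1.val := by
  revert v; decide

theorem exists_endNum {m : ℕ} (hm : m < 36) (h : m / 6 / 2 ≠ m % 6 / 2) : ∃ p, endNum p = m := by
  have h1 : vertNum (vertN (m / 6)) = m / 6 := vertNum_vertN (by omega)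
  have h2 : vertNum (vertN (m % 6)) = m % 6 := vertNum_vertN (by omega)
  refine ⟨⟨(vertN (m / 6), vertN (m % 6)), fun e => h ?_⟩, ?_⟩
  · rw [← h1, ← h2, vertNum_div, vertNum_div]
    exact congrArg _ e
  · change 6 * vertNum (vertN (m / 6)) + vertNum (vertN (m % 6)) = m
    rw [h1, h2]
    omega

section

variable {c : ℕ} (h : ValidCode c)

theorem vpairs_spec : ∀ p ∈ vpairs c, ∃ v w, vtxRel (gluingOf c h) v w ∧ vertNum v = p.1 ∧ vertNum w = p.2 := by
  intro p hp
  simp only [vpairs, List.mem_flatMap, List.mem_map, List.mem_range] at hp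
  obtain ⟨f, hf, i, hi, rfl⟩ := hp
  exact ⟨_, _, ⟨faceN f, ⟨i, hi⟩, rfl, rfl⟩, vertNum_mk f ⟨i, hi⟩, vertNum_vimg h hf ⟨i, hi⟩⟩

theorem mem_vpairs (v w : OctVertex) (hr : vtxRel (gluingOf c h) v w) : (vertNum v, vertNum w) ∈ vpairs c := by
  obtain ⟨F, i, rfl, rfl⟩ := hr
  rw [← faceN_faceNum F, vertNum_mk]
  simp only [vpairs, List.mem_flatMap, List.mem_map, List.mem_range]
  exact ⟨faceNum F, faceNum_lt F, i, i.2, Prod.ext rfl (vertNum_vimg h (faceNum_lt F) i).symm⟩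

theorem epairs_spec : ∀ p ∈ epairs c, ∃ v w, endRel (gluingOf c h) v w ∧ endNum v = p.1 ∧ endNum w = p.2 := by
  intro p hp
  simp only [epairs, List.mem_flatMap, List.mem_map, List.mem_range] at hp
  obtain ⟨f, hf, e, he, rfl⟩ := hp
  have hlt : e.1 < 3 ∧ e.2 < 3 ∧ e.1 ≠ e.2 := by
    revert he; revert e; decide
  have hij : (⟨e.1, hlt.1⟩ : Fin 3) ≠ ⟨e.2, hlt.2.1⟩ := fun e => hlt.2.2 (congrArg Fin.val e)
  refine ⟨⟨((⟨e.1, hlt.1⟩, faceN f _), (⟨e.2, hlt.2.1⟩, faceN f _)), hij⟩,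
    ⟨(vimg (gluingOf c h) (faceN f) ⟨e.1, hlt.1⟩, vimg (gluingOf c h) (faceN f) ⟨e.2, hlt.2.1⟩),
      fun e => hij (((gluingOf c h).axisMap (faceN f)).injective e)⟩, ⟨faceN f, _, _, hij, rfl, rfl⟩, ?_, ?_⟩
  · simp only [endNum, vertNum_mk]
  · simp only [endNum, vertNum_vimg h hf]

theorem mem_epairs (v w : EdgeEnd) (hr : endRel (gluingOf c h) v w) : (endNum v, endNum w) ∈ epairs c := by
  obtain ⟨F, i, j, hij, h1, h2⟩ := hr
  simp only [epairs, List.mem_flatMap, List.mem_map, List.mem_range]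
  refine ⟨faceNum F, faceNum_lt F, (i.val, j.val), ?_, Prod.ext ?_ ?_⟩
  · clear h1 h2
    revert i j; decide
  · simp only [endNum]
    rw [h1]
    simp only [← vertNum_mk, faceN_faceNum]
  · simp only [endNum]
    rw [h2]
    have e := vertNum_vimg h (faceNum_lt F)
    rw [faceN_faceNum] at e
    simp only [← e]
    rfl

/-- The number of vertices with label `l`. -/
def vsize (V : List ℕ) (l : ℕ) : ℕ := ((List.range 6).filter fun w => Nat.beq (lab V w) l).length

/-- The labels of the classes of edge-ends at the vertices with label `l`. -/
def edgeLabs (V E : List ℕ) (l : ℕ) : List ℕ :=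
  ((List.range 36).filter fun n => !Nat.beq (n / 6 / 2) (n % 6 / 2) && Nat.beq (lab V (n / 6)) l).map (lab E)

/-- The number of classes of edge-ends at the vertices with label `l`. -/
def ecount (V E : List ℕ) (l : ℕ) : ℕ := ((List.range 36).filter fun e => (edgeLabs V E l).any (Nat.beq e)).length

/-- The label of a vertex class. -/
def vtxLab (x : Quotient (vtxSetoid (gluingOf c h))) : ℕ :=
  Quotient.lift (fun v => lab (labels 6 (vpairs c)) (vertNum v))
    (fun v w hvw => (lab_eq_iff vertNum_injective vertNum_lt (vpairs_spec h) (mem_vpairs h) v w).2 hvw) x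

/-- The label of a class of edge-ends. -/
def endLab (x : Quotient (endSetoid (gluingOf c h))) : ℕ :=
  Quotient.lift (fun v => lab (labels 36 (epairs c)) (endNum v))
    (fun v w hvw => (lab_eq_iff endNum_injective endNum_lt (epairs_spec h) (mem_epairs h) v w).2 hvw) x

theorem endLab_mk (p : EdgeEnd) : endLab h (Quotient.mk _ p) = lab (labels 36 (epairs c)) (endNum p) := rfl

theorem vtxLab_injective : Function.Injective (vtxLab h) := by
  intro x y
  refine Quotient.inductionOn₂ x y fun v w e => Quotient.sound ?_
  exact (lab_eq_iff vertNum_injective vertNum_lt (vpairs_spec h) (mem_vpairs h) v w).1 e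

theorem endLab_injective : Function.Injective (endLab h) := by
  intro x y
  refine Quotient.inductionOn₂ x y fun v w e => Quotient.sound ?_
  exact (lab_eq_iff endNum_injective endNum_lt (epairs_spec h) (mem_epairs h) v w).1 e

theorem vtxLab_lt (x : Quotient (vtxSetoid (gluingOf c h))) : vtxLab h x < 6 :=
  Quotient.inductionOn x fun v => lab_labels_lt vertNum_lt (vpairs_spec h) v

theorem endLab_lt (x : Quotient (endSetoid (gluingOf c h))) : endLab h x < 36 :=
  Quotient.inductionOn x fun v => lab_labels_lt endNum_lt (epairs_spec h) v

theorem classSize_gluingOf (x : Quotient (vtxSetoid (gluingOf c h))) :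
    classSize (gluingOf c h) x = vsize (labels 6 (vpairs c)) (vtxLab h x) := by
  refine card_eq_length_filter vertNum vertNum_injective 6 _ _ (fun _ _ => vertNum_lt _) fun m hm => ?_
  rw [Nat.beq_eq]
  constructor
  · intro e
    refine ⟨vertN m, vtxLab_injective h ?_, vertNum_vertN hm⟩
    rw [← e]
    change lab _ (vertNum (vertN m)) = _
    rw [vertNum_vertN hm]
  · rintro ⟨v, rfl, rfl⟩
    rfl

theorem cornerCount_gluingOf (x : Quotient (vtxSetoid (gluingOf c h))) :
    cornerCount (gluingOf c h) x = ecount (labels 6 (vpairs c)) (labels 36 (epairs c)) (vtxLab h x) := by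
  refine card_eq_length_filter (endLab h) (endLab_injective h) 36 _ _ (fun q _ => endLab_lt h q) fun m hm => ?_
  simp only [List.any_eq_true, Nat.beq_eq, edgeLabs, List.mem_map, List.mem_filter, List.mem_range, Bool.and_eq_true,
    Bool.not_eq_true']
  constructor
  · rintro ⟨_, ⟨n, ⟨hn, hv, hl⟩, rfl⟩, e⟩
    obtain ⟨p, rfl⟩ := exists_endNum hn (Nat.ne_of_beq_eq_false hv)
    refine ⟨Quotient.mk _ p, ⟨p, rfl, vtxLab_injective h ?_⟩, (endLab_mk h p).trans e.symm⟩
    rw [← hl, endNum_div]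
    rfl
  · rintro ⟨q, ⟨p, rfl, rfl⟩, rfl⟩
    refine ⟨_, ⟨endNum p, ⟨endNum_lt p, ?_, ?_⟩, rfl⟩, endLab_mk h p⟩
    · rw [endNum_div, endNum_mod, vertNum_div, vertNum_div]
      exact Bool.eq_false_iff.2 fun e => p.2 (Fin.ext (Nat.eq_of_beq_eq_true e))
    · rw [endNum_div]
      rfl

/-- The numerical test for labellings of the vertices and of the edge-ends to give one genus-2 link and sphere
links otherwise. -/
def linkTest (V E : List ℕ) : Bool :=
  ((List.range 6).all fun l => Nat.beq (vsize V l) 0 || Nat.beq (ecount V E l) (vsize V l + 2) ||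
    Nat.beq (ecount V E l + 2) (vsize V l)) &&
  Nat.beq (((List.range 6).filter fun l => !Nat.beq (vsize V l) 0 && Nat.beq (ecount V E l + 2) (vsize V l)).length) 1

/-- The numerical test for the vertex-link data of a code. -/
def genusTwoTest (c : ℕ) : Bool := linkTest (labels 6 (vpairs c)) (labels 36 (epairs c))

theorem vsize_ne_zero (x : Quotient (vtxSetoid (gluingOf c h))) : vsize (labels 6 (vpairs c)) (vtxLab h x) ≠ 0 := by
  rw [← classSize_gluingOf]
  induction x using Quotient.inductionOn with
  | h v =>
    have : Nonempty {w : OctVertex // Quotient.mk (vtxSetoid (gluingOf c h)) w = Quotient.mk _ v} := ⟨v, rfl⟩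
    exact Nat.card_pos.ne'

theorem exists_vtxLab {l : ℕ} (hl : vsize (labels 6 (vpairs c)) l ≠ 0) : ∃ x, vtxLab h x = l := by
  obtain ⟨w, hw⟩ := List.exists_mem_of_ne_nil
    ((List.range 6).filter fun w => Nat.beq (lab (labels 6 (vpairs c)) w) l) fun e => hl (by rw [vsize, e]; rfl)
  rw [List.mem_filter, List.mem_range, Nat.beq_eq] at hw
  refine ⟨Quotient.mk _ (vertN w), ?_⟩
  change lab _ (vertNum (vertN w)) = _
  rw [vertNum_vertN hw.1, hw.2]

theorem linksGenusTwo_gluingOf : LinksGenusTwo (gluingOf c h) ↔ genusTwoTest c = true := by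
  rw [genusTwoTest, linkTest, Bool.and_eq_true, Nat.beq_eq, List.all_eq_true]
  refine and_congr ⟨fun H l _ => ?_, fun H x => ?_⟩ ?_
  · by_cases hl : vsize (labels 6 (vpairs c)) l = 0
    · rw [hl]; rfl
    · obtain ⟨x, rfl⟩ := exists_vtxLab h hl
      have := H x
      rw [linkChi, classSize_gluingOf, cornerCount_gluingOf] at this
      rw [Bool.or_eq_true, Bool.or_eq_true, Nat.beq_eq, Nat.beq_eq, Nat.beq_eq]
      omega
  · have := H _ (List.mem_range.2 (vtxLab_lt h x))
    have h0 := vsize_ne_zero h x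
    rw [Bool.or_eq_true, Bool.or_eq_true, Nat.beq_eq, Nat.beq_eq, Nat.beq_eq] at this
    rw [linkChi, classSize_gluingOf, cornerCount_gluingOf]
    omega
  · rw [card_eq_length_filter (vtxLab h) (vtxLab_injective h) 6
      (fun l => !Nat.beq (vsize (labels 6 (vpairs c)) l) 0 &&
        Nat.beq (ecount (labels 6 (vpairs c)) (labels 36 (epairs c)) l + 2) (vsize (labels 6 (vpairs c)) l))
      _ (fun x _ => vtxLab_lt h x) fun l _ => ?_]
    rw [Bool.and_eq_true, Bool.not_eq_true', ← Bool.not_eq_true, Nat.beq_eq, Nat.beq_eq]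
    constructor
    · rintro ⟨h0, h1⟩
      obtain ⟨x, rfl⟩ := exists_vtxLab h h0
      refine ⟨x, ?_, rfl⟩
      rw [linkChi, classSize_gluingOf, cornerCount_gluingOf]
      omega
    · rintro ⟨x, hx, rfl⟩
      rw [linkChi, classSize_gluingOf, cornerCount_gluingOf] at hx
      exact ⟨vsize_ne_zero h x, by omega⟩

end

/-! ### Computing combinatorial equivalence of codes -/

/-- The action of the symmetry with axis permutation `p` and sign mask `m` on faces. -/
def sface (p m f : ℕ) : ℕ :=
  fbit (Nat.xor f m) 0 * 2 ^ pact p 0 + fbit (Nat.xor f m) 1 * 2 ^ pact p 1 + fbit (Nat.xor f m) 2 * 2 ^ pact p 2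

/-- The numerical condition at the face `f` for a symmetry to carry one code to another. -/
def relAt (p m c c' f : ℕ) : Bool :=
  Nat.beq (csig c' (sface p m f)) (sface p m (csig c f)) &&
    (List.range 3).all fun i => Nat.beq (pact (cprm c' (sface p m f)) (pact p i)) (pact p (pact (cprm c f) i))

/-- The numerical condition for a symmetry to carry one code to another. -/
def relCode (p m c c' : ℕ) : Bool := (List.range 8).all (relAt p m c c')

theorem faceN_sface : ∀ p < 6, ∀ m < 8, ∀ f < 8,
    sface p m f < 8 ∧ symMapFace (permN p) (faceN m) (faceN f) = faceN (sface p m f) := by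
  decide +kernel

theorem exists_permN (ρ : Equiv.Perm (Fin 3)) : ∃ p < 6, ρ = permN p := by
  revert ρ; decide +kernel

theorem faceN_inj {f f' : ℕ} (hf : f < 8) (hf' : f' < 8) : faceN f = faceN f' ↔ f = f' :=
  ⟨fun e => by rw [← faceNum_faceN hf, e, faceNum_faceN hf'], fun e => by rw [e]⟩

theorem relCode_iff {p m c c' : ℕ} (hp : p < 6) (hm : m < 8) (h : ValidCode c) (h' : ValidCode c') :
    relCode p m c c' = true ↔ SymData (gluingOf c h) (gluingOf c' h') (permN p) (faceN m) := by
  have key : ∀ f < 8, relAt p m c c' f = true ↔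
      (gluingOf c' h').face (symMapFace (permN p) (faceN m) (faceN f)) =
        symMapFace (permN p) (faceN m) ((gluingOf c h).face (faceN f)) ∧
      (gluingOf c' h').axisMap (symMapFace (permN p) (faceN m) (faceN f)) =
        permN p * (gluingOf c h).axisMap (faceN f) * (permN p)⁻¹ := by
    intro f hf
    obtain ⟨h1, h2⟩ := faceN_sface p hp m hm f hf
    obtain ⟨h3, h4⟩ := faceN_sface p hp m hm _ (csig_lt c f)
    rw [h2, gluingOf_face h' h1, gluingOf_face h hf, h4, gluingOf_axisMap h' h1, gluingOf_axisMap h hf,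
      faceN_inj (csig_lt _ _) h3, relAt, Bool.and_eq_true, Nat.beq_eq, List.all_eq_true, eq_mul_inv_iff_mul_eq]
    refine and_congr_right fun _ => ⟨fun H => ?_, fun H i hi => ?_⟩
    · ext i
      have := H i (List.mem_range.2 i.2)
      rw [Nat.beq_eq, ← val_permN hp, ← val_permN (h f hf).2.2.1, ← val_permN (h' _ h1).2.2.1, ← val_permN hp] at this
      exact this
    · have := congrArg (fun π => (π ⟨i, List.mem_range.1 hi⟩).val) H
      simp only [Equiv.Perm.mul_apply, val_permN hp, val_permN (h f hf).2.2.1, val_permN (h' _ h1).2.2.1] at this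
      rw [Nat.beq_eq]
      exact this
  rw [relCode, List.all_eq_true]
  constructor
  · intro H
    have H : ∀ F, _ := fun F => (key (faceNum F) (faceNum_lt F)).1 (H _ (List.mem_range.2 (faceNum_lt F)))
    simp only [faceN_faceNum] at H
    exact ⟨fun F => (H F).1, fun F => (H F).2⟩
  · intro H f hf
    exact (key f (List.mem_range.1 hf)).2 ⟨H.1 _, H.2 _⟩

/-- No symmetry carries one code to the other. -/
def unrelated (c c' : ℕ) : Bool := (List.range 6).all fun p => (List.range 8).all fun m => !relCode p m c c'

theorem not_equiv_of_unrelated {c c' : ℕ} (h : ValidCode c) (h' : ValidCode c') (H : unrelated c c' = true) :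
    ¬EquivGluing (gluingOf c h) (gluingOf c' h') := by
  rintro ⟨ρ, ε, hs⟩
  obtain ⟨p, hp, rfl⟩ := exists_permN ρ
  rw [← faceN_faceNum ε] at hs
  have := List.all_eq_true.1 (List.all_eq_true.1 H p (List.mem_range.2 hp)) _ (List.mem_range.2 (faceNum_lt ε))
  rw [(relCode_iff hp (faceNum_lt ε) h h').2 hs] at this
  exact absurd this (by decide)

theorem faceSign_symMapFace (ρ : Equiv.Perm (Fin 3)) (ε : Fin 3 → Bool) (F : OctFace) :
    faceSign (symMapFace ρ ε F) = Bool.xor (faceSign F) (faceSign ε) := by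
  revert ρ ε F; decide +kernel

/-- The pullback of the face pairing of a gluing pattern along a symmetry. -/
def Gluing.pullFace (g : Gluing) (ρ : Equiv.Perm (Fin 3)) (ε : Fin 3 → Bool) (F : OctFace) : OctFace :=
  symMapFace ρ⁻¹ (fun i => ε (ρ⁻¹ i)) (g.face (symMapFace ρ ε F))

theorem Gluing.symMapFace_pullFace (g : Gluing) (ρ : Equiv.Perm (Fin 3)) (ε : Fin 3 → Bool) (F : OctFace) :
    symMapFace ρ ε (g.pullFace ρ ε F) = g.face (symMapFace ρ ε F) := symMapFace_symm' ρ ε _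

theorem Gluing.involutive_pullFace (g : Gluing) (ρ : Equiv.Perm (Fin 3)) (ε : Fin 3 → Bool) :
    Function.Involutive (g.pullFace ρ ε) := fun F => by
  rw [Gluing.pullFace, g.symMapFace_pullFace, g.face_face, symMapFace_symm]

/-- The pullback of the face identifications of a gluing pattern along a symmetry. -/
def Gluing.pullAxis (g : Gluing) (ρ : Equiv.Perm (Fin 3)) (ε : Fin 3 → Bool) (F : OctFace) : Equiv.Perm (Fin 3) :=
  ρ⁻¹ * g.axisMap (symMapFace ρ ε F) * ρ

theorem Gluing.isGluing_pull (g : Gluing) (ρ : Equiv.Perm (Fin 3)) (ε : Fin 3 → Bool) :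
    IsGluing ((g.involutive_pullFace ρ ε).toPerm _) (g.pullAxis ρ ε) := by
  refine ⟨g.involutive_pullFace ρ ε, fun F hF => ?_, fun F => ?_, fun F => ?_⟩
  · have : g.pullFace ρ ε F = F := hF
    refine g.face_ne (symMapFace ρ ε F) ?_
    rw [← g.symMapFace_pullFace, this]
  · change g.pullAxis ρ ε (g.pullFace ρ ε F) = _
    rw [Gluing.pullAxis, g.symMapFace_pullFace, g.axisMap_face, Gluing.pullAxis]
    group
  · change _ ↔ faceSign F ≠ faceSign (g.pullFace ρ ε F)
    have e : Equiv.Perm.sign (g.pullAxis ρ ε F) = Equiv.Perm.sign (g.axisMap (symMapFace ρ ε F)) := by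
      rw [Gluing.pullAxis, map_mul, map_mul, map_inv, mul_right_comm, inv_mul_cancel, one_mul]
    rw [e]
    refine (g.2.2.2.2 _).trans (not_congr ?_)
    change _ = faceSign (g.face (symMapFace ρ ε F)) ↔ _
    rw [← g.symMapFace_pullFace, faceSign_symMapFace, faceSign_symMapFace]
    simp

/-- The gluing pattern obtained by pulling back along a symmetry. -/
def Gluing.pull (g : Gluing) (ρ : Equiv.Perm (Fin 3)) (ε : Fin 3 → Bool) : Gluing :=
  ⟨((g.involutive_pullFace ρ ε).toPerm _, g.pullAxis ρ ε), g.isGluing_pull ρ ε⟩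

theorem SymData.pull (g : Gluing) (ρ : Equiv.Perm (Fin 3)) (ε : Fin 3 → Bool) : SymData (g.pull ρ ε) g ρ ε := by
  refine ⟨fun F => (g.symMapFace_pullFace ρ ε F).symm, fun F => ?_⟩
  change _ = ρ * (ρ⁻¹ * g.axisMap (symMapFace ρ ε F) * ρ) * ρ⁻¹
  group

/-! ### Enumeration of the gluing patterns -/

/-- The perfect matchings of a list. -/
def matchings : ℕ → List ℕ → List (List (ℕ × ℕ))
  | n + 1, a :: l => l.flatMap fun b => (matchings n (l.erase b)).map ((a, b) :: ·)
  | _, _ => [[]]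

theorem exists_matching (s : ℕ → ℕ) (n : ℕ) (l : List ℕ) (hl : l.Nodup)
    (hs : ∀ x ∈ l, s x ∈ l ∧ s (s x) = x ∧ s x ≠ x) : ∃ P ∈ matchings n l, ∀ q ∈ P, s q.1 = q.2 := by
  induction n generalizing l with
  | zero => exact ⟨[], by simp [matchings], by simp⟩
  | succ n ih =>
    cases l with
    | nil => exact ⟨[], by simp [matchings], by simp⟩
    | cons a l =>
      obtain ⟨h1, h2, h3⟩ := hs a (by simp)
      have hm : s a ∈ l := (List.mem_cons.1 h1).resolve_left h3
      obtain ⟨hal, hl⟩ := List.nodup_cons.1 hl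
      obtain ⟨P, hP, hs'⟩ := ih (l.erase (s a)) (hl.erase _) fun x hx => by
        obtain ⟨hne, hx⟩ := (hl.mem_erase_iff).1 hx
        obtain ⟨g1, g2, g3⟩ := hs x (List.mem_cons_of_mem _ hx)
        refine ⟨hl.mem_erase_iff.2 ⟨fun e => hal ?_, (List.mem_cons.1 g1).resolve_left fun e => hne ?_⟩, g2, g3⟩
        · rw [← h2, ← e, g2]
          exact hx
        · rw [← e, g2]
      refine ⟨(a, s a) :: P, ?_, ?_⟩
      · simp only [matchings, List.mem_flatMap, List.mem_map]
        exact ⟨s a, hm, P, hP, rfl⟩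
      · simpa using hs'

/-- The choices of axis maps for a pairing of the faces. -/
def axisChoices : List (ℕ × ℕ) → List (List (ℕ × ℕ × ℕ))
  | [] => [[]]
  | q :: R => (bif Nat.beq (cpar q.1) (cpar q.2) then [3, 4, 5] else [0, 1, 2]).flatMap fun p =>
      (axisChoices R).map ((q.1, q.2, p) :: ·)

theorem exists_permN_of_sign (ρ : Equiv.Perm (Fin 3)) (b : Bool) (h : Equiv.Perm.sign ρ = 1 ↔ b = false) :
    ∃ p ∈ (bif b then [3, 4, 5] else [0, 1, 2]), ρ = permN p := by
  revert ρ b; decide +kernel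

theorem exists_axisChoice (g : Gluing) (R : List (ℕ × ℕ))
    (hR : ∀ q ∈ R, q.1 < 8 ∧ q.2 < 8 ∧ g.face (faceN q.1) = faceN q.2) :
    ∃ T ∈ axisChoices R, ∀ t ∈ T, t.1 < 8 ∧ t.2.1 < 8 ∧ g.face (faceN t.1) = faceN t.2.1 ∧
      g.axisMap (faceN t.1) = permN t.2.2 := by
  induction R with
  | nil => exact ⟨[], by simp [axisChoices], by simp⟩
  | cons q R ih =>
    obtain ⟨T, hT, h⟩ := ih fun q hq => hR q (by simp [hq])
    obtain ⟨h1, h2, h3⟩ := hR q (by simp)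
    obtain ⟨p, hp, e⟩ := exists_permN_of_sign (g.axisMap (faceN q.1)) (Nat.beq (cpar q.1) (cpar q.2)) <| by
      refine (g.2.2.2.2 _).trans ?_
      change faceSign _ ≠ faceSign (g.face _) ↔ _
      rw [h3, faceSign_faceN h1 h2, Bool.eq_false_iff, ne_eq, ne_eq, Nat.beq_eq]
    refine ⟨(q.1, q.2, p) :: T, ?_, ?_⟩
    · simp only [axisChoices, List.mem_flatMap, List.mem_map]
      exact ⟨p, hp, T, hT, rfl⟩
    · intro t ht
      rcases List.mem_cons.1 ht with rfl | ht
      · exact ⟨h1, h2, h3, e⟩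
      · exact h t ht

/-- The code of a list of face identifications. -/
def codeOf (T : List (ℕ × ℕ × ℕ)) : ℕ :=
  T.foldr (fun t c => c + (t.2.1 + 8 * t.2.2) * 64 ^ t.1 + (t.1 + 8 * pinv t.2.2) * 64 ^ t.2.1) 0

/-- A code is valid and given by a list of face identifications. -/
def codeCheck (T : List (ℕ × ℕ × ℕ)) (c : ℕ) : Bool :=
  decide (ValidCode c) && (T.all fun t => Nat.beq (csig c t.1) t.2.1 && Nat.beq (cprm c t.1) t.2.2) &&
    (List.range 8).all fun f => T.any fun t => Nat.beq f t.1 || Nat.beq f t.2.1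

theorem eq_gluingOf (g : Gluing) {T : List (ℕ × ℕ × ℕ)} {c : ℕ} (hc : codeCheck T c = true)
    (hT : ∀ t ∈ T, t.1 < 8 ∧ t.2.1 < 8 ∧ g.face (faceN t.1) = faceN t.2.1 ∧ g.axisMap (faceN t.1) = permN t.2.2) :
    ∃ h, g = gluingOf c h := by
  simp only [codeCheck, Bool.and_eq_true, decide_eq_true_eq, List.all_eq_true, List.any_eq_true, Nat.beq_eq,
    List.mem_range, Bool.or_eq_true] at hc
  obtain ⟨⟨h, h1⟩, h2⟩ := hc
  have key : ∀ f < 8, g.face (faceN f) = (gluingOf c h).face (faceN f) ∧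
      g.axisMap (faceN f) = (gluingOf c h).axisMap (faceN f) := by
    intro f hf
    obtain ⟨t, ht, e⟩ := h2 f hf
    obtain ⟨a1, a2, a3, a4⟩ := hT t ht
    obtain ⟨b1, b2⟩ := h1 t ht
    have e1 : g.face (faceN t.1) = (gluingOf c h).face (faceN t.1) := by rw [a3, gluingOf_face h a1, b1]
    have e2 : g.axisMap (faceN t.1) = (gluingOf c h).axisMap (faceN t.1) := by rw [a4, gluingOf_axisMap h a1, b2]
    rcases e with rfl | rfl
    · exact ⟨e1, e2⟩
    · rw [← a3]
      refine ⟨?_, ?_⟩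
      · rw [Gluing.face_face]
        conv_rhs => rw [e1]
        rw [Gluing.face_face]
      · rw [Gluing.axisMap_face, e2]
        conv_rhs => rw [e1]
        rw [Gluing.axisMap_face]
  refine ⟨h, Subtype.ext (Prod.ext (Equiv.ext fun F => ?_) (funext fun F => ?_))⟩
  · rw [← faceN_faceNum F]
    exact (key _ (faceNum_lt F)).1
  · rw [← faceN_faceNum F]
    exact (key _ (faceNum_lt F)).2

/-- The gluing patterns with one genus-2 link: the index of the quotient space and the code. -/
def entries : List (ℕ × ℕ) := [
    (0, 84818091893572), (1, 49633721901892), (0, 84809501959492), (2, 84818360329036), (3, 49633990337356), 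
    (4, 49625400403276), (5, 84260014613836), (6, 111234296113092), (7, 111225704081348), (7, 181585856228292), 
    (6, 181594448260036), (6, 146401484138948), (7, 146418668202436), (8, 146410344606156), (9, 145860588825036), 
    (7, 86704656324228), (6, 51520286332548), (6, 86146310575748), (7, 50961940584068), (10, 86146579011212), 
    (11, 50962209019532), (12, 85588233296012), (13, 95330032522884), (14, 60154250368644), (14, 94780274611844), 
    (13, 59604492457604), (14, 95330032589444), (14, 60154250435204), (13, 94780274678404), (14, 59604492524164), 
    (15, 94230785136268), (16, 59055002982028), (17, 95330300958348), (18, 60154518804108), (19, 94780543047308), 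
    (20, 59604760893068), (21, 59055003048588), (22, 59055003015308), (23, 59054868764308), (24, 60154384586388), 
    (25, 59604626675348), (14, 182177488198596), (14, 146993116109252), (14, 112908259841988), 
    (14, 112358501930948), (14, 111825923921860), (14, 147010296011204), (13, 112375681832900), 
    (14, 111817334020036), (14, 182186078198724), (13, 112916849842116), (26, 146993384544716), 
    (27, 112358770366412), (28, 147010564446668), (29, 112375950268364), (30, 111817602455500), 
    (31, 182186346634188), (32, 112917118277580), (33, 146993250326996), (34, 112358636148692), 
    (35, 147010430228948), (36, 112375816050644), (37, 111817468237780), (38, 182186212416468), 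
    (39, 112916984059860), (40, 97789967356612), (41, 97789965259972), (41, 63155351081668), (41, 97807147258564), 
    (41, 97807145161924), (40, 63172530983620), (42, 97790235792076), (43, 97790233695436), (44, 63155619517132), 
    (45, 97807415694028), (46, 97807413597388), (47, 63172799419084), (48, 63155485299412), (49, 63172665201364), 
    (50, 111647317739486), (51, 111638725707742), (52, 181998877854686), (53, 182016061918174), 
    (54, 182007469886430), (55, 146814505765342), (56, 146831689828830), (57, 146823097797086), 
    (53, 183106981514222), (58, 183106847263726), (59, 147931067206126), (60, 186396639164190), 
    (61, 186413823227678), (62, 186405231195934), (63, 151212267042590), (64, 151229719542558), 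
    (65, 117135998580526), (66, 187504742823726), (53, 181971373284318), (67, 111619947419614), 
    (68, 111611357517790), (69, 181980101696478), (57, 147886512822766), (70, 147903692724718), 
    (71, 147895102822894), (72, 183079613324270), (73, 147895241234926), (74, 147895373355502), (8, 637854078343), 
    (9, 1187609891719), (75, 637992490375), (76, 1187748303751), (77, 71006736668047), (78, 71556492481423)]

/-- The pairings of the faces up to symmetry, and for each choice of the axis maps the index of an equivalent entry
and a symmetry. -/
def pairingReps : List (List (ℕ × ℕ) × List ℕ) := [
  ([(0, 1), (2, 3), (4, 5), (6, 7)], [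
    9999, 9999, 9999, 9999, 9999, 9999, 9999, 9999, 9999, 9999, 9999, 9999, 9999, 2, 50, 9999, 106, 104, 9999, 
    9999, 9999, 9999, 98, 100, 9999, 52, 4, 9999, 9999, 9999, 9999, 14, 118, 9999, 62, 116, 9999, 26, 122, 38, 146, 
    194, 134, 206, 250, 9999, 74, 124, 142, 218, 242, 88, 290, 232, 9999, 9999, 9999, 9999, 110, 64, 9999, 112, 16, 
    9999, 130, 76, 86, 230, 292, 136, 248, 220, 9999, 128, 28, 140, 244, 208, 40, 196, 148]),
  ([(0, 1), (2, 3), (4, 6), (5, 7)], [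
    9999, 9999, 9999, 9999, 9999, 9999, 9999, 9999, 9999, 9999, 9999, 9999, 9999, 9999, 9999, 9999, 9999, 9999, 
    9999, 9999, 9999, 9999, 9999, 9999, 9999, 9999, 9999, 9999, 9999, 9999, 9999, 9999, 9999, 9999, 9999, 9999, 
    9999, 9999, 9999, 9999, 9999, 9999, 9999, 9999, 9999, 9999, 9999, 9999, 9999, 9999, 9999, 9999, 9999, 9999, 
    9999, 9999, 9999, 9999, 9999, 9999, 9999, 9999, 9999, 9999, 9999, 9999, 9999, 9999, 9999, 9999, 9999, 9999, 
    9999, 9999, 9999, 9999, 9999, 9999, 9999, 9999, 9999]),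
  ([(0, 1), (2, 3), (4, 7), (5, 6)], [
    9999, 9999, 9999, 9999, 9999, 9999, 9999, 9999, 9999, 9999, 586, 346, 490, 9999, 394, 442, 538, 9999, 9999, 
    484, 436, 580, 9999, 532, 340, 388, 9999, 9999, 502, 454, 598, 9999, 550, 358, 406, 9999, 9999, 9999, 9999, 
    9999, 634, 9999, 9999, 9999, 9999, 9999, 9999, 9999, 9999, 682, 9999, 9999, 9999, 9999, 9999, 592, 352, 496, 
    9999, 400, 448, 544, 9999, 9999, 9999, 9999, 9999, 676, 9999, 9999, 9999, 9999, 9999, 9999, 9999, 9999, 628, 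
    9999, 9999, 9999, 9999]),
  ([(0, 1), (2, 4), (3, 5), (6, 7)], [
    9999, 9999, 9999, 9999, 776, 728, 9999, 730, 778, 9999, 722, 770, 9999, 9999, 9999, 9999, 818, 866, 9999, 772, 
    724, 9999, 868, 820, 9999, 9999, 9999, 9999, 9999, 9999, 812, 9999, 9999, 766, 9999, 9999, 758, 9999, 9999, 
    9999, 9999, 9999, 854, 914, 962, 808, 9999, 9999, 904, 1010, 1000, 9999, 9999, 9999, 9999, 9999, 9999, 764, 
    9999, 9999, 814, 9999, 9999, 806, 9999, 9999, 9999, 9999, 9999, 902, 998, 1012, 760, 9999, 9999, 856, 964, 916, 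
    9999, 9999, 9999]),
  ([(0, 1), (2, 4), (3, 6), (5, 7)], [
    9999, 1300, 1252, 9999, 1396, 1348, 9999, 9999, 9999, 9999, 9999, 9999, 9999, 9999, 9999, 9999, 9999, 9999, 
    9999, 1108, 1060, 9999, 1204, 1156, 9999, 9999, 9999, 9999, 9999, 9999, 1435, 9999, 9999, 1243, 1963, 1723, 
    9999, 9999, 9999, 1339, 9999, 9999, 1147, 1915, 1627, 9999, 1876, 1819, 9999, 1924, 1771, 9999, 1828, 1531, 
    9999, 9999, 9999, 1387, 9999, 9999, 1195, 1732, 1675, 9999, 9999, 9999, 1291, 9999, 9999, 1099, 1780, 1579, 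
    9999, 1588, 1540, 9999, 1684, 1636, 9999, 1492, 1444]),
  ([(0, 1), (2, 5), (3, 4), (6, 7)], [
    9999, 9999, 9999, 9999, 9999, 9999, 9999, 9999, 9999, 9999, 9999, 9999, 9999, 9999, 9999, 9999, 9999, 9999, 
    9999, 9999, 9999, 9999, 9999, 9999, 9999, 9999, 9999, 9999, 9999, 9999, 9999, 9999, 9999, 9999, 9999, 9999, 
    9999, 9999, 9999, 9999, 9999, 9999, 9999, 9999, 9999, 9999, 9999, 9999, 9999, 9999, 9999, 9999, 9999, 9999, 
    9999, 9999, 9999, 9999, 9999, 9999, 9999, 9999, 9999, 9999, 9999, 9999, 9999, 9999, 9999, 9999, 9999, 9999, 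
    9999, 9999, 9999, 9999, 9999, 9999, 9999, 9999, 9999]),
  ([(0, 1), (2, 5), (3, 6), (4, 7)], [
    9999, 1976, 2068, 2072, 9999, 2116, 1972, 2020, 9999, 9999, 2360, 2404, 2408, 2312, 9999, 2356, 9999, 2308, 
    9999, 9999, 9999, 9999, 2168, 2260, 9999, 2212, 2164, 9999, 9999, 9999, 9999, 9999, 2836, 9999, 2788, 9999, 
    9999, 3032, 3076, 3080, 2984, 9999, 3028, 9999, 2980, 9999, 9999, 9999, 9999, 9999, 2932, 9999, 2884, 9999, 
    9999, 9999, 9999, 9999, 9999, 2500, 9999, 2452, 9999, 9999, 2696, 2740, 2744, 2648, 9999, 2692, 9999, 2644, 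
    9999, 9999, 9999, 9999, 9999, 2596, 9999, 2548, 9999]),
  ([(0, 1), (2, 5), (3, 7), (4, 6)], [
    9999, 9999, 9999, 9999, 3128, 3220, 9999, 3172, 3124, 9999, 9999, 9999, 9999, 9999, 9999, 9999, 9999, 9999, 
    9999, 9999, 9999, 9999, 3272, 3364, 9999, 3316, 3268, 9999, 3143, 3239, 3241, 3529, 3700, 3145, 3431, 3527, 
    9999, 9999, 9999, 9999, 9999, 9999, 9999, 9999, 9999, 9999, 3287, 3383, 3385, 3673, 3748, 3289, 3575, 3671, 
    9999, 3191, 3162, 3159, 3416, 3508, 3193, 3460, 3412, 9999, 9999, 9999, 9999, 9999, 9999, 9999, 9999, 9999, 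
    9999, 3335, 3306, 3303, 3560, 3652, 3337, 3604, 3556]),
  ([(0, 3), (1, 2), (4, 7), (5, 6)], [
    9999, 4180, 3970, 4186, 9999, 4159, 3964, 4153, 9999, 4204, 4228, 4114, 4276, 4207, 4015, 4012, 4105, 9999, 
    3946, 4090, 3802, 3994, 4138, 3850, 3898, 4042, 9999, 4210, 4273, 4018, 4225, 4201, 4111, 4108, 4009, 9999, 
    9999, 4183, 4162, 4177, 9999, 3967, 4156, 3961, 9999, 4135, 3991, 3847, 4087, 3943, 3799, 4039, 3895, 9999, 
    3940, 3988, 3892, 4084, 4132, 4036, 3796, 3844, 9999, 4129, 4081, 4033, 3985, 3937, 3889, 3841, 3793, 9999, 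
    9999, 9999, 9999, 9999, 9999, 9999, 9999, 9999, 9999]),
  ([(0, 3), (1, 4), (2, 7), (5, 6)], [
    9999, 9999, 9999, 9999, 4412, 4526, 9999, 4630, 4408, 9999, 4394, 4520, 9999, 4346, 9999, 9999, 4442, 9999, 
    9999, 4612, 4402, 9999, 4460, 9999, 9999, 4564, 9999, 9999, 9999, 9999, 4382, 9999, 9999, 4616, 4568, 4456, 
    4376, 9999, 9999, 4328, 9999, 4472, 4424, 9999, 9999, 4622, 4574, 4450, 4430, 9999, 9999, 4594, 9999, 9999, 
    9999, 9999, 9999, 4516, 9999, 9999, 4390, 4438, 4342, 4534, 9999, 9999, 9999, 4490, 9999, 9999, 9999, 4486, 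
    4372, 4420, 4324, 9999, 9999, 4468, 9999, 9999, 9999]),
  ([(0, 3), (1, 6), (2, 5), (4, 7)], [
    9999, 4852, 4684, 9999, 4948, 9999, 9999, 4900, 9999, 9999, 4966, 9999, 9999, 5092, 9999, 5014, 5062, 4846, 
    9999, 4918, 9999, 4996, 5044, 4828, 9999, 9999, 9999, 4849, 9999, 4681, 4915, 9999, 9999, 4963, 9999, 9999, 
    4897, 9999, 9999, 9999, 9999, 9999, 5059, 5011, 4843, 4945, 9999, 9999, 5041, 4993, 4825, 5089, 9999, 9999, 
    4660, 4657, 9999, 9999, 9999, 9999, 9999, 9999, 9999, 9999, 9999, 9999, 9999, 9999, 4705, 4822, 4819, 4771, 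
    9999, 9999, 9999, 4804, 4801, 4753, 9999, 9999, 4708]),
  ([(0, 7), (1, 6), (2, 5), (3, 4)], [
    9999, 9999, 9999, 9999, 5174, 5186, 9999, 5188, 5138, 9999, 5137, 5185, 5184, 5233, 5280, 5154, 5235, 5234, 
    9999, 5187, 5167, 5136, 5237, 5232, 5189, 5283, 5236, 9999, 5190, 5148, 5143, 5239, 5241, 5191, 5286, 5240, 
    5162, 5245, 5249, 5251, 5329, 5376, 5255, 5382, 5330, 5198, 5292, 5244, 5253, 5388, 5328, 5301, 9999, 5397, 
    9999, 5142, 5195, 5193, 5243, 5289, 5161, 5238, 5242, 5200, 5247, 5295, 5298, 5394, 9999, 5250, 5331, 5391, 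
    5150, 5246, 5248, 5252, 5333, 5385, 5254, 5379, 5332])]

/-- Some symmetry carries the pairing `R` into the matching `P`. -/
def matchCheck (P R : List (ℕ × ℕ)) : Bool :=
  (List.range 6).any fun p => (List.range 8).any fun m => R.all fun q => P.any fun q' =>
    (Nat.beq (sface p m q.1) q'.1 && Nat.beq (sface p m q.2) q'.2) ||
      (Nat.beq (sface p m q.1) q'.2 && Nat.beq (sface p m q.2) q'.1)

theorem matchCheck_all : (matchings 8 (List.range 8)).all (fun P =>
    pairingReps.any fun R => matchCheck P R.1) = true := by
  decide +kernel

/-! ### Fast evaluation of the link test -/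

/-- The entry of a list at a given position. -/
def look (L : List ℕ) : ℕ → ℕ :=
  List.rec (fun _ => 0) (fun a _ ih x => Nat.rec a (fun n _ => ih n) x) L

theorem look_eq (L : List ℕ) (x : ℕ) : look L x = lab L x := by
  induction L generalizing x with
  | nil => rfl
  | cons a L ih =>
    cases x with
    | zero => rfl
    | succ n => exact ih n

/-- `labels`, with evaluation of all intermediate labellings. -/
def labelsK {α : Type} (k : List ℕ → α) : List (ℕ × ℕ) → List ℕ → α
  | [], L => k L
  | p :: ps, L => forceN (look L p.1) fun a => forceN (look L p.2) fun b => bif Nat.beq a b then labelsK k ps L else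
      forceMap (fun x => bif Nat.beq x b then a else x) L fun M => labelsK k ps M

theorem labelsK_eq {α : Type} (k : List ℕ → α) (ps : List (ℕ × ℕ)) (L : List ℕ) :
    labelsK k ps L = k (ps.foldl merge L) := by
  induction ps generalizing L with
  | nil => rfl
  | cons p ps ih =>
    rw [labelsK, forceN_eq, forceN_eq, forceMap_eq, ih, ih, look_eq, look_eq, List.foldl_cons, merge, relabel]
    cases Nat.beq (lab L p.1) (lab L p.2) <;> rfl

/-- The number of an edge-end with given vertices. -/
def endOf (a b : ℕ) : ℕ := Nat.add (Nat.mul 6 a) b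

/-- The identifications of vertices and edge-ends, evaluated. -/
def pairsK {α : Type} (c : ℕ) : List ℕ → (List (ℕ × ℕ) → List (ℕ × ℕ) → α) → α
  | [], k => k [] []
  | f :: fs, k => forceN (fvtx f 0) fun a => forceN (fvtx f 1) fun b => forceN (fvtx f 2) fun d =>
      forceN (cimg c f 0) fun a' => forceN (cimg c f 1) fun b' => forceN (cimg c f 2) fun d' =>
      pairsK c fs fun M N => k ((a, a') :: (b, b') :: (d, d') :: M)
        ((endOf a b, endOf a' b') :: (endOf a d, endOf a' d') :: (endOf b a, endOf b' a') ::
          (endOf b d, endOf b' d') :: (endOf d a, endOf d' a') :: (endOf d b, endOf d' b') :: N)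

theorem pairsK_eq {α : Type} (c : ℕ) (L : List ℕ) (k : List (ℕ × ℕ) → List (ℕ × ℕ) → α) :
    pairsK c L k = k (L.flatMap fun f => (List.range 3).map fun i => (fvtx f i, cimg c f i))
      (L.flatMap fun f => [(0, 1), (0, 2), (1, 0), (1, 2), (2, 0), (2, 1)].map fun e =>
        (6 * fvtx f e.1 + fvtx f e.2, 6 * cimg c f e.1 + cimg c f e.2)) := by
  induction L generalizing k with
  | nil => rfl
  | cons f L ih =>
    simp only [pairsK, forceN_eq, ih]
    rfl

/-- The index of the vertex of an edge-end among the labels, or `6` if the number is not used. -/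
def ownLab (V : List ℕ) (n : ℕ) : ℕ := bif Nat.beq (n / 6 / 2) (n % 6 / 2) then 6 else lab V (n / 6)

/-- The number of classes of edge-ends at the vertices with label `l`, evaluated. -/
def countK (Q : List (ℕ × ℕ)) (l : ℕ) : ℕ :=
  forceMap (fun q => q.2) (Q.filter fun q => Nat.beq q.1 l) fun M =>
    ((List.range 36).filter fun e => M.any (Nat.beq e)).length

/-- `linkTest` with evaluation of intermediate results. -/
def linkK (V E : List ℕ) : Bool :=
  forceMap (ownLab V) (List.range 36) fun own => forceMap (look E) (List.range 36) fun E' =>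
  forceMap (vsize V) (List.range 6) fun vs =>
  forceMap (fun l => bif Nat.beq (look vs l) 0 then 0 else countK (own.zip E') l) (List.range 6) fun es =>
    ((List.range 6).all fun l => Nat.beq (look vs l) 0 || Nat.beq (look es l) (look vs l + 2) ||
      Nat.beq (look es l + 2) (look vs l)) &&
    Nat.beq (((List.range 6).filter fun l => !Nat.beq (look vs l) 0 && Nat.beq (look es l + 2) (look vs l)).length) 1

theorem look_map_range (f : ℕ → ℕ) {n l : ℕ} (h : l < n) : look ((List.range n).map f) l = f l := by
  simp [look_eq, lab, List.getD_eq_getElem?_getD, h]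

theorem countK_eq (V E : List ℕ) {l : ℕ} (hl : l < 6) :
    countK (((List.range 36).map (ownLab V)).zip ((List.range 36).map (look E))) l = ecount V E l := by
  rw [countK, forceMap_eq, ecount, edgeLabs, List.zip_map', List.filter_map, List.map_map]
  congr 3
  have : (fun q : ℕ × ℕ => Nat.beq q.1 l) ∘ (fun x => (ownLab V x, look E x)) =
      fun n => !Nat.beq (n / 6 / 2) (n % 6 / 2) && Nat.beq (lab V (n / 6)) l := by
    funext n
    simp only [Function.comp, ownLab]
    cases Nat.beq (n / 6 / 2) (n % 6 / 2)
    · rfl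
    · simp only [cond_true, Bool.not_true, Bool.false_and, Bool.eq_false_iff, ne_eq, Nat.beq_eq]
      omega
  rw [this]
  funext e
  congr 2
  funext x
  exact look_eq E x

theorem linkK_eq (V E : List ℕ) : linkK V E = linkTest V E := by
  have hv : ∀ l < 6, look ((List.range 6).map (vsize V)) l = vsize V l := fun l hl => look_map_range _ hl
  simp only [linkK, forceMap_eq, linkTest]
  generalize hvs : (List.range 6).map (vsize V) = vs at hv
  have he : ∀ l < 6, vsize V l ≠ 0 → look ((List.range 6).map fun l => bif Nat.beq (look vs l) 0 then 0 else
      countK (((List.range 36).map (ownLab V)).zip ((List.range 36).map (look E))) l) l = ecount V E l := by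
    intro l hl h0
    rw [look_map_range _ hl, hv l hl, countK_eq V E hl, Bool.eq_false_iff.2 (fun e => h0 (Nat.eq_of_beq_eq_true e)),
      cond_false]
  generalize (List.range 6).map (fun l => bif Nat.beq (look vs l) 0 then 0 else
      countK (((List.range 36).map (ownLab V)).zip ((List.range 36).map (look E))) l) = es at he
  have h1 : ∀ l ∈ List.range 6, (Nat.beq (look vs l) 0 || Nat.beq (look es l) (look vs l + 2) ||
      Nat.beq (look es l + 2) (look vs l)) = (Nat.beq (vsize V l) 0 || Nat.beq (ecount V E l) (vsize V l + 2) ||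
      Nat.beq (ecount V E l + 2) (vsize V l)) := by
    intro l hl
    rw [hv l (List.mem_range.1 hl)]
    by_cases h0 : vsize V l = 0
    · rw [h0]; rfl
    · rw [he l (List.mem_range.1 hl) h0]
  have h2 : ∀ l ∈ List.range 6, (!Nat.beq (look vs l) 0 && Nat.beq (look es l + 2) (look vs l)) =
      (!Nat.beq (vsize V l) 0 && Nat.beq (ecount V E l + 2) (vsize V l)) := by
    intro l hl
    rw [hv l (List.mem_range.1 hl)]
    by_cases h0 : vsize V l = 0
    · rw [h0]; rfl
    · rw [he l (List.mem_range.1 hl) h0]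
  rw [List.filter_congr h2]
  congr 1
  rw [Bool.eq_iff_iff, List.all_eq_true, List.all_eq_true]
  exact forall₂_congr fun l hl => by rw [h1 l hl]

/-- `genusTwoTest` with evaluation of intermediate results. -/
def genusTwoK (c : ℕ) : Bool :=
  pairsK c (List.range 8) fun M N => labelsK (fun V => labelsK (linkK V) N (List.range 36)) M (List.range 6)

theorem genusTwoK_eq (c : ℕ) : genusTwoK c = genusTwoTest c := by
  rw [genusTwoK, pairsK_eq, labelsK_eq, labelsK_eq, linkK_eq]
  rfl

/-- The code either fails the link test or is carried to an entry by the indicated symmetry. -/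
def entryCheck (c k : ℕ) : Bool :=
  bif Nat.ble 9999 k then !genusTwoK c else
    relCode (k % 48 % 6) (k % 48 / 6) c (entries.getD (k / 48) (0, 0)).2 && Nat.blt (k / 48) 113

/-- The check for a list of lists of face identifications. -/
def choicesCheck : List (List (ℕ × ℕ × ℕ)) → List ℕ → Bool
  | [], _ => true
  | T :: L, k :: K => (forceN (codeOf T) fun c => codeCheck T c && entryCheck c k) && choicesCheck L K
  | _, _ => false

theorem entries_check : entries.all (fun e => decide (ValidCode e.2) && genusTwoK e.2) = true := by
  decide +kernel

theorem pairingReps_check : pairingReps.all (fun R => choicesCheck (axisChoices R.1) R.2 &&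
    R.1.all fun q => Nat.blt q.1 8 && Nat.blt q.2 8) = true := by
  decide +kernel

theorem entries_unrelated : entries.Pairwise fun a b => Nat.beq a.1 b.1 = false ∨ unrelated a.2 b.2 = true := by
  decide +kernel

/-! ### The list of codes is complete and without repetitions -/

theorem entry_valid {e : ℕ × ℕ} (he : e ∈ entries) : ValidCode e.2 := by
  have := List.all_eq_true.1 entries_check e he
  rw [Bool.and_eq_true] at this
  exact of_decide_eq_true this.1

theorem entry_links {e : ℕ × ℕ} (he : e ∈ entries) : LinksGenusTwo (gluingOf e.2 (entry_valid he)) := by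
  have := List.all_eq_true.1 entries_check e he
  rw [Bool.and_eq_true] at this
  rw [linksGenusTwo_gluingOf, ← genusTwoK_eq]
  exact this.2

/-- The gluing pattern of an entry. -/
def entryGluing (e : {e : ℕ × ℕ // e ∈ entries}) : Gluing := gluingOf e.1.2 (entry_valid e.2)

theorem exists_of_choicesCheck {L : List (List (ℕ × ℕ × ℕ))} {K : List ℕ} (h : choicesCheck L K = true)
    {T : List (ℕ × ℕ × ℕ)} (hT : T ∈ L) : ∃ k, codeCheck T (codeOf T) = true ∧ entryCheck (codeOf T) k = true := by
  induction L generalizing K with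
  | nil => simp at hT
  | cons T' L ih =>
    cases K with
    | nil => simp [choicesCheck] at h
    | cons k K =>
      rw [choicesCheck, forceN_eq, Bool.and_eq_true, Bool.and_eq_true] at h
      rcases List.mem_cons.1 hT with rfl | hT
      · exact ⟨k, h.1⟩
      · exact ih h.2 hT

theorem exists_equiv_of_entryCheck {c k : ℕ} (hc : ValidCode c) (hg : LinksGenusTwo (gluingOf c hc))
    (h : entryCheck c k = true) : ∃ e, EquivGluing (gluingOf c hc) (entryGluing e) := by
  unfold entryCheck at h
  cases hb : Nat.ble 9999 k
  · rw [hb, cond_false, Bool.and_eq_true] at h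
    have hk : k / 48 < entries.length := lt_of_lt_of_eq (Nat.le_of_ble_eq_true h.2) rfl
    have e : entries.getD (k / 48) (0, 0) = entries[k / 48] := by simp [List.getD_eq_getElem?_getD, hk]
    rw [e] at h
    have hm : entries[k / 48] ∈ entries := List.getElem_mem hk
    refine ⟨⟨_, hm⟩, _, _, (relCode_iff ?_ ?_ hc (entry_valid hm)).1 h.1⟩ <;> omega
  · rw [hb, cond_true, genusTwoK_eq, (linksGenusTwo_gluingOf hc).1 hg] at h
    simp at h

theorem exists_equiv_of_pairing {g : Gluing} (hg : LinksGenusTwo g) {R : List (ℕ × ℕ) × List ℕ}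
    (hR : R ∈ pairingReps) (h : ∀ q ∈ R.1, g.face (faceN q.1) = faceN q.2) : ∃ e, EquivGluing g (entryGluing e) := by
  have hc := List.all_eq_true.1 pairingReps_check R hR
  simp only [Bool.and_eq_true, List.all_eq_true] at hc
  obtain ⟨T, hT, hT'⟩ := exists_axisChoice g R.1 fun q hq =>
    ⟨Nat.le_of_ble_eq_true (hc.2 q hq).1, Nat.le_of_ble_eq_true (hc.2 q hq).2, h q hq⟩
  obtain ⟨k, hk, hk'⟩ := exists_of_choicesCheck hc.1 hT
  obtain ⟨hv, rfl⟩ := eq_gluingOf g hk hT'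
  exact exists_equiv_of_entryCheck hv hg hk'

theorem exists_entry {g : Gluing} (hg : LinksGenusTwo g) : ∃ e, EquivGluing g (entryGluing e) := by
  obtain ⟨P, hP, hs⟩ := exists_matching (fun f => faceNum (g.face (faceN f))) 8 (List.range 8) List.nodup_range <| by
    intro f hf
    refine ⟨List.mem_range.2 (faceNum_lt _), ?_, fun e => ?_⟩
    · rw [faceN_faceNum, Gluing.face_face, faceNum_faceN (List.mem_range.1 hf)]
    · refine g.face_ne (faceN f) ?_
      rw [← faceN_faceNum (g.face (faceN f))]
      exact congrArg faceN e
  obtain ⟨R, hR, hm⟩ := List.any_eq_true.1 (List.all_eq_true.1 matchCheck_all P hP)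
  simp only [matchCheck, List.any_eq_true, List.all_eq_true, Bool.or_eq_true, Bool.and_eq_true, Nat.beq_eq] at hm
  obtain ⟨p, hp, m, hm', hm⟩ := hm
  rw [List.mem_range] at hp hm'
  have hS := SymData.pull g (permN p) (faceN m)
  have hE : EquivGluing (g.pull (permN p) (faceN m)) g := ⟨_, _, hS⟩
  obtain ⟨e, he⟩ := exists_equiv_of_pairing (g := g.pull (permN p) (faceN m)) (hE.symm.linksGenusTwo hg) hR <| by
    intro q hq
    have hq8 := List.all_eq_true.1 (Bool.and_eq_true _ _ ▸ List.all_eq_true.1 pairingReps_check R hR).2 q hq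
    rw [Bool.and_eq_true] at hq8
    have e1 := faceN_sface p hp m hm' q.1 (Nat.le_of_ble_eq_true hq8.1)
    have e2 := faceN_sface p hp m hm' q.2 (Nat.le_of_ble_eq_true hq8.2)
    have hf : g.face (faceN (sface p m q.1)) = faceN (sface p m q.2) := by
      obtain ⟨q', hq', h | h⟩ := hm q hq
      · have := hs q' hq'
        rw [← h.1, ← h.2] at this
        rw [← this, faceN_faceNum]
      · have := hs q' hq'
        rw [← h.1, ← h.2] at this
        rw [← this, faceN_faceNum, Gluing.face_face]
    have := hS.1 (faceN q.1)
    rw [e1.2, hf, ← e2.2] at this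
    rw [← symMapFace_symm (permN p) (faceN m) (Gluing.face _ _), ← this, symMapFace_symm]
  exact ⟨e, hE.symm.trans he⟩

/-! ### Counting -/

/-- The quotient space of every entry is homeomorphic to the representative of its class. -/
def EntryHomeo : Prop := ∀ e : {e : ℕ × ℕ // e ∈ entries},
  ∃ A, spaceReps[e.1.1]? = some A ∧ Nonempty (XSpace (entryGluing e) ≃ₜ XSpace A.gl)

theorem entries_nodup : entries.Nodup := by decide +kernel

theorem not_equiv_entries (H : EntryHomeo) {e e' : {e : ℕ × ℕ // e ∈ entries}} (hne : e ≠ e') :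
    ¬EquivGluing (entryGluing e) (entryGluing e') := by
  intro hE
  by_cases h : e.1.1 = e'.1.1
  · have hsym : Std.Symm fun a b : ℕ × ℕ => (Nat.beq a.1 b.1 = false ∨ unrelated a.2 b.2 = true) ∨
        (Nat.beq b.1 a.1 = false ∨ unrelated b.2 a.2 = true) := ⟨fun _ _ h => h.symm⟩
    have := (entries_unrelated.imp (S := fun a b : ℕ × ℕ => (Nat.beq a.1 b.1 = false ∨ unrelated a.2 b.2 = true) ∨
      (Nat.beq b.1 a.1 = false ∨ unrelated b.2 a.2 = true)) fun h => Or.inl h).forall e.2 e'.2 fun e => hne (Subtype.ext e)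
    have hb : Nat.beq e.1.1 e'.1.1 = true := by rw [h]; exact Nat.beq_refl _
    have hb' : Nat.beq e'.1.1 e.1.1 = true := by rw [h]; exact Nat.beq_refl _
    rw [hb, hb'] at this
    rcases this with (h | h) | (h | h)
    · simp at h
    · exact not_equiv_of_unrelated _ _ h hE
    · simp at h
    · exact not_equiv_of_unrelated _ _ h hE.symm
  · obtain ⟨A, hA, ⟨f⟩⟩ := H e
    obtain ⟨B, hB, ⟨f'⟩⟩ := H e'
    obtain ⟨k⟩ := hE.homeo
    rw [List.getElem?_eq_some_iff] at hA hB
    obtain ⟨ha, rfl⟩ := hA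
    obtain ⟨hb, rfl⟩ := hB
    have hp := List.pairwise_iff_getElem.1 spaceReps_pairwise
    rcases Nat.lt_or_gt_of_ne h with h | h
    · exact hp _ _ ha hb h ⟨(f.symm.trans k).trans f'⟩
    · exact hp _ _ hb ha h ⟨((f.symm.trans k).trans f').symm⟩

theorem card_orbits (H : EntryHomeo) :
    Nat.card {s : Set Gluing // ∃ g : Gluing, LinksGenusTwo g ∧ s = orbit g} = 113 := by
  have e : {e : ℕ × ℕ // e ∈ entries} ≃ {s : Set Gluing // ∃ g : Gluing, LinksGenusTwo g ∧ s = orbit g} := by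
    refine Equiv.ofBijective (fun e => ⟨orbit (entryGluing e), _, entry_links e.2, rfl⟩) ⟨fun e e' h => ?_, ?_⟩
    · by_contra hne
      exact not_equiv_entries H hne (orbit_eq_iff.1 (congrArg Subtype.val h))
    · rintro ⟨_, g, hg, rfl⟩
      obtain ⟨e, he⟩ := exists_entry hg
      exact ⟨e, Subtype.ext (orbit_eq_iff.2 he).symm⟩
  rw [← Nat.card_congr e, ← Nat.card_congr (List.Nodup.getEquiv entries entries_nodup), Nat.card_fin]
  rfl

/-- The codes of the representatives are entries. -/
theorem spaceReps_code : ∀ A ∈ spaceReps, ∃ e ∈ entries, e.2 = A.p.code := by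
  have h : spaceReps.all (fun A => entries.any fun e => Nat.beq e.2 A.p.code) = true := by decide +kernel
  intro A hA
  obtain ⟨e, he, h⟩ := List.any_eq_true.1 (List.all_eq_true.1 h A hA)
  exact ⟨e, he, Nat.eq_of_beq_eq_true h⟩

theorem spaceReps_links (A : SpaceData) (hA : A ∈ spaceReps) : LinksGenusTwo A.gl := by
  obtain ⟨⟨i, c⟩, hi, rfl⟩ := spaceReps_code A hA
  exact entry_links hi

theorem gl_injective : ∀ A ∈ spaceReps, ∀ B ∈ spaceReps, A ≠ B → ¬Nonempty (XSpace A.gl ≃ₜ XSpace B.gl) := by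
  have : Std.Symm fun A B : SpaceData => ¬Nonempty (XSpace A.gl ≃ₜ XSpace B.gl) := ⟨fun _ _ h ⟨f⟩ => h ⟨f.symm⟩⟩
  exact fun A hA B hB h => spaceReps_pairwise.forall hA hB h

open Classical in
theorem exists_finset (H : EntryHomeo) : ∃ t : Finset Gluing, (∀ g ∈ t, LinksGenusTwo g) ∧ t.card = 79 ∧
      (∀ g : Gluing, LinksGenusTwo g → ∃ h ∈ t, Nonempty (XSpace g ≃ₜ XSpace h)) ∧
      (∀ h ∈ t, ∀ h' ∈ t, Nonempty (XSpace h ≃ₜ XSpace h') → h = h') := by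
  refine ⟨(spaceReps.map SpaceData.gl).toFinset, ?_, ?_, ?_, ?_⟩
  · simp only [List.mem_toFinset, List.mem_map]
    rintro _ ⟨A, hA, rfl⟩
    exact spaceReps_links A hA
  · rw [List.toFinset_card_of_nodup]
    · rfl
    · rw [List.Nodup, List.pairwise_map]
      exact spaceReps_pairwise.imp fun h e => h (by rw [e]; exact ⟨Homeomorph.refl _⟩)
  · intro g hg
    obtain ⟨e, he⟩ := exists_entry hg
    obtain ⟨A, hA, ⟨f⟩⟩ := H e
    obtain ⟨k⟩ := he.homeo
    exact ⟨A.gl, by simpa using ⟨A, List.mem_of_getElem? hA, rfl⟩, ⟨k.trans f⟩⟩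
  · simp only [List.mem_toFinset, List.mem_map]
    rintro _ ⟨A, hA, rfl⟩ _ ⟨B, hB, rfl⟩ hf
    by_contra h
    exact gl_injective A hA B hB (fun e => h (by rw [e])) hf

/-! ### Spaces glued from tetrahedra -/

/-- A continuous map between quotients, both being quotients of parts of a common space. -/
theorem quotient_map_of_common {Z Z' A : Type*} [TopologicalSpace Z] [TopologicalSpace Z']
    [CompactSpace Z'] [TopologicalSpace A] [T2Space A] {q : Z → A} {q' : Z' → A} (hq : Continuous q)
    (hq' : Continuous q') {r : Z → Z → Prop} {r' : Z' → Z' → Prop}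
    (h1 : ∀ a b, r a b → ∃ a' b', q' a' = q a ∧ q' b' = q b ∧ Relation.EqvGen r' a' b')
    (h2' : ∀ a b, q' a = q' b → Relation.EqvGen r' a b) (h3 : ∀ a, ∃ a', q' a' = q a) :
    ∃ f : Quotient (Relation.EqvGen.setoid r) → Quotient (Relation.EqvGen.setoid r'),
      Continuous f ∧ ∀ a a', q' a' = q a → f (Quotient.mk _ a) = Quotient.mk _ a' := by
  choose s hs using h3
  let F : Z → Quotient (Relation.EqvGen.setoid r') := fun a => Quotient.mk _ (s a)
  have hF : ∀ a a', q' a' = q a → F a = Quotient.mk _ a' := fun a a' h =>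
    Quotient.sound (h2' _ _ ((hs a).trans h.symm))
  have hFr : ∀ a b, Relation.EqvGen r a b → F a = F b := by
    intro a b h
    induction h with
    | rel a b h =>
      obtain ⟨a', b', ha, hb, h⟩ := h1 a b h
      rw [hF a a' ha, hF b b' hb]
      exact Quotient.sound h
    | refl a => rfl
    | symm a b _ ih => exact ih.symm
    | trans a b c _ _ ih ih' => exact ih.trans ih'
  have hc : Continuous F := by
    rw [continuous_iff_isClosed]
    intro C hC
    have : F ⁻¹' C = q ⁻¹' (q' '' (Quotient.mk _ ⁻¹' C)) := by
      ext a
      simp only [mem_preimage, mem_image]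
      constructor
      · exact fun h => ⟨s a, h, hs a⟩
      · rintro ⟨a', h, ha⟩
        rwa [hF a a' ha]
    rw [this]
    exact ((hC.preimage continuous_quotient_mk').isCompact.image hq').isClosed.preimage hq
  exact ⟨Quotient.lift F hFr, hc.quotient_lift _, hF⟩

/-- Two quotients of compact spaces are homeomorphic if both are quotients of parts of a common
Hausdorff space, and the gluing relations correspond there. -/
theorem homeo_of_common {Z Z' A : Type*} [TopologicalSpace Z] [CompactSpace Z] [TopologicalSpace Z']
    [CompactSpace Z'] [TopologicalSpace A] [T2Space A] {q : Z → A} {q' : Z' → A} (hq : Continuous q)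
    (hq' : Continuous q') {r : Z → Z → Prop} {r' : Z' → Z' → Prop}
    (h1 : ∀ a b, r a b → ∃ a' b', q' a' = q a ∧ q' b' = q b ∧ Relation.EqvGen r' a' b')
    (h1' : ∀ a b, r' a b → ∃ a' b', q a' = q' a ∧ q b' = q' b ∧ Relation.EqvGen r a' b')
    (h2 : ∀ a b, q a = q b → Relation.EqvGen r a b)
    (h2' : ∀ a b, q' a = q' b → Relation.EqvGen r' a b)
    (h3 : ∀ a, ∃ a', q' a' = q a) (h3' : ∀ a, ∃ a', q a' = q' a) :
    Nonempty (Quotient (Relation.EqvGen.setoid r) ≃ₜ Quotient (Relation.EqvGen.setoid r')) := by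
  obtain ⟨f, hf, hf1⟩ := quotient_map_of_common hq hq' h1 h2' h3
  obtain ⟨f', hf', hf1'⟩ := quotient_map_of_common hq' hq h1' h2 h3'
  refine ⟨⟨⟨f, f', fun x => ?_, fun x => ?_⟩, hf, hf'⟩⟩
  · induction x using Quotient.inductionOn with
    | h a =>
      obtain ⟨a', ha⟩ := h3 a
      rw [hf1 a a' ha, hf1' a' a ha.symm]
  · induction x using Quotient.inductionOn with
    | h a =>
      obtain ⟨a', ha⟩ := h3' a
      rw [hf1' a a' ha, hf1 a' a ha.symm]

/-- The image of barycentric coordinates under a map of vertices. -/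
def bary {m n : ℕ} (v : Fin m → Fin n) (w : Fin m → ℝ) (a : Fin n) : ℝ :=
  ∑ j, if v j = a then w j else 0

theorem bary_comp {l m n : ℕ} (v : Fin m → Fin n) (f : Fin l → Fin m) (w : Fin l → ℝ) :
    bary (v ∘ f) w = bary v (bary f w) := by
  ext a
  simp only [bary, Function.comp]
  have : ∀ j : Fin m, (if v j = a then ∑ i, (if f i = j then w i else 0) else 0) =
      ∑ i, if f i = j then (if v j = a then w i else 0) else 0 := by
    intro j
    split_ifs with h <;> simp
  simp_rw [this]
  rw [Finset.sum_comm]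
  simp

theorem bary_nonneg {m n : ℕ} (v : Fin m → Fin n) {w : Fin m → ℝ} (hw : ∀ j, 0 ≤ w j) (a : Fin n) :
    0 ≤ bary v w a := Finset.sum_nonneg fun j _ => by split_ifs <;> simp [hw]

theorem sum_bary {m n : ℕ} (v : Fin m → Fin n) (w : Fin m → ℝ) : ∑ a, bary v w a = ∑ j, w j := by
  simp only [bary]
  rw [Finset.sum_comm]
  simp

theorem bary_eq_zero {m n : ℕ} {v : Fin m → Fin n} {a : Fin n} (h : ∀ j, v j ≠ a) (w : Fin m → ℝ) :
    bary v w a = 0 := by simp [bary, h]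

theorem bary_perm {n : ℕ} (e : Equiv.Perm (Fin n)) (x : Fin n → ℝ) (a : Fin n) :
    bary e x a = x (e.symm a) := by
  simp only [bary, ← Equiv.eq_symm_apply]
  simp

theorem continuous_bary {m n : ℕ} (v : Fin m → Fin n) : Continuous (bary v) :=
  continuous_pi fun a => continuous_finsetSum _ fun j _ => by
    split_ifs <;> fun_prop

/-- Points of `n` disjoint tetrahedra. -/
abbrev Pt (n : ℕ) : Type := Fin n × stdSimplex ℝ (Fin 4)

/-- Move a point by a map of vertices. -/
def baryPt {m : ℕ} (v : Fin m → Fin 4) (x : stdSimplex ℝ (Fin m)) : stdSimplex ℝ (Fin 4) :=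
  ⟨bary v x, fun a => bary_nonneg v x.2.1 a, (sum_bary v _).trans x.2.2⟩

/-- The vertices of the triangle with code `k`: triangle `t; a, b, c` is `a + 4 b + 16 c + 64 t`. -/
def tvtx (k : ℕ) (j : Fin 3) : Fin 4 := ⟨(k >>> (2 * j.1)) % 4, Nat.mod_lt _ (by norm_num)⟩

/-- The tetrahedron of the triangle with code `k`. -/
def ttet (k : ℕ) : ℕ := k >>> 6

/-- The relation gluing pairs of triangles. -/
def triRel (n : ℕ) (L : List (ℕ × ℕ)) (z z' : Pt n) : Prop :=
  ∃ p ∈ L, z.1.1 = ttet p.1 ∧ z'.1.1 = ttet p.2 ∧ ∃ w : stdSimplex ℝ (Fin 3),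
    z.2 = baryPt (tvtx p.1) w ∧ z'.2 = baryPt (tvtx p.2) w

/-- The space obtained by gluing pairs of triangles of `n` tetrahedra. -/
abbrev TetSpace (n : ℕ) (L : List (ℕ × ℕ)) : Type :=
  Quotient (Relation.EqvGen.setoid (triRel n L))

/-! ### Equal gluings -/

/-- The pair `p` of triangles is glued in the same way as the pair `q`. -/
def subPair (p q : ℕ × ℕ) : Bool :=
  Nat.beq (ttet p.1) (ttet q.1) && Nat.beq (ttet p.2) (ttet q.2) &&
    [0, 1, 2].all fun i => [0, 1, 2].any fun j =>
      Nat.beq ((p.1 >>> (2 * i)) % 4) ((q.1 >>> (2 * j)) % 4) &&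
        Nat.beq ((p.2 >>> (2 * i)) % 4) ((q.2 >>> (2 * j)) % 4)

theorem subPair_spec {p q : ℕ × ℕ} (h : subPair p q = true) : ttet p.1 = ttet q.1 ∧
    ttet p.2 = ttet q.2 ∧ ∃ f : Fin 3 → Fin 3, tvtx p.1 = tvtx q.1 ∘ f ∧ tvtx p.2 = tvtx q.2 ∘ f := by
  simp only [subPair, Bool.and_eq_true, List.all_eq_true, List.any_eq_true] at h
  obtain ⟨⟨h1, h2⟩, h⟩ := h
  have : ∀ i : Fin 3, ∃ j : Fin 3, tvtx p.1 i = tvtx q.1 j ∧ tvtx p.2 i = tvtx q.2 j := by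
    intro i
    obtain ⟨j, hj, ha, hb⟩ := h i.1 (by fin_cases i <;> simp)
    have hj : j < 3 := by simp at hj; omega
    exact ⟨⟨j, hj⟩, Fin.ext (Nat.eq_of_beq_eq_true ha), Fin.ext (Nat.eq_of_beq_eq_true hb)⟩
  choose f hf using this
  exact ⟨Nat.eq_of_beq_eq_true h1, Nat.eq_of_beq_eq_true h2, f, funext fun i => (hf i).1,
    funext fun i => (hf i).2⟩

/-- Transport barycentric coordinates by a map of the vertices of a triangle. -/
theorem baryPt_comp {m l : ℕ} (f : Fin l → Fin m) (w : stdSimplex ℝ (Fin l)) :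
    ∃ w' : stdSimplex ℝ (Fin m), ∀ v : Fin m → Fin 4, baryPt (v ∘ f) w = baryPt v w' :=
  ⟨⟨bary f w, fun a => bary_nonneg f w.2.1 a, (sum_bary f _).trans w.2.2⟩,
    fun v => Subtype.ext (bary_comp v f w.1)⟩

theorem triRel_of_subPair {n : ℕ} {p q : ℕ × ℕ} (h : subPair p q = true) {z z' : Pt n}
    (hz : triRel n [p] z z') : triRel n [q] z z' := by
  obtain ⟨h1, h2, f, hf, hf'⟩ := subPair_spec h
  obtain ⟨p, hp, ha, hb, w, hw, hw'⟩ := hz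
  obtain rfl := List.mem_singleton.1 hp
  obtain ⟨w', h⟩ := baryPt_comp f w
  exact ⟨q, List.mem_singleton_self q, ha.trans h1, hb.trans h2, w', by rw [hw, hf, h], by rw [hw', hf', h]⟩

theorem triRel_mono {n : ℕ} {L M : List (ℕ × ℕ)} (h : L ⊆ M) {z z' : Pt n} (hz : triRel n L z z') :
    triRel n M z z' := by
  obtain ⟨p, hp, hz⟩ := hz
  exact ⟨p, h hp, hz⟩

theorem triRel_singleton {n : ℕ} {L : List (ℕ × ℕ)} {z z' : Pt n} (hz : triRel n L z z') :
    ∃ p ∈ L, triRel n [p] z z' := by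
  obtain ⟨p, hp, hz⟩ := hz
  exact ⟨p, hp, p, List.mem_singleton_self p, hz⟩

theorem triRel_swap {n : ℕ} {p : ℕ × ℕ} {z z' : Pt n} (hz : triRel n [p] z z') :
    triRel n [(p.2, p.1)] z' z := by
  obtain ⟨p, hp, ha, hb, w, hw, hw'⟩ := hz
  obtain rfl := List.mem_singleton.1 hp
  exact ⟨(p.2, p.1), List.mem_singleton_self _, hb, ha, w, hw', hw⟩

theorem eqvGen_of_eq {Z : Type*} {r : Z → Z → Prop} {a b : Z} (h : a = b) : Relation.EqvGen r a b :=
  h ▸ .refl a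

/-- All pairs of `L` are glued in the same way as pairs of `M`. -/
def subList (L M : List (ℕ × ℕ)) : Bool :=
  L.all fun p => M.any fun q => subPair p q || subPair (p.2, p.1) q

theorem eqvGen_of_subList {n : ℕ} {L M : List (ℕ × ℕ)} (h : subList L M = true) {z z' : Pt n}
    (hz : triRel n L z z') : Relation.EqvGen (triRel n M) z z' := by
  obtain ⟨p, hp, hz⟩ := triRel_singleton hz
  obtain ⟨q, hq, h⟩ := List.any_eq_true.1 (List.all_eq_true.1 h p hp)
  have hM : [q] ⊆ M := by simpa using hq
  rcases Bool.or_eq_true_iff.1 h with h | h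
  · exact .rel _ _ (triRel_mono hM (triRel_of_subPair h hz))
  · exact .symm _ _ (.rel _ _ (triRel_mono hM (triRel_of_subPair h (triRel_swap hz))))

theorem tetSpace_homeo_of_subList (n : ℕ) {L M : List (ℕ × ℕ)} (h : subList L M = true)
    (h' : subList M L = true) : Nonempty (TetSpace n L ≃ₜ TetSpace n M) :=
  homeo_of_common (A := Pt n) continuous_id continuous_id
    (fun a b hab => ⟨a, b, rfl, rfl, eqvGen_of_subList h hab⟩)
    (fun a b hab => ⟨a, b, rfl, rfl, eqvGen_of_subList h' hab⟩)
    (fun _ _ => eqvGen_of_eq) (fun _ _ => eqvGen_of_eq) (fun a => ⟨a, rfl⟩) fun a => ⟨a, rfl⟩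

/-! ### Relabelling -/

/-- The image of tetrahedron `t` under the relabelling `R`. -/
def rtet (R t : ℕ) : ℕ := (R >>> (12 * t)) % 16

/-- The image of vertex `a` of tetrahedron `t` under the relabelling `R`. -/
def rvtx (R t a : ℕ) : ℕ := (R >>> (12 * t + 4 + 2 * a)) % 4

/-- Relabel a triangle. -/
def rtri (R k : ℕ) : ℕ :=
  forceN (ttet k) fun t => forceN (64 * rtet R t + (rvtx R t (k % 4) + 4 * rvtx R t ((k >>> 2) % 4) +
    16 * rvtx R t ((k >>> 4) % 4))) fun x => x

/-- Relabel a list of pairs of triangles. -/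
def rlist (R : ℕ) (L : List (ℕ × ℕ)) : List (ℕ × ℕ) := L.map fun p => (rtri R p.1, rtri R p.2)

/-- The relabelling `R` of `n` tetrahedra is bijective. -/
def relabelCheck (n R : ℕ) : Prop :=
  (∀ t < n, rtet R t < n ∧ ∀ s < n, s < t → rtet R s ≠ rtet R t) ∧
    ∀ t < n, ∀ a < 4, ∀ b < a, rvtx R t a ≠ rvtx R t b

instance (n R : ℕ) : Decidable (relabelCheck n R) := by unfold relabelCheck; infer_instance

theorem ttet_rtri (R k : ℕ) : ttet (rtri R k) = rtet R (ttet k) := by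
  simp only [rtri, forceN_eq, ttet, Nat.shiftRight_eq_div_pow]
  have h0 : rvtx R (k / 2 ^ 6) (k % 4) < 4 := Nat.mod_lt _ (by norm_num)
  have h1 : rvtx R (k / 2 ^ 6) (k / 2 ^ 2 % 4) < 4 := Nat.mod_lt _ (by norm_num)
  have h2 : rvtx R (k / 2 ^ 6) (k / 2 ^ 4 % 4) < 4 := Nat.mod_lt _ (by norm_num)
  norm_num at h0 h1 h2 ⊢
  omega

theorem tvtx_rtri (R k : ℕ) (j : Fin 3) : (tvtx (rtri R k) j).1 = rvtx R (ttet k) (tvtx k j).1 := by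
  simp only [rtri, forceN_eq, ttet, tvtx, Nat.shiftRight_eq_div_pow]
  have h0 : rvtx R (k / 2 ^ 6) (k % 4) < 4 := Nat.mod_lt _ (by norm_num)
  have h1 : rvtx R (k / 2 ^ 6) (k / 2 ^ 2 % 4) < 4 := Nat.mod_lt _ (by norm_num)
  have h2 : rvtx R (k / 2 ^ 6) (k / 2 ^ 4 % 4) < 4 := Nat.mod_lt _ (by norm_num)
  fin_cases j <;> norm_num at h0 h1 h2 ⊢ <;> omega

/-- All triangles of `L` are triangles of `n` tetrahedra. -/
def okList (n : ℕ) (L : List (ℕ × ℕ)) : Bool :=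
  L.all fun p => Nat.blt (ttet p.1) n && Nat.blt (ttet p.2) n

theorem okList_spec {n : ℕ} {L : List (ℕ × ℕ)} (h : okList n L = true) {p : ℕ × ℕ} (hp : p ∈ L) :
    ttet p.1 < n ∧ ttet p.2 < n := by
  have := List.all_eq_true.1 h p hp
  rw [Bool.and_eq_true] at this
  exact ⟨Nat.le_of_ble_eq_true this.1, Nat.le_of_ble_eq_true this.2⟩

theorem tetSpace_homeo_rlist {n R : ℕ} (h : relabelCheck n R) {L : List (ℕ × ℕ)} (hL : okList n L = true) :
    Nonempty (TetSpace n L ≃ₜ TetSpace n (rlist R L)) := by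
  obtain ⟨ht, hv⟩ := h
  let σ : Fin n → Fin n := fun t => ⟨rtet R t, (ht t t.2).1⟩
  have hσ : Function.Injective σ := by
    intro s t hst
    have hst : rtet R s = rtet R t := congrArg Fin.val hst
    rcases Nat.lt_trichotomy s.1 t.1 with h | h | h
    · exact absurd hst ((ht t t.2).2 s s.2 h)
    · exact Fin.ext h
    · exact absurd hst.symm ((ht s s.2).2 t t.2 h)
  let ν : Fin n → Fin 4 → Fin 4 := fun t a => ⟨rvtx R t a, Nat.mod_lt _ (by norm_num)⟩
  have hν : ∀ t, Function.Injective (ν t) := by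
    intro t a b hab
    have hab : rvtx R t a = rvtx R t b := congrArg Fin.val hab
    rcases Nat.lt_trichotomy a.1 b.1 with h | h | h
    · exact absurd hab.symm (hv t t.2 b b.2 a h)
    · exact Fin.ext h
    · exact absurd hab (hv t t.2 a a.2 b h)
  have hσb := Finite.injective_iff_bijective.1 hσ
  have hνb := fun t => Finite.injective_iff_bijective.1 (hν t)
  let q : Pt n → Pt n := fun z => (σ z.1, baryPt (ν z.1) z.2)
  have hq : Continuous q := by
    rw [continuous_prod_of_discrete_left]
    exact fun t => Continuous.prodMk (continuous_const (y := σ t)) (((continuous_bary (ν t)).comp continuous_subtype_val).subtype_mk _)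
  have hinv : ∀ t (x : stdSimplex ℝ (Fin 4)) a, (baryPt (ν t) x).1 (ν t a) = x.1 a := by
    intro t x a
    have := bary_perm (Equiv.ofBijective _ (hνb t)) x.1 (ν t a)
    rw [show ν t a = Equiv.ofBijective _ (hνb t) a from rfl, Equiv.symm_apply_apply] at this
    exact this
  have hinj : Function.Injective q := by
    rintro ⟨t, x⟩ ⟨s, y⟩ h
    obtain ⟨h1, h2⟩ := Prod.ext_iff.1 h
    obtain rfl : t = s := hσ h1
    refine Prod.ext rfl (Subtype.ext (funext fun a => ?_))
    rw [← hinv t x a, ← hinv t y a]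
    exact congrArg (fun z : stdSimplex ℝ (Fin 4) => z.1 (ν t a)) h2
  have hsurj : ∀ z, ∃ z', q z' = z := by
    rintro ⟨t, x⟩
    obtain ⟨t, rfl⟩ := hσb.2 t
    refine ⟨(t, baryPt (Equiv.ofBijective _ (hνb t)).symm x), Prod.ext rfl (Subtype.ext ?_)⟩
    show bary (ν t) (bary _ x.1) = x.1
    rw [← bary_comp]
    have : ν t ∘ (Equiv.ofBijective _ (hνb t)).symm = Equiv.refl _ :=
      funext fun a => (Equiv.ofBijective _ (hνb t)).apply_symm_apply a
    rw [this]
    exact funext fun a => bary_perm _ _ _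
  have hpt : ∀ (t : Fin n) (k : ℕ) (w : stdSimplex ℝ (Fin 3)), t.1 = ttet k →
      baryPt (ν t) (baryPt (tvtx k) w) = baryPt (tvtx (rtri R k)) w := by
    intro t k w h
    refine Subtype.ext ?_
    show bary _ (bary _ _) = bary _ _
    rw [← bary_comp]
    congr 1
    refine funext fun j => Fin.ext ?_
    rw [tvtx_rtri, ← h]
    rfl
  refine homeo_of_common (q := q) (q' := id) hq continuous_id ?_ ?_ (fun a b h => eqvGen_of_eq (hinj h))
    (fun _ _ => eqvGen_of_eq) (fun a => ⟨q a, rfl⟩) hsurj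
  · rintro a b ⟨p, hp, ha, hb, w, hw, hw'⟩
    refine ⟨q a, q b, rfl, rfl, .rel _ _ ⟨_, List.mem_map_of_mem hp, ?_, ?_, w, ?_, ?_⟩⟩
    · rw [ttet_rtri, ← ha]
    · rw [ttet_rtri, ← hb]
    · rw [← hpt _ _ w ha, ← hw]
    · rw [← hpt _ _ w hb, ← hw']
  · intro a b hab
    obtain ⟨a, rfl⟩ := hsurj a
    obtain ⟨b, rfl⟩ := hsurj b
    refine ⟨a, b, rfl, rfl, .rel _ _ ?_⟩
    obtain ⟨p', hp, ha, hb, w, hw, hw'⟩ := hab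
    obtain ⟨p, hpL, rfl⟩ := List.mem_map.1 hp
    obtain ⟨h1, h2⟩ := okList_spec hL hpL
    have hlift : ∀ (a : Pt n) (k : ℕ), ttet k < n → (q a).1.1 = ttet (rtri R k) →
        (q a).2 = baryPt (tvtx (rtri R k)) w → a.1.1 = ttet k ∧ a.2 = baryPt (tvtx k) w := by
      intro a k hk h h'
      rw [ttet_rtri] at h
      have h1 : a.1 = ⟨ttet k, hk⟩ := hσ (Fin.ext h)
      have h2 : q (⟨ttet k, hk⟩, baryPt (tvtx k) w) = q a :=
        Prod.ext (by rw [← h1]) ((hpt _ k w rfl).trans h'.symm)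
      have := hinj h2
      rw [← this]
      exact ⟨rfl, rfl⟩
    exact ⟨p, hpL, (hlift a _ h1 ha hw).1, (hlift b _ h2 hb hw').1, w, (hlift a _ h1 ha hw).2,
      (hlift b _ h2 hb hw').2⟩

/-! ### The 2-3 move -/

/-- The vertex of the tetrahedron missing from a triangle. -/
def missV (k : ℕ) : ℕ := 6 - (k % 4 + (k >>> 2) % 4 + (k >>> 4) % 4)

/-- The triangle is not the common face `0, 1, 2` of the tetrahedra `0` and `1`. -/
def extTri (k : ℕ) : Bool :=
  Nat.ble 2 (ttet k) || forceN (missV k) fun i =>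
    Nat.blt i 3 && !Nat.beq (k % 4) i && !Nat.beq ((k >>> 2) % 4) i && !Nat.beq ((k >>> 4) % 4) i

/-- Replace vertex `3` by vertex `i`. -/
def swapV (i d : ℕ) : ℕ := bif Nat.beq d 3 then i else d

/-- The triangle after the 2-3 move. -/
def convTri (k : ℕ) : ℕ :=
  bif Nat.ble 2 (ttet k) then k + 64 else forceN (missV k) fun i => forceN
    (bif Nat.beq (ttet k) 0 then 64 * i + (k % 4 + 4 * ((k >>> 2) % 4) + 16 * ((k >>> 4) % 4)) else
      64 * i + (swapV i (k % 4) + 4 * swapV i ((k >>> 2) % 4) + 16 * swapV i ((k >>> 4) % 4)))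
    fun x => x

/-- The gluings between the three tetrahedra produced by the 2-3 move: the triangles
`i; k, 3, i` and `j; k, 3, j`. -/
def innerPairs : List (ℕ × ℕ) := [(14, 94), (13, 173), (92, 172)]

/-- The 2-3 move on the tetrahedra `0` and `1`. -/
def move23 (L : List (ℕ × ℕ)) : List (ℕ × ℕ) :=
  innerPairs ++ (L.filter fun p => extTri p.1 && extTri p.2).map fun p => (convTri p.1, convTri p.2)

/-- The list `L` glues the faces `0, 1, 2` of the tetrahedra `0` and `1` and no other triangles which
lie in these faces. -/
def moveCheck (L : List (ℕ × ℕ)) : Bool :=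
  (L.all fun p => subPair p (36, 100) || subPair (p.2, p.1) (36, 100) || extTri p.1 && extTri p.2) &&
    L.any fun p => subPair (36, 100) p || subPair (100, 36) p

/-- The reflection in the common face. -/
def flip3 (x : Fin 4 → ℝ) (a : Fin 4) : ℝ := if a = 3 then -x 3 else x a

/-- The coordinates of a point of the tetrahedron `i` around the new edge in the bipyramid. -/
def bip (i : Fin 4) (x : Fin 4 → ℝ) (a : Fin 4) : ℝ :=
  if a = 3 then x 3 - x i else (if a = i then 0 else x a) + 2 / 3 * min (x 3) (x i)

/-- The points of four tetrahedra, the first two of which form a bipyramid. -/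
def biPt (z : Pt 4) : ℕ × (Fin 4 → ℝ) :=
  if z.1.1 = 0 then (0, z.2.1) else if z.1.1 = 1 then (0, flip3 z.2.1) else (z.1.1 + 1, z.2.1)

/-- The points of five tetrahedra, the first three of which form a bipyramid. -/
def triPt (z : Pt 5) : ℕ × (Fin 4 → ℝ) :=
  if z.1.1 < 3 then (0, bip (Fin.ofNat 4 z.1.1) z.2.1) else (z.1.1, z.2.1)

theorem continuous_biPt : Continuous biPt := by
  rw [continuous_prod_of_discrete_left]
  intro t
  unfold biPt
  have h1 : Continuous flip3 := continuous_pi fun a => by unfold flip3; split_ifs <;> fun_prop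
  dsimp only
  split_ifs
  · exact continuous_const.prodMk continuous_subtype_val
  · exact continuous_const.prodMk (h1.comp continuous_subtype_val)
  · exact continuous_const.prodMk continuous_subtype_val

theorem continuous_triPt : Continuous triPt := by
  rw [continuous_prod_of_discrete_left]
  intro t
  unfold triPt
  have h1 : ∀ i, Continuous (bip i) := fun i => continuous_pi fun a => by
    unfold bip; split_ifs <;> fun_prop
  dsimp only
  split_ifs
  · exact continuous_const.prodMk ((h1 _).comp continuous_subtype_val)
  · exact continuous_const.prodMk continuous_subtype_val

theorem exists_biPt (z : Pt 5) : ∃ z', biPt z' = triPt z := by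
  obtain ⟨t, x, hx, hs⟩ := z
  by_cases ht : t.1 < 3
  · have key : ∀ i : Fin 4, i ≠ 3 → (x i ≤ x 3 → bip i x ∈ stdSimplex ℝ (Fin 4)) ∧
        (x 3 ≤ x i → flip3 (bip i x) ∈ stdSimplex ℝ (Fin 4)) := by
      intro i hi
      rw [Fin.sum_univ_four] at hs
      have := hx 0; have := hx 1; have := hx 2; have := hx 3
      refine ⟨fun h => ⟨fun a => ?_, ?_⟩, fun h => ⟨fun a => ?_, ?_⟩⟩
      · fin_cases i <;> fin_cases a <;> simp [bip] at h hi ⊢ <;> (try simp only [h, min_eq_right]) <;> first | linarith | (constructor <;> linarith)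
      · rw [Fin.sum_univ_four]
        fin_cases i <;> simp [bip] at h hi ⊢ <;> simp only [h, min_eq_right] <;> linarith
      · fin_cases i <;> fin_cases a <;> simp [bip, flip3] at h hi ⊢ <;> (try simp only [h, min_eq_left]) <;> first | linarith | (constructor <;> linarith)
      · rw [Fin.sum_univ_four]
        fin_cases i <;> simp [bip, flip3] at h hi ⊢ <;> simp only [h, min_eq_left] <;> linarith
    have hi : Fin.ofNat 4 t.1 ≠ 3 := by
      intro h
      have := congrArg Fin.val h
      simp [Fin.ofNat] at this
      omega
    rcases le_total (x (Fin.ofNat 4 t.1)) (x 3) with h | h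
    · exact ⟨(0, ⟨_, (key _ hi).1 h⟩), by simp [biPt, triPt, ht]⟩
    · refine ⟨(1, ⟨_, (key _ hi).2 h⟩), ?_⟩
      have : ∀ x, flip3 (flip3 x) = x := fun x => funext fun a => by
        simp only [flip3]; split_ifs <;> simp_all
      simp [biPt, triPt, ht, this]
  · refine ⟨(⟨t.1 - 1, by omega⟩, ⟨x, hx, hs⟩), ?_⟩
    simp [biPt, triPt, ht, show t.1 - 1 ≠ 0 by omega, show t.1 - 1 ≠ 1 by omega]
    omega

/-- The coordinates in the tetrahedron `i` of a point of the bipyramid. -/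
def unbip (i : Fin 4) (x : Fin 4 → ℝ) (a : Fin 4) : ℝ :=
  if a = 3 then max (x 3) 0 + 3 / 2 * x i else if a = i then max (-x 3) 0 + 3 / 2 * x i
    else x a - x i

theorem bip_unbip {i : Fin 4} (hi : i ≠ 3) (x : Fin 4 → ℝ) : bip i (unbip i x) = x := by
  ext a
  rcases le_total (x 3) 0 with h | h
  · have h' : 0 ≤ -x 3 := by linarith
    fin_cases i <;> fin_cases a <;> simp [bip, unbip, h] at hi ⊢ <;> linarith
  · have h' : -x 3 ≤ 0 := by linarith
    fin_cases i <;> fin_cases a <;> simp [bip, unbip, h] at hi ⊢ <;> linarith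

theorem unbip_mem {i : Fin 4} (hi : i ≠ 3) {x : Fin 4 → ℝ} (hx : ∀ a, a ≠ 3 → 0 ≤ x a)
    (hs : x 0 + x 1 + x 2 + |x 3| = 1) (hm : ∀ a, a ≠ 3 → x i ≤ x a) :
    unbip i x ∈ stdSimplex ℝ (Fin 4) := by
  have := hx 0 (by decide); have := hx 1 (by decide); have := hx 2 (by decide)
  have := hm 0 (by decide); have := hm 1 (by decide); have := hm 2 (by decide)
  refine ⟨fun a => ?_, ?_⟩
  · fin_cases i <;> fin_cases a <;> simp [unbip] at * <;>
      linarith [le_max_right (x 3) 0, le_max_right (-x 3) 0]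
  · rw [Fin.sum_univ_four]
    rcases le_total (x 3) 0 with h | h
    · rw [abs_of_nonpos h] at hs
      have h' : 0 ≤ -x 3 := by linarith
      fin_cases i <;> simp [unbip, h] at * <;> linarith
    · rw [abs_of_nonneg h] at hs
      have h' : -x 3 ≤ 0 := by linarith
      fin_cases i <;> simp [unbip, h] at * <;> linarith

theorem exists_triPt (z : Pt 4) : ∃ z', triPt z' = biPt z := by
  have key : ∀ x : Fin 4 → ℝ, (∀ a, a ≠ 3 → 0 ≤ x a) → x 0 + x 1 + x 2 + |x 3| = 1 →
      ∃ z', triPt z' = (0, x) := by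
    intro x hx hs
    obtain ⟨i, hi, hm⟩ : ∃ i : Fin 4, i.1 < 3 ∧ ∀ a, a ≠ 3 → x i ≤ x a := by
      obtain ⟨i, hi, h⟩ := Finset.exists_min_image (Finset.univ.erase (3 : Fin 4)) x ⟨0, by decide⟩
      exact ⟨i, by have := Finset.ne_of_mem_erase hi; omega, fun a ha => h a (by simp [ha])⟩
    have hi3 : i ≠ 3 := by rintro rfl; simp at hi
    refine ⟨(⟨i, by omega⟩, ⟨_, unbip_mem hi3 hx hs hm⟩), ?_⟩
    simp [triPt, hi, bip_unbip hi3]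
  obtain ⟨t, x, hx, hs⟩ := z
  rw [Fin.sum_univ_four] at hs
  unfold biPt
  dsimp only
  split_ifs with h0 h1
  · exact key x (fun a _ => hx a) (by rw [abs_of_nonneg (hx 3)]; exact hs)
  · refine key _ (fun a ha => by rw [flip3, if_neg ha]; exact hx a) ?_
    simp [flip3, abs_of_nonneg (hx 3), hs]
  · refine ⟨(⟨t.1 + 1, by omega⟩, ⟨x, hx, by rw [Fin.sum_univ_four, hs]⟩), ?_⟩
    simp only [triPt]
    rw [if_neg (by omega)]

theorem eqvGen_of_biPt {L : List (ℕ × ℕ)} (hL : moveCheck L = true) {a b : Pt 4}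
    (h : biPt a = biPt b) : Relation.EqvGen (triRel 4 L) a b := by
  have hsub : ∀ a b, triRel 4 [(36, 100)] a b → Relation.EqvGen (triRel 4 L) a b := by
    intro a b hab
    refine eqvGen_of_subList ?_ hab
    have := (Bool.and_eq_true_iff.1 hL).2
    simpa [subList] using this
  have key : ∀ a b : Pt 4, a.1 = 0 → b.1 = 1 → biPt a = biPt b → Relation.EqvGen (triRel 4 L) a b := by
    rintro ⟨_, x, hx, hs⟩ ⟨_, y, hy, hs'⟩ rfl rfl h
    have h : x = flip3 y := congrArg Prod.snd h
    refine hsub _ _ ⟨(36, 100), List.mem_singleton_self _, rfl, rfl, ?_⟩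
    have h3 : x 3 = 0 := by
      have h1 : x 3 = -y 3 := by rw [h]; rfl
      have := hx 3; have := hy 3
      linarith
    have hy3 : y 3 = 0 := by
      have h1 : x 3 = -y 3 := by rw [h]; rfl
      linarith
    have hxy : x = y := by
      ext a
      by_cases ha : a = 3
      · rw [ha, h3, hy3]
      · rw [h, flip3, if_neg ha]
    subst hxy
    rw [Fin.sum_univ_four, h3, add_zero] at hs
    have hb : ∀ k, k = 36 ∨ k = 100 → x = bary (tvtx k) ![x 0, x 1, x 2] := by
      rintro k (rfl | rfl) <;> ext a <;> fin_cases a <;>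
        simp [bary, tvtx, Fin.sum_univ_three, h3, Nat.shiftRight_eq_div_pow, Fin.ext_iff]
    refine ⟨⟨![x 0, x 1, x 2], fun a => ?_, ?_⟩, Subtype.ext (hb _ (Or.inl rfl)), Subtype.ext (hb _ (Or.inr rfl))⟩
    · fin_cases a <;> simp [hx]
    · simp [Fin.sum_univ_three, hs]
  obtain ⟨⟨t, ht⟩, x⟩ := a
  obtain ⟨⟨s, hs⟩, y⟩ := b
  by_cases ht0 : t = 0
  · subst ht0
    by_cases hs0 : s = 0
    · subst hs0
      exact eqvGen_of_eq (Prod.ext rfl (Subtype.ext (by simpa [biPt] using h)))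
    · by_cases hs1 : s = 1
      · subst hs1
        exact key _ _ rfl rfl h
      · simp [biPt, hs0, hs1] at h
  · by_cases ht1 : t = 1
    · subst ht1
      by_cases hs0 : s = 0
      · subst hs0
        exact .symm _ _ (key _ _ rfl rfl h.symm)
      · by_cases hs1 : s = 1
        · subst hs1
          have h : flip3 x.1 = flip3 y.1 := by simpa [biPt] using h
          refine eqvGen_of_eq (Prod.ext rfl (Subtype.ext (funext fun a => ?_)))
          have := congrFun h a
          unfold flip3 at this
          split_ifs at this with ha
          · rw [ha]; exact neg_injective this
          · exact this
        · simp [biPt, hs0, hs1] at h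
    · by_cases hs0 : s = 0
      · subst hs0
        simp [biPt, ht0, ht1] at h
      · by_cases hs1 : s = 1
        · subst hs1
          simp [biPt, ht0, ht1] at h
        · simp [biPt, ht0, ht1, hs0, hs1] at h
          exact eqvGen_of_eq (Prod.ext (Fin.ext h.1) (Subtype.ext h.2))

/-- A point of the tetrahedron `i` in the face opposite to the base vertex `j` is also a point of the
tetrahedron `j`. -/
theorem inner_point {i j k : Fin 4} (hi : i ≠ 3) (hj : j ≠ 3) (hk : k ≠ 3) (hij : i ≠ j) (hik : i ≠ k)
    (hjk : j ≠ k) {x y : Fin 4 → ℝ} (hx : ∀ a, 0 ≤ x a) (hy : ∀ a, 0 ≤ y a) (h : bip i x = bip j y) :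
    x j = 0 ∧ y i = 0 ∧ x i = y j ∧ x k = y k ∧ x 3 = y 3 := by
  have h3 := congrFun h 3
  have h1 := congrFun h i
  have h2 := congrFun h j
  have h4 := congrFun h k
  simp only [bip, if_true, if_neg hi, if_neg hj, if_neg hk, if_neg hij, if_neg hij.symm, if_neg hik.symm,
    if_neg hjk.symm] at h1 h2 h3 h4
  have hxj := hx j
  have hyi := hy i
  have hxj : x j = 0 := by linarith
  have hyi : y i = 0 := by linarith
  have hm : min (x 3) (x i) = min (y 3) (y j) := by linarith
  have : x i = y j := by
    rcases min_choice (x 3) (x i) with e | e <;> rcases min_choice (y 3) (y j) with e' | e' <;>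
      rw [e, e'] at hm
    · linarith
    · have := min_le_right (x 3) (x i)
      have := min_le_left (y 3) (y j)
      linarith
    · have := min_le_left (x 3) (x i)
      have := min_le_right (y 3) (y j)
      linarith
    · exact hm
  exact ⟨hxj, hyi, this, by linarith, by linarith⟩

theorem bip_injective {i : Fin 4} (hi : i ≠ 3) {x y : Fin 4 → ℝ} (h : bip i x = bip i y) : x = y := by
  have h3 := congrFun h 3
  have h1 := congrFun h i
  simp only [bip, if_true, if_neg hi] at h1 h3
  have hm : min (x 3) (x i) = min (y 3) (y i) := by linarith
  have hxy : x i = y i := by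
    rcases min_choice (x 3) (x i) with e | e <;> rcases min_choice (y 3) (y i) with e' | e' <;>
      rw [e, e'] at hm
    · linarith
    · have := min_le_right (x 3) (x i)
      have := min_le_left (y 3) (y i)
      linarith
    · have := min_le_left (x 3) (x i)
      have := min_le_right (y 3) (y i)
      linarith
    · exact hm
  ext a
  by_cases ha : a = 3
  · rw [ha]; linarith
  · by_cases hai : a = i
    · rw [hai, hxy]
    · have h4 := congrFun h a
      simp only [bip, if_neg ha, if_neg hai] at h4
      linarith

theorem eqvGen_of_triPt {L : List (ℕ × ℕ)} {a b : Pt 5}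
    (h : triPt a = triPt b) : Relation.EqvGen (triRel 5 (innerPairs ++ L)) a b := by
  have key : ∀ (t s : Fin 5) (x y : stdSimplex ℝ (Fin 4)) (p : ℕ × ℕ) (i j k : Fin 4), p ∈ innerPairs → i.1 = t.1 →
      j.1 = s.1 → ttet p.1 = i.1 → ttet p.2 = j.1 → i ≠ 3 → j ≠ 3 → k ≠ 3 → i ≠ j → i ≠ k → j ≠ k →
      tvtx p.1 = ![k, 3, i] → tvtx p.2 = ![k, 3, j] → triPt (t, x) = triPt (s, y) →
      triRel 5 (innerPairs ++ L) (t, x) (s, y) := by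
    intro t s x y p i j k hp ht hs hpt hps hi hj hk hij hik hjk hv hv' h
    have hi3 : i.1 < 3 := by omega
    have hj3 : j.1 < 3 := by omega
    have hi' : Fin.ofNat 4 t.1 = i := by rw [← ht]; exact Fin.ext (Nat.mod_eq_of_lt i.2)
    have hj' : Fin.ofNat 4 s.1 = j := by rw [← hs]; exact Fin.ext (Nat.mod_eq_of_lt j.2)
    simp only [triPt] at h
    rw [if_pos (by omega), if_pos (by omega), hi', hj'] at h
    obtain ⟨h1, h2, h3, h4, h5⟩ := inner_point hi hj hk hij hik hjk x.2.1 y.2.1 (Prod.ext_iff.1 h).2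
    have hall : ∀ a : Fin 4, a = i ∨ a = j ∨ a = k ∨ a = 3 := by omega
    have hsum : ∀ (x : Fin 4 → ℝ), ∑ a, x a = x i + x j + x k + x 3 := by
      intro x
      rw [show (Finset.univ : Finset (Fin 4)) = {i, j, k, 3} by ext e; simpa using hall e]
      simp [hi, hj, hk, hij, hik, hjk, add_assoc]
    refine ⟨p, List.mem_append_left _ hp, ht.symm.trans hpt.symm, hs.symm.trans hps.symm,
      ⟨![x.1 k, x.1 3, x.1 i], fun a => ?_, ?_⟩, Subtype.ext (funext fun a => ?_), Subtype.ext (funext fun a => ?_)⟩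
    · fin_cases a
      · exact x.2.1 _
      · exact x.2.1 _
      · exact x.2.1 _
    · have := x.2.2
      rw [hsum] at this
      simp only [Fin.sum_univ_three, Matrix.cons_val]
      linarith
    · show x.1 a = bary (tvtx p.1) ![x.1 k, x.1 3, x.1 i] a
      rw [hv]
      rcases hall a with rfl | rfl | rfl | rfl <;>
        simp [bary, Fin.sum_univ_three, hi, hk, hi.symm, hj.symm, hk.symm, hij, hik, hik.symm, hjk.symm, h1]
    · show y.1 a = bary (tvtx p.2) ![x.1 k, x.1 3, x.1 i] a
      rw [hv']
      rcases hall a with rfl | rfl | rfl | rfl <;>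
        simp [bary, Fin.sum_univ_three, hj, hk, hi.symm, hj.symm, hk.symm, hij.symm, hik.symm, hjk, hjk.symm, h2, h3, h4, h5]
  have hlt : ∀ (t s : Fin 5) (x y : stdSimplex ℝ (Fin 4)), t < s → s.1 < 3 → triPt (t, x) = triPt (s, y) →
      Relation.EqvGen (triRel 5 (innerPairs ++ L)) (t, x) (s, y) := by
    intro t s x y hts hs h
    refine .rel _ _ ?_
    obtain ⟨t, ht⟩ := t
    obtain ⟨s, hs'⟩ := s
    simp only [Fin.mk_lt_mk] at hts
    simp only at hs
    obtain ⟨rfl, rfl⟩ | ⟨rfl, rfl⟩ | ⟨rfl, rfl⟩ : t = 0 ∧ s = 1 ∨ t = 0 ∧ s = 2 ∨ t = 1 ∧ s = 2 := by omega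
    · exact key _ _ x y (14, 94) 0 1 2 (by decide) rfl rfl rfl rfl (by decide) (by decide) (by decide)
        (by decide) (by decide) (by decide) (by decide) (by decide) h
    · exact key _ _ x y (13, 173) 0 2 1 (by decide) rfl rfl rfl rfl (by decide) (by decide) (by decide)
        (by decide) (by decide) (by decide) (by decide) (by decide) h
    · exact key _ _ x y (92, 172) 1 2 0 (by decide) rfl rfl rfl rfl (by decide) (by decide) (by decide)
        (by decide) (by decide) (by decide) (by decide) (by decide) h
  obtain ⟨t, x⟩ := a
  obtain ⟨s, y⟩ := b
  by_cases ht : t.1 < 3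
  · by_cases hs : s.1 < 3
    · rcases lt_trichotomy t s with hts | rfl | hts
      · exact hlt t s x y hts hs h
      · simp only [triPt] at h
        rw [if_pos ht, if_pos ht] at h
        refine eqvGen_of_eq (Prod.ext rfl (Subtype.ext (bip_injective ?_ (Prod.ext_iff.1 h).2)))
        intro h
        have := congrArg Fin.val h
        simp [Fin.ofNat] at this
        omega
      · exact .symm _ _ (hlt s t y x hts ht h.symm)
    · simp only [triPt] at h
      rw [if_pos ht, if_neg hs] at h
      have := (Prod.ext_iff.1 h).1
      simp only at this
      omega
  · by_cases hs : s.1 < 3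
    · simp only [triPt] at h
      rw [if_neg ht, if_pos hs] at h
      have := (Prod.ext_iff.1 h).1
      simp only at this
      omega
    · simp only [triPt] at h
      rw [if_neg ht, if_neg hs] at h
      exact eqvGen_of_eq (Prod.ext (Fin.ext (Prod.ext_iff.1 h).1) (Subtype.ext (Prod.ext_iff.1 h).2))

theorem tvtx_convTri (k : ℕ) (h : ttet k < 2) (he : extTri k = true) : ∃ i : Fin 4, i ≠ 3 ∧
    (∀ j, tvtx k j ≠ i) ∧ ttet (convTri k) = i.1 ∧
    tvtx (convTri k) = if ttet k = 0 then tvtx k else Equiv.swap i 3 ∘ tvtx k := by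
  have h2 : Nat.ble 2 (ttet k) = false := by
    rw [Bool.eq_false_iff, Ne, Nat.ble_eq]; omega
  simp only [extTri, h2, forceN_eq, Bool.false_or, Bool.and_eq_true, Bool.not_eq_true', ← Bool.not_eq_true,
    Nat.beq_eq] at he
  obtain ⟨⟨⟨h3, e0⟩, e1⟩, e2⟩ := he
  have h3 : missV k < 3 := Nat.le_of_ble_eq_true h3
  refine ⟨⟨missV k, by omega⟩, fun h => ?_, fun j => ?_, ?_, ?_⟩
  · have := congrArg Fin.val h
    simp at this
    omega
  · intro h
    have := congrArg Fin.val h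
    fin_cases j <;> simp [tvtx] at this <;> contradiction
  · have hs : ∀ d, d < 4 → swapV (missV k) d < 4 := by
      intro d hd
      unfold swapV
      cases Nat.beq d 3
      · exact hd
      · show missV k < 4
        omega
    have a0 : k % 4 < 4 := Nat.mod_lt _ (by norm_num)
    have a1 : (k >>> 2) % 4 < 4 := Nat.mod_lt _ (by norm_num)
    have a2 : (k >>> 4) % 4 < 4 := Nat.mod_lt _ (by norm_num)
    have b0 := hs _ a0
    have b1 := hs _ a1
    have b2 := hs _ a2
    simp only [convTri, h2, forceN_eq, cond_false, ttet] at *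
    rw [Nat.shiftRight_eq_div_pow _ 6]
    cases Nat.beq (k >>> 6) 0
    · simp only [cond_false]; omega
    · simp only [cond_true]; omega
  · have hs : ∀ d, d < 4 → d ≠ missV k → swapV (missV k) d < 4 ∧
        swapV (missV k) d = (Equiv.swap (⟨missV k, by omega⟩ : Fin 4) 3 (Fin.ofNat 4 d)).1 := by
      intro d hd hne
      unfold swapV
      have hd' : (Fin.ofNat 4 d).1 = d := Nat.mod_eq_of_lt hd
      have n1 : Fin.ofNat 4 d ≠ ⟨missV k, by omega⟩ := fun h => hne (by rw [← hd', h])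
      by_cases h : d = 3
      · subst h
        simp [Fin.ofNat]
        omega
      · have n2 : Fin.ofNat 4 d ≠ 3 := fun h' => h (by rw [← hd', h']; rfl)
        rw [Equiv.swap_apply_of_ne_of_ne n1 n2, hd', show Nat.beq d 3 = false from by
          rw [Bool.eq_false_iff, Ne, Nat.beq_eq]; exact h]
        exact ⟨hd, rfl⟩
    have a0 : k % 4 < 4 := Nat.mod_lt _ (by norm_num)
    have a1 : (k >>> 2) % 4 < 4 := Nat.mod_lt _ (by norm_num)
    have a2 : (k >>> 4) % 4 < 4 := Nat.mod_lt _ (by norm_num)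
    obtain ⟨b0, c0⟩ := hs _ a0 e0
    obtain ⟨b1, c1⟩ := hs _ a1 e1
    obtain ⟨b2, c2⟩ := hs _ a2 e2
    by_cases h0 : ttet k = 0
    · rw [if_pos h0]
      ext j
      have h0' : Nat.beq (ttet k) 0 = true := by rw [Nat.beq_eq, h0]
      simp only [convTri, h2, forceN_eq, cond_false, h0', cond_true, tvtx]
      fin_cases j <;> simp [Nat.shiftRight_eq_div_pow] at a0 a1 a2 ⊢ <;> omega
    · rw [if_neg h0]
      ext j
      have h0' : Nat.beq (ttet k) 0 = false := by rw [Bool.eq_false_iff, Ne, Nat.beq_eq]; exact h0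
      have hof : ∀ d (hd : d % 4 < 4), (⟨d % 4, hd⟩ : Fin 4) = Fin.ofNat 4 (d % 4) :=
        fun d hd => Fin.ext (Nat.mod_mod _ _).symm
      simp only [convTri, h2, forceN_eq, cond_false, h0', tvtx, Function.comp, hof]
      fin_cases j
      · refine Eq.trans ?_ c0
        simp [Nat.shiftRight_eq_div_pow] at b0 b1 b2 ⊢; omega
      · refine Eq.trans ?_ c1
        simp [Nat.shiftRight_eq_div_pow] at b0 b1 b2 ⊢; omega
      · refine Eq.trans ?_ c2
        simp [Nat.shiftRight_eq_div_pow] at b0 b1 b2 ⊢; omega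

/-- The coordinates of a point of the boundary of the bipyramid in the tetrahedra around the new
edge. -/
theorem triPt_convTri {k : ℕ} (hk : ttet k < 4) (he : extTri k = true) (w : stdSimplex ℝ (Fin 3)) :
    ttet (convTri k) < 5 ∧ ∀ (t : Fin 4) (s : Fin 5), t.1 = ttet k → s.1 = ttet (convTri k) →
      triPt (s, baryPt (tvtx (convTri k)) w) = biPt (t, baryPt (tvtx k) w) := by
  by_cases h2 : ttet k < 2
  · obtain ⟨i, hi, hv, ht, htv⟩ := tvtx_convTri k h2 he
    have hi3 : i.1 < 3 := by omega
    refine ⟨by omega, fun t s hts hs => ?_⟩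
    have his : Fin.ofNat 4 s.1 = i := Fin.ext (by rw [hs, ht]; exact Nat.mod_eq_of_lt i.2)
    have hx : (baryPt (tvtx k) w).1 i = 0 := bary_eq_zero hv _
    have hxn := (baryPt (tvtx k) w).2.1 3
    simp only [triPt, biPt, his]
    rw [if_pos (by omega)]
    by_cases h0 : ttet k = 0
    · rw [if_pos h0] at htv
      rw [if_pos (by omega), htv]
      refine Prod.ext rfl (funext fun a => ?_)
      simp only [bip, hx]
      by_cases ha : a = 3
      · simp [ha]
      · by_cases hai : a = i
        · simp [hai, hi, hx]; exact hxn
        · simp [ha, hai]; exact hxn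
    · rw [if_neg h0] at htv
      rw [if_neg (by omega), if_pos (by omega), htv]
      have hy : ∀ a, (baryPt (Equiv.swap i 3 ∘ tvtx k) w).1 a = (baryPt (tvtx k) w).1 (Equiv.swap i 3 a) := by
        intro a
        show bary _ _ a = _
        rw [bary_comp, bary_perm]
        rfl
      refine Prod.ext rfl (funext fun a => ?_)
      simp only [bip, hy, Equiv.swap_apply_left, Equiv.swap_apply_right, hx, flip3]
      by_cases ha : a = 3
      · simp [ha]
      · by_cases hai : a = i
        · simp [hai, hi, hx]; exact hxn
        · simp [ha, hai, Equiv.swap_apply_of_ne_of_ne hai ha]; exact hxn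
  · have h2' : Nat.ble 2 (ttet k) = true := by rw [Nat.ble_eq]; omega
    have hc : convTri k = k + 64 := by rw [convTri, h2']; rfl
    have ht : ttet (convTri k) = ttet k + 1 := by
      rw [hc, ttet, ttet, Nat.shiftRight_eq_div_pow, Nat.shiftRight_eq_div_pow]
      omega
    have hv : tvtx (convTri k) = tvtx k := by
      ext j
      rw [hc]
      fin_cases j <;> simp [tvtx, Nat.shiftRight_eq_div_pow] <;> omega
    refine ⟨by omega, fun t s hts hs => ?_⟩
    simp only [triPt, biPt]
    rw [if_neg (by omega), if_neg (by omega), if_neg (by omega), hv, hs, ht, hts]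

theorem biPt_common : ∀ a b, triRel 4 [(36, 100)] a b → biPt a = biPt b := by
  rintro ⟨t, x⟩ ⟨s, y⟩ ⟨p, hp, ht, hs, w, hw, hw'⟩
  obtain rfl := List.mem_singleton.1 hp
  obtain rfl : t = 0 := Fin.ext ht
  obtain rfl : s = 1 := Fin.ext hs
  have h : tvtx 36 = tvtx 100 := by decide
  simp only at hw hw'
  rw [h, ← hw'] at hw
  subst hw
  refine Prod.ext rfl (funext fun a => ?_)
  show x.1 a = flip3 x.1 a
  by_cases ha : a = 3
  · have : x.1 3 = 0 := by
      rw [hw']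
      exact bary_eq_zero (by decide) _
    rw [ha, flip3, if_pos rfl, this, neg_zero]
  · rw [flip3, if_neg ha]

theorem bip_comm {i j k : Fin 4} (hi : i ≠ 3) (hj : j ≠ 3) (hk : k ≠ 3) (hij : i ≠ j) (hik : i ≠ k)
    (hjk : j ≠ k) (w : Fin 3 → ℝ) : bip i (bary ![k, 3, i] w) = bip j (bary ![k, 3, j] w) := by
  ext a
  simp only [bip, bary, Fin.sum_univ_three, Matrix.cons_val]
  have hall : a = i ∨ a = j ∨ a = k ∨ a = 3 := by omega
  rcases hall with rfl | rfl | rfl | rfl <;>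
    simp [hi, hj, hk, hi.symm, hj.symm, hk.symm, hij, hij.symm, hik, hik.symm, hjk, hjk.symm]

theorem triPt_inner : ∀ a b, triRel 5 innerPairs a b → triPt a = triPt b := by
  have key : ∀ (p : ℕ × ℕ) (i j k : Fin 4), ttet p.1 = i.1 → ttet p.2 = j.1 →
      i ≠ 3 → j ≠ 3 → k ≠ 3 → i ≠ j → i ≠ k → j ≠ k → tvtx p.1 = ![k, 3, i] →
      tvtx p.2 = ![k, 3, j] → ∀ a b, triRel 5 [p] a b → triPt a = triPt b := by
    rintro p i j k hi hj hi3 hj3 hk3 hij hik hjk hv hv' ⟨t, x⟩ ⟨s, y⟩ ⟨p, hp, ht, hs, w, hw, hw'⟩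
    obtain rfl := List.mem_singleton.1 hp
    rw [hi] at ht
    rw [hj] at hs
    simp only at ht hs hw hw'
    have ei : Fin.ofNat 4 t.1 = i := Fin.ext (by rw [ht]; exact Nat.mod_eq_of_lt i.2)
    have ej : Fin.ofNat 4 s.1 = j := Fin.ext (by rw [hs]; exact Nat.mod_eq_of_lt j.2)
    simp only [triPt, ei, ej]
    rw [if_pos (by omega), if_pos (by omega), hw, hw', hv, hv']
    exact Prod.ext rfl (bip_comm hi3 hj3 hk3 hij hik hjk w.1)
  intro a b h
  obtain ⟨p, hp, h⟩ := triRel_singleton h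
  simp only [innerPairs, List.mem_cons, List.not_mem_nil, or_false] at hp
  rcases hp with rfl | rfl | rfl
  · exact key (14, 94) 0 1 2 rfl rfl (by decide) (by decide) (by decide)
      (by decide) (by decide) (by decide) (by decide) (by decide) a b h
  · exact key (13, 173) 0 2 1 rfl rfl (by decide) (by decide) (by decide)
      (by decide) (by decide) (by decide) (by decide) (by decide) a b h
  · exact key (92, 172) 1 2 0 rfl rfl (by decide) (by decide) (by decide)
      (by decide) (by decide) (by decide) (by decide) (by decide) a b h

theorem tetSpace_homeo_move23 {L : List (ℕ × ℕ)} (hok : okList 4 L = true) (h : moveCheck L = true) :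
    Nonempty (TetSpace 4 L ≃ₜ TetSpace 5 (move23 L)) := by
  refine homeo_of_common continuous_biPt continuous_triPt ?_ ?_ (fun a b => eqvGen_of_biPt h)
    (fun a b => eqvGen_of_triPt) exists_triPt exists_biPt
  · intro a b hab
    obtain ⟨p, hp, hab⟩ := triRel_singleton hab
    have := List.all_eq_true.1 (Bool.and_eq_true_iff.1 h).1 p hp
    simp only [Bool.or_eq_true] at this
    rcases this with (h | h) | h
    · obtain ⟨a', ha⟩ := exists_triPt a
      exact ⟨a', a', ha, ha.trans (biPt_common _ _ (triRel_of_subPair h hab)), .refl _⟩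
    · obtain ⟨a', ha⟩ := exists_triPt a
      exact ⟨a', a', ha, ha.trans (biPt_common _ _ (triRel_of_subPair h (triRel_swap hab))).symm, .refl _⟩
    · obtain ⟨q, hq, ha, hb, w, hw, hw'⟩ := hab
      obtain rfl := List.mem_singleton.1 hq
      obtain ⟨l1, l2⟩ := okList_spec hok hp
      obtain ⟨h1, h2⟩ := Bool.and_eq_true_iff.1 h
      obtain ⟨t1, e1⟩ := triPt_convTri l1 h1 w
      obtain ⟨t2, e2⟩ := triPt_convTri l2 h2 w
      refine ⟨(⟨_, t1⟩, baryPt _ w), (⟨_, t2⟩, baryPt _ w), (e1 a.1 _ ha rfl).trans (by rw [← hw]),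
        (e2 b.1 _ hb rfl).trans (by rw [← hw']), .rel _ _ ⟨(convTri q.1, convTri q.2),
        List.mem_append_right _ (List.mem_map.2 ⟨q, List.mem_filter.2 ⟨hp, h⟩, rfl⟩), rfl, rfl, w, rfl, rfl⟩⟩
  · intro a b hab
    obtain ⟨p, hp, hab⟩ := triRel_singleton hab
    rcases List.mem_append.1 hp with hp | hp
    · obtain ⟨a', ha⟩ := exists_biPt a
      have := triPt_inner a b (triRel_mono (by simpa using hp) hab)
      exact ⟨a', a', ha, ha.trans this, .refl _⟩
    · obtain ⟨q, hq, rfl⟩ := List.mem_map.1 hp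
      obtain ⟨hq, he⟩ := List.mem_filter.1 hq
      obtain ⟨p, hpp, ha, hb, w, hw, hw'⟩ := hab
      obtain rfl := List.mem_singleton.1 hpp
      obtain ⟨l1, l2⟩ := okList_spec hok hq
      obtain ⟨h1, h2⟩ := Bool.and_eq_true_iff.1 he
      obtain ⟨t1, e1⟩ := triPt_convTri l1 h1 w
      obtain ⟨t2, e2⟩ := triPt_convTri l2 h2 w
      refine ⟨(⟨_, l1⟩, baryPt _ w), (⟨_, l2⟩, baryPt _ w), (e1 _ a.1 rfl ha).symm.trans (by rw [← hw]),
        (e2 _ b.1 rfl hb).symm.trans (by rw [← hw']), .rel _ _ ⟨q, hq, rfl, rfl, w, rfl, rfl⟩⟩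

/-! ### The octahedron as four tetrahedra -/

/-- The position of the vertex on axis `i` of the face `f` in the tetrahedron containing the face. -/
def posn (f i : ℕ) : ℕ := bif Nat.beq i 0 then 1 - fbit f 0 else i + 1

/-- The gluings of the four tetrahedra around the first axis which give the octahedron. -/
def axisPairs : List (ℕ × ℕ) := [(52, 116), (180, 244), (36, 164), (100, 228)]

/-- The triangle of the face `f` with its vertices permuted. -/
def faceTri (f i j k : ℕ) : ℕ := 64 * (f >>> 1) + (posn f i + 4 * posn f j + 16 * posn f k)

/-- The gluing of the face `f` in the pattern `c`. -/
def facePair (c f : ℕ) : ℕ × ℕ :=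
  forceN (faceTri f 0 1 2) fun a => forceN (csig c f) fun f' => forceN (cprm c f) fun p =>
    forceN (faceTri f' (pact p 0) (pact p 1) (pact p 2)) fun b => (a, b)

/-- The gluing of four tetrahedra which gives the quotient space of the pattern `c`. -/
def octList (c : ℕ) : List (ℕ × ℕ) :=
  axisPairs ++ [0, 1, 2, 3, 4, 5, 6, 7].map (facePair c)

/-- The vertices of the tetrahedra around the first axis. -/
def octVtx (t : ℕ) (a : Fin 4) : OctVertex :=
  ![(0, true), (0, false), (1, Nat.testBit t 0), (2, Nat.testBit t 1)] a

/-- The point of the octahedron corresponding to a point of one of the tetrahedra. -/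
def octPt (z : Pt 4) : Fin 3 → ℝ := ∑ a, z.2.1 a • vertexPt (octVtx z.1.1 a)

theorem octPt_mem (z : Pt 4) : octPt z ∈ SolidOcta :=
  (convex_convexHull ℝ _).sum_mem (fun a _ => z.2.2.1 a) z.2.2.2 fun _ _ => vertexPt_mem_solidOcta _

theorem octPt_apply (z : Pt 4) : octPt z =
    ![z.2.1 0 - z.2.1 1, sgn (Nat.testBit z.1.1 0) * z.2.1 2, sgn (Nat.testBit z.1.1 1) * z.2.1 3] := by
  ext j
  simp only [octPt, Finset.sum_apply, Pi.smul_apply, smul_eq_mul, vertexPt_apply, Fin.sum_univ_four, octVtx]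
  fin_cases j <;> simp [sgn]
  ring

theorem continuous_octPt : Continuous octPt := by
  rw [continuous_prod_of_discrete_left]
  intro t
  unfold octPt
  have : ∀ a, Continuous fun x : stdSimplex ℝ (Fin 4) => x.1 a := fun a =>
    (continuous_apply a).comp continuous_subtype_val
  exact continuous_finsetSum _ fun a _ => (this a).smul (continuous_const (y := vertexPt (octVtx t.1 a)))

theorem octPt_baryPt (t : Fin 4) {m : ℕ} (v : Fin m → Fin 4) (w : stdSimplex ℝ (Fin m)) :
    octPt (t, baryPt v w) = ∑ j, w.1 j • vertexPt (octVtx t.1 (v j)) := by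
  simp only [octPt, baryPt, bary, Finset.sum_smul]
  rw [Finset.sum_comm]
  refine Finset.sum_congr rfl fun j _ => ?_
  simp only [ite_smul, zero_smul, Finset.sum_ite_eq, Finset.mem_univ, if_true]
  rfl

theorem exists_octPt {x : Fin 3 → ℝ} (hx : x ∈ SolidOcta) : ∃ z, octPt z = x := by
  rw [mem_solidOcta, Fin.sum_univ_three] at hx
  obtain ⟨t, h1, h2⟩ : ∃ t : Fin 4, sgn (Nat.testBit t.1 0) * |x 1| = x 1 ∧ sgn (Nat.testBit t.1 1) * |x 2| = x 2 := by
    rcases le_total 0 (x 1) with h | h <;> rcases le_total 0 (x 2) with h' | h'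
    · exact ⟨3, by simp [sgn, abs_of_nonneg h], by simp [sgn, abs_of_nonneg h', Nat.testBit]⟩
    · exact ⟨1, by simp [sgn, abs_of_nonneg h], by simp [sgn, abs_of_nonpos h', Nat.testBit]⟩
    · exact ⟨2, by simp [sgn, abs_of_nonpos h], by simp [sgn, abs_of_nonneg h', Nat.testBit]⟩
    · exact ⟨0, by simp [sgn, abs_of_nonpos h], by simp [sgn, abs_of_nonpos h', Nat.testBit]⟩
  have hx0 := le_abs_self (x 0)
  have hx0' := neg_abs_le (x 0)
  refine ⟨(t, ⟨![(1 - |x 1| - |x 2| + x 0) / 2, (1 - |x 1| - |x 2| - x 0) / 2, |x 1|, |x 2|], fun a => ?_, ?_⟩), ?_⟩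
  · fin_cases a
    · show 0 ≤ (1 - |x 1| - |x 2| + x 0) / 2
      linarith
    · show 0 ≤ (1 - |x 1| - |x 2| - x 0) / 2
      linarith
    · exact abs_nonneg _
    · exact abs_nonneg _
  · simp only [Fin.sum_univ_four, Matrix.cons_val]
    ring
  · rw [octPt_apply]
    ext j
    fin_cases j
    · show (1 - |x 1| - |x 2| + x 0) / 2 - (1 - |x 1| - |x 2| - x 0) / 2 = x 0
      ring
    · exact h1
    · exact h2

theorem octVtx_faceTri : ∀ f < 8, ∀ i j k : Fin 3, ttet (faceTri f i j k) = f >>> 1 ∧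
    ∀ l : Fin 3, octVtx (f >>> 1) (tvtx (faceTri f i j k) l) =
      (![i, j, k] l, faceN f (![i, j, k] l)) := by decide +kernel

theorem facePair_spec {c : ℕ} (h : ValidCode c) {f : ℕ} (hf : f < 8) :
    ttet (facePair c f).1 = f >>> 1 ∧ ttet (facePair c f).2 = csig c f >>> 1 ∧ ∀ i,
      octVtx (f >>> 1) (tvtx (facePair c f).1 i) = (i, faceN f i) ∧
      octVtx (csig c f >>> 1) (tvtx (facePair c f).2 i) = ((gluingOf c h).axisMap (faceN f) i,
        (gluingOf c h).face (faceN f) ((gluingOf c h).axisMap (faceN f) i)) := by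
  have hp := (h f hf).2.2.1
  obtain ⟨h1, h2⟩ := octVtx_faceTri f hf 0 1 2
  obtain ⟨h3, h4⟩ := octVtx_faceTri _ (csig_lt c f) (permN (cprm c f) 0) (permN (cprm c f) 1) (permN (cprm c f) 2)
  rw [val_permN hp, val_permN hp, val_permN hp] at h3 h4
  simp only [facePair, forceN_eq]
  refine ⟨h1, h3, fun i => ⟨(h2 i).trans ?_, (h4 i).trans ?_⟩⟩
  · fin_cases i <;> rfl
  · rw [gluingOf_face h hf, gluingOf_axisMap h hf]
    fin_cases i <;> rfl

theorem octPt_inner : ∀ a b, triRel 4 axisPairs a b → octPt a = octPt b := by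
  rintro ⟨t, x⟩ ⟨s, y⟩ ⟨p, hp, ht, hs, w, hw, hw'⟩
  simp only at ht hs hw hw'
  rw [hw, hw', octPt_baryPt, octPt_baryPt, ht, hs]
  refine Finset.sum_congr rfl fun j _ => ?_
  have : ∀ p ∈ axisPairs, ∀ j, octVtx (ttet p.1) (tvtx p.1 j) = octVtx (ttet p.2) (tvtx p.2 j) := by
    decide +kernel
  rw [this p hp j]

theorem eqvGen_of_octPt {L : List (ℕ × ℕ)} {a b : Pt 4} (h : octPt a = octPt b) :
    Relation.EqvGen (triRel 4 (axisPairs ++ L)) a b := by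
  obtain ⟨t, x⟩ := a
  obtain ⟨s, y⟩ := b
  rw [octPt_apply, octPt_apply] at h
  have e0 : x.1 0 - x.1 1 = y.1 0 - y.1 1 := congrFun h 0
  have e1 : sgn (Nat.testBit t.1 0) * x.1 2 = sgn (Nat.testBit s.1 0) * y.1 2 := congrFun h 1
  have e2 : sgn (Nat.testBit t.1 1) * x.1 3 = sgn (Nat.testBit s.1 1) * y.1 3 := congrFun h 2
  have habs : ∀ (b b' : Bool) (u v : ℝ), 0 ≤ u → 0 ≤ v → sgn b * u = sgn b' * v → u = v ∧ (b ≠ b' → u = 0) := by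
    intro b b' u v hu hv h
    cases b <;> cases b' <;> simp [sgn] at h ⊢ <;> first | linarith | (constructor <;> linarith)
  obtain ⟨f1, g1⟩ := habs _ _ _ _ (x.2.1 2) (y.2.1 2) e1
  obtain ⟨f2, g2⟩ := habs _ _ _ _ (x.2.1 3) (y.2.1 3) e2
  have hx := x.2.2
  have hy := y.2.2
  rw [Fin.sum_univ_four] at hx hy
  obtain rfl : x = y := by
    refine Subtype.ext (funext fun a => ?_)
    fin_cases a
    · show x.1 0 = y.1 0
      linarith
    · show x.1 1 = y.1 1
      linarith
    · exact f1
    · exact f2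
  have step : ∀ (p : ℕ × ℕ) (a b c d : Fin 4), p ∈ axisPairs → tvtx p.1 = ![a, b, c] → tvtx p.2 = ![a, b, c] →
      a ≠ b → a ≠ c → b ≠ c → a ≠ d → b ≠ d → c ≠ d → x.1 d = 0 → ∀ t s : Fin 4, t.1 = ttet p.1 → s.1 = ttet p.2 →
      Relation.EqvGen (triRel 4 (axisPairs ++ L)) (t, x) (s, x) := by
    intro p a b c d hp hv hv' hab hac hbc had hbd hcd hd t s ht hs
    have hall : ∀ e : Fin 4, e = a ∨ e = b ∨ e = c ∨ e = d := by omega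
    have hsum : x.1 a + x.1 b + x.1 c = 1 := by
      have : ∑ e, x.1 e = x.1 a + x.1 b + x.1 c + x.1 d := by
        rw [show (Finset.univ : Finset (Fin 4)) = {a, b, c, d} by ext e; simpa using hall e]
        simp [hab, hac, hbc, had, hbd, hcd, add_assoc]
      rw [x.2.2, hd] at this
      linarith
    have hxe : ∀ e, x.1 e = bary ![a, b, c] ![x.1 a, x.1 b, x.1 c] e := by
      intro e
      rcases hall e with rfl | rfl | rfl | rfl <;>
        simp [bary, Fin.sum_univ_three, hab, hab.symm, hac, hac.symm, hbc, hbc.symm, had, hbd, hcd, hd]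
    refine .rel _ _ ⟨p, List.mem_append_left _ hp, ht, hs, ⟨![x.1 a, x.1 b, x.1 c], fun e => ?_, ?_⟩,
      Subtype.ext (funext fun e => ?_), Subtype.ext (funext fun e => ?_)⟩
    · fin_cases e
      · exact x.2.1 _
      · exact x.2.1 _
      · exact x.2.1 _
    · simpa [Fin.sum_univ_three] using hsum
    · show _ = bary (tvtx p.1) _ e
      rw [hv]; exact hxe e
    · show _ = bary (tvtx p.2) _ e
      rw [hv']; exact hxe e
  have s01 := fun h => step (52, 116) 0 1 3 2 (by decide) (by decide) (by decide) (by decide) (by decide) (by decide)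
    (by decide) (by decide) (by decide) h 0 1 rfl rfl
  have s23 := fun h => step (180, 244) 0 1 3 2 (by decide) (by decide) (by decide) (by decide) (by decide) (by decide)
    (by decide) (by decide) (by decide) h 2 3 rfl rfl
  have s02 := fun h => step (36, 164) 0 1 2 3 (by decide) (by decide) (by decide) (by decide) (by decide) (by decide)
    (by decide) (by decide) (by decide) h 0 2 rfl rfl
  have s13 := fun h => step (100, 228) 0 1 2 3 (by decide) (by decide) (by decide) (by decide) (by decide) (by decide)
    (by decide) (by decide) (by decide) h 1 3 rfl rfl
  clear step h e0 e1 e2 f1 f2 hx hy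
  fin_cases t <;> fin_cases s
  · exact .refl _
  · exact s01 (g1 (by decide))
  · exact s02 (g2 (by decide))
  · exact .trans _ _ _ (s01 (g1 (by decide))) (s13 (g2 (by decide)))
  · exact .symm _ _ (s01 (g1 (by decide)))
  · exact .refl _
  · exact .trans _ _ _ (.symm _ _ (s01 (g1 (by decide)))) (s02 (g2 (by decide)))
  · exact s13 (g2 (by decide))
  · exact .symm _ _ (s02 (g2 (by decide)))
  · exact .trans _ _ _ (.symm _ _ (s02 (g2 (by decide)))) (s01 (g1 (by decide)))
  · exact .refl _
  · exact s23 (g1 (by decide))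
  · exact .trans _ _ _ (.symm _ _ (s23 (g1 (by decide)))) (.symm _ _ (s02 (g2 (by decide))))
  · exact .symm _ _ (s13 (g2 (by decide)))
  · exact .symm _ _ (s23 (g1 (by decide)))
  · exact .refl _

theorem xspace_homeo_tetSpace {c : ℕ} (h : ValidCode c) :
    Nonempty (XSpace (gluingOf c h) ≃ₜ TetSpace 4 (octList c)) := by
  have hF : ∀ F : OctFace, ∃ f < 8, F = faceN f := fun F => ⟨_, faceNum_lt F, (faceN_faceNum F).symm⟩
  have hlt : ∀ f < 8, f >>> 1 < 4 := by decide
  have hmem : ∀ f < 8, facePair c f ∈ octList c := fun f hf =>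
    List.mem_append_right _ (List.mem_map_of_mem (by simp; omega))
  refine homeo_of_common continuous_subtype_val continuous_octPt ?_ ?_
    (fun a b h => eqvGen_of_eq (Subtype.ext h)) (fun a b => eqvGen_of_octPt) (fun a => exists_octPt a.2)
    fun a => ⟨⟨_, octPt_mem a⟩, rfl⟩
  · rintro a b ⟨F, w, hw, hw1, ha, hb⟩
    obtain ⟨f, hf, rfl⟩ := hF F
    obtain ⟨t1, t2, hv⟩ := facePair_spec h hf
    refine ⟨(⟨f >>> 1, hlt f hf⟩, baryPt (tvtx (facePair c f).1) ⟨w, hw, hw1⟩),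
      (⟨csig c f >>> 1, hlt _ (csig_lt c f)⟩, baryPt (tvtx (facePair c f).2) ⟨w, hw, hw1⟩), ?_, ?_,
      .rel _ _ ⟨_, hmem f hf, t1.symm, t2.symm, ⟨w, hw, hw1⟩, rfl, rfl⟩⟩
    · rw [octPt_baryPt, ha]
      exact Finset.sum_congr rfl fun i _ => by rw [(hv i).1]
    · rw [octPt_baryPt, hb]
      exact Finset.sum_congr rfl fun i _ => by rw [(hv i).2]
  · intro a b hab
    obtain ⟨p, hp, hab⟩ := triRel_singleton hab
    rcases List.mem_append.1 hp with hp | hp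
    · have := octPt_inner a b (triRel_mono (by simpa using hp) hab)
      exact ⟨⟨_, octPt_mem a⟩, ⟨_, octPt_mem a⟩, rfl, this, .refl _⟩
    · obtain ⟨f, hf, rfl⟩ := List.mem_map.1 hp
      have hf : f < 8 := by simp at hf; omega
      obtain ⟨t1, t2, hv⟩ := facePair_spec h hf
      obtain ⟨p, hpp, ha, hb, w, hw, hw'⟩ := hab
      obtain rfl := List.mem_singleton.1 hpp
      refine ⟨⟨_, octPt_mem a⟩, ⟨_, octPt_mem b⟩, rfl, rfl, .rel _ _ ⟨faceN f, w.1, w.2.1, w.2.2, ?_, ?_⟩⟩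
      · show octPt (a.1, a.2) = _
        rw [hw, octPt_baryPt, ha, t1]
        exact Finset.sum_congr rfl fun i _ => by rw [(hv i).1]
      · show octPt (b.1, b.2) = _
        rw [hw', octPt_baryPt, hb, t2]
        exact Finset.sum_congr rfl fun i _ => by rw [(hv i).2]

/-! ### Chains of moves -/

/-- Evaluate a list of pairs of numbers before passing it on. -/
def forceL {α : Type} : List (ℕ × ℕ) → (List (ℕ × ℕ) → α) → α
  | [], k => k []
  | p :: L, k => forceN p.1 fun a => forceN p.2 fun b => forceL L fun M => k ((a, b) :: M)

theorem forceL_eq {α : Type} (L : List (ℕ × ℕ)) (k : List (ℕ × ℕ) → α) : forceL L k = k L := by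
  induction L generalizing k with
  | nil => rfl
  | cons p L ih => simp only [forceL, forceN_eq, ih]

/-- The lists `A` and `B` define the same gluings of `n` tetrahedra. -/
def sameList (A B : List (ℕ × ℕ)) : Bool := subList A B && subList B A

/-- The relabelling `R` carries the gluing `A` of `n` tetrahedra to `B`. -/
def relabels (n R : ℕ) (A B : List (ℕ × ℕ)) : Bool :=
  decide (relabelCheck n R) && okList n A && forceL (rlist R A) fun M => sameList M B

theorem tetSpace_homeo_of_relabels {n R : ℕ} {A B : List (ℕ × ℕ)} (h : relabels n R A B = true) :
    Nonempty (TetSpace n A ≃ₜ TetSpace n B) := by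
  simp only [relabels, forceL_eq, sameList, Bool.and_eq_true, decide_eq_true_eq] at h
  obtain ⟨⟨hR, hA⟩, h, h'⟩ := h
  obtain ⟨f⟩ := tetSpace_homeo_rlist hR hA
  obtain ⟨g⟩ := tetSpace_homeo_of_subList n h h'
  exact ⟨f.trans g⟩

/-- Apply the relabelling `R` and a 2-3 move to `A`. -/
def relabelMove {α : Type} (R : ℕ) (A : List (ℕ × ℕ)) (z : α) (k : List (ℕ × ℕ) → α) : α :=
  forceL (rlist R A) fun M =>
    bif decide (relabelCheck 4 R) && okList 4 A && okList 4 M && moveCheck M then forceL (move23 M) k else z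

theorem relabelMove_spec {R : ℕ} {A : List (ℕ × ℕ)} {k : List (ℕ × ℕ) → Bool}
    (h : relabelMove R A false k = true) : ∃ M, Nonempty (TetSpace 4 A ≃ₜ TetSpace 5 M) ∧ k M = true := by
  simp only [relabelMove, forceL_eq, Bool.cond_false_right, Bool.and_eq_true, decide_eq_true_eq] at h
  obtain ⟨⟨⟨⟨hR, hA⟩, hM⟩, hm⟩, hk⟩ := h
  obtain ⟨f⟩ := tetSpace_homeo_rlist hR hA
  obtain ⟨g⟩ := tetSpace_homeo_move23 hM hm
  exact ⟨_, ⟨f.trans g⟩, hk⟩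

/-- The gluings `A` and `B` are related by relabelling, or by relabelling and 2-3 moves. -/
def linked (A : List (ℕ × ℕ)) (r r' s : ℕ) (B : List (ℕ × ℕ)) : Bool :=
  bif Nat.beq r 0 then relabels 4 s A B else
    relabelMove r A false fun M => relabelMove r' B false fun N => relabels 5 s M N

theorem tetSpace_homeo_of_linked {A B : List (ℕ × ℕ)} {r r' s : ℕ} (h : linked A r r' s B = true) :
    Nonempty (TetSpace 4 A ≃ₜ TetSpace 4 B) := by
  rw [linked] at h
  cases hr : Nat.beq r 0 <;> rw [hr] at h
  · obtain ⟨M, ⟨f⟩, h⟩ := relabelMove_spec h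
    obtain ⟨N, ⟨g⟩, h⟩ := relabelMove_spec h
    obtain ⟨k⟩ := tetSpace_homeo_of_relabels h
    exact ⟨(f.trans k).trans g.symm⟩
  · exact tetSpace_homeo_of_relabels h

/-- The list of pairs of triangles with a given number. -/
def gluingList : ℕ → ℕ → List (ℕ × ℕ)
  | 0, _ => []
  | k + 1, x => (x % 256, x / 256 % 256) :: gluingList k (x / 65536)

/-- A chain of linked gluings from `A` to `T`. -/
def chain (T : List (ℕ × ℕ)) : List (ℕ × ℕ × ℕ × ℕ) → List (ℕ × ℕ) → Bool
  | [], A => sameList A T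
  | (b, r, r', s) :: l, A => forceL (bif Nat.beq b 0 then T else gluingList 8 b) fun B => linked A r r' s B && chain T l B

theorem tetSpace_homeo_of_chain {T A : List (ℕ × ℕ)} {l : List (ℕ × ℕ × ℕ × ℕ)} (h : chain T l A = true) :
    Nonempty (TetSpace 4 A ≃ₜ TetSpace 4 T) := by
  induction l generalizing A with
  | nil =>
    obtain ⟨h, h'⟩ := Bool.and_eq_true_iff.1 h
    exact tetSpace_homeo_of_subList 4 h h'
  | cons p l ih =>
    obtain ⟨b, r, r', s⟩ := p
    simp only [chain, forceL_eq, Bool.and_eq_true] at h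
    obtain ⟨f⟩ := tetSpace_homeo_of_linked h.1
    obtain ⟨g⟩ := ih h.2
    exact ⟨f.trans g⟩

/-- A homeomorphism between the quotient spaces of the patterns with codes `c` and `c'`, given by a chain
between the rotated patterns `d` and `d'`. -/
structure Merge where
  c : ℕ
  p : ℕ
  d : ℕ
  steps : List (ℕ × ℕ × ℕ × ℕ)
  c' : ℕ
  p' : ℕ
  d' : ℕ

/-- The conditions on a homeomorphism given by a chain. -/
def Merge.check (m : Merge) : Bool :=
  Nat.blt m.p 6 && Nat.blt m.p' 6 && decide (ValidCode m.d) && decide (ValidCode m.d') && decide (ValidCode m.c') &&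
    relCode m.p 0 m.c m.d && relCode m.p' 0 m.c' m.d' &&
    forceL (octList m.d) fun A => forceL (octList m.d') fun B => chain B m.steps A

theorem exists_homeo_of_relCode {p c d : ℕ} (hp : Nat.blt p 6 = true) (hc : ValidCode c) (hd : ValidCode d)
    (h : relCode p 0 c d = true) : Nonempty (XSpace (gluingOf c hc) ≃ₜ TetSpace 4 (octList d)) := by
  have hE : EquivGluing (gluingOf c hc) (gluingOf d hd) :=
    ⟨_, _, (relCode_iff (Nat.le_of_ble_eq_true hp) (by norm_num) hc hd).1 h⟩
  obtain ⟨f⟩ := hE.homeo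
  obtain ⟨g⟩ := xspace_homeo_tetSpace hd
  exact ⟨f.trans g⟩

theorem Merge.homeo {m : Merge} (h : m.check = true) (hc : ValidCode m.c) : ∃ hc' : ValidCode m.c',
    Nonempty (XSpace (gluingOf m.c hc) ≃ₜ XSpace (gluingOf m.c' hc')) := by
  simp only [Merge.check, forceL_eq, Bool.and_eq_true, decide_eq_true_eq] at h
  obtain ⟨⟨⟨⟨⟨⟨⟨hp, hp'⟩, hd⟩, hd'⟩, hc'⟩, hr⟩, hr'⟩, h⟩ := h
  obtain ⟨f⟩ := exists_homeo_of_relCode hp hc hd hr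
  obtain ⟨g⟩ := exists_homeo_of_relCode hp' hc' hd' hr'
  obtain ⟨k⟩ := tetSpace_homeo_of_chain h
  exact ⟨hc', ⟨(f.trans k).trans g.symm⟩⟩

/-- The homeomorphisms between the quotient spaces of the inequivalent patterns. -/
def merges : List Merge := [
  ⟨84809501959492, 0, 84809501959492,
   [(296028131212604077644445323309056817465, 198029145816642, 250818639171138, 352210978739931586),
    (331916861168195129527769211044349114681, 250956044578368, 250818639171138, 946444539283642480),
    (0, 250956044578368, 250956044578368, 339126894555696658)],
   84818091893572, 2, 93749711733442⟩,
  ⟨51520286332548, 2, 59605180222210,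
   [(0, 29816797269570, 250932685966914, 812021252002752385)],
   111234296113092, 0, 111234296113092⟩,
  ⟨181594448260036, 0, 181594448260036,
   [(0, 155161127561664, 148544680115778, 703094038399041040)],
   51520286332548, 0, 51520286332548⟩,
  ⟨86146310575748, 2, 94231204465410,
   [(307907680541578430789139829368360040761, 108981634469442, 250818639179328, 703859164297305184),
    (0, 250943159675712, 250956052896192, 703819480947764368)],
   51520286332548, 0, 51520286332548⟩,
  ⟨146401484138948, 0, 146401484138948,
   [(300015368985090710720490990426325023033, 250956058204992, 198042077892162, 203920023203101984),
    (0, 250956044578368, 198029145816642, 703918447461273106)],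
   181594448260036, 0, 181594448260036⟩,
  ⟨181585856228292, 0, 181585856228292,
   [(268030881266584207422648892854302701881, 250923827596866, 250943159675712, 703806387735238768),
    (0, 250936717225536, 118877243845056, 487470776990313616)],
   111225704081348, 0, 111225704081348⟩,
  ⟨86704656324228, 0, 86704656324228,
   [(0, 148544680115778, 155161127561664, 1027836790527512080)],
   181585856228292, 0, 181585856228292⟩,
  ⟨146418668202436, 0, 146418668202436,
   [(0, 250932685966914, 29816797269570, 811892765068365331)],
   86704656324228, 2, 94780962376450⟩,
  ⟨50961940584068, 2, 59055422311170,
   [(281323343659038004511171850819843160377, 250818639171138, 250943159675712, 609349542782713120),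
    (0, 250818639179328, 250956058204992, 121961433772274866)],
   86704656324228, 0, 86704656324228⟩,
  ⟨637854078343, 2, 1170700522375,
   [(0, 0, 0, 118776270108210)],
   146410344606156, 0, 146410344606156⟩,
  ⟨1187609891719, 2, 1170568401799,
   [(0, 0, 0, 118982445303345)],
   145860588825036, 0, 145860588825036⟩,
  ⟨94780274678404, 2, 97817367677186,
   [(0, 250902089050560, 250902889631298, 1028118308476951648)],
   95330032522884, 2, 97826093927170⟩,
  ⟨59604492457604, 0, 59604492457604,
   [(281323647968529808274494710791286585657, 250956052896192, 250818639179328, 487633605591842080),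
    (0, 250943159675712, 250956052896192, 703819480947764368)],
   95330032522884, 0, 95330032522884⟩,
  ⟨112916849842116, 2, 194170900972930,
   [(0, 250902889631298, 250956055255488, 811892677865122960)],
   94780274678404, 0, 94780274678404⟩,
  ⟨112375681832900, 2, 194712064754562,
   [(0, 82593360128448, 49588633615938, 811892677865122960)],
   59604492457604, 0, 59604492457604⟩,
  ⟨59604492524164, 2, 63182751402242,
   [(0, 250902089050560, 250902889631298, 1028118308476951648)],
   60154250368644, 2, 63191477652226⟩,
  ⟨94780274611844, 0, 94780274611844,
   [(273348279993820313037071868429604518201, 250956052896192, 250818639179328, 487633605591842080),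
    (0, 250943159675712, 250956052896192, 703819480947764368)],
   60154250368644, 0, 60154250368644⟩,
  ⟨111825923921860, 0, 111825923921860,
   [(0, 250915773943362, 49588633615938, 1028118239698102483)],
   59604492524164, 0, 59604492524164⟩,
  ⟨182186078198724, 0, 182186078198724,
   [(0, 155161127561664, 250956055255488, 703094038399041040)],
   59604492524164, 0, 59604492524164⟩,
  ⟨95330032589444, 0, 95330032589444,
   [(314554246463174748615131194201306855737, 85872517332546, 250943159675712, 257880754536397921),
    (0, 108981636042306, 85872517332546, 541683294874766866)],
   94780274611844, 0, 94780274611844⟩,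
  ⟨112908259841988, 2, 193621145158018,
   [(0, 250902889631298, 250956055255488, 811892677865122960)],
   95330032589444, 0, 95330032589444⟩,
  ⟨182177488198596, 0, 182177488198596,
   [(330504597053929457987524606457414187321, 250956058204992, 250936717225536, 122785959858748513),
    (0, 250943159675712, 250956058204992, 339021324527996434)],
   112908259841988, 0, 112908259841988⟩,
  ⟨112358501930948, 2, 193612553126274,
   [(291956863496255071224894876255841188153, 250923827596866, 250936717225536, 703859164297305184),
    (0, 250943159675712, 118877243845056, 541408419402493072)],
   112908259841988, 0, 112908259841988⟩,
  ⟨111817334020036, 0, 111817334020036,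
   [(291956863496255071224894876255841188153, 118877243845056, 198042077892162, 487123569631575328),
    (0, 250943159675712, 118877243845056, 541408419402493072)],
   112908259841988, 0, 112908259841988⟩,
  ⟨60154250435204, 0, 60154250435204,
   [(0, 250956055255488, 155161127561664, 1027836790527512080)],
   182177488198596, 0, 182177488198596⟩,
  ⟨146993116109252, 2, 123260724576642,
   [(291956498399883835082330752318877235513, 250818639171138, 250943159675712, 244541479468219489),
    (0, 250936717225536, 250818639171138, 663386067726372370)],
   112358501930948, 2, 193612553126274⟩,
  ⟨147010296011204, 2, 124360236204930,
   [(0, 82593360128448, 49588633615938, 811892677865122960)],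
   60154250435204, 0, 60154250435204⟩,
  ⟨63172530983620, 2, 49568441697154,
   [(0, 82593360128448, 85891890286146, 1028118308476951648)],
   97789967356612, 2, 83653300060546⟩,
  ⟨97807147258564, 0, 97807147258564,
   [(0, 250915773943362, 85891890286146, 811892765855915155)],
   97789965259972, 2, 83644844343682⟩,
  ⟨63155351081668, 2, 48468930068866,
   [(265813890538757278579913972957435924025, 250818639171138, 250934295989826, 798100416863224528),
    (0, 250942349643330, 250818639171138, 797616828245095984)],
   97789965259972, 2, 83644844343682⟩,
  ⟨97807145161924, 2, 84744355971970,
   [(304361828202724036158316285052901920313, 250818639171138, 250934295989826, 1014326031352152544),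
    (293727678450240412741197780960773672505, 250956039851586, 250927048822338, 257711268178368964),
    (0, 250934295989826, 250818639171138, 662505540889097776)],
   97807147258564, 2, 84752811688834⟩,
  ⟨183106981514222, 0, 183106981514222,
   [(0, 148564057794864, 155161127561664, 703037637689690947)],
   182016061918174, 0, 182016061918174⟩,
  ⟨181971373284318, 2, 158401206178219,
   [(0, 0, 0, 230955487997313)],
   182016061918174, 0, 182016061918174⟩,
  ⟨147886512822766, 2, 123216697774499,
   [(0, 0, 0, 161807550593472)],
   146823097797086, 0, 146823097797086⟩]

theorem check_merges : merges.all Merge.check = true := by decide +kernel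

/-- The code `c` is joined to the code `t` by a sequence of merges. -/
def joined : ℕ → ℕ → ℕ → Bool
  | 0, c, t => Nat.beq c t
  | k + 1, c, t => Nat.beq c t || merges.any fun m => Nat.beq m.c c && joined k m.c' t

theorem homeo_of_joined {k c t : ℕ} (hc : ValidCode c) (ht : ValidCode t) (h : joined k c t = true) :
    Nonempty (XSpace (gluingOf c hc) ≃ₜ XSpace (gluingOf t ht)) := by
  have hbeq : ∀ {c} (hc : ValidCode c), Nat.beq c t = true →
      Nonempty (XSpace (gluingOf c hc) ≃ₜ XSpace (gluingOf t ht)) := by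
    intro c hc h
    obtain rfl := Nat.eq_of_beq_eq_true h
    exact ⟨.refl _⟩
  induction k generalizing c with
  | zero => exact hbeq hc h
  | succ k ih =>
    rcases Bool.or_eq_true_iff.1 h with h | h
    · exact hbeq hc h
    obtain ⟨m, hm, h⟩ := List.any_eq_true.1 h
    obtain ⟨h, h'⟩ := Bool.and_eq_true_iff.1 h
    obtain rfl := Nat.eq_of_beq_eq_true h
    obtain ⟨hc', ⟨f⟩⟩ := Merge.homeo (List.all_eq_true.1 check_merges m hm) hc
    obtain ⟨g⟩ := ih hc' h'
    exact ⟨f.trans g⟩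

theorem joined_entries : entries.all (fun e => match spaceReps[e.1]? with
    | none => false
    | some A => joined 8 e.2 A.p.code) = true := by
  decide +kernel

theorem entryHomeo : EntryHomeo := by
  rintro ⟨e, he⟩
  have h := List.all_eq_true.1 joined_entries e he
  cases hA : spaceReps[e.1]? with
  | none => rw [hA] at h; exact absurd h Bool.false_ne_true
  | some A => rw [hA] at h; exact ⟨A, rfl, homeo_of_joined _ A.ok.1 h⟩

end

/-- there are exactly `113` combinatorially inequivalent
orientation-reversing gluing patterns of the octahedron whose non-sphere vertex-link data
consists of a single genus-2 surface, and their quotient spaces fall into exactly `79`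
homeomorphism classes. -/
theorem count_genus_two_octahedral_manifolds :
    Nat.card {s : Set Gluing // ∃ g : Gluing, LinksGenusTwo g ∧ s = orbit g} = 113 ∧
    ∃ t : Finset Gluing, (∀ g ∈ t, LinksGenusTwo g) ∧ t.card = 79 ∧
      (∀ g : Gluing, LinksGenusTwo g → ∃ h ∈ t, Nonempty (XSpace g ≃ₜ XSpace h)) ∧
      (∀ h ∈ t, ∀ h' ∈ t, Nonempty (XSpace h ≃ₜ XSpace h') → h = h') :=
  ⟨card_orbits entryHomeo, exists_finset entryHomeo⟩
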